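/- Let S be a compact, orientable, two-dimensional embedded C^∞ submanifold of ℝ³ without boundary. There exist constants c > 0 and h₀ ∈ (0,1), depending only on S and γ₀ (in particular independent of z₀ and h), such that for every z₀ ∈ S and every admissible quasi-uniform triangulation T_h with h ≤ h₀, the error E = l̃ − L̃_h satisfies ∫_S ⟨∇_S E, ∇_S( r² E )⟩ ≤ (1/4) ∫_S r² |∇_S E|² + c h² |log h|. -/

import Mathlib

open MeasureTheory Metric
open scoped RealInnerProductSpace ENNReal NNReal

noncomputable section

/-- Ambient Euclidean space `ℝ³`. -/
abbrev E3 : Type := EuclideanSpace ℝ (Fin 3)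

/-- The tangential gradient of `w : E3 → ℝ` along the set `A` at `x`, with values projected
onto the subspace `P`: the orthogonal projection onto `P` of the Riesz representative of the
derivative of `w` within `A` at `x`. -/
def tGrad (A : Set E3) (P : Submodule ℝ E3) (w : E3 → ℝ) (x : E3) : E3 :=
  (Submodule.orthogonalProjectionOnto P ((InnerProductSpace.toDual ℝ E3).symm (fderivWithin ℝ w A x)) : E3)

/-- A compact, orientable, two-dimensional embedded `C^∞` submanifold of `ℝ³` without boundary,
described by a global smooth unit normal field `n` and local smooth regular defining functions. -/
structure SmoothSurface where
  S : Set E3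
  n : E3 → E3
  compact : IsCompact S
  nonempty : S.Nonempty
  localLevel : ∀ x ∈ S, ∃ U : Set E3, ∃ F : E3 → ℝ, IsOpen U ∧ x ∈ U ∧
    ContDiff ℝ (⊤ : ℕ∞) F ∧ S ∩ U = {y ∈ U | F y = 0} ∧
    (∀ y ∈ U, gradient F y ≠ 0) ∧
    (∀ y, y ∈ S ∩ U → ∃ t : ℝ, gradient F y = t • n y)
  n_unit : ∀ x ∈ S, ‖n x‖ = 1
  n_smooth : ∃ U : Set E3, IsOpen U ∧ S ⊆ U ∧ ContDiffOn ℝ (⊤ : ℕ∞) n U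

namespace SmoothSurface

variable (Srf : SmoothSurface)

/-- The tangent plane of `S` at `x`, as the orthogonal complement of the normal. -/
def tangent (x : E3) : Submodule ℝ E3 := (ℝ ∙ Srf.n x)ᗮ

/-- The tangential gradient `∇_S w` on the surface. -/
def grad (w : E3 → ℝ) (x : E3) : E3 := tGrad Srf.S (Srf.tangent x) w x

/-- The bilinear form `a(v,w) = ∫_S (⟨∇_S v, ∇_S w⟩ + v w)` (w.r.t. 2-dimensional
Hausdorff measure on `S`). -/
def aForm (v w : E3 → ℝ) : ℝ :=
  ∫ x in Srf.S, (⟪Srf.grad v x, Srf.grad w x⟫ + v x * w x) ∂μH[2]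

end SmoothSurface

/-- The (closed, flat) triangle with vertices `t.1, t.2.1, t.2.2`. -/
def triOf (t : E3 × E3 × E3) : Set E3 := convexHull ℝ {t.1, t.2.1, t.2.2}

/-- The vertex set of a triangle. -/
def vertsOf (t : E3 × E3 × E3) : Set E3 := {t.1, t.2.1, t.2.2}

/-- The plane spanned by a triangle. -/
def planeOf (t : E3 × E3 × E3) : Set E3 := (affineSpan ℝ (vertsOf t) : Set E3)

/-- The direction (2-dimensional linear subspace) of the plane of a triangle. -/
def dirOf (t : E3 × E3 × E3) : Submodule ℝ E3 := (affineSpan ℝ (vertsOf t)).direction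

/-- The triangle-wise tangential gradient `∇_{S_h} w` on the triangle `t`. -/
def gradTri (t : E3 × E3 × E3) (w : E3 → ℝ) (x : E3) : E3 := tGrad (triOf t) (dirOf t) w x

/-- An admissible quasi-uniform triangulation `T_h` of the surface `Srf` with mesh parameter `h`
and quasi-uniformity constant `γ₀`, together with the nearest-point projection `a` defined on
a tubular neighbourhood `N` of the surface. -/
structure Triangulation (Srf : SmoothSurface) (γ₀ h : ℝ) where
  T : Finset (E3 × E3 × E3)
  a : E3 → E3
  N : Set E3
  T_nonempty : T.Nonempty
  indep : ∀ t ∈ T, AffineIndependent ℝ ![t.1, t.2.1, t.2.2]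
  verts_on : ∀ t ∈ T, vertsOf t ⊆ Srf.S
  meet : ∀ t ∈ T, ∀ t' ∈ T, t ≠ t' →
    triOf t ∩ triOf t' = ∅ ∨
    (∃ v, v ∈ vertsOf t ∩ vertsOf t' ∧ triOf t ∩ triOf t' = {v}) ∨
    (∃ v w, v ≠ w ∧ v ∈ vertsOf t ∩ vertsOf t' ∧ w ∈ vertsOf t ∩ vertsOf t' ∧
      triOf t ∩ triOf t' = segment ℝ v w)
  diam_le : ∀ t ∈ T, Metric.diam (triOf t) ≤ h
  disk : ∀ t ∈ T, ∃ y ∈ triOf t, closedBall y (γ₀ * h) ∩ planeOf t ⊆ triOf t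
  N_open : IsOpen N
  S_sub : Srf.S ⊆ N
  Sh_sub : (⋃ t ∈ T, triOf t) ⊆ N
  a_smooth : ContDiffOn ℝ (⊤ : ℕ∞) a N
  a_mem : ∀ x ∈ N, a x ∈ Srf.S
  a_nearest : ∀ x ∈ N, ∀ y ∈ Srf.S, dist x (a x) ≤ dist x y
  a_unique : ∀ x ∈ N, ∀ y ∈ Srf.S, dist x y = dist x (a x) → y = a x
  a_bij : Set.BijOn a (⋃ t ∈ T, triOf t) Srf.S

namespace Triangulation

variable {Srf : SmoothSurface} {γ₀ h : ℝ} (Tr : Triangulation Srf γ₀ h)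

/-- The polyhedral surface `S_h`, the union of the triangles. -/
def Sh : Set E3 := ⋃ t ∈ Tr.T, triOf t

/-- Membership in the finite element space `V_h` of continuous, piecewise affine functions
on `S_h` (as functions `E3 → ℝ`; only the values on `S_h` are relevant). -/
def IsVh (v : E3 → ℝ) : Prop :=
  ContinuousOn v Tr.Sh ∧
  ∀ t ∈ Tr.T, ∃ (L : E3 →ₗ[ℝ] ℝ) (c : ℝ), ∀ x ∈ triOf t, v x = L x + c


/-- The discrete bilinear form
`a_h(v,w) = ∫_{S_h} (⟨∇_{S_h} v, ∇_{S_h} w⟩ + v w)`, computed triangle by triangle. -/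
def ahForm (v w : E3 → ℝ) : ℝ :=
  ∑ t ∈ Tr.T, ∫ x in triOf t,
    (⟪gradTri t v x, gradTri t w x⟫ + v x * w x) ∂μH[2]

/-- The lift of a function on `S_h` to a function on `S` via the inverse of `a|_{S_h}`. -/
def liftS (w : E3 → ℝ) : E3 → ℝ := fun y => w (Function.invFunOn Tr.a Tr.Sh y)

/-- The lift of `f : S → ℝ` to `S_h` is `f ∘ a`. -/
def liftSh (f : E3 → ℝ) : E3 → ℝ := fun x => f (Tr.a x)

end Triangulation

/-- `f` is smooth in a neighbourhood of the set `A`. -/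
def SmoothNear (f : E3 → ℝ) (A : Set E3) : Prop :=
  ∃ V : Set E3, IsOpen V ∧ A ⊆ V ∧ ContDiffOn ℝ (⊤ : ℕ∞) f V

/-- `u` is the (weak, hence smooth) solution of `-Δ_S u + u = f` on the surface `Srf`. -/
def IsSolution (Srf : SmoothSurface) (f u : E3 → ℝ) : Prop :=
  SmoothNear u Srf.S ∧
  ∀ φ : E3 → ℝ, ContDiff ℝ (⊤ : ℕ∞) φ → Srf.aForm u φ = ∫ x in Srf.S, f x * φ x ∂μH[2]

/-- `uh` is the discrete Galerkin solution in `V_h` with data the lift `f ∘ a` of `f`. -/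
def Triangulation.IsDiscreteSolution {Srf : SmoothSurface} {γ₀ h : ℝ}
    (Tr : Triangulation Srf γ₀ h) (f uh : E3 → ℝ) : Prop :=
  Tr.IsVh uh ∧
  ∀ φh : E3 → ℝ, Tr.IsVh φh →
    Tr.ahForm uh φh = ∫ x in Tr.Sh, f (Tr.a x) * φh x ∂μH[2]

/-- Orthogonal projection onto the affine tangent plane of `S` at `z₀`. -/
def SmoothSurface.P0 (Srf : SmoothSurface) (z₀ : E3) (x : E3) : E3 :=
  z₀ + (Submodule.orthogonalProjectionOnto (Srf.tangent z₀) (x - z₀) : E3)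

/-- `r(x) = ‖P₀(x) − z₀‖`, the distance of the tangential projection of `x` to `z₀`. -/
def SmoothSurface.rfn (Srf : SmoothSurface) (z₀ : E3) (x : E3) : ℝ :=
  ‖Srf.P0 z₀ x - z₀‖

/-- The affine tangent plane `z₀ + T_{z₀}S`. -/
def SmoothSurface.tplane (Srf : SmoothSurface) (z₀ : E3) : Set E3 :=
  {x : E3 | x - z₀ ∈ Srf.tangent z₀}

/-- The disk `D = B₁₀₀(z₀)` in the affine tangent plane at `z₀`. -/
def SmoothSurface.disk100 (Srf : SmoothSurface) (z₀ : E3) : Set E3 :=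
  Srf.tplane z₀ ∩ closedBall z₀ 100

/-- `r₁ > 0` is a graph radius for `S`: uniformly in `z₀ ∈ S`, the piece `B_{2r₁}(z₀) ∩ S`
is a graph over the tangent plane at `z₀`, in particular `P₀` is injective on it. -/
def SmoothSurface.IsGraphRadius (Srf : SmoothSurface) (r₁ : ℝ) : Prop :=
  0 < r₁ ∧ r₁ ≤ 1 ∧ ∀ z₀ ∈ Srf.S, Set.InjOn (Srf.P0 z₀) (Srf.S ∩ closedBall z₀ (2 * r₁))

/-- `ζ` is an admissible smooth cutoff at `z₀`: supported in the ball of radius `3r₁/2`,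
equal to `1` on the ball of radius `r₁`, with `C²`-bounds at most `Cζ` (uniform in `z₀`). -/
def IsCutoff (z₀ : E3) (r₁ Cζ : ℝ) (ζ : E3 → ℝ) : Prop :=
  ContDiff ℝ (⊤ : ℕ∞) ζ ∧ tsupport ζ ⊆ closedBall z₀ (3 / 2 * r₁) ∧
  (∀ x ∈ closedBall z₀ r₁, ζ x = 1) ∧
  ∀ x : E3, |ζ x| + ‖fderiv ℝ ζ x‖ + ‖fderiv ℝ (fderiv ℝ ζ) x‖ ≤ Cζ

/-- `v` is the Neumann Green's function with pole `z₀` of `−Δ + 1` on the disk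
`D = B₁₀₀(z₀)` in the tangent plane at `z₀`: it is smooth away from the pole, satisfies
`∫_D (⟨∇v, ∇φ⟩ + v φ) = φ(z₀)` for every smooth test function, and differs from
`(1/2π) log‖· − z₀‖` by an `H²(D)`-function with norm at most `CG`. -/
def SmoothSurface.IsGreen (Srf : SmoothSurface) (z₀ : E3) (CG : ℝ) (v : E3 → ℝ) : Prop :=
  ContDiffOn ℝ (⊤ : ℕ∞) v (Srf.disk100 z₀ \ {z₀}) ∧
  (∀ φ : E3 → ℝ, ContDiff ℝ (⊤ : ℕ∞) φ →
    ∫ x in Srf.disk100 z₀,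
      (⟪tGrad (Srf.disk100 z₀) (Srf.tangent z₀) v x,
        tGrad (Srf.disk100 z₀) (Srf.tangent z₀) φ x⟫ + v x * φ x) ∂μH[2] = φ z₀) ∧
  (∫ x in Srf.disk100 z₀,
      ((v x - (1 / (2 * Real.pi)) * Real.log ‖x - z₀‖) ^ 2 +
        ‖fderivWithin ℝ (fun y => v y - (1 / (2 * Real.pi)) * Real.log ‖y - z₀‖)
            (Srf.disk100 z₀) x‖ ^ 2 +
        ‖fderivWithin ℝ
            (fun y => fderivWithin ℝ
              (fun y' => v y' - (1 / (2 * Real.pi)) * Real.log ‖y' - z₀‖)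
              (Srf.disk100 z₀) y)
            (Srf.disk100 z₀) x‖ ^ 2) ∂μH[2]) ≤ CG

/-- The approximate Green's function `g̃(x) = ζ(x) v(P₀(x))` on `S`. -/
def approxGreen (Srf : SmoothSurface) (z₀ : E3) (ζ v : E3 → ℝ) : E3 → ℝ :=
  fun x => ζ x * v (Srf.P0 z₀ x)

/-- The cut-off lifted logarithm `l̃(x) = ζ(x) log r(x)` on `S`. -/
def cutLog (Srf : SmoothSurface) (z₀ : E3) (ζ : E3 → ℝ) : E3 → ℝ :=
  fun x => ζ x * Real.log (Srf.rfn z₀ x)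

/-- `lh` is the discrete (Galerkin) projection of the function `w` on `S`:
`a_h(lh, v_h) = a(w, V_h)` for all `v_h ∈ V_h`, where `V_h` is the lift of `v_h` to `S`. -/
def Triangulation.IsDiscreteProjection {Srf : SmoothSurface} {γ₀ h : ℝ}
    (Tr : Triangulation Srf γ₀ h) (w lh : E3 → ℝ) : Prop :=
  Tr.IsVh lh ∧ ∀ vh : E3 → ℝ, Tr.IsVh vh → Tr.ahForm lh vh = Srf.aForm w (Tr.liftS vh)


section
lemma unif_of_local {S : Set E3} (hS : IsCompact S) (f : E3 → E3 → ℝ) (k : ℕ) (M : ℝ)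
    (hM : ∀ p ∈ S, ∀ q ∈ S, f p q ≤ M)
    (hloc : ∀ x ∈ S, ∃ ε > 0, ∃ C : ℝ, ∀ p ∈ S, ∀ q ∈ S, dist p x < ε → dist q x < ε →
      f p q ≤ C * ‖q - p‖ ^ k) :
    ∃ C ≥ 0, ∀ p ∈ S, ∀ q ∈ S, f p q ≤ C * ‖q - p‖ ^ k := by
  have key : ∃ C : ℝ, 0 ≤ C ∧ ∃ δ > 0, ∀ p ∈ S, ∀ q ∈ S, p ∈ S → dist q p < δ →
      f p q ≤ C * ‖q - p‖ ^ k := by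
    refine hS.induction_on (p := fun s => ∃ C : ℝ, 0 ≤ C ∧ ∃ δ > 0, ∀ p ∈ s, ∀ q ∈ S, p ∈ S →
      dist q p < δ → f p q ≤ C * ‖q - p‖ ^ k) ?_ ?_ ?_ ?_
    · exact ⟨0, le_rfl, 1, one_pos, fun p hp => absurd hp (Set.notMem_empty p)⟩
    · rintro s t hst ⟨C, hC, δ, hδ, H⟩
      exact ⟨C, hC, δ, hδ, fun p hp => H p (hst hp)⟩
    · rintro s t ⟨C, hC, δ, hδ, H⟩ ⟨C', hC', δ', hδ', H'⟩
      refine ⟨max C C', le_max_of_le_left hC, min δ δ', lt_min hδ hδ', ?_⟩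
      rintro p (hp | hp) q hq hpS hd
      · refine (H p hp q hq hpS (lt_of_lt_of_le hd (min_le_left _ _))).trans ?_
        gcongr; exact le_max_left _ _
      · refine (H' p hp q hq hpS (lt_of_lt_of_le hd (min_le_right _ _))).trans ?_
        gcongr; exact le_max_right _ _
    · intro x hx
      obtain ⟨ε, hε, C, H⟩ := hloc x hx
      refine ⟨ball x (ε / 2), mem_nhdsWithin_of_mem_nhds (ball_mem_nhds x (by positivity)), |C|,
        abs_nonneg _, ε / 2, by positivity, ?_⟩
      intro p hp q hq hpS hd
      rw [mem_ball] at hp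
      refine (H p hpS q hq (by linarith) ?_).trans ?_
      · have := dist_triangle q p x
        linarith
      · gcongr; exact le_abs_self _
  obtain ⟨C, hC, δ, hδ, H⟩ := key
  refine ⟨C + |M| / δ ^ k, by positivity, ?_⟩
  intro p hp q hq
  by_cases hd : dist q p < δ
  · refine (H p hp q hq hp hd).trans ?_
    gcongr
    have : 0 ≤ |M| / δ ^ k := by positivity
    linarith
  · push Not at hd
    rw [dist_eq_norm] at hd
    have h1 : δ ^ k ≤ ‖q - p‖ ^ k := pow_le_pow_left₀ hδ.le hd k
    have h2 : |M| ≤ |M| / δ ^ k * ‖q - p‖ ^ k := by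
      rw [div_mul_eq_mul_div, le_div_iff₀ (by positivity)]
      gcongr
    have h3 : 0 ≤ C * ‖q - p‖ ^ k := by positivity
    calc f p q ≤ M := hM p hp q hq
      _ ≤ |M| := le_abs_self _
      _ ≤ _ := by rw [add_mul]; linarith

namespace SmoothSurface
variable (Srf : SmoothSurface)

lemma exists_bdd : ∃ C ≥ 0, ∀ p ∈ Srf.S, ∀ q ∈ Srf.S, ‖q - p‖ ≤ C := by
  obtain ⟨C, hC⟩ := Srf.compact.isBounded.exists_norm_le
  obtain ⟨x, hx⟩ := Srf.nonempty
  refine ⟨C + C, ?_, fun p hp q hq => (norm_sub_le _ _).trans (add_le_add (hC q hq) (hC p hp))⟩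
  have := (norm_nonneg x).trans (hC x hx)
  linarith

lemma n_contDiffAt {x : E3} (hx : x ∈ Srf.S) : ContDiffAt ℝ 1 Srf.n x := by
  obtain ⟨U, hU, hSU, h⟩ := Srf.n_smooth
  exact ((h x (hSU hx)).contDiffAt (hU.mem_nhds (hSU hx))).of_le (by exact_mod_cast le_top)

lemma n_continuousOn : ContinuousOn Srf.n Srf.S := fun x hx =>
  (Srf.n_contDiffAt hx).continuousAt.continuousWithinAt

lemma exists_n_lip : ∃ C ≥ 0, ∀ p ∈ Srf.S, ∀ q ∈ Srf.S, ‖Srf.n q - Srf.n p‖ ≤ C * ‖q - p‖ := by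
  suffices hh : ∃ C ≥ 0, ∀ p ∈ Srf.S, ∀ q ∈ Srf.S, ‖Srf.n q - Srf.n p‖ ≤ C * ‖q - p‖ ^ 1 by
    simpa only [pow_one] using hh
  refine unif_of_local Srf.compact (fun p q => ‖Srf.n q - Srf.n p‖) 1 2 ?_ ?_
  · intro p hp q hq
    refine (norm_sub_le _ _).trans ?_
    rw [Srf.n_unit p hp, Srf.n_unit q hq]; norm_num
  · intro x hx
    obtain ⟨K, t, ht, hL⟩ := (Srf.n_contDiffAt hx).exists_lipschitzOnWith
    obtain ⟨ε, hε, hb⟩ := Metric.mem_nhds_iff.1 ht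
    refine ⟨ε, hε, K, fun p hp q hq hdp hdq => ?_⟩
    have := hL.dist_le_mul q (hb hdq) p (hb hdp)
    simpa [dist_eq_norm] using this

/-- local Taylor estimate for C^2 functions -/
lemma taylor_local {F : E3 → ℝ} (hF : ContDiff ℝ 2 F) (x : E3) : ∃ ε > 0, ∃ C ≥ 0,
    ∀ p q : E3, dist p x < ε → dist q x < ε →
      |F q - F p - fderiv ℝ F p (q - p)| ≤ C * ‖q - p‖ ^ 2 := by
  have h1 : ContDiff ℝ 1 (fderiv ℝ F) := hF.fderiv_right (by norm_num)
  obtain ⟨K, t, ht, hL⟩ := (h1.contDiffAt (x := x)).exists_lipschitzOnWith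
  obtain ⟨ε, hε, hb⟩ := Metric.mem_nhds_iff.1 ht
  refine ⟨ε, hε, K, K.2, fun p q hp hq => ?_⟩
  have hseg : segment ℝ p q ⊆ ball x ε := (convex_ball x ε).segment_subset hp hq
  have := (convex_segment p q).norm_image_sub_le_of_norm_fderiv_le'
    (𝕜 := ℝ) (f := F) (φ := fderiv ℝ F p) (C := K * ‖q - p‖) (x := p) (y := q)
    (fun y hy => (hF.differentiable (by norm_num)).differentiableAt)
    (fun y hy => ?_) (left_mem_segment ℝ p q) (right_mem_segment ℝ p q)
  · rw [Real.norm_eq_abs] at this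
    calc _ ≤ _ := this
      _ = _ := by ring
  · have h2 := hL.dist_le_mul y (hb (hseg hy)) p (hb hp)
    rw [dist_eq_norm, dist_eq_norm] at h2
    refine h2.trans ?_
    gcongr
    obtain ⟨a, b, ha, hb', hab, rfl⟩ := hy
    have : a • p + b • q - p = b • (q - p) := by
      rw [show a = 1 - b by linarith]; module
    rw [this, norm_smul, Real.norm_eq_abs, abs_of_nonneg hb']
    exact mul_le_of_le_one_left (norm_nonneg _) (by linarith)

lemma fderiv_F {F : E3 → ℝ} {y n : E3} (hF : DifferentiableAt ℝ F y) {t : ℝ} (h : gradient F y = t • n)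
    (v : E3) : fderiv ℝ F y v = t * ⟪v, n⟫ := by
  have := hF.hasGradientAt.hasFDerivAt.fderiv
  rw [this, h]
  simp [real_inner_smul_left, real_inner_comm]

lemma exists_quad : ∃ C ≥ 0, ∀ p ∈ Srf.S, ∀ q ∈ Srf.S, |⟪q - p, Srf.n p⟫| ≤ C * ‖q - p‖ ^ 2 := by
  obtain ⟨B, hB, hBd⟩ := Srf.exists_bdd
  refine unif_of_local Srf.compact (fun p q => |⟪q - p, Srf.n p⟫|) 2 B ?_ ?_
  · intro p hp q hq
    refine (abs_real_inner_le_norm _ _).trans ?_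
    rw [Srf.n_unit p hp, mul_one]
    exact hBd p hp q hq
  · intro x hx
    obtain ⟨U, F, hU, hxU, hF, hSU, hne, hn⟩ := Srf.localLevel x hx
    have hF2 : ContDiff ℝ 2 F := contDiff_infty.1 hF 2
    obtain ⟨ε, hε, C, hC, H⟩ := taylor_local hF2 x
    have hcont : Continuous (fun y => ‖fderiv ℝ F y‖) :=
      (hF.continuous_fderiv (by simp)).norm
    have hdiff : Differentiable ℝ F := hF2.differentiable (by norm_num)
    have hpos : 0 < ‖fderiv ℝ F x‖ := by
      rw [norm_pos_iff]
      intro h0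
      apply hne x hxU
      simp [gradient, h0]
    set m := ‖fderiv ℝ F x‖ / 2 with hm
    have hnb : {y | m < ‖fderiv ℝ F y‖} ∩ U ∈ nhds x :=
      Filter.inter_mem ((isOpen_lt continuous_const hcont).mem_nhds (by simp [hm, hpos]))
        (hU.mem_nhds hxU)
    obtain ⟨ε', hε', hb⟩ := Metric.mem_nhds_iff.1 hnb
    refine ⟨min ε ε', lt_min hε hε', C / m, fun p hp q hq hdp hdq => ?_⟩
    obtain ⟨hpm, hpU⟩ := hb (mem_ball.2 (lt_of_lt_of_le hdp (min_le_right _ _)))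
    obtain ⟨-, hqU⟩ := hb (mem_ball.2 (lt_of_lt_of_le hdq (min_le_right _ _)))
    have hp0 : F p = 0 := by
      have : p ∈ Srf.S ∩ U := ⟨hp, hpU⟩
      rw [hSU] at this; exact this.2
    have hq0 : F q = 0 := by
      have : q ∈ Srf.S ∩ U := ⟨hq, hqU⟩
      rw [hSU] at this; exact this.2
    obtain ⟨t, ht⟩ := hn p ⟨hp, hpU⟩
    have h1 := H p q (lt_of_lt_of_le hdp (min_le_left _ _)) (lt_of_lt_of_le hdq (min_le_left _ _))
    rw [hp0, hq0, fderiv_F hdiff.differentiableAt ht, sub_zero, zero_sub, abs_neg, abs_mul] at h1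
    have hmt : m < |t| := by
      have hg : ‖gradient F p‖ = ‖fderiv ℝ F p‖ := by simp [gradient]
      have : ‖fderiv ℝ F p‖ = |t| := by
        rw [← hg, ht, norm_smul, Srf.n_unit p hp, mul_one, Real.norm_eq_abs]
      rw [← this]; exact hpm
    have hm0 : 0 < m := by positivity
    rw [div_mul_eq_mul_div, le_div_iff₀ hm0]
    have := mul_le_mul_of_nonneg_right hmt.le (abs_nonneg ⟪q - p, Srf.n p⟫)
    linarith

lemma mem_tangent {y v : E3} : v ∈ Srf.tangent y ↔ ⟪v, Srf.n y⟫ = 0 := by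
  unfold tangent
  rw [Submodule.mem_orthogonal_singleton_iff_inner_left]

/-- orthogonal projection on the tangent plane -/
def PT (y v : E3) : E3 := v - ⟪v, Srf.n y⟫ • Srf.n y

lemma PT_eq {y : E3} (hy : y ∈ Srf.S) (v : E3) :
    (Submodule.orthogonalProjectionOnto (Srf.tangent y) v : E3) = Srf.PT y v := by
  unfold PT
  rw [← Submodule.starProjection_apply]
  refine Submodule.eq_starProjection_of_mem_of_inner_eq_zero ?_ ?_
  · rw [mem_tangent, inner_sub_left, real_inner_smul_left, real_inner_self_eq_norm_sq,
      Srf.n_unit y hy]; ring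
  · intro w hw
    rw [mem_tangent] at hw
    rw [sub_sub_cancel, real_inner_smul_left, real_inner_comm w (Srf.n y), hw, mul_zero]

lemma PT_mem {y : E3} (hy : y ∈ Srf.S) (v : E3) : Srf.PT y v ∈ Srf.tangent y := by
  rw [← Srf.PT_eq hy]; exact Subtype.mem _

lemma PT_of_mem {y v : E3} (hv : v ∈ Srf.tangent y) : Srf.PT y v = v := by
  rw [mem_tangent] at hv
  simp [PT, hv]

lemma inner_PT {y v w : E3} (hw : w ∈ Srf.tangent y) : ⟪Srf.PT y v, w⟫ = ⟪v, w⟫ := by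
  rw [mem_tangent] at hw
  rw [PT, inner_sub_left, real_inner_smul_left, real_inner_comm w (Srf.n y), hw]; simp

lemma norm_PT_sq {y : E3} (hy : y ∈ Srf.S) (v : E3) :
    ‖Srf.PT y v‖ ^ 2 = ‖v‖ ^ 2 - ⟪v, Srf.n y⟫ ^ 2 := by
  rw [PT, norm_sub_sq_real, norm_smul, real_inner_smul_right, Srf.n_unit y hy, mul_one,
    Real.norm_eq_abs, sq_abs]; ring

lemma norm_PT_le {y : E3} (hy : y ∈ Srf.S) (v : E3) : ‖Srf.PT y v‖ ≤ ‖v‖ := by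
  have := Srf.norm_PT_sq hy v
  nlinarith [sq_nonneg ⟪v, Srf.n y⟫, norm_nonneg (Srf.PT y v), norm_nonneg v]

lemma PT_add (y v w : E3) : Srf.PT y (v + w) = Srf.PT y v + Srf.PT y w := by
  simp only [PT, inner_add_left]; module
lemma PT_sub (y v w : E3) : Srf.PT y (v - w) = Srf.PT y v - Srf.PT y w := by
  simp only [PT, inner_sub_left]; module
lemma PT_smul (y v : E3) (c : ℝ) : Srf.PT y (c • v) = c • Srf.PT y v := by
  simp only [PT, real_inner_smul_left]; module

lemma rfn_eq {z : E3} (hz : z ∈ Srf.S) (x : E3) : Srf.rfn z x = ‖Srf.PT z (x - z)‖ := by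
  rw [rfn, P0, Srf.PT_eq hz, add_sub_cancel_left]

/-- Local Lipschitz graph charts. -/
lemma exists_chart {p : E3} (hp : p ∈ Srf.S) : ∃ s > 0, ∃ ε > 0, ∃ L : ℝ≥0, ∃ φ : E3 → E3,
    (∀ τ ∈ Srf.tangent p, ‖τ‖ ≤ s → φ τ ∈ Srf.S ∧ Srf.PT p (φ τ - p) = τ) ∧
    LipschitzOnWith L φ (closedBall 0 s) ∧ φ 0 = p ∧
    (∀ x ∈ Srf.S, ‖x - p‖ < ε → φ (Srf.PT p (x - p)) = x) := by
  obtain ⟨U, F, hU, hpU, hF, hSU, hne, hn⟩ := Srf.localLevel p hp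
  obtain ⟨t, ht⟩ := hn p ⟨hp, hpU⟩
  have hF1 : ContDiff ℝ 1 F := hF.of_le (by exact_mod_cast le_top)
  have hdiff : Differentiable ℝ F := hF1.differentiable (by norm_num)
  have ht0 : t ≠ 0 := by
    rintro rfl
    apply hne p hpU
    rw [ht, zero_smul]
  set n := Srf.n p with hnn
  have hn1 : ⟪n, n⟫ = 1 := by
    rw [real_inner_self_eq_norm_sq, Srf.n_unit p hp]; norm_num
  let PL : E3 →L[ℝ] E3 := ContinuousLinearMap.id ℝ E3 - (innerSL ℝ n).smulRight n
  have hPL : ∀ v, PL v = Srf.PT p v := by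
    intro v; simp [PL, PT, real_inner_comm, hnn]
  let G : E3 → E3 := fun x => PL (x - p) + F x • n
  let G' : E3 →L[ℝ] E3 := PL + (fderiv ℝ F p).smulRight n
  have hG : HasStrictFDerivAt G G' p := by
    have h1 : HasStrictFDerivAt (fun x => PL (x - p)) PL p := by
      have := PL.hasStrictFDerivAt.comp p ((hasStrictFDerivAt_id p).sub_const p)
      simpa using this
    have h2 : HasStrictFDerivAt F (fderiv ℝ F p) p := hF1.contDiffAt.hasStrictFDerivAt (by norm_num)
    exact h1.add (h2.smul_const n)
  have hG'ap : ∀ v, G' v = Srf.PT p v + (t * ⟪v, n⟫) • n := by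
    intro v
    simp only [G', add_apply, hPL, ContinuousLinearMap.smulRight_apply]
    rw [fderiv_F hdiff.differentiableAt ht]
  have hinj : Function.Injective G' := by
    rw [injective_iff_map_eq_zero]
    intro v hv
    rw [hG'ap] at hv
    have h1 : ⟪Srf.PT p v + (t * ⟪v, n⟫) • n, n⟫ = 0 := by rw [hv, inner_zero_left]
    rw [inner_add_left, (Srf.mem_tangent).1 (Srf.PT_mem hp v), real_inner_smul_left, hn1] at h1
    have h2 : ⟪v, n⟫ = 0 := by
      have : t * ⟪v, n⟫ = 0 := by linarith
      exact (mul_eq_zero.1 this).resolve_left ht0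
    rw [h2] at hv
    simpa [PT, ← hnn, h2] using hv
  let e : E3 ≃L[ℝ] E3 := (LinearEquiv.ofInjectiveEndo (G' : E3 →ₗ[ℝ] E3) hinj).toContinuousLinearEquiv
  have he : (e : E3 →L[ℝ] E3) = G' := by ext v; rfl
  have hGe : HasStrictFDerivAt G (e : E3 →L[ℝ] E3) p := by rw [he]; exact hG
  have hp0 : F p = 0 := by
    have : p ∈ Srf.S ∩ U := ⟨hp, hpU⟩
    rw [hSU] at this; exact this.2
  have hGp : G p = 0 := by simp [G, hp0]
  set φ := hGe.localInverse G e p with hφ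
  have hright : ∀ᶠ w in nhds (0 : E3), G (φ w) = w := by
    have := hGe.eventually_right_inverse; rwa [hGp] at this
  have hleft : ∀ᶠ x in nhds p, φ (G x) = x := hGe.eventually_left_inverse
  have hφ0 : φ 0 = p := by
    have := hGe.localInverse_apply_image; rwa [hGp] at this
  have hstr : HasStrictFDerivAt φ (e.symm : E3 →L[ℝ] E3) 0 := by
    have := hGe.to_localInverse; rwa [hGp] at this
  obtain ⟨L, tt, htt, hL⟩ := hstr.exists_lipschitzOnWith
  have hcont : ContinuousAt φ 0 := hstr.hasFDerivAt.continuousAt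
  have hUe : ∀ᶠ w in nhds (0 : E3), φ w ∈ U := hcont.eventually_mem (by
    rw [hφ0]; exact hU.mem_nhds hpU)
  obtain ⟨s, hs, hsb⟩ := Metric.eventually_nhds_iff_ball.1 (hright.and (hUe.and htt))
  obtain ⟨ε, hε, hεb⟩ := Metric.eventually_nhds_iff_ball.1
    (hleft.and (hU.mem_nhds hpU))
  refine ⟨s / 2, by positivity, ε, hε, L, φ, ?_, ?_, hφ0, ?_⟩
  · intro τ hτ hτs
    obtain ⟨h1, h2, -⟩ := hsb τ (by rw [mem_ball_zero_iff]; linarith)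
    have h3 : Srf.PT p (φ τ - p) + F (φ τ) • n = τ := by
      rw [← hPL]; exact h1
    have h4 : F (φ τ) = 0 := by
      have : ⟪Srf.PT p (φ τ - p) + F (φ τ) • n, n⟫ = 0 := by
        rw [h3]; exact Srf.mem_tangent.1 hτ
      rw [inner_add_left, (Srf.mem_tangent).1 (Srf.PT_mem hp _), real_inner_smul_left, hn1] at this
      linarith
    refine ⟨?_, by rw [h4] at h3; simpa using h3⟩
    have : φ τ ∈ Srf.S ∩ U := by rw [hSU]; exact ⟨h2, h4⟩
    exact this.1
  · refine hL.mono fun w hw => (hsb w ?_).2.2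
    rw [mem_closedBall_zero_iff] at hw
    rw [mem_ball_zero_iff]; linarith
  · intro x hx hxp
    obtain ⟨h1, h2⟩ := hεb x (by rw [mem_ball_iff_norm]; exact hxp)
    have : x ∈ Srf.S ∩ U := ⟨hx, h2⟩
    rw [hSU] at this
    have hGx : G x = Srf.PT p (x - p) := by simp [G, this.2, hPL]
    rw [← hGx]; exact h1

end SmoothSurface
end

section
lemma inner_gradient (W : E3 → ℝ) (y v : E3) : ⟪gradient W y, v⟫ = fderiv ℝ W y v := by
  simp [gradient]

lemma tGrad_eq {A : Set E3} {P : Submodule ℝ E3} {w : E3 → ℝ} {x : E3} {D : E3 →L[ℝ] ℝ}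
    (hD : HasFDerivWithinAt w D A x) (hP : ∀ τ ∈ P, τ ∈ tangentConeAt ℝ A x) :
    tGrad A P w x =
      (Submodule.orthogonalProjectionOnto P ((InnerProductSpace.toDual ℝ E3).symm D) : E3) := by
  unfold tGrad
  congr 1
  rw [← sub_eq_zero, ← map_sub, Submodule.orthogonalProjectionOnto_eq_zero_iff,
    Submodule.mem_orthogonal']
  intro τ hτ
  have h1 := hD.differentiableWithinAt.hasFDerivWithinAt.unique_on hD (hP τ hτ)
  rw [inner_sub_left, InnerProductSpace.toDual_symm_apply, InnerProductSpace.toDual_symm_apply, h1,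
    sub_self]

namespace SmoothSurface
variable (Srf : SmoothSurface)

lemma exists_curve {y τ : E3} (hy : y ∈ Srf.S) (hτ : τ ∈ Srf.tangent y) :
    ∃ s₀ > 0, ∃ C ≥ 0, ∃ γ : ℝ → E3, ∀ s : ℝ, |s| ≤ s₀ →
      γ s ∈ Srf.S ∧ ‖γ s - y - s • τ‖ ≤ C * s ^ 2 := by
  obtain ⟨s, hs, ε, hε, L, φ, h1, h2, h3, h4⟩ := Srf.exists_chart hy
  obtain ⟨C, hC, hq⟩ := Srf.exists_quad
  refine ⟨s / (‖τ‖ + 1), by positivity, C * (L * ‖τ‖) ^ 2, by positivity, fun t => φ (t • τ), ?_⟩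
  intro t ht
  have hle : ‖t • τ‖ ≤ s := by
    rw [norm_smul, Real.norm_eq_abs]
    rw [le_div_iff₀ (by positivity)] at ht
    nlinarith [norm_nonneg τ, abs_nonneg t]
  obtain ⟨hS, hPT⟩ := h1 (t • τ) (Submodule.smul_mem _ _ hτ) hle
  refine ⟨hS, ?_⟩
  have e1 : φ (t • τ) - y - t • τ = ⟪φ (t • τ) - y, Srf.n y⟫ • Srf.n y := by
    nth_rewrite 2 [← hPT]
    rw [PT]; abel
  have e2 := hq y hy _ hS
  have e3 : ‖φ (t • τ) - y‖ ≤ L * ‖τ‖ * |t| := by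
    have := h2.dist_le_mul (t • τ) (by simpa using hle) 0 (by simp [hs.le])
    rw [h3, dist_eq_norm, dist_zero_right, norm_smul, Real.norm_eq_abs] at this
    calc _ ≤ _ := this
      _ = _ := by ring
  show ‖φ (t • τ) - y - t • τ‖ ≤ _
  rw [e1, norm_smul, Srf.n_unit y hy, mul_one, Real.norm_eq_abs]
  calc _ ≤ _ := e2
    _ ≤ C * (L * ‖τ‖ * |t|) ^ 2 := by gcongr
    _ = _ := by rw [mul_pow, sq_abs]; ring

lemma tangent_sub_cone {y : E3} (hy : y ∈ Srf.S) :
    ∀ τ ∈ Srf.tangent y, τ ∈ tangentConeAt ℝ Srf.S y := by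
  intro τ hτ
  obtain ⟨s₀, hs₀, C, hC, γ, hγ⟩ := Srf.exists_curve hy hτ
  have hlim : Filter.Tendsto (fun n : ℕ => s₀ * (1 / ((n : ℝ) + 1))) Filter.atTop (nhds 0) := by
    simpa using (tendsto_one_div_add_atTop_nhds_zero_nat (𝕜 := ℝ)).const_mul s₀
  set u : ℕ → ℝ := fun n => s₀ * (1 / ((n : ℝ) + 1)) with hu
  have hupos : ∀ n, 0 < u n := fun n => by simp only [hu]; positivity
  have hule : ∀ n, |u n| ≤ s₀ := fun n => by
    rw [abs_of_pos (hupos n)]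
    simp only [hu]
    have : 1 / ((n : ℝ) + 1) ≤ 1 := by
      rw [div_le_one (by positivity)]
      have : (0 : ℝ) ≤ n := by positivity
      linarith
    nlinarith
  have key : Filter.Tendsto (fun n => (u n)⁻¹ • (γ (u n) - y)) Filter.atTop (nhds τ) := by
    rw [tendsto_iff_norm_sub_tendsto_zero]
    refine squeeze_zero (fun n => norm_nonneg _) (g := fun n => C * u n) (fun n => ?_) ?_
    · have h1 := (hγ (u n) (hule n)).2
      have h2 : (u n)⁻¹ • (γ (u n) - y) - τ = (u n)⁻¹ • (γ (u n) - y - u n • τ) := by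
        rw [smul_sub _ (γ (u n) - y), smul_smul, inv_mul_cancel₀ (hupos n).ne', one_smul]
      rw [h2, norm_smul, norm_inv, Real.norm_eq_abs, abs_of_pos (hupos n)]
      rw [inv_mul_le_iff₀ (hupos n)]
      calc _ ≤ _ := h1
        _ = _ := by ring
    · simpa using hlim.const_mul C
  refine mem_tangentConeAt_of_seq (Filter.atTop : Filter ℕ) (fun n => (u n)⁻¹)
    (fun n => γ (u n) - y) ?_ ?_ key
  · have := hlim.smul key
    rw [zero_smul] at this
    refine this.congr fun n => ?_
    change u n • (u n)⁻¹ • (γ (u n) - y) = _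
    rw [smul_smul, mul_inv_cancel₀ (hupos n).ne', one_smul]
  · refine Filter.Eventually.of_forall fun n => ?_
    rw [add_sub_cancel]
    exact (hγ (u n) (hule n)).1

/-- `w` is locally on `S` the restriction of an ambient `C¹` function. -/
def SC1 (w : E3 → ℝ) (y : E3) : Prop :=
  ∃ W : E3 → ℝ, ContDiffAt ℝ 1 W y ∧ w =ᶠ[nhdsWithin y Srf.S] W

variable {Srf}

lemma grad_eq {w W : E3 → ℝ} {y : E3} (hy : y ∈ Srf.S) (hW : DifferentiableAt ℝ W y)
    (h : w =ᶠ[nhdsWithin y Srf.S] W) : Srf.grad w y = Srf.PT y (gradient W y) := by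
  have h1 : HasFDerivWithinAt w (fderiv ℝ W y) Srf.S y :=
    hW.hasFDerivAt.hasFDerivWithinAt.congr_of_eventuallyEq h (h.self_of_nhdsWithin hy)
  rw [grad, tGrad_eq h1 (Srf.tangent_sub_cone hy), Srf.PT_eq hy, gradient]

lemma grad_of_diff {W : E3 → ℝ} {y : E3} (hy : y ∈ Srf.S) (hW : DifferentiableAt ℝ W y) :
    Srf.grad W y = Srf.PT y (gradient W y) := grad_eq hy hW Filter.EventuallyEq.rfl

lemma SC1.of_contDiffAt {W : E3 → ℝ} {y : E3} (hW : ContDiffAt ℝ 1 W y) : Srf.SC1 W y :=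
  ⟨W, hW, Filter.EventuallyEq.rfl⟩

lemma SC1.sub {v w : E3 → ℝ} {y : E3} (hv : Srf.SC1 v y) (hw : Srf.SC1 w y) :
    Srf.SC1 (fun x => v x - w x) y := by
  obtain ⟨V, hV, h1⟩ := hv
  obtain ⟨W, hW, h2⟩ := hw
  exact ⟨fun x => V x - W x, hV.sub hW, h1.sub h2⟩

lemma SC1.add {v w : E3 → ℝ} {y : E3} (hv : Srf.SC1 v y) (hw : Srf.SC1 w y) :
    Srf.SC1 (fun x => v x + w x) y := by
  obtain ⟨V, hV, h1⟩ := hv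
  obtain ⟨W, hW, h2⟩ := hw
  exact ⟨fun x => V x + W x, hV.add hW, h1.add h2⟩

lemma SC1.mul {v w : E3 → ℝ} {y : E3} (hv : Srf.SC1 v y) (hw : Srf.SC1 w y) :
    Srf.SC1 (fun x => v x * w x) y := by
  obtain ⟨V, hV, h1⟩ := hv
  obtain ⟨W, hW, h2⟩ := hw
  exact ⟨fun x => V x * W x, hV.mul hW, h1.mul h2⟩

lemma grad_sub {v w : E3 → ℝ} {y : E3} (hy : y ∈ Srf.S) (hv : Srf.SC1 v y) (hw : Srf.SC1 w y) :
    Srf.grad (fun x => v x - w x) y = Srf.grad v y - Srf.grad w y := by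
  obtain ⟨V, hV, h1⟩ := hv
  obtain ⟨W, hW, h2⟩ := hw
  have dV := hV.differentiableAt one_ne_zero
  have dW := hW.differentiableAt one_ne_zero
  rw [grad_eq hy dV h1, grad_eq hy dW h2, grad_eq (w := fun x => v x - w x) (W := V - W) hy (dV.sub dW) (h1.sub h2 : (fun x => v x - w x) =ᶠ[_] _), ← PT_sub]
  congr 1
  simp only [gradient]
  rw [fderiv_sub dV dW, map_sub]

lemma grad_add {v w : E3 → ℝ} {y : E3} (hy : y ∈ Srf.S) (hv : Srf.SC1 v y) (hw : Srf.SC1 w y) :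
    Srf.grad (fun x => v x + w x) y = Srf.grad v y + Srf.grad w y := by
  obtain ⟨V, hV, h1⟩ := hv
  obtain ⟨W, hW, h2⟩ := hw
  have dV := hV.differentiableAt one_ne_zero
  have dW := hW.differentiableAt one_ne_zero
  rw [grad_eq hy dV h1, grad_eq hy dW h2, grad_eq (w := fun x => v x + w x) (W := V + W) hy (dV.add dW) (h1.add h2 : (fun x => v x + w x) =ᶠ[_] _), ← PT_add]
  congr 1
  simp only [gradient]
  rw [fderiv_add dV dW, map_add]

lemma grad_mul {v w : E3 → ℝ} {y : E3} (hy : y ∈ Srf.S) (hv : Srf.SC1 v y) (hw : Srf.SC1 w y) :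
    Srf.grad (fun x => v x * w x) y = v y • Srf.grad w y + w y • Srf.grad v y := by
  obtain ⟨V, hV, h1⟩ := hv
  obtain ⟨W, hW, h2⟩ := hw
  have dV := hV.differentiableAt one_ne_zero
  have dW := hW.differentiableAt one_ne_zero
  rw [grad_eq hy dV h1, grad_eq hy dW h2, grad_eq (w := fun x => v x * w x) (W := V * W) hy (dV.mul dW) (h1.mul h2 : (fun x => v x * w x) =ᶠ[_] _),
    h1.self_of_nhdsWithin hy, h2.self_of_nhdsWithin hy, ← PT_smul, ← PT_smul, ← PT_add]
  congr 1
  simp only [gradient]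
  rw [fderiv_mul dV dW, map_add, map_smul, map_smul]

lemma continuousWithinAt_PT {f : E3 → E3} {y : E3} (hy : y ∈ Srf.S)
    (hf : ContinuousWithinAt f Srf.S y) :
    ContinuousWithinAt (fun x => Srf.PT x (f x)) Srf.S y := by
  have hn := Srf.n_continuousOn y hy
  exact hf.sub (ContinuousWithinAt.smul (hf.inner (𝕜 := ℝ) hn) hn)

lemma SC1.continuousWithinAt {w : E3 → ℝ} {y : E3} (hy : y ∈ Srf.S) (hw : Srf.SC1 w y) :
    ContinuousWithinAt w Srf.S y := by
  obtain ⟨W, hW, h⟩ := hw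
  exact (hW.continuousAt.continuousWithinAt).congr_of_eventuallyEq h (h.self_of_nhdsWithin hy)

lemma SC1.grad_continuousWithinAt {w : E3 → ℝ} {y : E3} (hy : y ∈ Srf.S) (hw : Srf.SC1 w y) :
    ContinuousWithinAt (Srf.grad w) Srf.S y := by
  obtain ⟨W, hW, h⟩ := hw
  have h1 : ContinuousAt (gradient W) y := by
    have : ContDiffAt ℝ 0 (fderiv ℝ W) y := hW.fderiv_right (by norm_num)
    exact (InnerProductSpace.toDual ℝ E3).symm.continuous.continuousAt.comp this.continuousAt
  have h2 := continuousWithinAt_PT hy h1.continuousWithinAt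
  have h3 : ∀ᶠ x in nhds y, DifferentiableAt ℝ W x := by
    filter_upwards [hW.eventually (by norm_num)] with x hx
    exact hx.differentiableAt one_ne_zero
  have h4 : Srf.grad w =ᶠ[nhdsWithin y Srf.S] fun x => Srf.PT x (gradient W x) := by
    filter_upwards [nhdsWithin_le_nhds h3, eventually_eventually_nhdsWithin.2 h,
      self_mem_nhdsWithin] with x hx1 hx2 hx3
    exact grad_eq hx3 hx1 hx2
  exact h2.congr_of_eventuallyEq h4 (h4.self_of_nhdsWithin hy)

lemma grad_mem {w : E3 → ℝ} {y : E3} : Srf.grad w y ∈ Srf.tangent y := Subtype.mem _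

lemma SC1.lipAt {w : E3 → ℝ} {y : E3} (hy : y ∈ Srf.S) (hw : Srf.SC1 w y) {ε : ℝ} (hε : 0 < ε) :
    ∀ᶠ x in nhdsWithin y Srf.S, |w x - w y| ≤ (‖Srf.grad w y‖ + ε) * ‖x - y‖ := by
  obtain ⟨W, hW, h⟩ := hw
  have dW := hW.differentiableAt one_ne_zero
  have hg := grad_eq hy dW h
  obtain ⟨C, hC, hq⟩ := Srf.exists_quad
  set m := |⟪gradient W y, Srf.n y⟫| with hm
  have h1 := dW.hasFDerivAt.isLittleO.def (half_pos hε)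
  have h2 : ∀ᶠ x in nhds y, m * C * ‖x - y‖ < ε / 2 := by
    have : ContinuousAt (fun x => m * C * ‖x - y‖) y := by fun_prop
    exact this.eventually_lt_const (by simpa using half_pos hε)
  filter_upwards [h, nhdsWithin_le_nhds h1, nhdsWithin_le_nhds h2, self_mem_nhdsWithin]
    with x hx1 hx2 hx3 hxS
  rw [hx1, h.self_of_nhdsWithin hy]
  rw [← inner_gradient, Real.norm_eq_abs] at hx2
  have e1 : ⟪gradient W y, x - y⟫ = ⟪Srf.grad w y, x - y⟫ +
      ⟪gradient W y, Srf.n y⟫ * ⟪x - y, Srf.n y⟫ := by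
    rw [hg, PT, inner_sub_left, real_inner_smul_left, real_inner_comm (x - y) (Srf.n y)]; ring
  have e2 : |⟪Srf.grad w y, x - y⟫| ≤ ‖Srf.grad w y‖ * ‖x - y‖ := abs_real_inner_le_norm _ _
  have e3 : |⟪gradient W y, Srf.n y⟫ * ⟪x - y, Srf.n y⟫| ≤ ε / 2 * ‖x - y‖ := by
    rw [abs_mul]
    calc m * |⟪x - y, Srf.n y⟫| ≤ m * (C * ‖x - y‖ ^ 2) := by gcongr; exact hq y hy x hxS
      _ = (m * C * ‖x - y‖) * ‖x - y‖ := by ring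
      _ ≤ _ := by gcongr
  calc |W x - W y| = |(W x - W y - ⟪gradient W y, x - y⟫) + (⟪Srf.grad w y, x - y⟫ +
      ⟪gradient W y, Srf.n y⟫ * ⟪x - y, Srf.n y⟫)| := by rw [← e1]; ring_nf
    _ ≤ ε / 2 * ‖x - y‖ + (‖Srf.grad w y‖ * ‖x - y‖ + ε / 2 * ‖x - y‖) :=
      (abs_add_le _ _).trans (add_le_add hx2 ((abs_add_le _ _).trans (add_le_add e2 e3)))
    _ = _ := by ring

variable (Srf) in
/-- `r ≥ c d` uniformly on the graph patch. -/
lemma exists_r_lower {r₁ : ℝ} (hr₁ : Srf.IsGraphRadius r₁) : ∃ c > 0, ∀ z ∈ Srf.S, ∀ x ∈ Srf.S,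
    ‖x - z‖ ≤ 2 * r₁ → c * ‖x - z‖ ≤ Srf.rfn z x := by
  obtain ⟨C, hC, hq⟩ := Srf.exists_quad
  set δ : ℝ := 1 / (2 * (C + 1)) with hδ
  have hδ0 : 0 < δ := by positivity
  have hnear : ∀ z ∈ Srf.S, ∀ x ∈ Srf.S, ‖x - z‖ ≤ δ → 1 / 2 * ‖x - z‖ ≤ Srf.rfn z x := by
    intro z hz x hx hd
    rw [Srf.rfn_eq hz]
    refine le_of_sq_le_sq ?_ (norm_nonneg _)
    rw [Srf.norm_PT_sq hz]
    have h1 := hq z hz x hx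
    have h2 : C * ‖x - z‖ ^ 2 ≤ 1 / 2 * ‖x - z‖ := by
      have : C * ‖x - z‖ ≤ 1 / 2 := by
        calc C * ‖x - z‖ ≤ C * δ := by gcongr
          _ ≤ 1 / 2 := by rw [hδ, mul_one_div, div_le_div_iff₀ (by positivity) (by norm_num)]; linarith
      nlinarith [norm_nonneg (x - z)]
    have h3 : ⟪x - z, Srf.n z⟫ ^ 2 ≤ (1 / 2 * ‖x - z‖) ^ 2 := by
      rw [← sq_abs]; gcongr; exact h1.trans h2
    nlinarith [sq_nonneg ‖x - z‖]
  let A : Set (E3 × E3) := (Srf.S ×ˢ Srf.S) ∩ {p | δ ≤ ‖p.2 - p.1‖ ∧ ‖p.2 - p.1‖ ≤ 2 * r₁}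
  have hA : IsCompact A := by
    refine (Srf.compact.prod Srf.compact).inter_right ?_
    have hc : Continuous (fun p : E3 × E3 => ‖p.2 - p.1‖) := by fun_prop
    exact (isClosed_le continuous_const hc).inter (isClosed_le hc continuous_const)
  let f : E3 × E3 → ℝ := fun p => ‖Srf.PT p.1 (p.2 - p.1)‖
  have hf : ContinuousOn f A := by
    have hn : ContinuousOn (fun p : E3 × E3 => Srf.n p.1) A :=
      Srf.n_continuousOn.comp continuous_fst.continuousOn fun p hp => hp.1.1
    have hs : ContinuousOn (fun p : E3 × E3 => p.2 - p.1) A := by fun_prop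
    have hi : ContinuousOn (fun p : E3 × E3 => ⟪p.2 - p.1, Srf.n p.1⟫) A := hs.inner (𝕜 := ℝ) hn
    have h2 : ContinuousOn (fun p : E3 × E3 => ⟪p.2 - p.1, Srf.n p.1⟫ • Srf.n p.1) A := hi.smul hn
    exact (hs.sub h2).norm
  have hpos : ∀ p ∈ A, 0 < f p := by
    rintro ⟨z, x⟩ ⟨⟨hz, hx⟩, h1, h2⟩
    simp only at hz hx h1 h2
    show 0 < ‖Srf.PT z (x - z)‖
    rw [norm_pos_iff]
    intro h0
    have := hr₁.2.2 z hz (x₁ := x) (x₂ := z) ⟨hx, by rwa [mem_closedBall, dist_eq_norm]⟩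
      ⟨hz, by simp [hr₁.1.le]⟩ (by
        rw [P0, P0, Srf.PT_eq hz, Srf.PT_eq hz, h0, sub_self]; simp [PT])
    rw [this, sub_self, norm_zero] at h1
    linarith
  by_cases hne : A.Nonempty
  · obtain ⟨p₀, hp₀, hmin⟩ := hA.exists_isMinOn hne hf
    set m := f p₀ with hm
    have hm0 : 0 < m := hpos p₀ hp₀
    refine ⟨min (1 / 2) (m / (2 * r₁)), lt_min (by norm_num) (by have := hr₁.1; positivity), ?_⟩
    intro z hz x hx hd
    by_cases hdd : ‖x - z‖ ≤ δ
    · refine le_trans ?_ (hnear z hz x hx hdd)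
      gcongr; exact min_le_left _ _
    · push Not at hdd
      have h1 : m ≤ f (z, x) := hmin ⟨⟨hz, hx⟩, hdd.le, hd⟩
      rw [Srf.rfn_eq hz]
      refine le_trans ?_ h1
      have := hr₁.1
      calc _ ≤ m / (2 * r₁) * (2 * r₁) := by
            gcongr; exact min_le_right _ _
        _ = m := by field_simp
  · refine ⟨1 / 2, by norm_num, fun z hz x hx hd => hnear z hz x hx ?_⟩
    by_contra h
    push Not at h
    exact hne ⟨(z, x), ⟨hz, hx⟩, h.le, hd⟩

end SmoothSurface
end

section
lemma exists_unit_orth (a b : E3) : ∃ u : E3, ‖u‖ = 1 ∧ ⟪u, a⟫ = 0 ∧ ⟪u, b⟫ = 0 := by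
  have h1 : Module.finrank ℝ (Submodule.span ℝ ({a, b} : Set E3)) ≤ 2 := by
    classical
    have := finrank_span_finset_le_card (R := ℝ) ({a, b} : Finset E3)
    have h2 : ({a, b} : Finset E3).card ≤ 2 := Finset.card_le_two
    simp only [Finset.coe_insert, Finset.coe_singleton] at this
    exact le_trans this h2
  have h2 := Submodule.finrank_add_finrank_orthogonal (Submodule.span ℝ ({a, b} : Set E3))
  have h3 : Module.finrank ℝ E3 = 3 := by simp
  have h4 : 0 < Module.finrank ℝ (Submodule.span ℝ ({a, b} : Set E3))ᗮ := by omega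
  have h5 : (Submodule.span ℝ ({a, b} : Set E3))ᗮ ≠ ⊥ := by
    intro h; rw [h, finrank_bot] at h4; exact lt_irrefl _ h4
  obtain ⟨v, hv, hv0⟩ := Submodule.exists_mem_ne_zero_of_ne_bot h5
  rw [Submodule.mem_orthogonal'] at hv
  have hn : ‖v‖ ≠ 0 := norm_ne_zero_iff.2 hv0
  refine ⟨‖v‖⁻¹ • v, ?_, ?_, ?_⟩
  · rw [norm_smul, norm_inv, norm_norm, inv_mul_cancel₀ hn]
  · rw [real_inner_smul_left, hv a (Submodule.subset_span (by simp)), mul_zero]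
  · rw [real_inner_smul_left, hv b (Submodule.subset_span (by simp)), mul_zero]

lemma orth_expand {n τ σ : E3} (hn : ‖n‖ = 1) (hτ : ‖τ‖ = 1) (hσ : ‖σ‖ = 1)
    (h1 : ⟪n, τ⟫ = 0) (h2 : ⟪n, σ⟫ = 0) (h3 : ⟪τ, σ⟫ = 0) (v : E3) :
    v = ⟪n, v⟫ • n + ⟪τ, v⟫ • τ + ⟪σ, v⟫ • σ := by
  have ho : Orthonormal ℝ ![n, τ, σ] := by
    constructor
    · intro i; fin_cases i <;> simp [hn, hτ, hσ]
    · intro i j hij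
      fin_cases i <;> fin_cases j <;> simp_all [real_inner_comm]
  let b := basisOfOrthonormalOfCardEqFinrank ho (by simp)
  have hb : ⇑b = ![n, τ, σ] := coe_basisOfOrthonormalOfCardEqFinrank _ _
  let ob := b.toOrthonormalBasis (by rw [hb]; exact ho)
  have hob : ⇑ob = ![n, τ, σ] := by simp [ob, hb]
  have := ob.sum_repr' v
  rw [Fin.sum_univ_three, hob] at this
  simpa using this.symm

namespace SmoothSurface
variable (Srf : SmoothSurface)

/-- orthonormal frame of the tangent plane -/
structure Frame (p τ σ : E3) : Prop where
  τ1 : ‖τ‖ = 1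
  σ1 : ‖σ‖ = 1
  τn : ⟪τ, Srf.n p⟫ = 0
  σn : ⟪σ, Srf.n p⟫ = 0
  τσ : ⟪τ, σ⟫ = 0

lemma exists_frame (p z : E3) : ∃ τ σ, Srf.Frame p τ σ ∧ ⟪τ, Srf.n z⟫ = 0 := by
  obtain ⟨τ, h1, h2, h3⟩ := exists_unit_orth (Srf.n p) (Srf.n z)
  obtain ⟨σ, h4, h5, h6⟩ := exists_unit_orth (Srf.n p) τ
  exact ⟨τ, σ, ⟨h1, h4, h2, h5, by rw [real_inner_comm]; exact h6⟩, h3⟩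

/-- charts in coordinates -/
lemma exists_chart2 {p : E3} (hp : p ∈ Srf.S) : ∃ s > 0, ∃ ε > 0, ∃ L : ℝ≥0, ∀ τ σ : E3,
    Srf.Frame p τ σ → ∃ Φ : ℝ × ℝ → E3,
    (∀ y : ℝ × ℝ, |y.1| ≤ s → |y.2| ≤ s →
      Φ y ∈ Srf.S ∧ ⟪Φ y - p, τ⟫ = y.1 ∧ ⟪Φ y - p, σ⟫ = y.2) ∧
    LipschitzOnWith L Φ (Set.Icc (-s) s ×ˢ Set.Icc (-s) s) ∧
    (∀ x ∈ Srf.S, ‖x - p‖ < ε → ‖x - p‖ < s ∧ Φ (⟪x - p, τ⟫, ⟪x - p, σ⟫) = x) := by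
  obtain ⟨s, hs, ε, hε, L, φ, h1, h2, h3, h4⟩ := Srf.exists_chart hp
  refine ⟨s / 2, by positivity, min ε (s / 2), lt_min hε (by positivity), L * 2, ?_⟩
  intro τ σ hF
  have hmem : ∀ y : ℝ × ℝ, y.1 • τ + y.2 • σ ∈ Srf.tangent p := by
    intro y
    rw [mem_tangent, inner_add_left, real_inner_smul_left, real_inner_smul_left, hF.τn, hF.σn]
    ring
  have hnorm : ∀ a b : ℝ, ‖a • τ + b • σ‖ ≤ |a| + |b| := by
    intro a b
    refine (norm_add_le _ _).trans ?_
    rw [norm_smul, norm_smul, hF.τ1, hF.σ1]; simp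
  have hexp : ∀ v : E3, Srf.PT p v = ⟪v, τ⟫ • τ + ⟪v, σ⟫ • σ := by
    intro v
    have := orth_expand (Srf.n_unit p hp) hF.τ1 hF.σ1
      (by rw [real_inner_comm]; exact hF.τn) (by rw [real_inner_comm]; exact hF.σn) hF.τσ v
    rw [PT]
    nth_rewrite 1 [this]
    rw [real_inner_comm v (Srf.n p), real_inner_comm v τ, real_inner_comm v σ]
    abel
  refine ⟨fun y => φ (y.1 • τ + y.2 • σ), ?_, ?_, ?_⟩
  · intro y hy1 hy2
    obtain ⟨hS, hPT⟩ := h1 _ (hmem y) ((hnorm _ _).trans (by linarith))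
    refine ⟨hS, ?_, ?_⟩
    · rw [← Srf.inner_PT (Srf.mem_tangent.2 hF.τn), hPT, inner_add_left, real_inner_smul_left,
        real_inner_smul_left, real_inner_self_eq_norm_sq, hF.τ1, real_inner_comm, hF.τσ]; ring
    · rw [← Srf.inner_PT (Srf.mem_tangent.2 hF.σn), hPT, inner_add_left, real_inner_smul_left,
        real_inner_smul_left, real_inner_self_eq_norm_sq, hF.σ1, hF.τσ]; ring
  · refine LipschitzOnWith.of_dist_le_mul ?_
    rintro x ⟨hx1, hx2⟩ y ⟨hy1, hy2⟩
    have hb : ∀ y : ℝ × ℝ, y.1 ∈ Set.Icc (-(s/2)) (s/2) → y.2 ∈ Set.Icc (-(s/2)) (s/2) →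
        y.1 • τ + y.2 • σ ∈ closedBall (0 : E3) s := by
      intro y h1 h2
      rw [mem_closedBall_zero_iff]
      have := abs_le.2 h1
      have := abs_le.2 h2
      exact (hnorm _ _).trans (by linarith)
    have := h2.dist_le_mul _ (hb x hx1 hx2) _ (hb y hy1 hy2)
    refine this.trans ?_
    rw [NNReal.coe_mul, mul_assoc]
    gcongr
    rw [dist_eq_norm]
    have e : x.1 • τ + x.2 • σ - (y.1 • τ + y.2 • σ) = (x.1 - y.1) • τ + (x.2 - y.2) • σ := by
      module
    rw [e]
    refine (hnorm _ _).trans ?_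
    have e1 : |x.1 - y.1| ≤ dist x y := by rw [Prod.dist_eq]; exact le_max_left _ _
    have e2 : |x.2 - y.2| ≤ dist x y := by rw [Prod.dist_eq]; exact le_max_right _ _
    push_cast
    linarith
  · intro x hx hd
    refine ⟨lt_of_lt_of_le hd (min_le_right _ _), ?_⟩
    show φ _ = x
    rw [← hexp]
    exact h4 x hx (lt_of_lt_of_le hd (min_le_left _ _))

/-- Ahlfors upper regularity -/
lemma exists_ahlfors : ∃ C : ℝ, 0 < C ∧ ∀ z : E3, ∀ s : ℝ, 0 < s →
    (μH[2] : Measure E3) (Srf.S ∩ ball z s) ≤ ENNReal.ofReal (C * s ^ 2) := by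
  have key : ∃ C : ℝ, 0 < C ∧ ∀ z : E3, ∀ s : ℝ, 0 < s →
      (μH[2] : Measure E3) (Srf.S ∩ Srf.S ∩ ball z s) ≤ ENNReal.ofReal (C * s ^ 2) := by
    refine Srf.compact.induction_on (p := fun A => ∃ C : ℝ, 0 < C ∧ ∀ z : E3, ∀ s : ℝ, 0 < s →
      (μH[2] : Measure E3) (Srf.S ∩ A ∩ ball z s) ≤ ENNReal.ofReal (C * s ^ 2)) ?_ ?_ ?_ ?_
    · exact ⟨1, one_pos, fun z s hs => by simp⟩
    · rintro A B hAB ⟨C, hC, H⟩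
      refine ⟨C, hC, fun z s hs => (measure_mono ?_).trans (H z s hs)⟩
      gcongr
    · rintro A B ⟨C, hC, H⟩ ⟨C', hC', H'⟩
      refine ⟨C + C', by positivity, fun z s hs => ?_⟩
      rw [Set.inter_union_distrib_left, Set.union_inter_distrib_right]
      refine (measure_union_le _ _).trans ?_
      rw [add_mul, ENNReal.ofReal_add (by positivity) (by positivity)]
      exact add_le_add (H z s hs) (H' z s hs)
    · intro p hp
      obtain ⟨s₀, hs₀, ε, hε, L, hch⟩ := Srf.exists_chart2 hp
      obtain ⟨τ, σ, hF, -⟩ := Srf.exists_frame p p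
      obtain ⟨Φ, h1, h2, h3⟩ := hch τ σ hF
      refine ⟨ball p ε, mem_nhdsWithin_of_mem_nhds (ball_mem_nhds p hε), 4 * (L : ℝ) ^ 2 + 1,
        by positivity, fun z s hs => ?_⟩
      set D := Set.Icc (-s₀) s₀ ×ˢ Set.Icc (-s₀) s₀ with hD
      set c : ℝ × ℝ := (⟪z - p, τ⟫, ⟪z - p, σ⟫) with hc
      have hsub : Srf.S ∩ ball p ε ∩ ball z s ⊆ Φ '' (ball c s ∩ D) := by
        rintro x ⟨⟨hxS, hxp⟩, hxz⟩
        rw [mem_ball_iff_norm] at hxp hxz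
        obtain ⟨hd, hx⟩ := h3 x hxS hxp
        have hb : ∀ u : E3, ‖u‖ = 1 → ∀ w : E3, |⟪w, u⟫| ≤ ‖w‖ := fun u hu w => by
          have := abs_real_inner_le_norm w u; rwa [hu, mul_one] at this
        refine ⟨_, ⟨?_, ?_, ?_⟩, hx⟩
        · rw [mem_ball, Prod.dist_eq]
          refine max_lt ?_ ?_
          · simp only [hc, Real.dist_eq, ← inner_sub_left]
            rw [sub_sub_sub_cancel_right]
            exact (hb τ hF.τ1 _).trans_lt hxz
          · simp only [hc, Real.dist_eq, ← inner_sub_left]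
            rw [sub_sub_sub_cancel_right]
            exact (hb σ hF.σ1 _).trans_lt hxz
        · exact abs_le.1 ((hb τ hF.τ1 _).trans hd.le)
        · exact abs_le.1 ((hb σ hF.σ1 _).trans hd.le)
      refine (measure_mono hsub).trans ?_
      refine ((h2.mono Set.inter_subset_right).hausdorffMeasure_image_le (by norm_num)).trans ?_
      rw [hausdorffMeasure_prod_real]
      have hv : volume (ball c s) = ENNReal.ofReal ((2 * s) * (2 * s)) := by
        rw [show c = (c.1, c.2) from rfl, ← ball_prod_same, Measure.volume_eq_prod,
          Measure.prod_prod, Real.volume_ball, Real.volume_ball, ← ENNReal.ofReal_mul (by positivity)]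
      calc _ ≤ (L : ℝ≥0∞) ^ (2 : ℝ) * ENNReal.ofReal ((2 * s) * (2 * s)) := by
            gcongr; rw [← hv]; exact measure_mono Set.inter_subset_left
        _ = ENNReal.ofReal ((L : ℝ) ^ 2 * ((2 * s) * (2 * s))) := by
            rw [ENNReal.ofReal_mul (p := (L : ℝ) ^ 2) (by positivity), ENNReal.rpow_two, ENNReal.ofReal_pow (by positivity),
              ENNReal.ofReal_coe_nnreal]
        _ ≤ _ := by
            apply ENNReal.ofReal_le_ofReal
            nlinarith [sq_nonneg s]
  obtain ⟨C, hC, H⟩ := key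
  exact ⟨C, hC, fun z s hs => by simpa using H z s hs⟩

end SmoothSurface
end

section
namespace SmoothSurface
variable (Srf : SmoothSurface)

/-- surface measure -/
def mu : Measure E3 := (μH[2] : Measure E3).restrict Srf.S

lemma measS : MeasurableSet Srf.S := Srf.compact.measurableSet

lemma mu_ball_le {C : ℝ} (H : ∀ z : E3, ∀ s : ℝ, 0 < s →
    (μH[2] : Measure E3) (Srf.S ∩ ball z s) ≤ ENNReal.ofReal (C * s ^ 2)) (z : E3) {s : ℝ}
    (hs : 0 < s) : Srf.mu (ball z s) ≤ ENNReal.ofReal (C * s ^ 2) := by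
  rw [mu, Measure.restrict_apply measurableSet_ball, Set.inter_comm]
  exact H z s hs

instance : IsFiniteMeasure Srf.mu := by
  obtain ⟨C, hC, H⟩ := Srf.exists_ahlfors
  obtain ⟨B, hB, hBd⟩ := Srf.exists_bdd
  obtain ⟨p, hp⟩ := Srf.nonempty
  refine ⟨?_⟩
  rw [mu, Measure.restrict_apply_univ]
  have : Srf.S ⊆ Srf.S ∩ ball p (B + 1) := fun x hx =>
    ⟨hx, by rw [mem_ball_iff_norm]; linarith [hBd p hp x hx]⟩
  exact ((measure_mono this).trans (H p _ (by linarith))).trans_lt ENNReal.ofReal_lt_top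

lemma ae_mem : ∀ᵐ x ∂Srf.mu, x ∈ Srf.S := ae_restrict_mem Srf.measS

/-- weights -/
def kap (z : E3) (h : ℝ) (x : E3) : ℝ := h ^ 2 / (‖x - z‖ ^ 2 + h ^ 2)

open Classical in
def wgt (z : E3) (h : ℝ) (x : E3) : ℝ := if ‖x - z‖ < h then h / ‖x - z‖ else 0

lemma kap_nonneg (z : E3) (h : ℝ) (x : E3) : 0 ≤ kap z h x := by unfold kap; positivity
lemma kap_le_one (z : E3) (h : ℝ) (x : E3) : kap z h x ≤ 1 := by
  unfold kap; exact div_le_one_of_le₀ (by nlinarith [sq_nonneg ‖x - z‖]) (by positivity)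
lemma wgt_nonneg (z : E3) {h : ℝ} (hh : 0 < h) (x : E3) : 0 ≤ wgt z h x := by
  unfold wgt; split_ifs <;> positivity

lemma measurable_kap (z : E3) (h : ℝ) : Measurable (kap z h) := by
  unfold kap; fun_prop
lemma measurable_wgt (z : E3) (h : ℝ) : Measurable (wgt z h) := by
  unfold wgt
  refine Measurable.ite (measurableSet_lt (by fun_prop) measurable_const) (by fun_prop) measurable_const

lemma lint_ind {C : ℝ} (H : ∀ z : E3, ∀ s : ℝ, 0 < s →
    (μH[2] : Measure E3) (Srf.S ∩ ball z s) ≤ ENNReal.ofReal (C * s ^ 2)) (z : E3) {s c : ℝ}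
    (hs : 0 < s) (hc : 0 ≤ c) :
    ∫⁻ x, (ball z s).indicator (fun _ => ENNReal.ofReal c) x ∂Srf.mu ≤
      ENNReal.ofReal (c * (C * s ^ 2)) := by
  rw [lintegral_indicator_const measurableSet_ball, ENNReal.ofReal_mul hc]
  gcongr
  exact Srf.mu_ball_le H z hs

lemma exists_J3 : ∃ C > 0, ∀ z : E3, ∀ h : ℝ, 0 < h →
    ∫⁻ x, ENNReal.ofReal (wgt z h x) ∂Srf.mu ≤ ENNReal.ofReal (C * h ^ 2) := by
  obtain ⟨C, hC, H⟩ := Srf.exists_ahlfors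
  refine ⟨4 * C, by positivity, fun z h hh => ?_⟩
  have hpt : ∀ x, ENNReal.ofReal (wgt z h x) ≤
      ∑' k : ℕ, (ball z ((1 / 2 : ℝ) ^ k * h)).indicator (fun _ => ENNReal.ofReal (2 ^ (k + 1))) x := by
    intro x
    unfold wgt
    split_ifs with hd
    · rcases (norm_nonneg (x - z)).eq_or_lt with h0 | h0
      · rw [← h0]; simp
      · obtain ⟨k, hk1, hk2⟩ := exists_nat_pow_near_of_lt_one (x := ‖x - z‖ / h) (y := (1 / 2 : ℝ))
          (by positivity) ((div_le_one hh).2 hd.le) (by norm_num) (by norm_num)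
        rw [lt_div_iff₀ hh] at hk1
        rw [div_le_iff₀ hh] at hk2
        rcases hk2.lt_or_eq with hk2 | hk2
        · refine le_trans ?_ (ENNReal.le_tsum k)
          rw [Set.indicator_of_mem (by rwa [mem_ball_iff_norm])]
          apply ENNReal.ofReal_le_ofReal
          rw [div_le_iff₀ h0]
          have : (2 : ℝ) ^ (k + 1) * ((1 / 2) ^ (k + 1) * h) = h := by
            rw [← mul_assoc, ← mul_pow]; norm_num
          nlinarith [pow_pos (two_pos : (0 : ℝ) < 2) (k + 1)]
        · rcases k with _ | k
          · simp at hk2; linarith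
          refine le_trans ?_ (ENNReal.le_tsum k)
          have hp : (0 : ℝ) < (1 / 2) ^ k := by positivity
          rw [Set.indicator_of_mem (by
            rw [mem_ball_iff_norm, hk2, pow_succ]; nlinarith)]
          apply ENNReal.ofReal_le_ofReal
          rw [div_le_iff₀ h0, hk2]
          have : (2 : ℝ) ^ (k + 1) * ((1 / 2) ^ (k + 1) * h) = h := by
            rw [← mul_assoc, ← mul_pow]; norm_num
          linarith
    · simp
  calc _ ≤ _ := lintegral_mono hpt
    _ = ∑' k : ℕ, ∫⁻ x, (ball z ((1 / 2 : ℝ) ^ k * h)).indicator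
          (fun _ => ENNReal.ofReal (2 ^ (k + 1))) x ∂Srf.mu :=
        lintegral_tsum fun k => (measurable_const.indicator measurableSet_ball).aemeasurable
    _ ≤ ∑' k : ℕ, ENNReal.ofReal (2 * C * h ^ 2 * (1 / 2) ^ k) := by
        refine ENNReal.tsum_le_tsum fun k => ?_
        refine (Srf.lint_ind H z (by positivity) (by positivity)).trans (le_of_eq ?_)
        congr 1
        have : (2 : ℝ) ^ k * (1 / 2) ^ k = 1 := by rw [← mul_pow]; norm_num
        calc _ = 2 * C * h ^ 2 * (1 / 2) ^ k * ((2 : ℝ) ^ k * (1 / 2) ^ k) := by ring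
          _ = _ := by rw [this, mul_one]
    _ = ENNReal.ofReal (4 * C * h ^ 2) := by
        rw [← ENNReal.ofReal_tsum_of_nonneg (fun k => by positivity)
          (summable_geometric_two.mul_left _), tsum_mul_left, tsum_geometric_two]
        congr 1; ring

lemma exists_J2 : ∃ C > 0, ∀ z : E3, ∀ h : ℝ, 0 < h →
    ∫⁻ x, ENNReal.ofReal ((h / (‖x - z‖ ^ 2 + h ^ 2)) ^ 2) ∂Srf.mu ≤ ENNReal.ofReal C := by
  obtain ⟨C, hC, H⟩ := Srf.exists_ahlfors
  refine ⟨32 * C, by positivity, fun z h hh => ?_⟩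
  have hpt : ∀ x, ENNReal.ofReal ((h / (‖x - z‖ ^ 2 + h ^ 2)) ^ 2) ≤
      ∑' k : ℕ, (ball z ((2 : ℝ) ^ k * h)).indicator
        (fun _ => ENNReal.ofReal (16 * (1 / 16) ^ k / h ^ 2)) x := by
    intro x
    have hden : 0 < ‖x - z‖ ^ 2 + h ^ 2 := by positivity
    rcases lt_or_ge (‖x - z‖) h with hd | hd
    · refine le_trans ?_ (ENNReal.le_tsum 0)
      rw [Set.indicator_of_mem (by rw [mem_ball_iff_norm]; simpa using hd)]
      apply ENNReal.ofReal_le_ofReal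
      rw [div_pow, div_le_div_iff₀ (by positivity) (by positivity)]
      nlinarith [sq_nonneg ‖x - z‖, pow_pos hh 2, mul_nonneg (sq_nonneg ‖x - z‖) (sq_nonneg h),
        sq_nonneg (‖x - z‖ ^ 2)]
    · obtain ⟨k, hk1, hk2⟩ := exists_nat_pow_near (x := ‖x - z‖ / h) (y := (2 : ℝ))
          ((one_le_div hh).2 hd) (by norm_num)
      rw [le_div_iff₀ hh] at hk1
      rw [div_lt_iff₀ hh] at hk2
      refine le_trans ?_ (ENNReal.le_tsum (k + 1))
      rw [Set.indicator_of_mem (by rwa [mem_ball_iff_norm])]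
      apply ENNReal.ofReal_le_ofReal
      rw [div_pow, div_le_div_iff₀ (by positivity) (by positivity)]
      have e1 : (2 ^ k * h) ^ 2 ≤ ‖x - z‖ ^ 2 + h ^ 2 := by
        have := pow_le_pow_left₀ (by positivity) hk1 2
        nlinarith [sq_nonneg h]
      have e2 : ((2 ^ k * h) ^ 2) ^ 2 ≤ (‖x - z‖ ^ 2 + h ^ 2) ^ 2 := pow_le_pow_left₀ (by positivity) e1 2
      have e3 : (1 / 16 : ℝ) ^ k * (2 ^ k) ^ 4 = 1 := by
        rw [← pow_mul, mul_comm k 4, pow_mul, ← mul_pow]; norm_num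
      calc h ^ 2 * h ^ 2 = ((1 / 16 : ℝ) ^ k * (2 ^ k) ^ 4) * (h ^ 2 * h ^ 2) := by rw [e3, one_mul]
        _ = 16 * (1 / 16) ^ (k + 1) * ((2 ^ k * h) ^ 2) ^ 2 := by ring
        _ ≤ _ := by gcongr
  calc _ ≤ _ := lintegral_mono hpt
    _ = ∑' k : ℕ, ∫⁻ x, (ball z ((2 : ℝ) ^ k * h)).indicator
          (fun _ => ENNReal.ofReal (16 * (1 / 16) ^ k / h ^ 2)) x ∂Srf.mu :=
        lintegral_tsum fun k => (measurable_const.indicator measurableSet_ball).aemeasurable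
    _ ≤ ∑' k : ℕ, ENNReal.ofReal (16 * C * (1 / 2) ^ k) := by
        refine ENNReal.tsum_le_tsum fun k => ?_
        refine (Srf.lint_ind H z (by positivity) (by positivity)).trans ?_
        apply ENNReal.ofReal_le_ofReal
        have e : (1 / 16 : ℝ) ^ k * (2 ^ k) ^ 2 = (1 / 4) ^ k := by
          rw [← pow_mul, mul_comm k 2, pow_mul, ← mul_pow]; norm_num
        calc _ = 16 * C * ((1 / 16 : ℝ) ^ k * (2 ^ k) ^ 2) := by field_simp
          _ = 16 * C * (1 / 4) ^ k := by rw [e]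
          _ ≤ _ := by gcongr; norm_num
    _ = ENNReal.ofReal (32 * C) := by
        rw [← ENNReal.ofReal_tsum_of_nonneg (fun k => by positivity)
          (summable_geometric_two.mul_left _), tsum_mul_left, tsum_geometric_two]
        congr 1; ring

lemma exists_J1 : ∃ C > 0, ∀ z ∈ Srf.S, ∀ h : ℝ, 0 < h → h ≤ 1 / 2 →
    ∫⁻ x, ENNReal.ofReal (kap z h x) ∂Srf.mu ≤ ENNReal.ofReal (C * h ^ 2 * |Real.log h|) := by
  obtain ⟨C, hC, H⟩ := Srf.exists_ahlfors
  obtain ⟨B, hB, hBd⟩ := Srf.exists_bdd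
  set B1 := B + 1 with hB1
  refine ⟨4 * C * ((Real.log B1 + 3) / (Real.log 2) ^ 2 + 1), by
    have := Real.log_nonneg (show 1 ≤ B1 by linarith)
    positivity, fun z hz h hh hh2 => ?_⟩
  have hl2 : 0 < Real.log 2 := Real.log_pos (by norm_num)
  have hlB := Real.log_nonneg (show 1 ≤ B1 by linarith)
  obtain ⟨K, hK1, hK2⟩ := exists_nat_pow_near (x := B1 / h) (y := (2 : ℝ))
    ((one_le_div hh).2 (by linarith)) (by norm_num)
  rw [div_lt_iff₀ hh] at hK2
  have hpt : ∀ x ∈ Srf.S, ENNReal.ofReal (kap z h x) ≤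
      ∑ k ∈ Finset.range (K + 2), (ball z ((2 : ℝ) ^ k * h)).indicator
        (fun _ => ENNReal.ofReal (4 * (1 / 4) ^ k)) x := by
    intro x hx
    unfold kap
    rcases lt_or_ge (‖x - z‖) h with hd | hd
    · refine le_trans ?_ (Finset.single_le_sum (f := fun k : ℕ => (ball z ((2 : ℝ) ^ k * h)).indicator
        (fun _ => ENNReal.ofReal (4 * (1 / 4) ^ k)) x) (fun i _ => zero_le) (a := 0) (by simp))
      rw [Set.indicator_of_mem (by rw [mem_ball_iff_norm]; simpa using hd)]
      apply ENNReal.ofReal_le_ofReal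
      rw [div_le_iff₀ (by positivity)]
      nlinarith [sq_nonneg ‖x - z‖, pow_pos hh 2]
    · obtain ⟨k, hk1, hk2⟩ := exists_nat_pow_near (x := ‖x - z‖ / h) (y := (2 : ℝ))
          ((one_le_div hh).2 hd) (by norm_num)
      rw [le_div_iff₀ hh] at hk1
      rw [div_lt_iff₀ hh] at hk2
      have hkK : k + 1 < K + 2 := by
        have h1 : (2 : ℝ) ^ k < 2 ^ (K + 1) := by
          have : ‖x - z‖ < B1 := by linarith [hBd z hz x hx]
          have h3 : (2 : ℝ) ^ k * h < 2 ^ (K + 1) * h := by linarith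
          exact lt_of_mul_lt_mul_right h3 hh.le
        have := (pow_lt_pow_iff_right₀ (by norm_num : (1 : ℝ) < 2)).1 h1
        omega
      refine le_trans ?_ (Finset.single_le_sum (f := fun k : ℕ => (ball z ((2 : ℝ) ^ k * h)).indicator
        (fun _ => ENNReal.ofReal (4 * (1 / 4) ^ k)) x) (fun i _ => zero_le) (a := k + 1)
        (Finset.mem_range.2 hkK))
      rw [Set.indicator_of_mem (by rwa [mem_ball_iff_norm])]
      apply ENNReal.ofReal_le_ofReal
      rw [div_le_iff₀ (by positivity)]
      have e1 : (2 ^ k * h) ^ 2 ≤ ‖x - z‖ ^ 2 + h ^ 2 := by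
        have := pow_le_pow_left₀ (by positivity) hk1 2
        nlinarith [sq_nonneg h]
      have e3 : (1 / 4 : ℝ) ^ k * (2 ^ k) ^ 2 = 1 := by
        rw [← pow_mul, mul_comm k 2, pow_mul, ← mul_pow]; norm_num
      calc h ^ 2 = ((1 / 4 : ℝ) ^ k * (2 ^ k) ^ 2) * h ^ 2 := by rw [e3, one_mul]
        _ = 4 * (1 / 4) ^ (k + 1) * (2 ^ k * h) ^ 2 := by ring
        _ ≤ _ := by gcongr
  calc _ ≤ ∫⁻ x, ∑ k ∈ Finset.range (K + 2), (ball z ((2 : ℝ) ^ k * h)).indicator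
        (fun _ => ENNReal.ofReal (4 * (1 / 4) ^ k)) x ∂Srf.mu := by
        refine lintegral_mono_ae ?_
        filter_upwards [Srf.ae_mem] with x hx using hpt x hx
    _ = ∑ k ∈ Finset.range (K + 2), ∫⁻ x, (ball z ((2 : ℝ) ^ k * h)).indicator
          (fun _ => ENNReal.ofReal (4 * (1 / 4) ^ k)) x ∂Srf.mu :=
        lintegral_finsetSum _ fun k _ => (measurable_const.indicator measurableSet_ball)
    _ ≤ ∑ k ∈ Finset.range (K + 2), ENNReal.ofReal (4 * C * h ^ 2) := by
        refine Finset.sum_le_sum fun k _ => ?_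
        refine (Srf.lint_ind H z (by positivity) (by positivity)).trans ?_
        apply ENNReal.ofReal_le_ofReal
        have e : (1 / 4 : ℝ) ^ k * (2 ^ k) ^ 2 = 1 := by
          rw [← pow_mul, mul_comm k 2, pow_mul, ← mul_pow]; norm_num
        apply le_of_eq
        calc _ = 4 * C * h ^ 2 * ((1 / 4 : ℝ) ^ k * (2 ^ k) ^ 2) := by ring
          _ = _ := by rw [e, mul_one]
    _ = ENNReal.ofReal ((K + 2) * (4 * C * h ^ 2)) := by
        rw [Finset.sum_const, Finset.card_range, nsmul_eq_mul, ENNReal.ofReal_mul (p := ((K : ℝ) + 2)) (by positivity)]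
        congr 1
        rw [show ((K : ℝ) + 2) = ((K + 2 : ℕ) : ℝ) by push_cast; ring, ENNReal.ofReal_natCast]
    _ ≤ _ := by
        apply ENNReal.ofReal_le_ofReal
        have hlog : Real.log h ≤ - Real.log 2 := by
          rw [← Real.log_inv]
          exact Real.log_le_log hh (by linarith)
        have habs : |Real.log h| = - Real.log h := abs_of_nonpos (by linarith)
        have h1 : K * Real.log 2 ≤ Real.log B1 - Real.log h := by
          rw [← Real.log_pow, ← Real.log_div (by linarith) hh.ne']
          exact Real.log_le_log (by positivity) hK1
        rw [habs]
        set l := - Real.log h with hl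
        have hl1 : Real.log 2 ≤ l := by linarith
        have hlt : Real.log 2 < 1 := by
          have := Real.log_two_lt_d9; linarith
        have h2 : (K : ℝ) + 2 ≤ ((Real.log B1 + 3) / (Real.log 2) ^ 2 + 1) * l := by
          have e1 : (K : ℝ) ≤ (Real.log B1 + l) / Real.log 2 := by
            rw [le_div_iff₀ hl2]; linarith
          have e2 : (Real.log B1 + l) / Real.log 2 + 2 ≤ ((Real.log B1 + 3) / (Real.log 2) ^ 2 + 1) * l := by
            rw [div_add' _ _ _ hl2.ne', div_add' _ _ _ (by positivity), div_mul_eq_mul_div,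
              div_le_div_iff₀ hl2 (by positivity)]
            set m := Real.log 2
            set b := Real.log B1
            have : (b + l + 2 * m) * m ≤ (b + 3 + m ^ 2) * l := by
              nlinarith [mul_nonneg hlB (sub_nonneg.2 hl1), mul_nonneg hlB hl2.le,
                mul_le_mul_of_nonneg_right hlt.le hl2.le, mul_le_mul_of_nonneg_left hlt.le (hl2.le.trans hl1), mul_nonneg hl2.le (hl2.le.trans hl1)]
            nlinarith
          linarith
        calc ((K : ℝ) + 2) * (4 * C * h ^ 2) ≤
            (((Real.log B1 + 3) / (Real.log 2) ^ 2 + 1) * l) * (4 * C * h ^ 2) := by gcongr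
          _ = _ := by ring

end SmoothSurface
end

section
/-- uniform surface constants -/
structure SmoothSurface.Cst (Srf : SmoothSurface) (K : ℝ) : Prop where
  one : 1 ≤ K
  quad : ∀ p ∈ Srf.S, ∀ q ∈ Srf.S, |⟪q - p, Srf.n p⟫| ≤ K * ‖q - p‖ ^ 2
  nlip : ∀ p ∈ Srf.S, ∀ q ∈ Srf.S, ‖Srf.n q - Srf.n p‖ ≤ K * ‖q - p‖

lemma SmoothSurface.exists_Cst (Srf : SmoothSurface) : ∃ K, Srf.Cst K := by
  obtain ⟨C, hC, h1⟩ := Srf.exists_quad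
  obtain ⟨D, hD, h2⟩ := Srf.exists_n_lip
  refine ⟨C + D + 1, by linarith, fun p hp q hq => (h1 p hp q hq).trans ?_,
    fun p hp q hq => (h2 p hp q hq).trans ?_⟩ <;> gcongr <;> linarith

lemma vert_sub_tri (t : E3 × E3 × E3) : vertsOf t ⊆ triOf t := subset_convexHull ℝ _

lemma tri_sub_plane (t : E3 × E3 × E3) : triOf t ⊆ planeOf t :=
  convexHull_subset_affineSpan _

lemma tri_compact (t : E3 × E3 × E3) : IsCompact (triOf t) := by
  apply Set.Finite.isCompact_convexHull
  simp

lemma tri_convex (t : E3 × E3 × E3) : Convex ℝ (triOf t) := convex_convexHull ℝ _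

lemma tri_nonempty (t : E3 × E3 × E3) : t.1 ∈ triOf t := vert_sub_tri t (by simp [vertsOf])

lemma sub_mem_dir {t : E3 × E3 × E3} {x y : E3} (hx : x ∈ planeOf t) (hy : y ∈ planeOf t) :
    x - y ∈ dirOf t := AffineSubspace.vsub_mem_direction hx hy

lemma add_mem_plane {t : E3 × E3 × E3} {x g : E3} (hx : x ∈ planeOf t) (hg : g ∈ dirOf t) :
    x + g ∈ planeOf t := by
  have := AffineSubspace.vadd_mem_of_mem_direction hg hx
  rwa [vadd_eq_add, add_comm] at this

/-- an affine function bounded at vertices is bounded on the triangle -/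
lemma tri_bound {t : E3 × E3 × E3} {L : E3 →ₗ[ℝ] ℝ} {c M : ℝ}
    (H : ∀ p ∈ vertsOf t, |L p + c| ≤ M) : ∀ x ∈ triOf t, |L x + c| ≤ M := by
  have hc : Convex ℝ {x : E3 | |L x + c| ≤ M} := by
    intro x hx y hy a b ha hb hab
    simp only [Set.mem_setOf_eq, abs_le] at *
    have : L (a • x + b • y) + c = a * (L x + c) + b * (L y + c) := by
      simp only [map_add, map_smul, smul_eq_mul]
      linear_combination (-c) * hab
    rw [this]
    have hM : M = a * M + b * M := by rw [← add_mul, hab, one_mul]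
    constructor <;> nlinarith
  exact fun x hx => convexHull_min (s := vertsOf t) H hc hx

namespace Triangulation
variable {Srf : SmoothSurface} {γ₀ h : ℝ} (Tr : Triangulation Srf γ₀ h)
variable {Tr} {t : E3 × E3 × E3} {K : ℝ}

lemma tri_dist (ht : t ∈ Tr.T) {x y : E3} (hx : x ∈ triOf t) (hy : y ∈ triOf t) : ‖x - y‖ ≤ h := by
  rw [← dist_eq_norm]
  exact (dist_le_diam_of_mem (tri_compact t).isBounded hx hy).trans (Tr.diam_le t ht)

lemma lin_bound (hγ : 0 < γ₀) (hh : 0 < h) (ht : t ∈ Tr.T) {L : E3 →ₗ[ℝ] ℝ} {c M : ℝ}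
    (H : ∀ p ∈ vertsOf t, |L p + c| ≤ M) {g : E3} (hg : g ∈ dirOf t) :
    |L g| ≤ M / (γ₀ * h) * ‖g‖ := by
  have H' := tri_bound H
  by_cases h0 : g = 0
  · simp [h0]
  have hgp : 0 < ‖g‖ := norm_pos_iff.2 h0
  obtain ⟨y, hy, hd⟩ := Tr.disk t ht
  have hin : ∀ ε : ℝ, |ε| ≤ γ₀ * h / ‖g‖ → y + ε • g ∈ triOf t := by
    intro ε hε
    apply hd
    refine ⟨?_, add_mem_plane (tri_sub_plane t hy) (Submodule.smul_mem _ _ hg)⟩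
    rw [mem_closedBall_iff_norm, add_sub_cancel_left, norm_smul, Real.norm_eq_abs]
    rwa [le_div_iff₀ hgp] at hε
  have hp : 0 < γ₀ * h / ‖g‖ := by positivity
  have h1 := H' _ (hin (γ₀ * h / ‖g‖) (abs_of_pos hp).le)
  have h2 := H' _ (hin (-(γ₀ * h / ‖g‖)) (by rw [abs_neg]; exact (abs_of_pos hp).le))
  simp only [map_add, map_smul, smul_eq_mul, abs_le] at h1 h2
  rw [show M / (γ₀ * h) * ‖g‖ = M / (γ₀ * h / ‖g‖) by field_simp, le_div_iff₀ hp,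
    show |L g| * (γ₀ * h / ‖g‖) = |L g * (γ₀ * h / ‖g‖)| by rw [abs_mul, abs_of_pos hp], abs_le]
  constructor <;> nlinarith

lemma vert_mem_S (ht : t ∈ Tr.T) {p : E3} (hp : p ∈ vertsOf t) : p ∈ Srf.S := Tr.verts_on t ht hp

lemma tri_sub_Sh (ht : t ∈ Tr.T) : triOf t ⊆ Tr.Sh := Set.subset_biUnion_of_mem (u := triOf) ht

lemma tri_sub_N (ht : t ∈ Tr.T) : triOf t ⊆ Tr.N := (tri_sub_Sh ht).trans Tr.Sh_sub

lemma a_mem_S (ht : t ∈ Tr.T) {x : E3} (hx : x ∈ triOf t) : Tr.a x ∈ Srf.S :=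
  Tr.a_mem x (tri_sub_N ht hx)

lemma a_dist (ht : t ∈ Tr.T) {x : E3} (hx : x ∈ triOf t) : ‖x - Tr.a x‖ ≤ h := by
  have h1 := Tr.a_nearest x (tri_sub_N ht hx) t.1 (vert_mem_S ht (by simp [vertsOf]))
  rw [dist_eq_norm, dist_eq_norm] at h1
  exact h1.trans (tri_dist ht hx (tri_nonempty t))

lemma a_dist' (ht : t ∈ Tr.T) {x y : E3} (hx : x ∈ triOf t) (hy : y ∈ triOf t) :
    ‖y - Tr.a x‖ ≤ 2 * h := by
  have := norm_add_le (y - x) (x - Tr.a x)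
  rw [sub_add_sub_cancel] at this
  linarith [a_dist ht hx, tri_dist ht hy hx]

lemma dir_normal (hγ : 0 < γ₀) (hh : 0 < h) (hK : Srf.Cst K) (ht : t ∈ Tr.T) {y : E3}
    (hy : y ∈ Srf.S) (hyv : ∀ p ∈ vertsOf t, ‖p - y‖ ≤ 3 * h) {g : E3} (hg : g ∈ dirOf t) :
    |⟪g, Srf.n y⟫| ≤ (9 * K / γ₀) * h * ‖g‖ := by
  have hK1 := hK.one
  have := lin_bound (L := (innerSL ℝ (Srf.n y) : E3 →L[ℝ] ℝ).toLinearMap)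
    (c := - ⟪y, Srf.n y⟫) (M := K * (3 * h) ^ 2) hγ hh ht ?_ hg
  · simp only [ContinuousLinearMap.coe_coe, innerSL_apply_apply] at this
    rw [real_inner_comm]
    refine this.trans (le_of_eq ?_)
    field_simp; ring
  · intro p hp
    simp only [ContinuousLinearMap.coe_coe, innerSL_apply_apply]
    rw [real_inner_comm, ← sub_eq_add_neg, ← inner_sub_left]
    refine (hK.quad y hy p (vert_mem_S ht hp)).trans ?_
    gcongr
    exact hyv p hp

lemma a_perp {x : E3} (hx : x ∈ Tr.N) {τ : E3} (hτ : τ ∈ Srf.tangent (Tr.a x)) :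
    ⟪x - Tr.a x, τ⟫ = 0 := by
  obtain ⟨s₀, hs₀, C, hC, γ, H⟩ := Srf.exists_curve (Tr.a_mem x hx) hτ
  set w := x - Tr.a x with hw
  -- for |s|≤s₀: 2 s <w,τ> ≤ M s^2
  have key : ∀ s : ℝ, |s| ≤ s₀ → 2 * s * ⟪w, τ⟫ ≤ (2 * ‖w‖ * C + (‖τ‖ + C * s₀) ^ 2) * s ^ 2 := by
    intro s hs
    obtain ⟨h1, h2⟩ := H s hs
    have h3 := Tr.a_nearest x hx _ h1
    rw [dist_eq_norm, dist_eq_norm] at h3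
    set e := γ s - Tr.a x - s • τ with he
    have e1 : x - γ s = w - (s • τ + e) := by rw [he, hw]; abel
    rw [e1, ← hw] at h3
    have h4 : ‖w‖ ^ 2 ≤ ‖w - (s • τ + e)‖ ^ 2 := by gcongr
    rw [norm_sub_sq_real w, inner_add_right, real_inner_smul_right] at h4
    have h5 : |⟪w, e⟫| ≤ ‖w‖ * (C * s ^ 2) :=
      (abs_real_inner_le_norm _ _).trans (by gcongr)
    have h6 : ‖s • τ + e‖ ≤ |s| * (‖τ‖ + C * s₀) := by
      refine (norm_add_le _ _).trans ?_
      rw [norm_smul, Real.norm_eq_abs, mul_add]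
      have : C * s ^ 2 ≤ |s| * (C * s₀) := by
        rw [← sq_abs]; nlinarith [mul_le_mul_of_nonneg_left hs (mul_nonneg hC (abs_nonneg s))]
      linarith
    have h7 : ‖s • τ + e‖ ^ 2 ≤ s ^ 2 * (‖τ‖ + C * s₀) ^ 2 := by
      rw [← sq_abs s, ← mul_pow]; gcongr
    nlinarith [abs_le.1 h5]
  set M := 2 * ‖w‖ * C + (‖τ‖ + C * s₀) ^ 2 with hM
  have hM0 : 0 ≤ M := by positivity
  by_contra hne
  set b := ⟪w, τ⟫ with hb
  have hbp : 0 < |b| := abs_pos.2 hne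
  -- s = σ * ε, ε small
  set ε := min s₀ (|b| / (M + 1)) with hε
  have hεp : 0 < ε := lt_min hs₀ (by positivity)
  have hε2 : ε * (M + 1) ≤ |b| := by
    have := min_le_right s₀ (|b| / (M + 1)); rwa [← hε, le_div_iff₀ (by positivity)] at this
  have hε1 : ε ≤ s₀ := min_le_left _ _
  rcases lt_or_gt_of_ne hne with hlt | hgt
  · have := key (-ε) (by rw [abs_neg, abs_of_pos hεp]; exact hε1)
    rw [abs_of_neg hlt] at hε2 hbp
    nlinarith
  · have := key ε (by rw [abs_of_pos hεp]; exact hε1)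
    rw [abs_of_pos hgt] at hε2
    nlinarith

lemma a_normal {x : E3} (hx : x ∈ Tr.N) :
    x - Tr.a x = ⟪x - Tr.a x, Srf.n (Tr.a x)⟫ • Srf.n (Tr.a x) := by
  have h1 := a_perp hx (Srf.PT_mem (Tr.a_mem x hx) (x - Tr.a x))
  have h2 := Srf.inner_PT (v := x - Tr.a x) (Srf.PT_mem (Tr.a_mem x hx) (x - Tr.a x))
  rw [h1, inner_self_eq_zero, SmoothSurface.PT, sub_eq_zero] at h2
  exact h2

lemma a_height (hK : Srf.Cst K) (ht : t ∈ Tr.T) {x : E3} (hx : x ∈ triOf t) :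
    |⟪x - Tr.a x, Srf.n (Tr.a x)⟫| ≤ 4 * K * h ^ 2 := by
  have hK1 := hK.one
  have := tri_bound (t := t) (L := (innerSL ℝ (Srf.n (Tr.a x)) : E3 →L[ℝ] ℝ).toLinearMap)
    (c := - ⟪Tr.a x, Srf.n (Tr.a x)⟫) (M := K * (2 * h) ^ 2) ?_ x hx
  · simp only [ContinuousLinearMap.coe_coe, innerSL_apply_apply] at this
    rw [real_inner_comm, ← sub_eq_add_neg, ← inner_sub_left] at this
    refine this.trans (le_of_eq (by ring))
  · intro p hp
    simp only [ContinuousLinearMap.coe_coe, innerSL_apply_apply]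
    rw [real_inner_comm, ← sub_eq_add_neg, ← inner_sub_left]
    refine (hK.quad _ (a_mem_S ht hx) p (vert_mem_S ht hp)).trans ?_
    gcongr
    exact a_dist' ht hx (vert_sub_tri t hp)

lemma a_dist2 (hK : Srf.Cst K) (ht : t ∈ Tr.T) {x : E3} (hx : x ∈ triOf t) :
    ‖x - Tr.a x‖ ≤ 4 * K * h ^ 2 := by
  rw [a_normal (tri_sub_N ht hx), norm_smul, Srf.n_unit _ (a_mem_S ht hx), mul_one]
  exact a_height hK ht hx

lemma a_bilip (hγ : 0 < γ₀) (hh : 0 < h) (hK : Srf.Cst K) (hsm : 8 * K * h ≤ 1) (ht : t ∈ Tr.T)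
    {x y : E3} (hx : x ∈ triOf t) (hy : y ∈ triOf t) :
    ‖(x - y) - (Tr.a x - Tr.a y)‖ ≤ (18 * K / γ₀ + 8 * K) * h * ‖x - y‖ := by
  have hK1 := hK.one
  set b := Tr.a x with hb
  set b' := Tr.a y with hb'
  have hbS : b ∈ Srf.S := a_mem_S ht hx
  have hbS' : b' ∈ Srf.S := a_mem_S ht hy
  have hxn := a_normal (tri_sub_N ht hx)
  have hyn := a_normal (tri_sub_N ht hy)
  have hys := a_height hK ht hy
  rw [← hb] at hxn
  rw [← hb'] at hyn hys
  set s := ⟪x - b, Srf.n b⟫ with hs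
  set s' := ⟪y - b', Srf.n b'⟫ with hs'
  set D := (x - y) - (b - b') with hD
  have hDe : D = s • Srf.n b - s' • Srf.n b' := by rw [← hxn, ← hyn, hD]; abel
  have hbb : ‖b - b'‖ ≤ 3 * h := by
    have h1 := norm_add_le (b - x) (x - b')
    rw [sub_add_sub_cancel, norm_sub_rev b x] at h1
    linarith [a_dist ht hx, a_dist' ht hy hx]
  -- tangential part
  have h1 : Srf.PT b D = - (s' • Srf.PT b (Srf.n b' - Srf.n b)) := by
    have h0 : Srf.PT b (Srf.n b) = 0 := by
      rw [SmoothSurface.PT, real_inner_self_eq_norm_sq, Srf.n_unit b hbS]; simp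
    rw [hDe, Srf.PT_sub, Srf.PT_smul, Srf.PT_smul, h0, Srf.PT_sub, h0]; simp
  have h1' : ‖Srf.PT b D‖ ≤ 4 * K * h ^ 2 * (K * ‖b - b'‖) := by
    rw [h1, norm_neg, norm_smul, Real.norm_eq_abs]
    gcongr
    refine (Srf.norm_PT_le hbS _).trans ?_
    rw [norm_sub_rev b b']; exact hK.nlip b hbS b' hbS'
  have h2 : |⟪D, Srf.n b⟫| ≤ (9 * K / γ₀) * h * ‖x - y‖ + K * (3 * h) * ‖b - b'‖ := by
    rw [hD, inner_sub_left]
    refine (abs_sub _ _).trans ?_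
    refine add_le_add ?_ ?_
    · refine dir_normal hγ hh hK ht hbS ?_ (sub_mem_dir (tri_sub_plane t hx) (tri_sub_plane t hy))
      intro p hp
      exact (a_dist' ht hx (vert_sub_tri t hp)).trans (by linarith)
    · rw [← neg_sub b' b, inner_neg_left, abs_neg, norm_neg]
      refine (hK.quad b hbS b' hbS').trans ?_
      rw [norm_sub_rev] at hbb
      nlinarith [mul_le_mul_of_nonneg_left hbb (mul_nonneg (zero_le_one.trans hK1) (norm_nonneg (b' - b)))]
  have h3 : ‖D‖ ≤ ‖Srf.PT b D‖ + |⟪D, Srf.n b⟫| := by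
    have : D = Srf.PT b D + ⟪D, Srf.n b⟫ • Srf.n b := by rw [SmoothSurface.PT]; abel
    conv_lhs => rw [this]
    refine (norm_add_le _ _).trans ?_
    rw [norm_smul, Srf.n_unit b hbS, mul_one, Real.norm_eq_abs]
  have h4 : ‖b - b'‖ ≤ ‖x - y‖ + ‖D‖ := by
    have : b - b' = (x - y) - D := by rw [hD]; abel
    rw [this]; exact norm_sub_le _ _
  have h5 : 4 * K * h ^ 2 * (K * ‖b - b'‖) ≤ (K * h) * ‖b - b'‖ := by
    have : 4 * K * h ^ 2 * (K * ‖b - b'‖) = (4 * K * h) * ((K * h) * ‖b - b'‖) := by ring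
    rw [this]
    have h0 : 0 ≤ (K * h) * ‖b - b'‖ := by positivity
    nlinarith
  have h6 : ‖D‖ ≤ (9 * K / γ₀) * h * ‖x - y‖ + (4 * K * h) * (‖x - y‖ + ‖D‖) := by
    have : (4 * K * h) * ‖b - b'‖ ≤ (4 * K * h) * (‖x - y‖ + ‖D‖) := by gcongr
    nlinarith
  have h7 : (4 * K * h) * ‖D‖ ≤ 1 / 2 * ‖D‖ := by
    apply mul_le_mul_of_nonneg_right _ (norm_nonneg _); linarith
  have e : (18 * K / γ₀ + 8 * K) * h * ‖x - y‖ = 2 * ((9 * K / γ₀) * h * ‖x - y‖ + (4 * K * h) * ‖x - y‖) := by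
    ring
  rw [e]
  nlinarith

end Triangulation
end

section
/-- union of the edges -/
def edg (t : E3 × E3 × E3) : Set E3 :=
  segment ℝ t.1 t.2.1 ∪ segment ℝ t.2.1 t.2.2 ∪ segment ℝ t.1 t.2.2

def intT (t : E3 × E3 × E3) : Set E3 := triOf t \ edg t

lemma mem_tri_iff {t : E3 × E3 × E3} {x : E3} : x ∈ triOf t ↔
    ∃ a b c : ℝ, 0 ≤ a ∧ 0 ≤ b ∧ 0 ≤ c ∧ a + b + c = 1 ∧ a • t.1 + b • t.2.1 + c • t.2.2 = x := by
  unfold triOf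
  constructor
  · intro hx
    rw [convexHull_insert (by simp), mem_convexJoin] at hx
    obtain ⟨p, hp, q, hq, hx⟩ := hx
    rw [Set.mem_singleton_iff] at hp
    subst hp
    rw [convexHull_pair] at hq
    obtain ⟨a, b, ha, hb, hab, rfl⟩ := hq
    obtain ⟨c, d, hc, hd, hcd, rfl⟩ := hx
    refine ⟨c, d * a, d * b, hc, by positivity, by positivity, ?_, ?_⟩
    · rw [add_assoc, ← mul_add, hab, mul_one, hcd]
    · rw [smul_add, smul_smul, smul_smul, add_assoc]
  · rintro ⟨a, b, c, ha, hb, hc, habc, rfl⟩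
    have hcv := convex_convexHull ℝ ({t.1, t.2.1, t.2.2} : Set E3)
    have h1 : t.1 ∈ convexHull ℝ ({t.1, t.2.1, t.2.2} : Set E3) := subset_convexHull ℝ _ (by simp)
    have h2 : t.2.1 ∈ convexHull ℝ ({t.1, t.2.1, t.2.2} : Set E3) := subset_convexHull ℝ _ (by simp)
    have h3 : t.2.2 ∈ convexHull ℝ ({t.1, t.2.1, t.2.2} : Set E3) := subset_convexHull ℝ _ (by simp)
    have := hcv.sum_mem (t := Finset.univ) (w := ![a, b, c]) (z := ![t.1, t.2.1, t.2.2])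
      (by intro i _; fin_cases i <;> simpa) (by simp [Fin.sum_univ_three, habc])
      (by intro i _; fin_cases i <;> simpa)
    simpa [Fin.sum_univ_three] using this

lemma segment_sub_edg {t : E3 × E3 × E3} {v w : E3} (hvw : v ≠ w) (hv : v ∈ vertsOf t)
    (hw : w ∈ vertsOf t) : segment ℝ v w ⊆ edg t := by
  simp only [vertsOf, Set.mem_insert_iff, Set.mem_singleton_iff] at hv hw
  unfold edg
  rcases hv with rfl | rfl | rfl <;> rcases hw with rfl | rfl | rfl <;>
    first
    | exact absurd rfl hvw
    | (intro x hx; first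
        | exact Or.inl (Or.inl hx)
        | exact Or.inl (Or.inr hx)
        | exact Or.inr hx
        | (rw [segment_symm] at hx; first
            | exact Or.inl (Or.inl hx)
            | exact Or.inl (Or.inr hx)
            | exact Or.inr hx))

lemma vert_sub_edg {t : E3 × E3 × E3} : vertsOf t ⊆ edg t := by
  intro v hv
  simp only [vertsOf, Set.mem_insert_iff, Set.mem_singleton_iff] at hv
  rcases hv with rfl | rfl | rfl
  · exact Or.inl (Or.inl (left_mem_segment ℝ _ _))
  · exact Or.inl (Or.inl (right_mem_segment ℝ _ _))
  · exact Or.inr (right_mem_segment ℝ _ _)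

lemma edg_sub_tri (t : E3 × E3 × E3) : edg t ⊆ triOf t := by
  have h1 : t.1 ∈ triOf t := vert_sub_tri t (by simp [vertsOf])
  have h2 : t.2.1 ∈ triOf t := vert_sub_tri t (by simp [vertsOf])
  have h3 : t.2.2 ∈ triOf t := vert_sub_tri t (by simp [vertsOf])
  rintro x ((hx | hx) | hx)
  · exact (tri_convex t).segment_subset h1 h2 hx
  · exact (tri_convex t).segment_subset h2 h3 hx
  · exact (tri_convex t).segment_subset h1 h3 hx

lemma seg_compact (a b : E3) : IsCompact (segment ℝ a b) := by
  rw [← convexHull_pair]; apply Set.Finite.isCompact_convexHull; simp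

lemma edg_compact (t : E3 × E3 × E3) : IsCompact (edg t) :=
  ((seg_compact _ _).union (seg_compact _ _)).union (seg_compact _ _)

lemma intT_sub (t : E3 × E3 × E3) : intT t ⊆ triOf t := Set.sdiff_subset

lemma intT_pos {t : E3 × E3 × E3} {x : E3} (hx : x ∈ intT t) :
    ∃ a b c : ℝ, 0 < a ∧ 0 < b ∧ 0 < c ∧ a + b + c = 1 ∧ a • t.1 + b • t.2.1 + c • t.2.2 = x := by
  obtain ⟨hx1, hx2⟩ := hx
  obtain ⟨a, b, c, ha, hb, hc, habc, rfl⟩ := mem_tri_iff.1 hx1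
  refine ⟨a, b, c, ha.lt_of_ne ?_, hb.lt_of_ne ?_, hc.lt_of_ne ?_, habc, rfl⟩
  · rintro rfl
    exact hx2 (Or.inl (Or.inr ⟨b, c, hb, hc, by linarith, by simp⟩))
  · rintro rfl
    exact hx2 (Or.inr ⟨a, c, ha, hc, by linarith, by simp⟩)
  · rintro rfl
    exact hx2 (Or.inl (Or.inl ⟨a, b, ha, hb, by linarith, by simp⟩))

namespace Triangulation
variable {Srf : SmoothSurface} {γ₀ h : ℝ} {Tr : Triangulation Srf γ₀ h}
variable {t : E3 × E3 × E3} {K : ℝ}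

lemma intT_nhds (hγ : 0 < γ₀) (hh : 0 < h) (ht : t ∈ Tr.T) {x : E3} (hx : x ∈ intT t) :
    ∃ ε > 0, ∀ g ∈ dirOf t, ‖g‖ ≤ ε → x + g ∈ triOf t := by
  obtain ⟨y, hy, hd⟩ := Tr.disk t ht
  obtain ⟨a, b, c, ha, hb, hc, habc, hxe⟩ := intT_pos hx
  obtain ⟨a', b', c', ha', hb', hc', habc', hye⟩ := mem_tri_iff.1 hy
  set δ := min a (min b c) with hδ
  have hδp : 0 < δ := lt_min ha (lt_min hb hc)
  have h1 : δ ≤ a := min_le_left _ _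
  have h2 : δ ≤ b := (min_le_right _ _).trans (min_le_left _ _)
  have h3 : δ ≤ c := (min_le_right _ _).trans (min_le_right _ _)
  have hx' : x + δ • (x - y) ∈ triOf t := by
    rw [mem_tri_iff]
    refine ⟨a + δ * (a - a'), b + δ * (b - b'), c + δ * (c - c'), by nlinarith, by nlinarith,
      by nlinarith, ?_, ?_⟩
    · linear_combination (1 + δ) * habc - δ * habc'
    · rw [← hxe, ← hye]; module
  refine ⟨γ₀ * h * (δ / (1 + δ)), by positivity, fun g hg hgn => ?_⟩
  have hy' : y + ((1 + δ) / δ) • g ∈ triOf t := by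
    apply hd
    refine ⟨?_, add_mem_plane (tri_sub_plane t hy) (Submodule.smul_mem _ _ hg)⟩
    rw [mem_closedBall_iff_norm, add_sub_cancel_left, norm_smul, Real.norm_eq_abs,
      abs_of_pos (by positivity)]
    calc (1 + δ) / δ * ‖g‖ ≤ (1 + δ) / δ * (γ₀ * h * (δ / (1 + δ))) := by gcongr
      _ = _ := by field_simp
  have := tri_convex t hx' hy' (a := 1 / (1 + δ)) (b := δ / (1 + δ)) (by positivity) (by positivity)
    (by field_simp)
  convert this using 1
  have e1 : (1 / (1 + δ)) • (x + δ • (x - y)) = (1 / (1 + δ)) • ((1 + δ) • x) - (δ / (1 + δ)) • y := by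
    rw [div_eq_mul_inv δ, mul_comm δ]; module
  rw [e1, smul_add, smul_smul, smul_smul]
  rw [show δ / (1 + δ) * ((1 + δ) / δ) = 1 by field_simp, one_div_mul_cancel (by positivity)]
  module

lemma intT_disj {t' : E3 × E3 × E3} (ht : t ∈ Tr.T) (ht' : t' ∈ Tr.T) (hne : t ≠ t') :
    Disjoint (intT t) (triOf t') := by
  rw [Set.disjoint_left]
  rintro x ⟨hx, hxe⟩ hx'
  have hxi : x ∈ triOf t ∩ triOf t' := ⟨hx, hx'⟩
  rcases Tr.meet t ht t' ht' hne with h1 | ⟨v, hv, h1⟩ | ⟨v, w, hvw, hv, hw, h1⟩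
  · rw [h1] at hxi; exact hxi
  · rw [h1, Set.mem_singleton_iff] at hxi
    subst hxi
    exact hxe (vert_sub_edg hv.1)
  · rw [h1] at hxi
    exact hxe (segment_sub_edg hvw hv.1 hw.1 hxi)

lemma a_contOn : ContinuousOn Tr.a Tr.Sh := Tr.a_smooth.continuousOn.mono Tr.Sh_sub

lemma Sh_compact : IsCompact Tr.Sh := Tr.T.isCompact_biUnion fun t _ => tri_compact t

/-- open image property -/
lemma local_image (ht : t ∈ Tr.T) {x₀ : E3} (hx₀ : x₀ ∈ intT t) {O : Set E3} (hO : O ∈ nhds x₀) :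
    ∀ᶠ y in nhdsWithin (Tr.a x₀) Srf.S, ∃ x ∈ intT t ∩ O, Tr.a x = y := by
  obtain ⟨O', hO'O, hO', hx₀O⟩ := _root_.mem_nhds_iff.1 hO
  have hSh : x₀ ∈ Tr.Sh := tri_sub_Sh ht hx₀.1
  set B : Set E3 := (Tr.Sh \ O') ∪ (edg t ∪ ⋃ t' ∈ Tr.T.erase t, triOf t') with hB
  have hBS : B ⊆ Tr.Sh := by
    rintro x (hx | hx | hx)
    · exact hx.1
    · exact tri_sub_Sh ht (edg_sub_tri t hx)
    · simp only [Set.mem_iUnion] at hx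
      obtain ⟨t', h1, h2⟩ := hx
      exact tri_sub_Sh (Finset.mem_of_mem_erase h1) h2
  have hBc : IsCompact B :=
    (Sh_compact.diff hO').union ((edg_compact t).union
      ((Tr.T.erase t).isCompact_biUnion fun t _ => tri_compact t))
  have hBi : IsClosed (Tr.a '' B) := (hBc.image_of_continuousOn (a_contOn.mono hBS)).isClosed
  have hxB : x₀ ∉ B := by
    rintro (hx | hx | hx)
    · exact hx.2 hx₀O
    · exact hx₀.2 hx
    · simp only [Set.mem_iUnion] at hx
      obtain ⟨t', h1, h2⟩ := hx
      exact Set.disjoint_left.1 (intT_disj ht (Finset.mem_of_mem_erase h1)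
        (Finset.ne_of_mem_erase h1).symm) hx₀ h2
  have hyB : Tr.a x₀ ∉ Tr.a '' B := by
    rintro ⟨x, hx, hxx⟩
    rw [Tr.a_bij.injOn (hBS hx) hSh hxx] at hx
    exact hxB hx
  have h1 : ∀ᶠ y in nhdsWithin (Tr.a x₀) Srf.S, y ∉ Tr.a '' B :=
    mem_nhdsWithin_of_mem_nhds (hBi.isOpen_compl.mem_nhds hyB)
  filter_upwards [h1, self_mem_nhdsWithin] with y hy hyS
  obtain ⟨x, hx, rfl⟩ := Tr.a_bij.surjOn hyS
  have hxB' : x ∉ B := fun hx => hy ⟨x, hx, rfl⟩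
  have hxO : x ∈ O' := by
    by_contra hxO
    exact hxB' (Or.inl ⟨hx, hxO⟩)
  simp only [Set.mem_iUnion] at hx
  obtain ⟨t', h1, h2⟩ := hx
  have htt : t' = t := by
    by_contra hne
    refine hxB' (Or.inr (Or.inr ?_))
    simp only [Set.mem_iUnion]
    exact ⟨t', Finset.mem_erase.2 ⟨hne, h1⟩, h2⟩
  subst htt
  exact ⟨x, ⟨⟨h2, fun he => hxB' (Or.inr (Or.inl he))⟩, hO'O hxO⟩, rfl⟩

lemma liftS_apply {v : E3 → ℝ} {x : E3} (hx : x ∈ Tr.Sh) : Tr.liftS v (Tr.a x) = v x := by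
  have h1 : Tr.a x ∈ Tr.a '' Tr.Sh := ⟨x, hx, rfl⟩
  have h2 := Function.invFunOn_mem h1
  have h3 := Function.invFunOn_eq h1
  unfold liftS
  rw [Tr.a_bij.injOn h2 hx h3]

lemma dir_cone (hγ : 0 < γ₀) (hh : 0 < h) (ht : t ∈ Tr.T) {x : E3} (hx : x ∈ intT t) :
    ∀ τ ∈ dirOf t, τ ∈ tangentConeAt ℝ (triOf t) x := by
  intro g hg
  obtain ⟨ε, hε, H⟩ := intT_nhds hγ hh ht hx
  refine mem_tangentConeAt_of_pow_smul (r := (1 / 2 : ℝ)) (by norm_num) (by norm_num) ?_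
  have : Filter.Tendsto (fun n : ℕ => ((1 / 2 : ℝ) ^ n) • g) Filter.atTop (nhds 0) := by
    have := (tendsto_pow_atTop_nhds_zero_of_lt_one (r := (1 / 2 : ℝ)) (by norm_num) (by norm_num)).smul_const g
    rwa [zero_smul] at this
  filter_upwards [this.eventually_mem (closedBall_mem_nhds _ hε)] with n hn
  exact H _ (Submodule.smul_mem _ _ hg) (mem_closedBall_zero_iff.1 hn)

/-- constant in the bi-Lipschitz estimate -/
def C2 (K γ₀ : ℝ) : ℝ := 18 * K / γ₀ + 8 * K

lemma a_deriv (hγ : 0 < γ₀) (hh : 0 < h) (hK : Srf.Cst K) (hsm : 8 * K * h ≤ 1) (ht : t ∈ Tr.T)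
    {x : E3} (hx : x ∈ intT t) {A : E3 →L[ℝ] E3} (hA : HasFDerivAt Tr.a A x) {g : E3}
    (hg : g ∈ dirOf t) : ‖A g - g‖ ≤ C2 K γ₀ * h * ‖g‖ := by
  have hK1 := hK.one
  obtain ⟨ε, hε, H⟩ := intT_nhds hγ hh ht hx
  have h1 : HasDerivAt (fun s : ℝ => x + s • g) g 0 := by
    simpa using ((hasDerivAt_id (0 : ℝ)).smul_const g).const_add x
  have h2 : HasDerivAt (fun s : ℝ => Tr.a (x + s • g) - s • g) (A g - g) 0 := by
    have h3 : HasDerivAt (fun s : ℝ => s • g) g 0 := by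
      simpa using ((hasDerivAt_id (0 : ℝ)).smul_const g)
    refine HasDerivAt.sub ?_ h3
    have hA' : HasFDerivAt Tr.a A (x + (0 : ℝ) • g) := by simpa using hA
    exact hA'.comp_hasDerivAt (0 : ℝ) h1
  have h0 : 0 ≤ C2 K γ₀ * h * ‖g‖ := by unfold C2; positivity
  refine h2.le_of_lip' h0 ?_
  have : Filter.Tendsto (fun s : ℝ => s • g) (nhds 0) (nhds 0) := by
    have := (Filter.tendsto_id (α := ℝ) (x := nhds 0)).smul_const g
    simpa using this
  filter_upwards [this.eventually_mem (closedBall_mem_nhds _ hε)] with s hs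
  have := a_bilip hγ hh hK hsm ht (H _ (Submodule.smul_mem _ s hg) (mem_closedBall_zero_iff.1 hs)) hx.1
  rw [← norm_neg] at this
  rw [add_sub_cancel_left, norm_smul] at this
  simp only [zero_smul, add_zero, sub_zero]
  calc _ = _ := by congr 1; abel
    _ ≤ _ := this
    _ = _ := by unfold C2; ring

end Triangulation
end

section
/-- Riesz representative of a linear map on the triangle direction -/
def gvec (t : E3 × E3 × E3) (L : E3 →ₗ[ℝ] ℝ) : E3 :=
  (Submodule.orthogonalProjectionOnto (dirOf t)
    ((InnerProductSpace.toDual ℝ E3).symm (LinearMap.toContinuousLinearMap L)) : E3)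

lemma gvec_mem (t : E3 × E3 × E3) (L : E3 →ₗ[ℝ] ℝ) : gvec t L ∈ dirOf t := Subtype.mem _

lemma inner_gvec {t : E3 × E3 × E3} (L : E3 →ₗ[ℝ] ℝ) {g : E3} (hg : g ∈ dirOf t) :
    ⟪gvec t L, g⟫ = L g := by
  unfold gvec
  rw [← Submodule.starProjection_apply, Submodule.inner_starProjection_left_eq_right,
    Submodule.starProjection_eq_self_iff.2 hg, InnerProductSpace.toDual_symm_apply]
  simp

lemma norm_le_of_inner_le {u : E3} {c : ℝ} (hc : 0 ≤ c) (H : ⟪u, u⟫ ≤ c * ‖u‖) : ‖u‖ ≤ c := by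
  rw [real_inner_self_eq_norm_sq] at H
  by_contra hlt
  push Not at hlt
  nlinarith [norm_nonneg u]

namespace Triangulation
variable {Srf : SmoothSurface} {γ₀ h : ℝ} {Tr : Triangulation Srf γ₀ h}
variable {t : E3 × E3 × E3} {K : ℝ}

lemma gradTri_eq (hγ : 0 < γ₀) (hh : 0 < h) (ht : t ∈ Tr.T) {v : E3 → ℝ} {L : E3 →ₗ[ℝ] ℝ} {c : ℝ}
    (hv : ∀ x ∈ triOf t, v x = L x + c) {x : E3} (hx : x ∈ intT t) : gradTri t v x = gvec t L := by
  have h1 : HasFDerivWithinAt v (LinearMap.toContinuousLinearMap L) (triOf t) x := by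
    have h2 : HasFDerivWithinAt (fun x => (LinearMap.toContinuousLinearMap L) x + c)
        (LinearMap.toContinuousLinearMap L) (triOf t) x :=
      ((LinearMap.toContinuousLinearMap L).hasFDerivAt.add_const c).hasFDerivWithinAt
    exact h2.congr (fun y hy => by rw [hv y hy]; simp) (by rw [hv x hx.1]; simp)
  unfold gradTri gvec
  rw [tGrad_eq h1 (dir_cone hγ hh ht hx)]

lemma lift_SC1 (hγ : 0 < γ₀) (hh : 0 < h) (hK : Srf.Cst K) (hsm : 8 * K * h ≤ 1)
    (hsm2 : C2 K γ₀ * h ≤ 1 / 2) (ht : t ∈ Tr.T) {v : E3 → ℝ} {L : E3 →ₗ[ℝ] ℝ} {c : ℝ}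
    (hv : ∀ x ∈ triOf t, v x = L x + c) {x₀ : E3} (hx₀ : x₀ ∈ intT t) :
    Srf.SC1 (Tr.liftS v) (Tr.a x₀) ∧
      ‖Srf.grad (Tr.liftS v) (Tr.a x₀) - gvec t L‖ ≤ 3 * C2 K γ₀ * h * ‖gvec t L‖ := by
  have hK1 := hK.one
  have hC2 : 0 < C2 K γ₀ := by unfold C2; positivity
  set g := gvec t L with hg
  have hgd : g ∈ dirOf t := gvec_mem t L
  set Q : E3 →L[ℝ] E3 := (dirOf t).starProjection with hQ
  have hQm : ∀ u, Q u ∈ dirOf t := fun u => Submodule.starProjection_apply_mem _ _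
  have hQn : ∀ u, ‖Q u‖ ≤ ‖u‖ := fun u => Submodule.norm_starProjection_apply_le _ u
  have hQs : ∀ u ∈ dirOf t, Q u = u := fun u hu => Submodule.starProjection_eq_self_iff.2 hu
  have hN : x₀ ∈ Tr.N := tri_sub_N ht hx₀.1
  have hac : ContDiffAt ℝ 1 Tr.a x₀ :=
    ((Tr.a_smooth.contDiffAt (Tr.N_open.mem_nhds hN))).of_le (by exact_mod_cast le_top)
  set A := fderiv ℝ Tr.a x₀ with hA
  have hAd : HasFDerivAt Tr.a A x₀ := (hac.differentiableAt (by norm_num)).hasFDerivAt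
  set pr : E3 → E3 := fun z => x₀ + Q (z - x₀) with hpr
  have hprd : HasFDerivAt pr Q x₀ := by
    have : HasFDerivAt (fun z : E3 => z - x₀) (ContinuousLinearMap.id ℝ E3) x₀ :=
      (hasFDerivAt_id x₀).sub_const x₀
    have h2 := (Q.hasFDerivAt.comp x₀ this).const_add x₀
    rw [ContinuousLinearMap.comp_id] at h2
    exact h2
  have hprc : ContDiff ℝ 1 pr := by
    simp only [hpr]
    exact contDiff_const.add (Q.contDiff.comp (contDiff_id.sub contDiff_const))
  have hpr0 : pr x₀ = x₀ := by simp [hpr]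
  set Ψ : E3 → E3 := fun z => Tr.a (pr z) + (z - pr z) with hΨ
  have hΨc : ContDiffAt ℝ 1 Ψ x₀ := by
    have h1 : ContDiffAt ℝ 1 Tr.a (pr x₀) := by rwa [hpr0]
    exact (h1.comp x₀ hprc.contDiffAt).add (contDiffAt_id.sub hprc.contDiffAt)
  set B : E3 →L[ℝ] E3 := A.comp Q + (ContinuousLinearMap.id ℝ E3 - Q) with hB
  have hΨd : HasFDerivAt Ψ B x₀ := by
    have h1 : HasFDerivAt Tr.a A (pr x₀) := by rwa [hpr0]
    exact (h1.comp x₀ hprd).add ((hasFDerivAt_id x₀).sub hprd)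
  have hBn : ∀ u, ‖B u - u‖ ≤ C2 K γ₀ * h * ‖u‖ := by
    intro u
    have e : B u - u = A (Q u) - Q u := by simp [hB]; abel
    rw [e]
    refine (a_deriv hγ hh hK hsm ht hx₀ hAd (hQm u)).trans ?_
    gcongr
    exact hQn u
  have hinj : Function.Injective B := by
    rw [injective_iff_map_eq_zero]
    intro u hu
    have := hBn u
    rw [hu, zero_sub, norm_neg] at this
    rw [← norm_eq_zero]
    nlinarith [norm_nonneg u]
  let e : E3 ≃L[ℝ] E3 := (LinearEquiv.ofInjectiveEndo (B : E3 →ₗ[ℝ] E3) hinj).toContinuousLinearEquiv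
  have he : (e : E3 →L[ℝ] E3) = B := by ext v; rfl
  have heap : ∀ u, e u = B u := fun u => rfl
  have hΨe : HasFDerivAt Ψ (e : E3 →L[ℝ] E3) x₀ := by rw [he]; exact hΨd
  have hstr : HasStrictFDerivAt Ψ (e : E3 →L[ℝ] E3) x₀ := hΨc.hasStrictFDerivAt' hΨe (by norm_num)
  set φ := hstr.localInverse Ψ e x₀ with hφ
  have hΨ0 : Ψ x₀ = Tr.a x₀ := by simp [hΨ, hpr0]
  have hleft : ∀ᶠ x in nhds x₀, φ (Ψ x) = x := hstr.eventually_left_inverse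
  have hφ0 : φ (Tr.a x₀) = x₀ := by
    have := hstr.localInverse_apply_image; rwa [hΨ0] at this
  have hφd : HasStrictFDerivAt φ (e.symm : E3 →L[ℝ] E3) (Tr.a x₀) := by
    have := hstr.to_localInverse; rwa [hΨ0] at this
  have hφc : ContDiffAt ℝ 1 φ (Tr.a x₀) := by
    have := hΨc.to_localInverse hΨe (by norm_num)
    rw [hΨ0] at this
    exact this
  set L' : E3 →L[ℝ] ℝ := LinearMap.toContinuousLinearMap L with hL'
  have hL'ap : ∀ u, L' u = L u := fun u => by simp [hL']
  set W : E3 → ℝ := fun y => L' (pr (φ y)) + c with hW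
  have hWc : ContDiffAt ℝ 1 W (Tr.a x₀) :=
    ((L'.contDiff.comp hprc).contDiffAt.comp _ hφc).add contDiffAt_const
  have hWd : HasFDerivAt W (L'.comp (Q.comp (e.symm : E3 →L[ℝ] E3))) (Tr.a x₀) := by
    have h1 : HasFDerivAt pr Q (φ (Tr.a x₀)) := by rwa [hφ0]
    have h2 := h1.comp (Tr.a x₀) hφd.hasFDerivAt
    exact (L'.hasFDerivAt.comp (Tr.a x₀) h2).add_const c
  have hyS : Tr.a x₀ ∈ Srf.S := a_mem_S ht hx₀.1
  have heq : Tr.liftS v =ᶠ[nhdsWithin (Tr.a x₀) Srf.S] W := by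
    filter_upwards [local_image ht hx₀ hleft] with y hy
    obtain ⟨x, ⟨hx1, hx2⟩, rfl⟩ := hy
    have hprx : pr x = x := by
      simp only [hpr]
      rw [hQs _ (sub_mem_dir (tri_sub_plane t hx1.1) (tri_sub_plane t hx₀.1))]; abel
    have hΨx : Ψ x = Tr.a x := by simp [hΨ, hprx]
    have : φ (Tr.a x) = x := by rw [← hΨx]; exact hx2
    rw [liftS_apply (tri_sub_Sh ht hx1.1), hv x hx1.1]
    simp only [hW]
    rw [this, hprx, hL'ap]
  refine ⟨⟨W, hWc, heq⟩, ?_⟩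
  rw [SmoothSurface.grad_eq hyS hWd.differentiableAt heq]
  have hinv : ∀ w, ‖e.symm w - w‖ ≤ 2 * C2 K γ₀ * h * ‖w‖ := by
    intro w
    set u := e.symm w with hu
    have h1 : w = B u := by rw [← heap, hu]; simp
    have h2 := hBn u
    rw [← h1] at h2
    have h3 : ‖u‖ ≤ ‖w‖ + ‖w - u‖ := by
      have := norm_sub_le w (w - u); rwa [sub_sub_cancel] at this
    have h4 : C2 K γ₀ * h * ‖u‖ ≤ 1 / 2 * ‖u‖ := by gcongr
    have h5 : ‖u‖ ≤ 2 * ‖w‖ := by linarith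
    rw [norm_sub_rev]
    calc ‖w - u‖ ≤ C2 K γ₀ * h * ‖u‖ := h2
      _ ≤ C2 K γ₀ * h * (2 * ‖w‖) := by gcongr
      _ = _ := by ring
  set D := gradient W (Tr.a x₀) with hD
  have h1 : ‖D - g‖ ≤ 2 * C2 K γ₀ * h * ‖g‖ := by
    apply norm_le_of_inner_le (by positivity)
    set w := D - g with hw
    have e0 : ⟪D, w⟫ = ⟪g, e.symm w⟫ := by
      rw [hD, inner_gradient, hWd.fderiv]
      simp only [ContinuousLinearMap.comp_apply]
      rw [hL'ap, ← inner_gvec L (hQm _), ← hg, hQ, ← Submodule.inner_starProjection_left_eq_right,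
        Submodule.starProjection_eq_self_iff.2 hgd]
      rfl
    have e1 : ⟪w, w⟫ = ⟪g, e.symm w - w⟫ := by
      rw [inner_sub_right g, ← e0, ← inner_sub_left]
    rw [e1]
    refine (real_inner_le_norm _ _).trans ?_
    calc ‖g‖ * ‖e.symm w - w‖ ≤ ‖g‖ * (2 * C2 K γ₀ * h * ‖w‖) := by gcongr; exact hinv w
      _ = _ := by ring
  have h2 : ‖Srf.PT (Tr.a x₀) g - g‖ ≤ C2 K γ₀ * h * ‖g‖ := by
    have : Srf.PT (Tr.a x₀) g - g = - (⟪g, Srf.n (Tr.a x₀)⟫ • Srf.n (Tr.a x₀)) := by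
      rw [SmoothSurface.PT]; abel
    rw [this, norm_neg, norm_smul, Srf.n_unit _ hyS, mul_one, Real.norm_eq_abs]
    refine (dir_normal hγ hh hK ht hyS (fun p hp => ?_) hgd).trans ?_
    · exact (a_dist' ht hx₀.1 (vert_sub_tri t hp)).trans (by linarith)
    · have : 9 * K / γ₀ ≤ C2 K γ₀ := by
        unfold C2
        have : 0 ≤ 9 * K / γ₀ := by positivity
        have e : 18 * K / γ₀ = 2 * (9 * K / γ₀) := by ring
        rw [e]; nlinarith
      gcongr
  have h3 : Srf.PT (Tr.a x₀) D - g = Srf.PT (Tr.a x₀) (D - g) + (Srf.PT (Tr.a x₀) g - g) := by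
    rw [Srf.PT_sub]; abel
  rw [h3]
  refine (norm_add_le _ _).trans ?_
  have := Srf.norm_PT_le hyS (D - g)
  calc _ ≤ 2 * C2 K γ₀ * h * ‖g‖ + C2 K γ₀ * h * ‖g‖ := add_le_add (this.trans h1) h2
    _ = _ := by ring

end Triangulation
end

section
lemma seg_null (x y : E3) : (μH[2] : Measure E3) (segment ℝ x y) = 0 := by
  rcases Measure.hausdorffMeasure_zero_or_top (X := E3) (d₁ := 1) (d₂ := 2) (by norm_num)
    (segment ℝ x y) with h | h
  · exact h
  · rw [hausdorffMeasure_segment] at h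
    exact absurd h (edist_ne_top _ _)

lemma edg_null (t : E3 × E3 × E3) : (μH[2] : Measure E3) (edg t) = 0 := by
  unfold edg
  rw [measure_union_null_iff, measure_union_null_iff]
  exact ⟨⟨seg_null _ _, seg_null _ _⟩, seg_null _ _⟩

/-- two measures comparable up to `1+δ` have nearby integrals -/
lemma integral_compare {ν₁ ν₂ : Measure E3} {δ : ℝ} (hδ : 0 ≤ δ)
    (h1 : ν₁ ≤ ENNReal.ofReal (1 + δ) • ν₂) (h2 : ν₂ ≤ ENNReal.ofReal (1 + δ) • ν₁)
    {φ : E3 → ℝ} (hφ : Integrable φ ν₁) :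
    Integrable φ ν₂ ∧ |∫ x, φ x ∂ν₁ - ∫ x, φ x ∂ν₂| ≤ δ * (1 + δ) * ∫ x, |φ x| ∂ν₁ := by
  have hφ2 : Integrable φ ν₂ := (hφ.smul_measure ENNReal.ofReal_ne_top).mono_measure h2
  refine ⟨hφ2, ?_⟩
  have key : ∀ f : E3 → ℝ, (∀ x, 0 ≤ f x) → Integrable f ν₁ → Integrable f ν₂ →
      |∫ x, f x ∂ν₁ - ∫ x, f x ∂ν₂| ≤ δ * (1 + δ) * ∫ x, f x ∂ν₁ := by
    intro f hf hf1 hf2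
    have hle : ∀ {μ ν : Measure E3}, Integrable f ν → μ ≤ ENNReal.ofReal (1 + δ) • ν →
        ∫ x, f x ∂μ ≤ (1 + δ) * ∫ x, f x ∂ν := by
      intro μ ν hfν hle
      have := integral_mono_measure hle (Filter.Eventually.of_forall hf)
        (hfν.smul_measure ENNReal.ofReal_ne_top)
      rw [integral_smul_measure, ENNReal.toReal_ofReal (by positivity), smul_eq_mul] at this
      exact this
    have a1 := hle hf2 h1
    have a2 := hle hf1 h2
    have a3 : 0 ≤ ∫ x, f x ∂ν₁ := integral_nonneg hf
    rw [abs_le]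
    generalize ∫ x, f x ∂ν₁ = X1 at *
    generalize ∫ x, f x ∂ν₂ = X2 at *
    have q1 := mul_le_mul_of_nonneg_left a2 hδ
    have q2 := mul_nonneg hδ a3
    have q3 := mul_nonneg (mul_nonneg hδ hδ) a3
    constructor <;> nlinarith
  have hp1 := hφ.pos_part
  have hp2 := hφ2.pos_part
  have hn1 := hφ.neg_part
  have hn2 := hφ2.neg_part
  have b1 := key _ (fun x => le_max_right _ _) hp1 hp2
  have b2 := key _ (fun x => le_max_right _ _) hn1 hn2
  have e : ∀ x, φ x = max (φ x) 0 - max (- φ x) 0 := fun x => by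
    rcases le_total 0 (φ x) with h | h <;> simp [h]
  have e' : ∀ x, |φ x| = max (φ x) 0 + max (- φ x) 0 := fun x => by
    rcases le_total 0 (φ x) with h | h
    · simp [h, abs_of_nonneg]
    · simp [h, abs_of_nonpos]
  have c1 : ∫ x, φ x ∂ν₁ = ∫ x, max (φ x) 0 ∂ν₁ - ∫ x, max (- φ x) 0 ∂ν₁ := by
    rw [← integral_sub hp1 hn1]; exact integral_congr_ae (Filter.Eventually.of_forall e)
  have c2 : ∫ x, φ x ∂ν₂ = ∫ x, max (φ x) 0 ∂ν₂ - ∫ x, max (- φ x) 0 ∂ν₂ := by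
    rw [← integral_sub hp2 hn2]; exact integral_congr_ae (Filter.Eventually.of_forall e)
  have c3 : ∫ x, |φ x| ∂ν₁ = ∫ x, max (φ x) 0 ∂ν₁ + ∫ x, max (- φ x) 0 ∂ν₁ := by
    rw [← integral_add hp1 hn1]; exact integral_congr_ae (Filter.Eventually.of_forall e')
  rw [c1, c2, c3, mul_add]
  rw [abs_le] at *
  constructor <;> linarith

namespace Triangulation
variable {Srf : SmoothSurface} {γ₀ h : ℝ} (Tr : Triangulation Srf γ₀ h)
variable {t : E3 × E3 × E3} {K : ℝ}

/-- image of the open triangle -/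
def Om (t : E3 × E3 × E3) : Set E3 := Tr.a '' intT t
def Omt : Set E3 := ⋃ t ∈ Tr.T, Tr.Om t

variable {Tr}

lemma mem_Omt {y : E3} : y ∈ Tr.Omt ↔ ∃ t ∈ Tr.T, y ∈ Tr.Om t := by simp [Omt]

lemma Om_sub (ht : t ∈ Tr.T) : Tr.Om t ⊆ Srf.S := by
  rintro _ ⟨x, hx, rfl⟩; exact a_mem_S ht hx.1

lemma Omt_sub : Tr.Omt ⊆ Srf.S := by
  intro y hy; obtain ⟨t, ht, h1⟩ := mem_Omt.1 hy; exact Om_sub ht h1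

lemma Om_open (ht : t ∈ Tr.T) {y : E3} (hy : y ∈ Tr.Om t) : ∀ᶠ y' in nhdsWithin y Srf.S, y' ∈ Tr.Om t := by
  obtain ⟨x, hx, rfl⟩ := hy
  filter_upwards [local_image ht hx Filter.univ_mem] with y' h1
  obtain ⟨x', h2, rfl⟩ := h1
  exact ⟨x', h2.1, rfl⟩

lemma Om_disj {t' : E3 × E3 × E3} (ht : t ∈ Tr.T) (ht' : t' ∈ Tr.T) (hne : t ≠ t') :
    Disjoint (Tr.Om t) (Tr.Om t') := by
  rw [Set.disjoint_left]
  rintro _ ⟨x, hx, rfl⟩ ⟨x', hx', he⟩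
  have := Tr.a_bij.injOn (tri_sub_Sh ht' hx'.1) (tri_sub_Sh ht hx.1) he
  subst this
  exact Set.disjoint_left.1 (intT_disj ht ht' hne) hx hx'.1

lemma intT_meas (t : E3 × E3 × E3) : MeasurableSet (intT t) :=
  (tri_compact t).measurableSet.diff (edg_compact t).measurableSet

lemma Om_meas (ht : t ∈ Tr.T) : MeasurableSet (Tr.Om t) := by
  have : Tr.Om t = Tr.a '' triOf t \ Tr.a '' edg t := by
    unfold Om intT
    rw [(Tr.a_bij.injOn.mono (tri_sub_Sh ht)).image_diff_subset (edg_sub_tri t)]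
  rw [this]
  have hc : ContinuousOn Tr.a (triOf t) := a_contOn.mono (tri_sub_Sh ht)
  exact ((tri_compact t).image_of_continuousOn hc).measurableSet.diff
    ((edg_compact t).image_of_continuousOn (hc.mono (edg_sub_tri t))).measurableSet

lemma Omt_meas : MeasurableSet Tr.Omt := Finset.measurableSet_biUnion _ fun _ ht => Om_meas ht

lemma C2_nonneg (hγ : 0 < γ₀) (hK : Srf.Cst K) : 0 ≤ C2 K γ₀ := by
  have := hK.one; unfold C2; positivity

lemma a_lip (hγ : 0 < γ₀) (hh : 0 < h) (hK : Srf.Cst K) (hsm : 8 * K * h ≤ 1) (ht : t ∈ Tr.T) :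
    LipschitzOnWith (Real.toNNReal (1 + C2 K γ₀ * h)) Tr.a (triOf t) := by
  have := C2_nonneg hγ hK
  refine LipschitzOnWith.of_dist_le_mul fun x hx y hy => ?_
  rw [Real.coe_toNNReal _ (by positivity), dist_eq_norm, dist_eq_norm]
  have h1 := a_bilip hγ hh hK hsm ht hx hy
  have h2 := norm_sub_le (x - y) ((x - y) - (Tr.a x - Tr.a y))
  rw [sub_sub_cancel] at h2
  rw [← C2] at h1
  linarith

lemma inv_lip (hγ : 0 < γ₀) (hh : 0 < h) (hK : Srf.Cst K) (hsm : 8 * K * h ≤ 1)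
    (hsm2 : C2 K γ₀ * h ≤ 1 / 2) (ht : t ∈ Tr.T) :
    LipschitzOnWith (Real.toNNReal (1 + 2 * (C2 K γ₀ * h))) (Function.invFunOn Tr.a Tr.Sh)
      (Tr.a '' triOf t) := by
  have := C2_nonneg hγ hK
  refine LipschitzOnWith.of_dist_le_mul ?_
  rintro _ ⟨x, hx, rfl⟩ _ ⟨y, hy, rfl⟩
  have hinj : Set.InjOn Tr.a Tr.Sh := Tr.a_bij.injOn
  rw [hinj.leftInvOn_invFunOn (tri_sub_Sh ht hx),
    hinj.leftInvOn_invFunOn (tri_sub_Sh ht hy)]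
  rw [Real.coe_toNNReal _ (by positivity), dist_eq_norm, dist_eq_norm]
  have h1 := a_bilip hγ hh hK hsm ht hx hy
  have h2 := norm_add_le ((x - y) - (Tr.a x - Tr.a y)) (Tr.a x - Tr.a y)
  rw [sub_add_cancel] at h2
  rw [← C2] at h1
  set δ := C2 K γ₀ * h
  have hδ : 0 ≤ δ := by positivity
  have h3 : (1 - δ) * ‖x - y‖ ≤ ‖Tr.a x - Tr.a y‖ := by nlinarith
  nlinarith [norm_nonneg (x - y), mul_le_mul_of_nonneg_left h3 (by positivity : 0 ≤ 1 + 2 * δ),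
    mul_nonneg (mul_nonneg hδ (by linarith : 0 ≤ 1 - 2 * δ)) (norm_nonneg (x - y))]

lemma a_edg_null (hγ : 0 < γ₀) (hh : 0 < h) (hK : Srf.Cst K) (hsm : 8 * K * h ≤ 1) (ht : t ∈ Tr.T) :
    (μH[2] : Measure E3) (Tr.a '' edg t) = 0 := by
  have := ((a_lip hγ hh hK hsm ht).mono (edg_sub_tri t)).hausdorffMeasure_image_le (d := 2) (by norm_num)
  rw [edg_null, mul_zero] at this
  exact le_antisymm this (zero_le)

lemma ae_Omt (hγ : 0 < γ₀) (hh : 0 < h) (hK : Srf.Cst K) (hsm : 8 * K * h ≤ 1) :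
    ∀ᵐ y ∂Srf.mu, y ∈ Tr.Omt := by
  rw [SmoothSurface.mu, ae_restrict_iff' Srf.measS]
  have : (μH[2] : Measure E3) (⋃ t ∈ Tr.T, Tr.a '' edg t) = 0 := by
    refine (measure_biUnion_null_iff (I := (Tr.T : Set (E3 × E3 × E3))) Tr.T.countable_toSet).2 ?_
    exact fun t ht => a_edg_null hγ hh hK hsm ht
  filter_upwards [measure_eq_zero_iff_ae_notMem.1 this] with y hy hyS
  obtain ⟨x, hx, rfl⟩ := Tr.a_bij.surjOn hyS
  simp only [Set.mem_iUnion] at hx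
  obtain ⟨t, ht, hxt⟩ := hx
  refine mem_Omt.2 ⟨t, ht, x, ⟨hxt, fun he => hy ?_⟩, rfl⟩
  simp only [Set.mem_iUnion]
  exact ⟨t, ht, x, he, rfl⟩

/-- measurability from continuity on the good set -/
lemma aesm_of_cont {F : Type*} [NormedAddCommGroup F] (hγ : 0 < γ₀) (hh : 0 < h) (hK : Srf.Cst K)
    (hsm : 8 * K * h ≤ 1) (z : E3) [SecondCountableTopology F] {f : E3 → F}
    (hf : ∀ y ∈ Tr.Omt, y ≠ z → ContinuousWithinAt f Srf.S y) : AEStronglyMeasurable f Srf.mu := by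
  have : NullSingletonClass (μH[2] : Measure E3) := Measure.nullSingletonClass_hausdorff E3 (by norm_num)
  have hm : MeasurableSet (Tr.Omt \ {z}) := Omt_meas.diff (measurableSet_singleton z)
  have h1 : Srf.mu.restrict (Tr.Omt \ {z}) = Srf.mu := by
    apply Measure.restrict_eq_self_of_ae_mem
    have h2 : ∀ᵐ y ∂Srf.mu, y ≠ z := by
      rw [SmoothSurface.mu]
      apply ae_restrict_of_ae
      exact measure_eq_zero_iff_ae_notMem.1 (measure_singleton z)
    filter_upwards [ae_Omt (Tr := Tr) hγ hh hK hsm, h2] with y h3 h4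
    exact ⟨h3, h4⟩
  rw [← h1]
  refine ContinuousOn.aestronglyMeasurable (fun y hy => ?_) hm
  exact (hf y hy.1 hy.2).mono (Set.sdiff_subset.trans Omt_sub)

/-- pushed forward measure of a triangle -/
def nu2 (Tr : Triangulation Srf γ₀ h) (t : E3 × E3 × E3) : Measure E3 :=
  ((μH[2] : Measure E3).restrict (intT t)).map Tr.a

lemma a_aemeas (ht : t ∈ Tr.T) : AEMeasurable Tr.a ((μH[2] : Measure E3).restrict (intT t)) :=
  (a_contOn.mono ((intT_sub t).trans (tri_sub_Sh ht))).aemeasurable (intT_meas t)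

lemma restrict_Om (ht : t ∈ Tr.T) : Srf.mu.restrict (Tr.Om t) = (μH[2] : Measure E3).restrict (Tr.Om t) := by
  rw [SmoothSurface.mu, Measure.restrict_restrict (Om_meas ht),
    Set.inter_eq_left.2 (Om_sub ht)]

lemma nu_compare (hγ : 0 < γ₀) (hh : 0 < h) (hK : Srf.Cst K) (hsm : 8 * K * h ≤ 1)
    (hsm2 : C2 K γ₀ * h ≤ 1 / 2) (ht : t ∈ Tr.T) :
    Srf.mu.restrict (Tr.Om t) ≤ ENNReal.ofReal (1 + 6 * (C2 K γ₀ * h)) • Tr.nu2 t ∧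
    Tr.nu2 t ≤ ENNReal.ofReal (1 + 6 * (C2 K γ₀ * h)) • Srf.mu.restrict (Tr.Om t) := by
  have hC := C2_nonneg hγ hK
  have hδ : 0 ≤ C2 K γ₀ * h := by positivity
  set δ := C2 K γ₀ * h with hδd
  have himg : ∀ A : Set E3, A ∩ Tr.Om t = Tr.a '' (Tr.a ⁻¹' A ∩ intT t) := by
    intro A; unfold Om; rw [Set.image_preimage_inter]
  rw [restrict_Om ht]
  constructor
  · refine Measure.le_intro fun A hA _ => ?_
    rw [Measure.smul_apply, nu2, Measure.map_apply_of_aemeasurable (a_aemeas ht) hA,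
      Measure.restrict_apply hA, Measure.restrict_apply' (intT_meas t), himg, smul_eq_mul]
    refine ((((a_lip hγ hh hK hsm ht).mono (Set.inter_subset_right.trans
      (intT_sub t)))).hausdorffMeasure_image_le (d := 2) (by norm_num)).trans ?_
    gcongr
    rw [ENNReal.rpow_two, ← ENNReal.ofReal, ← ENNReal.ofReal_pow (by positivity)]
    apply ENNReal.ofReal_le_ofReal
    nlinarith
  · refine Measure.le_intro fun A hA _ => ?_
    rw [Measure.smul_apply, nu2, Measure.map_apply_of_aemeasurable (a_aemeas ht) hA,
      Measure.restrict_apply hA, Measure.restrict_apply' (intT_meas t), himg, smul_eq_mul]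
    set B := Tr.a ⁻¹' A ∩ intT t with hB
    have hBt : B ⊆ triOf t := Set.inter_subset_right.trans (intT_sub t)
    have hinj : Set.InjOn Tr.a Tr.Sh := Tr.a_bij.injOn
    have h1 : B = Function.invFunOn Tr.a Tr.Sh '' (Tr.a '' B) := by
      rw [(hinj.leftInvOn_invFunOn.mono (hBt.trans (tri_sub_Sh ht))).image_image]
    conv_lhs => rw [h1]
    refine ((((inv_lip hγ hh hK hsm hsm2 ht).mono (Set.image_mono hBt))).hausdorffMeasure_image_le
      (d := 2) (by norm_num)).trans ?_
    gcongr
    rw [ENNReal.rpow_two, ← ENNReal.ofReal, ← ENNReal.ofReal_pow (by positivity)]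
    apply ENNReal.ofReal_le_ofReal
    rw [← hδd]
    nlinarith

end Triangulation
end

section
namespace Triangulation
variable {Srf : SmoothSurface} {γ₀ h : ℝ} {Tr : Triangulation Srf γ₀ h}
variable {t : E3 × E3 × E3} {K : ℝ}

/-- smallness of the mesh size -/
structure Sm (Srf : SmoothSurface) (γ₀ h K : ℝ) : Prop where
  hγ : 0 < γ₀
  hh : 0 < h
  hK : Srf.Cst K
  s1 : 8 * K * h ≤ 1
  s2 : 100 * (C2 K γ₀ * h) ≤ 1
  s3 : h ≤ 1 / 2

lemma Sm.s2' (sm : Sm Srf γ₀ h K) : C2 K γ₀ * h ≤ 1 / 2 := by linarith [sm.s2]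
lemma Sm.C2n (sm : Sm Srf γ₀ h K) : 0 ≤ C2 K γ₀ := C2_nonneg sm.hγ sm.hK
lemma Sm.C2hn (sm : Sm Srf γ₀ h K) : 0 ≤ C2 K γ₀ * h := mul_nonneg sm.C2n sm.hh.le

/-- description of a finite element function on one triangle -/
lemma Vh_tri (sm : Sm Srf γ₀ h K) {v : E3 → ℝ} (hv : Tr.IsVh v) (ht : t ∈ Tr.T) :
    ∃ g ∈ dirOf t, (∀ x ∈ triOf t, ∀ x' ∈ triOf t, v x - v x' = ⟪g, x - x'⟫) ∧
      (∀ x ∈ intT t, gradTri t v x = g) ∧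
      ∀ x ∈ intT t, Srf.SC1 (Tr.liftS v) (Tr.a x) ∧
        ‖Srf.grad (Tr.liftS v) (Tr.a x) - g‖ ≤ 3 * C2 K γ₀ * h * ‖g‖ := by
  obtain ⟨L, c, hL⟩ := hv.2 t ht
  refine ⟨gvec t L, gvec_mem t L, ?_, ?_, ?_⟩
  · intro x hx x' hx'
    rw [inner_gvec L (sub_mem_dir (tri_sub_plane t hx) (tri_sub_plane t hx')), hL x hx, hL x' hx', map_sub]; ring
  · intro x hx; exact gradTri_eq sm.hγ sm.hh ht hL hx
  · intro x hx; exact lift_SC1 sm.hγ sm.hh sm.hK sm.s1 sm.s2' ht hL hx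

lemma half_compare (sm : Sm Srf γ₀ h K) {a g : E3} (H : ‖a - g‖ ≤ 3 * C2 K γ₀ * h * ‖g‖) :
    ‖g‖ ≤ 2 * ‖a‖ ∧ ‖a‖ ≤ 2 * ‖g‖ ∧ ‖a - g‖ ≤ 6 * (C2 K γ₀ * h) * ‖a‖ := by
  have h1 : ‖a - g‖ ≤ 1 / 2 * ‖g‖ := by
    refine H.trans ?_
    have := sm.s2
    exact mul_le_mul_of_nonneg_right (by nlinarith) (norm_nonneg _)
  have h2 := norm_sub_norm_le g a
  have h3 := norm_sub_norm_le a g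
  rw [norm_sub_rev] at h2
  have h4 : ‖g‖ ≤ 2 * ‖a‖ := by linarith
  refine ⟨h4, by linarith [norm_nonneg g], H.trans ?_⟩
  have := mul_le_mul_of_nonneg_left h4 sm.C2hn
  nlinarith

/-- comparability of values and gradients at two points of one triangle -/
lemma Vh_same (sm : Sm Srf γ₀ h K) {v : E3 → ℝ} (hv : Tr.IsVh v) (ht : t ∈ Tr.T)
    {y y' : E3} (hy : y ∈ Tr.Om t) (hy' : y' ∈ Tr.Om t) :
    ‖Srf.grad (Tr.liftS v) y‖ ≤ 4 * ‖Srf.grad (Tr.liftS v) y'‖ ∧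
    |Tr.liftS v y - Tr.liftS v y'| ≤ 2 * h * ‖Srf.grad (Tr.liftS v) y'‖ := by
  obtain ⟨x, hx, rfl⟩ := hy
  obtain ⟨x', hx', rfl⟩ := hy'
  obtain ⟨g, hg, h1, h2, h3⟩ := Vh_tri sm hv ht
  have k1 := half_compare sm (h3 x hx).2
  have k2 := half_compare sm (h3 x' hx').2
  refine ⟨by linarith [k1.2.1, k2.1], ?_⟩
  rw [liftS_apply (tri_sub_Sh ht hx.1), liftS_apply (tri_sub_Sh ht hx'.1), h1 x hx.1 x' hx'.1]
  refine (abs_real_inner_le_norm _ _).trans ?_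
  have := tri_dist ht hx.1 hx'.1
  calc ‖g‖ * ‖x - x'‖ ≤ (2 * ‖Srf.grad (Tr.liftS v) (Tr.a x')‖) * h :=
        mul_le_mul k2.1 this (norm_nonneg _) (by positivity)
    _ = _ := by ring

lemma Vh_SC1 (sm : Sm Srf γ₀ h K) {v : E3 → ℝ} (hv : Tr.IsVh v) {y : E3} (hy : y ∈ Tr.Omt) :
    Srf.SC1 (Tr.liftS v) y := by
  obtain ⟨t, ht, x, hx, rfl⟩ := mem_Omt.1 hy
  obtain ⟨g, hg, h1, h2, h3⟩ := Vh_tri sm hv ht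
  exact (h3 x hx).1

lemma Vh_cont {v : E3 → ℝ} (hv : Tr.IsVh v) :
    ∃ M : ℝ, 0 ≤ M ∧ ∀ y ∈ Srf.S, |Tr.liftS v y| ≤ M := by
  obtain ⟨M, hM⟩ := (Sh_compact (Tr := Tr)).exists_bound_of_continuousOn hv.1
  refine ⟨max M 0, le_max_right _ _, fun y hy => ?_⟩
  obtain ⟨x, hx, rfl⟩ := Tr.a_bij.surjOn hy
  rw [liftS_apply hx]
  exact (hM x hx).trans (le_max_left _ _)

lemma Vh_bdd (sm : Sm Srf γ₀ h K) {v : E3 → ℝ} (hv : Tr.IsVh v) :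
    ∃ M : ℝ, 0 ≤ M ∧ (∀ y ∈ Srf.S, |Tr.liftS v y| ≤ M) ∧ ∀ y ∈ Tr.Omt, ‖Srf.grad (Tr.liftS v) y‖ ≤ M := by
  obtain ⟨M, hM0, hM⟩ := Vh_cont hv
  have : ∀ t ∈ Tr.T, ∃ m : ℝ, 0 ≤ m ∧ ∀ y ∈ Tr.Om t, ‖Srf.grad (Tr.liftS v) y‖ ≤ m := by
    intro t ht
    obtain ⟨g, hg, h1, h2, h3⟩ := Vh_tri sm hv ht
    refine ⟨2 * ‖g‖, by positivity, ?_⟩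
    rintro _ ⟨x, hx, rfl⟩
    exact (half_compare sm (h3 x hx).2).2.1
  choose! m hm0 hm using this
  refine ⟨M + ∑ t ∈ Tr.T, m t, add_nonneg hM0 (Finset.sum_nonneg hm0), fun y hy => ?_, fun y hy => ?_⟩
  · linarith [hM y hy, Finset.sum_nonneg hm0]
  · obtain ⟨t, ht, hyt⟩ := mem_Omt.1 hy
    linarith [hm t ht y hyt, Finset.single_le_sum hm0 ht]

lemma sm_aesm (sm : Sm Srf γ₀ h K) {F : Type*} [NormedAddCommGroup F]
    (z : E3) [SecondCountableTopology F] {f : E3 → F}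
    (hf : ∀ y ∈ Tr.Omt, y ≠ z → ContinuousWithinAt f Srf.S y) : AEStronglyMeasurable f Srf.mu :=
  aesm_of_cont sm.hγ sm.hh sm.hK sm.s1 z hf

lemma sm_ae (sm : Sm Srf γ₀ h K) : ∀ᵐ y ∂Srf.mu, y ∈ Tr.Omt := ae_Omt sm.hγ sm.hh sm.hK sm.s1

lemma Vh_aesm (sm : Sm Srf γ₀ h K) {v : E3 → ℝ} (hv : Tr.IsVh v) :
    AEStronglyMeasurable (Tr.liftS v) Srf.mu ∧ AEStronglyMeasurable (Srf.grad (Tr.liftS v)) Srf.mu :=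
  ⟨sm_aesm sm 0 fun _ hy _ => (Vh_SC1 sm hv hy).continuousWithinAt (Omt_sub hy),
   sm_aesm sm 0 fun _ hy _ => (Vh_SC1 sm hv hy).grad_continuousWithinAt (Omt_sub hy)⟩

lemma integrable_bdd {f : E3 → ℝ} (hf : AEStronglyMeasurable f Srf.mu) {M : ℝ}
    (hM : ∀ᵐ y ∂Srf.mu, |f y| ≤ M) : Integrable f Srf.mu :=
  Integrable.mono' (integrable_const M) hf hM

/-- integral over the surface as a sum over triangles -/
lemma integral_sum (sm : Sm Srf γ₀ h K) {f : E3 → ℝ} (hf : Integrable f Srf.mu) :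
    ∫ y, f y ∂Srf.mu = ∑ t ∈ Tr.T, ∫ y in Tr.Om t, f y ∂Srf.mu := by
  rw [← integral_biUnion_finset _ (fun t ht => Om_meas ht)
    (fun t ht t' ht' hne => Om_disj ht ht' hne) (fun t _ => hf.integrableOn)]
  have : Srf.mu.restrict (⋃ t ∈ Tr.T, Tr.Om t) = Srf.mu :=
    Measure.restrict_eq_self_of_ae_mem (sm_ae sm)
  rw [this]

/-- geometric error of the bilinear form -/
lemma form_error (sm : Sm Srf γ₀ h K) {l v : E3 → ℝ} (hl : Tr.IsVh l) (hv : Tr.IsVh v) :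
    |Srf.aForm (Tr.liftS l) (Tr.liftS v) - Tr.ahForm l v| ≤ 100 * C2 K γ₀ * h *
      ∫ y, (‖Srf.grad (Tr.liftS l) y‖ * ‖Srf.grad (Tr.liftS v) y‖ + |Tr.liftS l y| * |Tr.liftS v y|) ∂Srf.mu := by
  obtain ⟨Ml, hMl0, hMl, hMl'⟩ := Vh_bdd sm hl
  obtain ⟨Mv, hMv0, hMv, hMv'⟩ := Vh_bdd sm hv
  obtain ⟨ml, ml'⟩ := Vh_aesm sm hl
  obtain ⟨mv, mv'⟩ := Vh_aesm sm hv
  have I1 : Integrable (fun y => ⟪Srf.grad (Tr.liftS l) y, Srf.grad (Tr.liftS v) y⟫) Srf.mu := by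
    refine integrable_bdd (M := Ml * Mv) (ml'.inner mv') ?_
    filter_upwards [sm_ae (Tr := Tr) sm] with y hy
    exact (abs_real_inner_le_norm _ _).trans (mul_le_mul (hMl' y hy) (hMv' y hy) (norm_nonneg _) hMl0)
  have I2 : Integrable (fun y => Tr.liftS l y * Tr.liftS v y) Srf.mu := by
    refine integrable_bdd (M := Ml * Mv) (ml.mul mv) ?_
    filter_upwards [sm_ae (Tr := Tr) sm] with y hy
    rw [abs_mul]
    exact (mul_le_mul (hMl y (Omt_sub hy)) (hMv y (Omt_sub hy)) (abs_nonneg _) hMl0)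
  have I3 : Integrable (fun y => ‖Srf.grad (Tr.liftS l) y‖ * ‖Srf.grad (Tr.liftS v) y‖) Srf.mu := by
    refine integrable_bdd (M := Ml * Mv) (ml'.norm.mul mv'.norm) ?_
    filter_upwards [sm_ae (Tr := Tr) sm] with y hy
    rw [abs_mul, abs_norm, abs_norm]
    exact (mul_le_mul (hMl' y hy) (hMv' y hy) (norm_nonneg _) hMl0)
  have I4 : Integrable (fun y => |Tr.liftS l y| * |Tr.liftS v y|) Srf.mu := by
    simpa only [abs_mul] using I2.abs
  have hC := sm.C2hn
  have e1 : Srf.aForm (Tr.liftS l) (Tr.liftS v) =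
      ∫ y, (⟪Srf.grad (Tr.liftS l) y, Srf.grad (Tr.liftS v) y⟫ + Tr.liftS l y * Tr.liftS v y) ∂Srf.mu := rfl
  have I12 : Integrable (fun y => ⟪Srf.grad (Tr.liftS l) y, Srf.grad (Tr.liftS v) y⟫ + Tr.liftS l y * Tr.liftS v y) Srf.mu := I1.add I2
  have I34 : Integrable (fun y => ‖Srf.grad (Tr.liftS l) y‖ * ‖Srf.grad (Tr.liftS v) y‖ + |Tr.liftS l y| * |Tr.liftS v y|) Srf.mu := I3.add I4
  rw [e1, integral_sum (Tr := Tr) sm I12, integral_sum (Tr := Tr) sm I34, ahForm, ← Finset.sum_sub_distrib,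
    Finset.mul_sum]
  refine (Finset.abs_sum_le_sum_abs _ _).trans (Finset.sum_le_sum fun t ht => ?_)
  obtain ⟨gl, -, -, l2, l3⟩ := Vh_tri sm hl ht
  obtain ⟨gv, -, -, v2, v3⟩ := Vh_tri sm hv ht
  set φ : E3 → ℝ := fun y => ⟪gl, gv⟫ + Tr.liftS l y * Tr.liftS v y with hφ
  have J2 := I2.integrableOn (s := Tr.Om t)
  have Iφ : Integrable φ (Srf.mu.restrict (Tr.Om t)) := (integrable_const _).add J2
  obtain ⟨c1, c2⟩ := nu_compare sm.hγ sm.hh sm.hK sm.s1 sm.s2' ht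
  obtain ⟨Iφ2, hcmp⟩ := integral_compare (by positivity) c1 c2 Iφ
  have e2 : ∫ x in triOf t, (⟪gradTri t l x, gradTri t v x⟫ + l x * v x) ∂μH[2] = ∫ y, φ y ∂(Tr.nu2 t) := by
    rw [nu2, integral_map (a_aemeas ht) Iφ2.aestronglyMeasurable]
    have hset : triOf t =ᵐ[(μH[2] : Measure E3)] intT t := by
      have := diff_null_ae_eq_self (s := triOf t) (edg_null t)
      exact this.symm
    rw [setIntegral_congr_set hset]
    refine setIntegral_congr_fun (intT_meas t) fun x hx => ?_
    simp only [hφ]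
    rw [l2 x hx, v2 x hx, liftS_apply (tri_sub_Sh ht hx.1), liftS_apply (tri_sub_Sh ht hx.1)]
  rw [e2]
  set B := ∫ y in Tr.Om t, (‖Srf.grad (Tr.liftS l) y‖ * ‖Srf.grad (Tr.liftS v) y‖ + |Tr.liftS l y| * |Tr.liftS v y|) ∂Srf.mu with hB
  have JB : Integrable (fun y => ‖Srf.grad (Tr.liftS l) y‖ * ‖Srf.grad (Tr.liftS v) y‖ + |Tr.liftS l y| * |Tr.liftS v y|) (Srf.mu.restrict (Tr.Om t)) :=
    (I3.add I4).integrableOn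
  have hB0 : 0 ≤ B := integral_nonneg fun y => by positivity
  have b1 : ∫ y in Tr.Om t, |φ y| ∂Srf.mu ≤ 4 * B := by
    rw [hB, ← integral_const_mul]
    refine integral_mono_ae Iφ.abs (JB.const_mul 4) ?_
    filter_upwards [ae_restrict_mem (Om_meas ht)] with y hy
    obtain ⟨x, hx, rfl⟩ := hy
    have k1 := (half_compare sm (l3 x hx).2).1
    have k2 := (half_compare sm (v3 x hx).2).1
    simp only [hφ]
    refine (abs_add_le _ _).trans ?_
    rw [abs_mul]
    have q1 := (abs_real_inner_le_norm gl gv).trans (mul_le_mul k1 k2 (norm_nonneg _) (by positivity))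
    have q2 : 0 ≤ |Tr.liftS l (Tr.a x)| * |Tr.liftS v (Tr.a x)| := by positivity
    nlinarith
  have b2 : |∫ y in Tr.Om t, (⟪Srf.grad (Tr.liftS l) y, Srf.grad (Tr.liftS v) y⟫ + Tr.liftS l y * Tr.liftS v y) ∂Srf.mu
      - ∫ y in Tr.Om t, φ y ∂Srf.mu| ≤ 18 * (C2 K γ₀ * h) * B := by
    rw [← integral_sub I12.integrableOn Iφ, hB, ← integral_const_mul]
    refine (abs_integral_le_integral_abs).trans ?_
    refine integral_mono_ae (I12.integrableOn.sub Iφ).abs (JB.const_mul _) ?_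
    filter_upwards [ae_restrict_mem (Om_meas ht)] with y hy
    obtain ⟨x, hx, rfl⟩ := hy
    have k1 := (half_compare sm (l3 x hx).2)
    have k2 := (half_compare sm (v3 x hx).2)
    simp only [hφ]
    set A := Srf.grad (Tr.liftS l) (Tr.a x)
    set A' := Srf.grad (Tr.liftS v) (Tr.a x)
    have e : ⟪A, A'⟫ + Tr.liftS l (Tr.a x) * Tr.liftS v (Tr.a x) - (⟪gl, gv⟫ + Tr.liftS l (Tr.a x) * Tr.liftS v (Tr.a x))
        = ⟪A - gl, A'⟫ + ⟪gl, A' - gv⟫ := by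
      rw [inner_sub_left, inner_sub_right]; ring
    rw [e]
    have q1 := (abs_real_inner_le_norm (A - gl) A').trans (mul_le_mul_of_nonneg_right k1.2.2 (norm_nonneg _))
    have q2 := (abs_real_inner_le_norm gl (A' - gv)).trans (mul_le_mul k1.1 k2.2.2 (norm_nonneg _) (by positivity))
    have q3 : 0 ≤ |Tr.liftS l (Tr.a x)| * |Tr.liftS v (Tr.a x)| := by positivity
    have := mul_nonneg hC q3
    refine (abs_add_le _ _).trans ?_
    nlinarith
  have b3 : 6 * (C2 K γ₀ * h) * (1 + 6 * (C2 K γ₀ * h)) * ∫ y in Tr.Om t, |φ y| ∂Srf.mu ≤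
      12 * (C2 K γ₀ * h) * (4 * B) := by
    have := sm.s2
    refine mul_le_mul (by nlinarith) b1 (integral_nonneg fun _ => abs_nonneg _) (by positivity)
  have h5 := abs_sub_le (∫ y in Tr.Om t, (⟪Srf.grad (Tr.liftS l) y, Srf.grad (Tr.liftS v) y⟫ + Tr.liftS l y * Tr.liftS v y) ∂Srf.mu)
    (∫ y in Tr.Om t, φ y ∂Srf.mu) (∫ y, φ y ∂(Tr.nu2 t))
  have h6 := mul_nonneg hC hB0
  refine (h5.trans (add_le_add b2 (hcmp.trans b3))).trans ?_
  simp only [mul_assoc] at h6 ⊢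
  linarith

end Triangulation
end

section
namespace Triangulation
variable {Srf : SmoothSurface} {γ₀ h : ℝ} {Tr : Triangulation Srf γ₀ h}
variable {t : E3 × E3 × E3} {K : ℝ}

lemma finrank_dir (ht : t ∈ Tr.T) : Module.finrank ℝ (dirOf t) = 2 := by
  have h1 := (Tr.indep t ht).finrank_vectorSpan (n := 2) (by simp)
  have h2 : Set.range ![t.1, t.2.1, t.2.2] = vertsOf t := by
    rw [Matrix.range_cons, Matrix.range_cons, Matrix.range_cons, Matrix.range_empty]
    simp [vertsOf, Set.insert_def]
    ext; simp; tauto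
  rw [h2] at h1
  rw [dirOf, direction_affineSpan]; exact h1

/-- an orthonormal frame adapted to a triangle -/
lemma dir_frame (ht : t ∈ Tr.T) : ∃ ν τ σ : E3, ‖ν‖ = 1 ∧ ‖τ‖ = 1 ∧ ‖σ‖ = 1 ∧ ⟪ν, τ⟫ = 0 ∧ ⟪ν, σ⟫ = 0 ∧
    ⟪τ, σ⟫ = 0 ∧ τ ∈ dirOf t ∧ σ ∈ dirOf t ∧ ∀ g ∈ dirOf t, ⟪ν, g⟫ = 0 := by
  set b := (stdOrthonormalBasis ℝ (dirOf t)).reindex (finCongr (finrank_dir ht)) with hb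
  have ho := b.orthonormal
  obtain ⟨ν, h1, h2, h3⟩ := exists_unit_orth (b 0 : E3) (b 1 : E3)
  refine ⟨ν, b 0, b 1, h1, ho.1 0, ho.1 1, h2, h3,
    ho.2 (show (0 : Fin 2) ≠ 1 by simp), (b 0).2, (b 1).2, fun g hg => ?_⟩
  have := b.sum_repr ⟨g, hg⟩
  rw [Fin.sum_univ_two] at this
  have h4 := congrArg Subtype.val this
  simp only [Submodule.coe_add, Submodule.coe_smul] at h4
  rw [← h4, inner_add_right, inner_smul_right, inner_smul_right, h2, h3]; simp

lemma area_lower (hγ : 0 < γ₀) (hh : 0 < h) (ht : t ∈ Tr.T) :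
    ENNReal.ofReal (γ₀ ^ 2 * h ^ 2) ≤ (μH[2] : Measure E3) (intT t) := by
  have e1 : (μH[2] : Measure E3) (intT t) = (μH[2] : Measure E3) (triOf t) :=
    measure_congr (sdiff_null_ae_eq_self (edg_null t))
  rw [e1]
  obtain ⟨ν, τ, σ, h1, h2, h3, h4, h5, h6, hτ, hσ, -⟩ := dir_frame ht
  obtain ⟨y, hy, hd⟩ := Tr.disk t ht
  set P : E3 → ℝ × ℝ := fun x => (⟪x - y, τ⟫, ⟪x - y, σ⟫) with hP
  have hlip : LipschitzWith 1 P := by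
    refine LipschitzWith.of_dist_le_mul fun x x' => ?_
    rw [NNReal.coe_one, one_mul, Prod.dist_eq, dist_eq_norm x x']
    have hb : ∀ u : E3, ‖u‖ = 1 → |⟪x - x', u⟫| ≤ ‖x - x'‖ := fun u hu => by
      have := abs_real_inner_le_norm (x - x') u
      rwa [hu, mul_one] at this
    refine max_le ?_ ?_
    · simp only [hP, Real.dist_eq, ← inner_sub_left]; rw [sub_sub_sub_cancel_right]; exact hb τ h2
    · simp only [hP, Real.dist_eq, ← inner_sub_left]; rw [sub_sub_sub_cancel_right]; exact hb σ h3
  have hsub : ball (0 : ℝ × ℝ) (γ₀ * h / 2) ⊆ P '' triOf t := by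
    rintro ⟨u, w⟩ hw
    rw [mem_ball_zero_iff, Prod.norm_def, max_lt_iff] at hw
    simp only [Real.norm_eq_abs] at hw
    refine ⟨y + (u • τ + w • σ), hd ⟨?_, ?_⟩, ?_⟩
    · rw [mem_closedBall, dist_eq_norm, add_sub_cancel_left]
      refine (norm_add_le _ _).trans ?_
      rw [norm_smul, norm_smul, h2, h3, Real.norm_eq_abs, Real.norm_eq_abs]; linarith [hw.1, hw.2]
    · exact add_mem_plane (tri_sub_plane t hy) (add_mem (Submodule.smul_mem _ _ hτ) (Submodule.smul_mem _ _ hσ))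
    · simp only [hP]
      have h6' : ⟪σ, τ⟫ = 0 := by rw [real_inner_comm]; exact h6
      rw [add_sub_cancel_left, inner_add_left, inner_add_left, inner_smul_left, inner_smul_left,
        inner_smul_left, inner_smul_left, h6, h6', real_inner_self_eq_norm_sq, real_inner_self_eq_norm_sq, h2, h3]
      simp
  have hm := (hlip.lipschitzOnWith (s := triOf t)).hausdorffMeasure_image_le (d := 2) (by norm_num)
  simp only [ENNReal.coe_one, ENNReal.one_rpow, one_mul] at hm
  refine le_trans ?_ hm
  refine le_trans ?_ (measure_mono hsub)
  rw [hausdorffMeasure_prod_real]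
  rw [show (0 : ℝ × ℝ) = (0, 0) from rfl, ← ball_prod_same, Measure.volume_eq_prod,
          Measure.prod_prod, Real.volume_ball, ← ENNReal.ofReal_mul (by positivity)]
  apply ENNReal.ofReal_le_ofReal
  apply le_of_eq; ring

lemma mu_Om_lower (sm : Sm Srf γ₀ h K) (ht : t ∈ Tr.T) :
    ENNReal.ofReal (γ₀ ^ 2 / 2 * h ^ 2) ≤ Srf.mu (Tr.Om t) := by
  have h1 := (nu_compare sm.hγ sm.hh sm.hK sm.s1 sm.s2' ht).2 Set.univ
  rw [Measure.smul_apply, nu2, Measure.map_apply_of_aemeasurable (a_aemeas ht) MeasurableSet.univ,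
    Set.preimage_univ, Measure.restrict_apply_univ, Measure.restrict_apply_univ, smul_eq_mul] at h1
  have h2 := (area_lower sm.hγ sm.hh ht).trans h1
  have h3 : ENNReal.ofReal (1 + 6 * (C2 K γ₀ * h)) ≤ ENNReal.ofReal 2 :=
    ENNReal.ofReal_le_ofReal (by linarith [sm.s2])
  have h4 := h2.trans (mul_le_mul_left h3 (Srf.mu (Tr.Om t)))
  have e : γ₀ ^ 2 * h ^ 2 = 2 * (γ₀ ^ 2 / 2 * h ^ 2) := by ring
  rw [e, ENNReal.ofReal_mul (by norm_num)] at h4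
  exact (ENNReal.mul_le_mul_iff_right (by simp) (by simp)).1 h4

lemma lint_sum (sm : Sm Srf γ₀ h K) (f : E3 → ℝ≥0∞) :
    ∫⁻ y, f y ∂Srf.mu = ∑ t ∈ Tr.T, ∫⁻ y in Tr.Om t, f y ∂Srf.mu := by
  rw [← lintegral_biUnion_finset (fun t ht t' ht' hne => Om_disj ht ht' hne) (fun t ht => Om_meas ht)]
  have : Srf.mu.restrict (⋃ t ∈ Tr.T, Tr.Om t) = Srf.mu :=
    Measure.restrict_eq_self_of_ae_mem (sm_ae sm)
  rw [this]

end Triangulation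

open Triangulation in
/-- local averaging against the singular weight -/
lemma exists_near (Srf : SmoothSurface) (γ₀ : ℝ) (hγ : 0 < γ₀) : ∃ C > 0, ∀ h K : ℝ, Sm Srf γ₀ h K →
    ∀ Tr : Triangulation Srf γ₀ h, ∀ z : E3, ∀ f F : E3 → ℝ, AEStronglyMeasurable f Srf.mu →
    (∀ y, 0 ≤ f y) → (∀ y, 0 ≤ F y) →
    Integrable F Srf.mu → (∀ t ∈ Tr.T, ∀ y ∈ Tr.Om t, ∀ y' ∈ Tr.Om t, f y ≤ F y') →
    Integrable (fun y => SmoothSurface.wgt z h y * f y) Srf.mu ∧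
    ∫ y, SmoothSurface.wgt z h y * f y ∂Srf.mu ≤ C * ∫ y, F y ∂Srf.mu := by
  obtain ⟨C, hC, H⟩ := Srf.exists_J3
  refine ⟨C * (2 / γ₀ ^ 2), by positivity, fun h K sm Tr z f F hf hf0 hF0 hF hfF => ?_⟩
  have hh := sm.hh
  have hw0 := fun y => SmoothSurface.wgt_nonneg z hh y
  have key : ∫⁻ y, ENNReal.ofReal (SmoothSurface.wgt z h y * f y) ∂Srf.mu ≤
      ENNReal.ofReal (C * (2 / γ₀ ^ 2)) * ∫⁻ y, ENNReal.ofReal (F y) ∂Srf.mu := by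
    rw [lint_sum (Tr := Tr) sm, lint_sum (Tr := Tr) sm, Finset.mul_sum]
    refine Finset.sum_le_sum fun t ht => ?_
    have h1 : ∀ y' ∈ Tr.Om t, ∫⁻ y in Tr.Om t, ENNReal.ofReal (SmoothSurface.wgt z h y * f y) ∂Srf.mu ≤
        ENNReal.ofReal (C * h ^ 2) * ENNReal.ofReal (F y') := by
      intro y' hy'
      calc _ ≤ ∫⁻ y in Tr.Om t, ENNReal.ofReal (SmoothSurface.wgt z h y) * ENNReal.ofReal (F y') ∂Srf.mu := by
            refine setLIntegral_mono' (Om_meas ht) fun y hy => ?_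
            rw [← ENNReal.ofReal_mul (hw0 y)]
            exact ENNReal.ofReal_le_ofReal (mul_le_mul_of_nonneg_left (hfF t ht y hy y' hy') (hw0 y))
        _ = (∫⁻ y in Tr.Om t, ENNReal.ofReal (SmoothSurface.wgt z h y) ∂Srf.mu) * ENNReal.ofReal (F y') := by
            rw [lintegral_mul_const' _ _ ENNReal.ofReal_ne_top]
        _ ≤ _ := by
            gcongr
            exact (setLIntegral_le_lintegral _ _).trans (H z h hh)
    set I := ∫⁻ y in Tr.Om t, ENNReal.ofReal (SmoothSurface.wgt z h y * f y) ∂Srf.mu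
    have h2 : I * Srf.mu (Tr.Om t) ≤ ENNReal.ofReal (C * h ^ 2) * ∫⁻ y in Tr.Om t, ENNReal.ofReal (F y) ∂Srf.mu := by
      rw [← setLIntegral_const, ← lintegral_const_mul' _ _ ENNReal.ofReal_ne_top]
      exact setLIntegral_mono' (Om_meas ht) h1
    have h3 : ENNReal.ofReal (γ₀ ^ 2 / 2 * h ^ 2) * I ≤
        ENNReal.ofReal (γ₀ ^ 2 / 2 * h ^ 2) *
          (ENNReal.ofReal (C * (2 / γ₀ ^ 2)) * ∫⁻ y in Tr.Om t, ENNReal.ofReal (F y) ∂Srf.mu) := by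
      rw [← mul_assoc, ← ENNReal.ofReal_mul (by positivity)]
      have e : γ₀ ^ 2 / 2 * h ^ 2 * (C * (2 / γ₀ ^ 2)) = C * h ^ 2 := by field_simp
      rw [e]
      refine le_trans ?_ h2
      rw [mul_comm]
      gcongr
      exact mu_Om_lower sm ht
    refine (ENNReal.mul_le_mul_iff_right ?_ ENNReal.ofReal_ne_top).1 h3
    have : 0 < γ₀ ^ 2 / 2 * h ^ 2 := by positivity
    simpa using this
  have hFi : ∫⁻ y, ENNReal.ofReal (F y) ∂Srf.mu = ENNReal.ofReal (∫ y, F y ∂Srf.mu) :=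
    (ofReal_integral_eq_lintegral_ofReal hF (Filter.Eventually.of_forall hF0)).symm
  rw [hFi, ← ENNReal.ofReal_mul (by positivity)] at key
  have hm : AEStronglyMeasurable (fun y => SmoothSurface.wgt z h y * f y) Srf.mu :=
    (SmoothSurface.measurable_wgt z h).aestronglyMeasurable.mul hf
  have hnn : ∀ y, 0 ≤ SmoothSurface.wgt z h y * f y := fun y => mul_nonneg (hw0 y) (hf0 y)
  have hi : Integrable (fun y => SmoothSurface.wgt z h y * f y) Srf.mu := by
    refine ⟨hm, ?_⟩
    rw [hasFiniteIntegral_iff_ofReal (Filter.Eventually.of_forall hnn)]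
    exact key.trans_lt ENNReal.ofReal_lt_top
  refine ⟨hi, ?_⟩
  rw [← ofReal_integral_eq_lintegral_ofReal hi (Filter.Eventually.of_forall hnn)] at key
  refine (ENNReal.ofReal_le_ofReal_iff ?_).1 key
  exact mul_nonneg (by positivity) (integral_nonneg hF0)

namespace Triangulation
variable {Srf : SmoothSurface} {γ₀ h : ℝ} {Tr : Triangulation Srf γ₀ h}
variable {t : E3 × E3 × E3} {K : ℝ}

/-- tangent vectors are nearly in the triangle plane -/
lemma tangent_dir (sm : Sm Srf γ₀ h K) (ht : t ∈ Tr.T) {y : E3} (hy : y ∈ Tr.Om t) {ν τ σ D : E3}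
    (h1 : ‖ν‖ = 1) (h2 : ‖τ‖ = 1) (h3 : ‖σ‖ = 1) (h4 : ⟪ν, τ⟫ = 0) (h5 : ⟪ν, σ⟫ = 0)
    (h6 : ⟪τ, σ⟫ = 0) (hτ : τ ∈ dirOf t) (hσ : σ ∈ dirOf t) (hD : D ∈ Srf.tangent y) :
    |⟪ν, D⟫| ≤ 2 * (C2 K γ₀ * h) * ‖D‖ := by
  obtain ⟨x, hx, rfl⟩ := hy
  have hyS := a_mem_S ht hx.1
  have hh := sm.hh
  have hγ := sm.hγ
  have hK := sm.hK.one
  have hv : ∀ p ∈ vertsOf t, ‖p - Tr.a x‖ ≤ 3 * h := fun p hp =>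
    (a_dist' ht hx.1 (vert_sub_tri t hp)).trans (by linarith)
  have n1 := dir_normal sm.hγ sm.hh sm.hK ht hyS hv hτ
  have n2 := dir_normal sm.hγ sm.hh sm.hK ht hyS hv hσ
  rw [h2, mul_one] at n1
  rw [h3, mul_one] at n2
  set n := Srf.n (Tr.a x)
  set c := 9 * K / γ₀ * h
  have hc : 2 * c ≤ C2 K γ₀ * h := by
    have : 0 ≤ 8 * K * h := by positivity
    have e : C2 K γ₀ * h = 2 * c + 8 * K * h := by simp only [C2, c]; ring
    linarith
  have e1 := orth_expand h1 h2 h3 h4 h5 h6 D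
  have hnD : ⟪n, D⟫ = 0 := by rw [real_inner_comm]; exact (Srf.mem_tangent).1 hD
  have e2 : ⟪ν, D⟫ * ⟪n, ν⟫ + ⟪τ, D⟫ * ⟪n, τ⟫ + ⟪σ, D⟫ * ⟪n, σ⟫ = 0 := by
    rw [← hnD]
    conv_rhs => rw [e1]
    simp only [inner_add_right, inner_smul_right]
  have e3 := orth_expand h1 h2 h3 h4 h5 h6 n
  have hn1 : ‖n‖ = 1 := Srf.n_unit _ hyS
  have e4 : ⟪ν, n⟫ * ⟪ν, n⟫ + ⟪τ, n⟫ * ⟪τ, n⟫ + ⟪σ, n⟫ * ⟪σ, n⟫ = 1 := by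
    have : ⟪n, n⟫ = 1 := by rw [real_inner_self_eq_norm_sq, hn1]; norm_num
    rw [← this]
    conv_rhs => rw [e3]
    simp only [inner_add_left, inner_smul_left, RCLike.conj_to_real]
    rw [← e3]
  rw [real_inner_comm ν n, real_inner_comm τ n, real_inner_comm σ n] at e2
  have b : ∀ u : E3, ‖u‖ = 1 → |⟪u, D⟫| ≤ ‖D‖ := fun u hu => by
    have := abs_real_inner_le_norm u D
    rwa [hu, one_mul] at this
  have b1 := b τ h2
  have b2 := b σ h3
  set A := ⟪ν, n⟫
  set a1 := ⟪τ, n⟫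
  set a2 := ⟪σ, n⟫
  have hc' : 100 * (2 * c) ≤ 1 := by linarith [sm.s2]
  have hc0 : 0 ≤ c := (abs_nonneg _).trans n1
  have s1 : a1 * a1 ≤ c * c := by
    rw [← abs_mul_abs_self a1]; exact mul_le_mul n1 n1 (abs_nonneg _) hc0
  have s2 : a2 * a2 ≤ c * c := by
    rw [← abs_mul_abs_self a2]; exact mul_le_mul n2 n2 (abs_nonneg _) hc0
  have hA : 1 / 2 ≤ |A| := by
    rw [← abs_mul_abs_self A] at e4
    by_contra hcon
    push Not at hcon
    nlinarith [abs_nonneg A]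
  have e5 : |⟪ν, D⟫| * |A| ≤ 2 * c * ‖D‖ := by
    rw [← abs_mul]
    have : ⟪ν, D⟫ * A = -(⟪τ, D⟫ * a1) - ⟪σ, D⟫ * a2 := by linarith
    rw [this]
    refine (abs_sub _ _).trans ?_
    rw [abs_neg, abs_mul, abs_mul]
    have q1 := mul_le_mul b1 n1 (abs_nonneg _) (norm_nonneg D)
    have q2 := mul_le_mul b2 n2 (abs_nonneg _) (norm_nonneg D)
    linarith
  have e6 := mul_le_mul_of_nonneg_left hA (abs_nonneg ⟪ν, D⟫)
  have e7 := mul_le_mul_of_nonneg_right hc (norm_nonneg D)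
  nlinarith

set_option maxHeartbeats 800000 in
/-- interpolation estimate at one point -/
lemma interp_est (sm : Sm Srf γ₀ h K) {v : E3 → ℝ} (hv : Tr.IsVh v) (ht : t ∈ Tr.T) {y : E3} (hy : y ∈ Tr.Om t)
    {T0 M : ℝ} {w : E3} (H : ∀ p ∈ vertsOf t, |v p - (T0 + ⟪w, p - y⟫)| ≤ M * h ^ 2) :
    ‖Srf.grad (Tr.liftS v) y - Srf.PT y w‖ ≤ (2 / γ₀ + 16 * C2 K γ₀) * h * (M + ‖w‖) ∧
    |Tr.liftS v y - T0| ≤ (1 + 4 * K) * h ^ 2 * (M + ‖w‖) := by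
  have hyO := hy
  obtain ⟨x, hx, rfl⟩ := hy
  have hyS := a_mem_S ht hx.1
  obtain ⟨g, hg, h1, -, h3⟩ := Vh_tri sm hv ht
  have hh := sm.hh
  have hγ := sm.hγ
  have hK1 := sm.hK.one
  have hM : 0 ≤ M := by
    have := (abs_nonneg _).trans (H t.1 (by simp [vertsOf]))
    by_contra hc; push Not at hc; nlinarith [pow_pos hh 2]
  obtain ⟨k1, k2, k3⟩ := half_compare sm (h3 x hx).2
  replace h3 := (h3 x hx).2
  set y := Tr.a x with hyd
  have hxy := a_dist2 sm.hK ht hx.1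
  rw [← hyd] at hxy
  have e : ∀ p, p ∈ triOf t → v p - (T0 + ⟪w, p - y⟫) = (innerSL ℝ (g - w) : E3 →L[ℝ] ℝ).toLinearMap p +
      (v x - ⟪g, x⟫ - T0 + ⟪w, y⟫) := by
    intro p hp
    have := h1 p hp x hx.1
    simp only [ContinuousLinearMap.coe_coe, innerSL_apply_apply]
    rw [inner_sub_left, inner_sub_right]
    rw [inner_sub_right] at this
    linarith
  have H' : ∀ p ∈ vertsOf t, |(innerSL ℝ (g - w) : E3 →L[ℝ] ℝ).toLinearMap p +
      (v x - ⟪g, x⟫ - T0 + ⟪w, y⟫)| ≤ M * h ^ 2 := fun p hp => by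
    rw [← e p (vert_sub_tri t hp)]; exact H p hp
  have hb := tri_bound H' x hx.1
  rw [← e x hx.1] at hb
  have hlin : ∀ u ∈ dirOf t, |⟪g - w, u⟫| ≤ M * h / γ₀ * ‖u‖ := by
    intro u hu
    have := lin_bound hγ hh ht H' hu
    simp only [ContinuousLinearMap.coe_coe, innerSL_apply_apply] at this
    refine this.trans (le_of_eq ?_)
    field_simp
  constructor
  · obtain ⟨ν, τ, σ, o1, o2, o3, o4, o5, o6, hτ, hσ, hν⟩ := dir_frame ht
    set A := Srf.grad (Tr.liftS v) y
    have hA : A ∈ Srf.tangent y := SmoothSurface.grad_mem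
    set D := A - Srf.PT y w with hDd
    have hD : D ∈ Srf.tangent y := Submodule.sub_mem _ hA (Srf.PT_mem hyS w)
    have hνD := tangent_dir sm ht hyO o1 o2 o3 o4 o5 o6 hτ hσ hD
    set u := D - ⟪ν, D⟫ • ν with hu
    have hud : u ∈ dirOf t := by
      have : u = ⟪τ, D⟫ • τ + ⟪σ, D⟫ • σ := by
        rw [hu, sub_eq_iff_eq_add]
        nth_rewrite 1 [orth_expand o1 o2 o3 o4 o5 o6 D]; abel
      rw [this]; exact add_mem (Submodule.smul_mem _ _ hτ) (Submodule.smul_mem _ _ hσ)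
    have hun : ‖u‖ ≤ ‖D‖ := by
      have : ‖u‖ ^ 2 ≤ ‖D‖ ^ 2 := by
        rw [hu, norm_sub_sq_real, inner_smul_right, norm_smul, o1, real_inner_comm, mul_one, Real.norm_eq_abs,
          sq_abs]
        nlinarith [sq_nonneg ⟪ν, D⟫]
      exact le_of_sq_le_sq this (norm_nonneg _)
    have e1 : ‖D‖ ^ 2 = ⟪A - g, D⟫ + ⟪g - w, u⟫ - ⟪ν, D⟫ * ⟪ν, w⟫ := by
      have q1 : ⟪Srf.PT y w, D⟫ = ⟪w, D⟫ := Srf.inner_PT hD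
      have q2 : ⟪D, D⟫ = ⟪A, D⟫ - ⟪w, D⟫ := by
        nth_rewrite 1 [hDd]; rw [inner_sub_left, q1]
      rw [← real_inner_self_eq_norm_sq, q2, hu, inner_sub_right (g - w), inner_smul_right]
      have q3 := hν g hg
      rw [inner_sub_left A g D, inner_sub_left g w D, inner_sub_left g w ν, real_inner_comm ν g, q3, real_inner_comm ν w]
      ring
    have f1 := (abs_real_inner_le_norm (A - g) D).trans (mul_le_mul_of_nonneg_right h3 (norm_nonneg _))
    have f2 := (hlin u hud).trans (mul_le_mul_of_nonneg_left hun (by positivity))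
    have f3 : |⟪ν, w⟫| ≤ ‖w‖ := by
      have := abs_real_inner_le_norm ν w; rwa [o1, one_mul] at this
    have f4 := mul_le_mul hνD f3 (abs_nonneg _) (mul_nonneg (by linarith [sm.C2hn]) (norm_nonneg D))
    rw [← abs_mul] at f4
    have hPw := Srf.norm_PT_le hyS w
    have hAD : ‖A‖ ≤ ‖D‖ + ‖w‖ := by
      have := norm_add_le D (Srf.PT y w)
      rw [hDd, sub_add_cancel] at this
      linarith
    have f5 : ‖D‖ ^ 2 ≤ ((3 * C2 K γ₀ * h) * (2 * (‖D‖ + ‖w‖)) + M * h / γ₀ + 2 * (C2 K γ₀ * h) * ‖w‖) * ‖D‖ := by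
      have g1 := le_abs_self ⟪A - g, D⟫
      have g2 := le_abs_self ⟪g - w, u⟫
      have g3 := neg_abs_le (⟪ν, D⟫ * ⟪ν, w⟫)
      have g4 : (3 * C2 K γ₀ * h) * ‖g‖ * ‖D‖ ≤ (3 * C2 K γ₀ * h) * (2 * (‖D‖ + ‖w‖)) * ‖D‖ := by
        have := sm.C2n
        gcongr; linarith
      rw [e1]; nlinarith
    have f6 : ‖D‖ ≤ (3 * C2 K γ₀ * h) * (2 * (‖D‖ + ‖w‖)) + M * h / γ₀ + 2 * (C2 K γ₀ * h) * ‖w‖ := by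
      rcases (norm_nonneg D).eq_or_lt with h0 | h0
      · rw [← h0]; have := sm.C2n; positivity
      · rw [sq] at f5; exact le_of_mul_le_mul_right f5 h0
    have f7 : (C2 K γ₀ * h) * ‖D‖ ≤ 1 / 100 * ‖D‖ := mul_le_mul_of_nonneg_right (by linarith [sm.s2]) (norm_nonneg _)
    have f8 : ‖D‖ ≤ 2 / γ₀ * (M * h) + 16 * (C2 K γ₀ * h) * ‖w‖ := by
      have f9 : 2 / γ₀ * (M * h) = 2 * (M * h / γ₀) := by ring
      rw [f9]
      have f10 := mul_nonneg sm.C2hn (norm_nonneg w)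
      have : 0 ≤ M * h / γ₀ := by positivity
      have f11 : (3 * C2 K γ₀ * h) * (2 * (‖D‖ + ‖w‖)) = 6 * (C2 K γ₀ * h * ‖D‖) + 6 * (C2 K γ₀ * h * ‖w‖) := by ring
      rw [f11] at f6
      have f12 : 2 * (C2 K γ₀ * h) * ‖w‖ = 2 * (C2 K γ₀ * h * ‖w‖) := by ring
      have f13 : 16 * (C2 K γ₀ * h) * ‖w‖ = 16 * (C2 K γ₀ * h * ‖w‖) := by ring
      rw [f12] at f6
      rw [f13]
      linarith [norm_nonneg D]
    refine f8.trans ?_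
    have i1 : 0 ≤ 2 / γ₀ * h * ‖w‖ := by positivity
    have i2 : 0 ≤ C2 K γ₀ * h * M := mul_nonneg sm.C2hn hM
    have i3 : (2 / γ₀ + 16 * C2 K γ₀) * h * (M + ‖w‖) = 2 / γ₀ * (M * h) + 16 * (C2 K γ₀ * h) * ‖w‖ +
      2 / γ₀ * h * ‖w‖ + 16 * (C2 K γ₀ * h * M) := by ring
    rw [i3]
    linarith
  · rw [liftS_apply (tri_sub_Sh ht hx.1)]
    have e2 : v x - T0 = (v x - (T0 + ⟪w, x - y⟫)) + ⟪w, x - y⟫ := by ring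
    rw [e2]
    refine (abs_add_le _ _).trans ?_
    have q1 := (abs_real_inner_le_norm w (x - y)).trans (mul_le_mul_of_nonneg_left hxy (norm_nonneg w))
    have q2 : 0 ≤ h ^ 2 * ‖w‖ := by positivity
    have q3 : 0 ≤ K * h ^ 2 * M := by positivity
    nlinarith

/-- Taylor expansion at vertices of a finite element function -/
lemma vert_taylor (sm : Sm Srf γ₀ h K) {v : E3 → ℝ} (hv : Tr.IsVh v) (ht : t ∈ Tr.T) {y : E3} (hy : y ∈ Tr.Om t)
    {p : E3} (hp : p ∈ vertsOf t) :
    |v p - (Tr.liftS v y + ⟪Srf.grad (Tr.liftS v) y, p - y⟫)| ≤ 7 * C2 K γ₀ * h ^ 2 * ‖Srf.grad (Tr.liftS v) y‖ := by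
  obtain ⟨x, hx, rfl⟩ := hy
  obtain ⟨g, hg, h1, -, h3⟩ := Vh_tri sm hv ht
  obtain ⟨k1, k2, k3⟩ := half_compare sm (h3 x hx).2
  have hh := sm.hh
  have hγ := sm.hγ
  have hK1 := sm.hK.one
  have hxy := a_dist2 sm.hK ht hx.1
  have hpx := tri_dist ht (vert_sub_tri t hp) hx.1
  rw [liftS_apply (tri_sub_Sh ht hx.1)]
  set A := Srf.grad (Tr.liftS v) (Tr.a x)
  have e : v p - (v x + ⟪A, p - Tr.a x⟫) = - ⟪A - g, p - x⟫ - ⟪A, x - Tr.a x⟫ := by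
    have := h1 p (vert_sub_tri t hp) x hx.1
    have e2 : p - Tr.a x = (p - x) + (x - Tr.a x) := by abel
    rw [e2, inner_add_right, inner_sub_left]
    linarith
  rw [e]
  refine (abs_sub _ _).trans ?_
  rw [abs_neg]
  have q1 := (abs_real_inner_le_norm (A - g) (p - x)).trans (mul_le_mul k3 hpx (norm_nonneg _)
    (mul_nonneg (by linarith [sm.C2hn]) (norm_nonneg A)))
  have q2 := (abs_real_inner_le_norm A (x - Tr.a x)).trans (mul_le_mul_of_nonneg_left hxy (norm_nonneg A))
  have q3 : 4 * K ≤ C2 K γ₀ := by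
    have : 0 ≤ 18 * K / γ₀ := by positivity
    unfold C2; linarith
  have q4 := mul_le_mul_of_nonneg_right q3 (by positivity : 0 ≤ h ^ 2 * ‖A‖)
  nlinarith

lemma Om_diam (ht : t ∈ Tr.T) {y p : E3} (hy : y ∈ Tr.Om t) (hp : p ∈ vertsOf t) :
    ‖p - y‖ ≤ 2 * h := by
  obtain ⟨x, hx, rfl⟩ := hy
  exact a_dist' ht hx.1 (vert_sub_tri t hp)

end Triangulation
end

section
lemma exists_linear_values {ι V : Type*} [AddCommGroup V] [Module ℝ V] {v : ι → V}
    (hv : LinearIndependent ℝ v) (w : ι → ℝ) : ∃ L : V →ₗ[ℝ] ℝ, ∀ i, L (v i) = w i := by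
  obtain ⟨g, hg⟩ := ((Module.Basis.span hv).constr ℝ w).exists_extend
  refine ⟨g, fun i => ?_⟩
  have := LinearMap.congr_fun hg (Module.Basis.span hv i)
  rw [Module.Basis.constr_basis, LinearMap.comp_apply, Submodule.subtype_apply, Module.Basis.span_apply] at this
  exact this

namespace Triangulation
variable {Srf : SmoothSurface} {γ₀ h : ℝ} {Tr : Triangulation Srf γ₀ h}
variable {t : E3 × E3 × E3} {K : ℝ}

lemma exists_affine (ht : t ∈ Tr.T) (φ : E3 → ℝ) :
    ∃ (L : E3 →ₗ[ℝ] ℝ) (c : ℝ), ∀ p ∈ vertsOf t, L p + c = φ p := by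
  have h1 := (affineIndependent_iff_linearIndependent_vsub ℝ _ (0 : Fin 3)).1 (Tr.indep t ht)
  obtain ⟨L, hL⟩ := exists_linear_values h1 (fun i => φ (![t.1, t.2.1, t.2.2] i) - φ t.1)
  refine ⟨L, φ t.1 - L t.1, ?_⟩
  have a1 := hL ⟨1, by simp⟩
  have a2 := hL ⟨2, by simp⟩
  simp only [Matrix.cons_val, vsub_eq_sub, map_sub] at a1 a2
  rintro p (rfl | rfl | rfl) <;> linarith

/-- nodal interpolation -/
lemma exists_interp (Tr : Triangulation Srf γ₀ h) (φ : E3 → ℝ) :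
    ∃ v : E3 → ℝ, Tr.IsVh v ∧ ∀ t ∈ Tr.T, ∀ p ∈ vertsOf t, v p = φ p := by
  classical
  have := fun t (ht : t ∈ Tr.T) => exists_affine (Tr := Tr) ht φ
  choose! L c hLc using this
  have hex : ∀ x ∈ Tr.Sh, ∃ t ∈ Tr.T, x ∈ triOf t := fun x hx => by
    simpa [Sh] using hx
  choose! s hsT hs using hex
  have hcons : ∀ t ∈ Tr.T, ∀ t' ∈ Tr.T, ∀ x ∈ triOf t ∩ triOf t', L t x + c t = L t' x + c t' := by
    intro t ht t' ht' x hx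
    by_cases hne : t = t'
    · rw [hne]
    have hv : ∀ p ∈ vertsOf t ∩ vertsOf t', L t p + c t = L t' p + c t' := fun p hp => by
      rw [hLc t ht p hp.1, hLc t' ht' p hp.2]
    rcases Tr.meet t ht t' ht' hne with h0 | ⟨p, hp, h1⟩ | ⟨p, q, -, hp, hq, h1⟩
    · rw [h0] at hx; exact absurd hx (Set.notMem_empty x)
    · rw [h1] at hx; rw [Set.mem_singleton_iff.1 hx]; exact hv p hp
    · rw [h1] at hx
      obtain ⟨a, b, ha, hb, hab, rfl⟩ := hx
      have e1 := hv p hp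
      have e2 := hv q hq
      simp only [map_add, map_smul, smul_eq_mul]
      have : b = 1 - a := by linarith
      subst this
      linear_combination a * e1 + (1 - a) * e2
  set v : E3 → ℝ := fun x => L (s x) x + c (s x) with hvd
  have hval : ∀ t ∈ Tr.T, ∀ x ∈ triOf t, v x = L t x + c t := by
    intro t ht x hx
    have hxS := tri_sub_Sh ht hx
    exact hcons _ (hsT x hxS) t ht x ⟨hs x hxS, hx⟩
  refine ⟨v, ⟨?_, fun t ht => ⟨L t, c t, hval t ht⟩⟩, fun t ht p hp => ?_⟩
  · have : Tr.Sh = ⋃ t : {t // t ∈ Tr.T}, triOf t := by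
      ext x; simp [Sh]
    rw [this]
    refine (locallyFinite_of_finite _).continuousOn_iUnion (fun t => (tri_compact t.1).isClosed) fun t => ?_
    have hc : Continuous fun x => L t.1 x + c t.1 := (L t.1).continuous_of_finiteDimensional.add continuous_const
    exact hc.continuousOn.congr fun x hx => hval t.1 t.2 x hx
  · rw [hval t ht p (vert_sub_tri t hp), hLc t ht p hp]

end Triangulation
end

section
/-- one dimensional pointwise inequality behind Hardy -/
lemma hardy_pt {s u f f' y k : ℝ} (hs : 0 < s) (hy : |y| ≤ s) (hk : k = 1 - (y / s) ^ 2) :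
    1 / 4 * k ^ 2 * f ^ 2 - (16 / s ^ 2 + 2) * (u ^ 2 * (f' ^ 2 + f ^ 2)) ≤
      (k ^ 2 + u * (2 * k * (-(2 * (y / s) * (1 / s))))) * f ^ 2 + (u * k ^ 2) * (2 * f * f') := by
  have h1 : |y / s| ≤ 1 := by rw [abs_div, abs_of_pos hs]; exact (div_le_one hs).2 hy
  have h2 : (y / s) ^ 2 ≤ 1 := by rw [← sq_abs]; exact pow_le_one₀ (abs_nonneg _) h1
  have hk0 : 0 ≤ k := by rw [hk]; linarith
  have hk1 : k ≤ 1 := by rw [hk]; linarith [sq_nonneg (y / s)]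
  set q := y / s with hq
  set i := 1 / s with hi
  have e : (16 : ℝ) / s ^ 2 = 16 * i ^ 2 := by rw [hi]; field_simp
  rw [e]
  -- first: cross term with cutoff derivative
  have a1 : -(1 / 4 * k ^ 2 + 16 * i ^ 2 * u ^ 2) ≤ -(4 * (u * k * q * i)) := by
    have : 0 ≤ (k / 2 - 4 * (u * i * q) * 1) ^ 2 := sq_nonneg _
    have h3 : 16 * (u * i) ^ 2 * q ^ 2 ≤ 16 * (u * i) ^ 2 * 1 := mul_le_mul_of_nonneg_left h2 (by positivity)
    nlinarith
  have a2 : -(1 / 2 * k ^ 2 * f ^ 2 + 2 * u ^ 2 * f' ^ 2) ≤ 2 * (u * k ^ 2 * f * f') := by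
    have h4 : 0 ≤ k ^ 2 * (f + 2 * (u * f')) ^ 2 := by positivity
    have h5 : k ^ 2 * (u * f') ^ 2 ≤ 1 * (u * f') ^ 2 := by
      apply mul_le_mul_of_nonneg_right _ (sq_nonneg _); exact pow_le_one₀ hk0 hk1
    nlinarith
  have a3 := mul_le_mul_of_nonneg_right a1 (sq_nonneg f)
  have a4 : 0 ≤ 16 * i ^ 2 * u ^ 2 * f' ^ 2 := by positivity
  have a5 : 0 ≤ 2 * u ^ 2 * f ^ 2 := by positivity
  nlinarith

lemma hardy1 {s : ℝ} (hs : 0 < s) {f g : ℝ → ℝ} {Λ : ℝ≥0} (hf : LipschitzOnWith Λ f (Set.Icc (-s) s)) (c : ℝ)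
    (hg : ∀ᵐ y : ℝ, y ∈ Set.Ioo (-s) s → DifferentiableAt ℝ f y → |deriv f y| ≤ g y) :
    ∫⁻ y in Set.Icc (-(s / 2)) (s / 2), ENNReal.ofReal (f y ^ 2) ≤
      ENNReal.ofReal (8 * (16 / s ^ 2 + 2)) *
        ∫⁻ y in Set.Icc (-s) s, ENNReal.ofReal ((y - c) ^ 2 * (g y ^ 2 + f y ^ 2)) := by
  have hle : -s ≤ s := by linarith
  have hAC : AbsolutelyContinuousOnInterval f (-s) s := by
    apply LipschitzOnWith.absolutelyContinuousOnInterval (K := Λ)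
    rwa [Set.uIcc_of_le hle]
  set k : ℝ → ℝ := fun y => 1 - (y / s) ^ 2 with hk
  set W : ℝ → ℝ := fun y => (y - c) * k y ^ 2 with hW
  have hWd : ∀ y, HasDerivAt W (k y ^ 2 + (y - c) * (2 * k y * (-(2 * (y / s) * (1 / s))))) y := by
    intro y
    have d1 : HasDerivAt k (-(2 * (y / s) * (1 / s))) y := by
      have := (((hasDerivAt_id y).div_const s).pow 2).const_sub 1
      simpa [hk] using this
    have := ((hasDerivAt_id y).sub_const c).mul (d1.pow 2)
    refine this.congr_deriv ?_
    simp
  have hWC : ContDiff ℝ 1 W := by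
    simp only [hW, hk]; fun_prop
  have hWAC : AbsolutelyContinuousOnInterval W (-s) s := by
    obtain ⟨K', hK'⟩ := hWC.contDiffOn.exists_lipschitzOnWith (s := Set.uIcc (-s) s) (n := 1) one_ne_zero
      (by rw [Set.uIcc_of_le hle]; exact convex_Icc _ _) isCompact_uIcc
    exact hK'.absolutelyContinuousOnInterval
  have hff : AbsolutelyContinuousOnInterval (fun y => f y * f y) (-s) s := hAC.fun_mul hAC
  have hIBP := hWAC.integral_deriv_mul_eq_sub hff
  have hk1 : k s = 0 := by simp [hk, div_self hs.ne']
  have hk2 : k (-s) = 0 := by simp [hk, neg_div, div_self hs.ne']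
  have hWs : W s = 0 := by simp [hW, hk1]
  have hWs' : W (-s) = 0 := by simp [hW, hk2]
  rw [hWs, hWs', zero_mul, zero_mul, sub_zero, intervalIntegral.integral_of_le hle] at hIBP
  have hfc : ContinuousOn f (Set.Icc (-s) s) := hf.continuousOn
  have hkc : Continuous k := by simp only [hk]; fun_prop
  have hIint : IntegrableOn (fun y => deriv W y * (f y * f y) + W y * deriv (fun y => f y * f y) y) (Set.Ioc (-s) s) := by
    have h1 := (hWAC.intervalIntegrable_deriv.mul_continuousOn hff.continuousOn).add
      (hff.intervalIntegrable_deriv.continuousOn_mul hWAC.continuousOn)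
    exact (intervalIntegrable_iff_integrableOn_Ioc_of_le hle).1 h1
  have hdb : ∀ y ∈ Set.Ioo (-s) s, |deriv f y| ≤ Λ := fun y hy =>
    norm_deriv_le_of_lipschitzOn (Icc_mem_nhds hy.1 hy.2) hf
  have hae : ∀ᵐ y ∂(volume.restrict (Set.Ioc (-s) s)), y ∈ Set.Ioo (-s) s := by
    have e : (volume.restrict (Set.Ioc (-s) s) : Measure ℝ) = volume.restrict (Set.Ioo (-s) s) :=
      Measure.restrict_congr_set Ioo_ae_eq_Ioc.symm
    rw [e]; exact ae_restrict_mem measurableSet_Ioo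
  have hdint : IntegrableOn (fun y => (y - c) ^ 2 * (deriv f y ^ 2 + f y ^ 2)) (Set.Ioc (-s) s) := by
    have m1 : AEStronglyMeasurable (fun y => (y - c) ^ 2 * (deriv f y ^ 2)) (volume.restrict (Set.Ioc (-s) s)) :=
      ((by fun_prop : Continuous fun y : ℝ => (y - c) ^ 2).aestronglyMeasurable).mul
        ((measurable_deriv f).pow_const 2).aestronglyMeasurable
    have i1 : IntegrableOn (fun y => (y - c) ^ 2 * (deriv f y ^ 2)) (Set.Ioc (-s) s) := by
      refine Integrable.mono' (g := fun _ => (s + |c|) ^ 2 * (Λ : ℝ) ^ 2) (integrable_const _) m1 ?_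
      filter_upwards [hae] with y hy
      rw [Real.norm_eq_abs, abs_of_nonneg (by positivity)]
      refine mul_le_mul ?_ ?_ (by positivity) (by positivity)
      · rw [← sq_abs]
        refine pow_le_pow_left₀ (abs_nonneg _) ((abs_sub _ _).trans ?_) 2
        have := abs_lt.2 ⟨hy.1, hy.2⟩
        linarith
      · rw [← sq_abs]; exact pow_le_pow_left₀ (abs_nonneg _) (hdb y hy) 2
    have i2 : IntegrableOn (fun y => (y - c) ^ 2 * (f y ^ 2)) (Set.Icc (-s) s) :=
      ContinuousOn.integrableOn_Icc (by fun_prop)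
    have := i1.add (i2.mono_set Set.Ioc_subset_Icc_self)
    refine this.congr (Filter.Eventually.of_forall fun y => ?_)
    simp only [Pi.add_apply]; ring
  have hkint : IntegrableOn (fun y => k y ^ 2 * f y ^ 2) (Set.Ioc (-s) s) :=
    (ContinuousOn.integrableOn_Icc (by fun_prop)).mono_set Set.Ioc_subset_Icc_self
  have hAE := hAC.ae_differentiableAt
  set Cs := 16 / s ^ 2 + 2 with hCs
  have hCs0 : 0 ≤ Cs := by positivity
  have main : 1 / 4 * ∫ y in Set.Ioc (-s) s, k y ^ 2 * f y ^ 2 ≤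
      Cs * ∫ y in Set.Ioc (-s) s, (y - c) ^ 2 * (deriv f y ^ 2 + f y ^ 2) := by
    rw [← sub_nonpos, ← hIBP, ← integral_const_mul, ← integral_const_mul,
      ← integral_sub (hkint.const_mul _) (hdint.const_mul _)]
    refine integral_mono_ae ((hkint.const_mul _).sub (hdint.const_mul _)) hIint ?_
    filter_upwards [hae, ae_restrict_of_ae hAE] with y hy hd
    have hd' : DifferentiableAt ℝ f y := hd (by rw [Set.uIcc_of_le hle]; exact ⟨hy.1.le, hy.2.le⟩)
    have hp := hardy_pt (u := y - c) (f := f y) (f' := deriv f y) hs (abs_le.2 ⟨hy.1.le, hy.2.le⟩) (rfl : k y = _)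
    have e1 : deriv (fun y => f y * f y) y = 2 * f y * deriv f y := by
      have h0 := (hd'.hasDerivAt.mul hd'.hasDerivAt).deriv
      change deriv (f * f) y = _
      rw [h0]; ring
    rw [(hWd y).deriv, e1]
    simp only [hW]
    calc _ = 1 / 4 * k y ^ 2 * f y ^ 2 - Cs * ((y - c) ^ 2 * (deriv f y ^ 2 + f y ^ 2)) := by ring
      _ ≤ _ := hp
      _ = _ := by ring
  have hsub : Set.Icc (-(s / 2)) (s / 2) ⊆ Set.Ioc (-s) s := fun y hy => ⟨by linarith [hy.1], by linarith [hy.2]⟩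
  calc ∫⁻ y in Set.Icc (-(s / 2)) (s / 2), ENNReal.ofReal (f y ^ 2)
      ≤ ∫⁻ y in Set.Icc (-(s / 2)) (s / 2), ENNReal.ofReal (2 * (k y ^ 2 * f y ^ 2)) := by
        refine setLIntegral_mono' measurableSet_Icc fun y hy => ENNReal.ofReal_le_ofReal ?_
        have h1 : |y / s| ≤ 1 / 2 := by
          rw [abs_div, abs_of_pos hs, div_le_iff₀ hs]
          have := abs_le.2 ⟨hy.1, hy.2⟩; linarith
        have h2 : (y / s) ^ 2 ≤ 1 / 4 := by
          rw [← sq_abs]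
          calc |y / s| ^ 2 ≤ (1 / 2) ^ 2 := pow_le_pow_left₀ (abs_nonneg _) h1 2
            _ = 1 / 4 := by norm_num
        have h3 : 3 / 4 ≤ k y := by simp only [hk]; linarith
        have h4 : 1 ≤ 2 * k y ^ 2 := by nlinarith
        nlinarith [sq_nonneg (f y)]
    _ ≤ ∫⁻ y in Set.Ioc (-s) s, ENNReal.ofReal (2 * (k y ^ 2 * f y ^ 2)) := lintegral_mono_set hsub
    _ = ENNReal.ofReal (∫ y in Set.Ioc (-s) s, 2 * (k y ^ 2 * f y ^ 2)) := by
        rw [ofReal_integral_eq_lintegral_ofReal (hkint.const_mul 2) (Filter.Eventually.of_forall fun y => by positivity)]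
    _ ≤ ENNReal.ofReal (8 * Cs * ∫ y in Set.Ioc (-s) s, (y - c) ^ 2 * (deriv f y ^ 2 + f y ^ 2)) := by
        apply ENNReal.ofReal_le_ofReal
        rw [integral_const_mul]; linarith
    _ = ENNReal.ofReal (8 * Cs) * ∫⁻ y in Set.Ioc (-s) s, ENNReal.ofReal ((y - c) ^ 2 * (deriv f y ^ 2 + f y ^ 2)) := by
        rw [ENNReal.ofReal_mul (by positivity),
          ofReal_integral_eq_lintegral_ofReal hdint (Filter.Eventually.of_forall fun y => by positivity)]
    _ ≤ ENNReal.ofReal (8 * Cs) * ∫⁻ y in Set.Ioc (-s) s, ENNReal.ofReal ((y - c) ^ 2 * (g y ^ 2 + f y ^ 2)) := by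
        gcongr 1
        refine lintegral_mono_ae ?_
        filter_upwards [hae, ae_restrict_of_ae hAE, ae_restrict_of_ae hg] with y hy hd hgy
        have hd' : DifferentiableAt ℝ f y := hd (by rw [Set.uIcc_of_le hle]; exact ⟨hy.1.le, hy.2.le⟩)
        apply ENNReal.ofReal_le_ofReal
        have := pow_le_pow_left₀ (abs_nonneg _) (hgy hy hd') 2
        rw [sq_abs] at this
        gcongr
    _ ≤ _ := by
        gcongr 1
        exact lintegral_mono_set Set.Ioc_subset_Icc_self

/-- a continuous function, Lipschitz on each piece of a finite closed cover, is Lipschitz -/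
lemma lip_of_cover {ι : Type*} (T : Finset ι) (A : ι → Set ℝ) {α β Λ : ℝ} {f : ℝ → ℝ} (hΛ : 0 ≤ Λ)
    (hf : ContinuousOn f (Set.Icc α β)) (hcl : ∀ t ∈ T, IsClosed (A t))
    (hcov : Set.Icc α β ⊆ ⋃ t ∈ T, A t)
    (hlip : ∀ t ∈ T, ∀ x ∈ A t, ∀ y ∈ A t, |f x - f y| ≤ Λ * |x - y|) :
    ∀ x ∈ Set.Icc α β, |f x - f α| ≤ Λ * (x - α) := by
  intro x hx
  refine le_of_forall_pos_le_add fun ε hε => ?_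
  have hαβ : α ≤ β := hx.1.trans hx.2
  set ε' := ε / (β - α + 1) with hε'
  have hε'0 : 0 < ε' := div_pos hε (by linarith)
  have key := image_norm_le_of_liminf_right_slope_norm_lt_deriv_boundary (f := fun x => f x - f α)
    (f' := fun _ => Λ) (a := α) (b := β) (B := fun x => (Λ + ε') * (x - α)) (B' := fun _ => Λ + ε')
    (by fun_prop) ?_ (by simp) (by fun_prop) ?_ ?_ hx
  · rw [Real.norm_eq_abs] at key
    refine key.trans ?_
    have h1 : ε' * (x - α) ≤ ε' * (β - α + 1) := mul_le_mul_of_nonneg_left (by linarith [hx.2]) hε'0.le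
    have h2 : ε' * (β - α + 1) = ε := by rw [hε']; field_simp; rw [div_self (by linarith)]
    linarith
  · intro x hx r hr
    have hev : ∀ᶠ z in nhdsWithin x (Set.Ioi x), z ∈ Set.Icc α β ∧ x < z := by
      filter_upwards [Ioo_mem_nhdsGT hx.2] with z hz
      exact ⟨⟨hx.1.trans hz.1.le, hz.2.le⟩, hz.1⟩
    obtain ⟨t, ht, hfr⟩ : ∃ t ∈ T, ∃ᶠ z in nhdsWithin x (Set.Ioi x), z ∈ A t := by
      by_contra hcon
      push Not at hcon
      have h1 : ∀ t ∈ T, ∀ᶠ z in nhdsWithin x (Set.Ioi x), z ∉ A t := fun t ht =>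
        Filter.not_frequently.1 (by simpa using hcon t ht)
      have h2 := (Filter.eventually_all_finset T).2 h1
      obtain ⟨z, hz, hz2⟩ := (h2.and hev).exists
      have := hcov hz2.1
      simp only [Set.mem_iUnion] at this
      obtain ⟨t, ht, h3⟩ := this
      exact hz t ht h3
    have hxA : x ∈ A t := by
      rw [← (hcl t ht).closure_eq]
      exact mem_closure_iff_frequently.2 (hfr.filter_mono nhdsWithin_le_nhds)
    refine (hfr.and_eventually hev).mono fun z hz => ?_
    have hzx : 0 < z - x := sub_pos.2 hz.2.2
    rw [slope_def_field, div_lt_iff₀ hzx]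
    simp only [Function.comp, Real.norm_eq_abs]
    have h1 := hlip t ht z hz.1 x hxA
    rw [abs_of_pos hzx] at h1
    have h2 := abs_sub_abs_le_abs_sub (f z - f α) (f x - f α)
    rw [sub_sub_sub_cancel_right] at h2
    have h3 := mul_lt_mul_of_pos_right hr hzx
    linarith
  · intro x _
    have := ((hasDerivAt_id x).sub_const α).const_mul (Λ + ε')
    simpa using this.hasDerivWithinAt
  · intro x _ _
    linarith
end

section
namespace Triangulation
variable {Srf : SmoothSurface} {γ₀ h : ℝ} {Tr : Triangulation Srf γ₀ h}
variable {t : E3 × E3 × E3} {K : ℝ}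

lemma Vh_piece (sm : Sm Srf γ₀ h K) {v : E3 → ℝ} (hv : Tr.IsVh v) :
    ∃ Λ : ℝ≥0, ∀ t ∈ Tr.T, LipschitzOnWith Λ (Tr.liftS v) (Tr.a '' triOf t) := by
  have key : ∀ t, ∃ Λ : ℝ≥0, t ∈ Tr.T → LipschitzOnWith Λ (Tr.liftS v) (Tr.a '' triOf t) := by
    intro t
    by_cases ht : t ∈ Tr.T
    · obtain ⟨g, -, hg, -⟩ := Vh_tri sm hv ht
      have h1 : LipschitzOnWith ‖g‖₊ v (triOf t) := by
        refine LipschitzOnWith.of_dist_le_mul fun x hx x' hx' => ?_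
        rw [Real.dist_eq, hg x hx x' hx', dist_eq_norm]
        exact abs_real_inner_le_norm _ _
      have h2 := inv_lip sm.hγ sm.hh sm.hK sm.s1 sm.s2' ht
      refine ⟨_, fun _ => h1.comp h2 ?_⟩
      rintro _ ⟨x, hx, rfl⟩
      have hinj : Set.InjOn Tr.a Tr.Sh := Tr.a_bij.injOn
      rw [hinj.leftInvOn_invFunOn (tri_sub_Sh ht hx)]
      exact hx
    · exact ⟨0, fun h => absurd h ht⟩
  choose f hf using key
  refine ⟨∑ t ∈ Tr.T, f t, fun t ht => (hf t ht).weaken ?_⟩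
  exact Finset.single_le_sum (f := f) (fun _ _ => zero_le) ht

lemma S_cover : Srf.S ⊆ ⋃ t ∈ Tr.T, Tr.a '' triOf t := by
  intro y hy
  obtain ⟨x, hx, rfl⟩ := Tr.a_bij.surjOn hy
  simp only [Set.mem_iUnion] at hx ⊢
  obtain ⟨t, ht, hx⟩ := hx
  exact ⟨t, ht, x, hx, rfl⟩

lemma piece_closed (ht : t ∈ Tr.T) : IsClosed (Tr.a '' triOf t) :=
  ((tri_compact t).image_of_continuousOn (a_contOn.mono (tri_sub_Sh ht))).isClosed

lemma Vh_contOn (sm : Sm Srf γ₀ h K) {v : E3 → ℝ} (hv : Tr.IsVh v) : ContinuousOn (Tr.liftS v) Srf.S := by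
  obtain ⟨Λ, hΛ⟩ := Vh_piece sm hv
  have := LocallyFinite.continuousOn_iUnion (g := Tr.liftS v) (f := fun t : {t // t ∈ Tr.T} => Tr.a '' triOf t.1)
    (locallyFinite_of_finite _) (fun t => piece_closed t.2) (fun t => (hΛ t.1 t.2).continuousOn)
  refine this.mono ?_
  intro y hy
  have := S_cover (Tr := Tr) hy
  simp only [Set.mem_iUnion] at this ⊢
  obtain ⟨t, ht, h1⟩ := this
  exact ⟨⟨t, ht⟩, h1⟩

lemma Vh_curve (sm : Sm Srf γ₀ h K) {v : E3 → ℝ} (hv : Tr.IsVh v) : ∃ Λ : ℝ≥0, ∀ (α β : ℝ) (L : ℝ≥0) (γ : ℝ → E3),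
    LipschitzOnWith L γ (Set.Icc α β) → Set.MapsTo γ (Set.Icc α β) Srf.S →
    LipschitzOnWith (Λ * L) (fun u => Tr.liftS v (γ u)) (Set.Icc α β) := by
  obtain ⟨Λ, hΛ⟩ := Vh_piece sm hv
  refine ⟨Λ, fun α β L γ hγ hm => ?_⟩
  have hc := Vh_contOn sm hv
  have main : ∀ x ∈ Set.Icc α β, ∀ y ∈ Set.Icc α β, x ≤ y →
      |Tr.liftS v (γ y) - Tr.liftS v (γ x)| ≤ (Λ * L : ℝ≥0) * (y - x) := by
    intro x hx y hy hxy
    have hsub : Set.Icc x y ⊆ Set.Icc α β := Set.Icc_subset_Icc hx.1 hy.2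
    have hγc := (hγ.continuousOn.mono hsub)
    refine lip_of_cover Tr.T (fun t => Set.Icc x y ∩ γ ⁻¹' (Tr.a '' triOf t)) (α := x) (β := y)
      (f := fun u => Tr.liftS v (γ u)) (by positivity) (hc.comp hγc fun u hu => hm (hsub hu)) ?_ ?_ ?_ y ⟨hxy, le_rfl⟩
    · intro t ht
      exact hγc.preimage_isClosed_of_isClosed isClosed_Icc (piece_closed ht)
    · intro u hu
      have := S_cover (Tr := Tr) (hm (hsub hu))
      simp only [Set.mem_iUnion] at this ⊢
      obtain ⟨t, ht, h1⟩ := this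
      exact ⟨t, ht, hu, h1⟩
    · rintro t ht u ⟨hu, hu1⟩ w ⟨hw, hw1⟩
      have h1 := (hΛ t ht).dist_le_mul _ hu1 _ hw1
      have h2 := hγ.dist_le_mul _ (hsub hu) _ (hsub hw)
      rw [Real.dist_eq] at h1 h2
      refine h1.trans ?_
      push_cast
      rw [mul_assoc]
      gcongr
  refine LipschitzOnWith.of_dist_le_mul fun x hx y hy => ?_
  rw [Real.dist_eq, Real.dist_eq]
  rcases le_total x y with hxy | hxy
  · rw [abs_sub_comm, abs_sub_comm x y, abs_of_nonneg (sub_nonneg.2 hxy)]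
    exact main x hx y hy hxy
  · rw [abs_of_nonneg (sub_nonneg.2 hxy)]
    exact main y hy x hx hxy

lemma curve_deriv {w : E3 → ℝ} {γ : ℝ → E3} {s y : ℝ} {L : ℝ≥0} (hy : y ∈ Set.Ioo (-s) s)
    (hγ : LipschitzOnWith L γ (Set.Icc (-s) s)) (hm : Set.MapsTo γ (Set.Icc (-s) s) Srf.S)
    (hw : Srf.SC1 w (γ y)) : |deriv (fun u => w (γ u)) y| ≤ L * ‖Srf.grad w (γ y)‖ := by
  have hnb : Set.Icc (-s) s ∈ nhds y := Icc_mem_nhds hy.1 hy.2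
  have hyI : y ∈ Set.Icc (-s) s := ⟨hy.1.le, hy.2.le⟩
  refine le_of_forall_pos_le_add fun ε hε => ?_
  have hε' : 0 < ε / (L + 1) := by positivity
  have h1 := hw.lipAt (hm hyI) hε'
  have ht : Filter.Tendsto γ (nhds y) (nhdsWithin (γ y) Srf.S) :=
    tendsto_nhdsWithin_iff.2 ⟨(hγ.continuousOn.continuousAt hnb), by filter_upwards [hnb] with u hu using hm hu⟩
  have h2 := ht.eventually h1
  have := norm_deriv_le_of_lip' (f := fun u => w (γ u)) (x₀ := y) (C := L * ‖Srf.grad w (γ y)‖ + ε) (by positivity) ?_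
  · rwa [Real.norm_eq_abs] at this
  · filter_upwards [h2, hnb] with u hu huI
    have h3 := hγ.dist_le_mul _ huI _ hyI
    rw [dist_eq_norm, dist_eq_norm] at h3
    rw [Real.norm_eq_abs]
    refine hu.trans ?_
    calc _ ≤ (‖Srf.grad w (γ y)‖ + ε / (L + 1)) * (L * ‖u - y‖) := by gcongr
      _ = (L * ‖Srf.grad w (γ y)‖ + ε * (L / (L + 1))) * ‖u - y‖ := by ring
      _ ≤ _ := by
        gcongr
        have : (L : ℝ) / (L + 1) ≤ 1 := by rw [div_le_one (by positivity)]; linarith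
        nlinarith
end Triangulation

namespace SmoothSurface
variable {Srf : SmoothSurface}

/-- square -/
def sq (s : ℝ) : Set (ℝ × ℝ) := Set.Icc (-s) s ×ˢ Set.Icc (-s) s

lemma sq_meas (s : ℝ) : MeasurableSet (sq s) := measurableSet_Icc.prod measurableSet_Icc

lemma rfn_ge {z x τ : E3} (hz : z ∈ Srf.S) (h1 : ‖τ‖ = 1) (hτ : ⟪τ, Srf.n z⟫ = 0) :
    |⟪x - z, τ⟫| ≤ Srf.rfn z x := by
  rw [Srf.rfn_eq hz, ← Srf.inner_PT (Srf.mem_tangent.2 hτ)]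
  have := abs_real_inner_le_norm (Srf.PT z (x - z)) τ
  rwa [h1, mul_one] at this

lemma chart_map_le {p τ σ : E3} {s : ℝ} {L : ℝ≥0} (hF : Srf.Frame p τ σ) {Φ : ℝ × ℝ → E3}
    (h1 : ∀ y : ℝ × ℝ, |y.1| ≤ s → |y.2| ≤ s → Φ y ∈ Srf.S ∧ ⟪Φ y - p, τ⟫ = y.1 ∧ ⟪Φ y - p, σ⟫ = y.2)
    (h2 : LipschitzOnWith L Φ (sq s)) :
    AEMeasurable Φ (volume.restrict (sq s)) ∧ (volume.restrict (sq s)).map Φ ≤ Srf.mu := by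
  have hm : AEMeasurable Φ (volume.restrict (sq s)) := h2.continuousOn.aemeasurable (sq_meas s)
  refine ⟨hm, Measure.le_intro fun A hA _ => ?_⟩
  rw [Measure.map_apply_of_aemeasurable hm hA, Measure.restrict_apply' (sq_meas s), mu, Measure.restrict_apply hA]
  set π : E3 → ℝ × ℝ := fun x => (⟪x - p, τ⟫, ⟪x - p, σ⟫) with hπ
  have hlip : LipschitzWith 1 π := by
    refine LipschitzWith.of_dist_le_mul fun x y => ?_
    have hb : ∀ u : E3, ‖u‖ = 1 → |⟪x - p, u⟫ - ⟪y - p, u⟫| ≤ dist x y := fun u hu => by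
      rw [← inner_sub_left, sub_sub_sub_cancel_right, dist_eq_norm]
      have := abs_real_inner_le_norm (x - y) u; rwa [hu, mul_one] at this
    rw [Prod.dist_eq, NNReal.coe_one, one_mul]
    exact max_le (hb τ hF.τ1) (hb σ hF.σ1)
  have hsub : Φ ⁻¹' A ∩ sq s ⊆ π '' (A ∩ Srf.S) := by
    rintro y ⟨hyA, hy1, hy2⟩
    obtain ⟨a1, a2, a3⟩ := h1 y (abs_le.2 hy1) (abs_le.2 hy2)
    exact ⟨Φ y, ⟨hyA, a1⟩, by simp only [hπ, a2, a3]⟩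
  refine (measure_mono hsub).trans ?_
  rw [← hausdorffMeasure_prod_real]
  have := (hlip.lipschitzOnWith (s := A ∩ Srf.S)).hausdorffMeasure_image_le (d := 2) (by norm_num)
  simpa using this

lemma chart_le_map {p τ σ : E3} {s ε : ℝ} {L : ℝ≥0} (hF : Srf.Frame p τ σ) {Φ : ℝ × ℝ → E3}
    (hs : 0 < s) (h2 : LipschitzOnWith L Φ (sq s))
    (h3 : ∀ x ∈ Srf.S, ‖x - p‖ < ε → ‖x - p‖ < s ∧ Φ (⟪x - p, τ⟫, ⟪x - p, σ⟫) = x) :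
    Srf.mu.restrict (ball p (min ε (s / 2))) ≤ ((L : ℝ≥0∞) ^ 2) • (volume.restrict (sq (s / 2))).map Φ := by
  have hsq : sq (s / 2) ⊆ sq s := by
    apply Set.prod_mono <;> exact Set.Icc_subset_Icc (by linarith) (by linarith)
  have hm : AEMeasurable Φ (volume.restrict (sq (s / 2))) := (h2.mono hsq).continuousOn.aemeasurable (sq_meas _)
  refine Measure.le_intro fun A hA _ => ?_
  rw [Measure.smul_apply, Measure.map_apply_of_aemeasurable hm hA, Measure.restrict_apply' (sq_meas _),
    Measure.restrict_apply hA, mu, Measure.restrict_apply (hA.inter measurableSet_ball)]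
  have hsub : A ∩ ball p (min ε (s / 2)) ∩ Srf.S ⊆ Φ '' (Φ ⁻¹' A ∩ sq (s / 2)) := by
    rintro x ⟨⟨hxA, hxb⟩, hxS⟩
    rw [mem_ball_iff_norm, lt_min_iff] at hxb
    obtain ⟨hd, hx⟩ := h3 x hxS hxb.1
    have hb : ∀ u : E3, ‖u‖ = 1 → |⟪x - p, u⟫| ≤ s / 2 := fun u hu => by
      have := abs_real_inner_le_norm (x - p) u; rw [hu, mul_one] at this; linarith [hxb.2]
    exact ⟨_, ⟨by rw [Set.mem_preimage, hx]; exact hxA, abs_le.1 (hb τ hF.τ1), abs_le.1 (hb σ hF.σ1)⟩, hx⟩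
  refine (measure_mono hsub).trans ?_
  refine ((h2.mono (Set.inter_subset_right.trans hsq)).hausdorffMeasure_image_le (d := 2) (by norm_num)).trans ?_
  rw [hausdorffMeasure_prod_real, ENNReal.rpow_two]
  rfl
end SmoothSurface
end

section
namespace SmoothSurface
open Triangulation
variable {Srf : SmoothSurface}

lemma rfn_continuous (z : E3) : Continuous (Srf.rfn z) := by
  unfold rfn P0; fun_prop

lemma Frame.swap {p τ σ : E3} (hF : Srf.Frame p τ σ) : Srf.Frame p σ τ :=
  ⟨hF.σ1, hF.τ1, hF.σn, hF.τn, by rw [real_inner_comm]; exact hF.τσ⟩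

lemma hardy_local {p : E3} (hp : p ∈ Srf.S) : ∃ ε > 0, ∃ C : ℝ≥0, ∀ z ∈ Srf.S, ∀ (γ₀ h K : ℝ), Sm Srf γ₀ h K →
    ∀ (Tr : Triangulation Srf γ₀ h) (v : E3 → ℝ), Tr.IsVh v →
    ∫⁻ x in ball p ε, ENNReal.ofReal (Tr.liftS v x ^ 2) ∂Srf.mu ≤
      C * ∫⁻ x, ENNReal.ofReal (Srf.rfn z x ^ 2 * (‖Srf.grad (Tr.liftS v) x‖ ^ 2 + Tr.liftS v x ^ 2)) ∂Srf.mu := by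
  obtain ⟨s, hs, ε, hε, L, hch⟩ := Srf.exists_chart2 hp
  refine ⟨min ε (s / 2), lt_min hε (by positivity),
    L ^ 2 * (Real.toNNReal (8 * (16 / s ^ 2 + 2)) * (L ^ 2 + 1)), ?_⟩
  intro z hz γ₀ h K sm Tr v hv
  obtain ⟨τ, σ, hF, hτz⟩ := Srf.exists_frame p z
  obtain ⟨Φ, h1, h2, h3⟩ := hch σ τ hF.swap
  set V := Tr.liftS v with hV
  set W : E3 → ℝ≥0∞ := fun x => ENNReal.ofReal (Srf.rfn z x ^ 2 * (‖Srf.grad V x‖ ^ 2 + V x ^ 2)) with hW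
  obtain ⟨hm, hle⟩ := chart_map_le hF.swap h1 h2
  have hsq : sq (s / 2) ⊆ sq s := by
    apply Set.prod_mono <;> exact Set.Icc_subset_Icc (by linarith) (by linarith)
  obtain ⟨mV, mgV⟩ := Vh_aesm sm hv
  have mW : AEMeasurable W Srf.mu := by
    refine AEMeasurable.ennreal_ofReal ?_
    exact (((rfn_continuous z).measurable.pow_const 2).aemeasurable).mul
      ((mgV.norm.aemeasurable.pow_const 2).add (mV.aemeasurable.pow_const 2))
  have hac : (volume.restrict (sq s)).map Φ ≪ Srf.mu := Measure.absolutelyContinuous_of_le hle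
  have mWΦ : AEMeasurable (fun y => W (Φ y)) (volume.restrict (sq s)) :=
    (mW.mono_ac hac).comp_aemeasurable hm
  have mV2 : AEMeasurable (fun x => ENNReal.ofReal (V x ^ 2)) Srf.mu :=
    (mV.aemeasurable.pow_const 2).ennreal_ofReal
  have hprod : ∀ A B : Set ℝ, (volume.restrict (A ×ˢ B) : Measure (ℝ × ℝ)) =
      (volume.restrict A).prod (volume.restrict B) := fun A B => by
    rw [Measure.prod_restrict, Measure.volume_eq_prod]
  have haeO : ∀ᵐ y ∂(volume.restrict (sq s)), Φ y ∈ Tr.Omt := by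
    have : ∀ᵐ x ∂((volume.restrict (sq s)).map Φ), x ∈ Tr.Omt := hac.ae_le (sm_ae (Tr := Tr) sm)
    exact ae_of_ae_map hm this
  rw [sq, hprod] at haeO
  have haeO' := Measure.ae_ae_of_ae_prod haeO
  have step1 : ∫⁻ x in ball p (min ε (s / 2)), ENNReal.ofReal (V x ^ 2) ∂Srf.mu ≤
      (L : ℝ≥0∞) ^ 2 * ∫⁻ y in sq (s / 2), ENNReal.ofReal (V (Φ y) ^ 2) := by
    refine (lintegral_mono' (chart_le_map hF.swap hs h2 h3) le_rfl).trans ?_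
    rw [lintegral_smul_measure, smul_eq_mul]
    gcongr
    have hle2 : (volume.restrict (sq (s / 2))).map Φ ≤ (volume.restrict (sq s)).map Φ :=
      Measure.le_intro fun A hA _ => by
        rw [Measure.map_apply_of_aemeasurable hm hA,
          Measure.map_apply_of_aemeasurable (hm.mono_set hsq) hA]
        exact Measure.restrict_mono hsq le_rfl _
    rw [lintegral_map' (mV2.mono_ac ((Measure.absolutelyContinuous_of_le hle2).trans hac)) (hm.mono_set hsq)]
  set c := ⟪z - p, τ⟫ with hc
  set Cs : ℝ := 8 * (16 / s ^ 2 + 2) with hCs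
  obtain ⟨Λ, hΛ⟩ := Vh_curve sm hv
  have hline : ∀ y₁ ∈ Set.Icc (-s) s, LipschitzOnWith L (fun u => Φ (y₁, u)) (Set.Icc (-s) s) ∧
      Set.MapsTo (fun u => Φ (y₁, u)) (Set.Icc (-s) s) Srf.S := by
    intro y₁ hy₁
    refine ⟨?_, fun u hu => (h1 (y₁, u) (abs_le.2 hy₁) (abs_le.2 hu)).1⟩
    refine LipschitzOnWith.of_dist_le_mul fun u hu w hw => ?_
    have := h2.dist_le_mul (y₁, u) ⟨hy₁, hu⟩ (y₁, w) ⟨hy₁, hw⟩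
    rwa [Prod.dist_eq, dist_self, max_eq_right dist_nonneg] at this
  have step2 : ∫⁻ y in sq (s / 2), ENNReal.ofReal (V (Φ y) ^ 2) ≤
      ENNReal.ofReal Cs * ((L : ℝ≥0∞) ^ 2 + 1) * ∫⁻ y in sq s, W (Φ y) := by
    rw [sq, hprod]
    refine (lintegral_prod_le _).trans ?_
    rw [sq, hprod] at mWΦ ⊢
    rw [lintegral_prod _ mWΦ]
    have hIsub : Set.Icc (-(s / 2)) (s / 2) ⊆ Set.Icc (-s) s := Set.Icc_subset_Icc (by linarith) (by linarith)
    have hmono : (volume.restrict (Set.Icc (-(s / 2)) (s / 2)) : Measure ℝ) ≤ volume.restrict (Set.Icc (-s) s) :=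
      Measure.restrict_mono hIsub le_rfl
    refine le_trans (lintegral_mono' hmono le_rfl) ?_
    rw [← lintegral_const_mul' _ _ (by finiteness)]
    refine lintegral_mono_ae ?_
    filter_upwards [haeO', ae_restrict_mem measurableSet_Icc] with y₁ hO hy₁
    obtain ⟨hl1, hl2⟩ := hline y₁ hy₁
    have hf := hΛ (-s) s L _ hl1 hl2
    have hO' := (ae_restrict_iff' measurableSet_Icc).1 hO
    have hH := hardy1 hs hf c (g := fun u => L * ‖Srf.grad V (Φ (y₁, u))‖) (by
      filter_upwards [hO'] with u hu hui _
      exact curve_deriv hui hl1 hl2 (Vh_SC1 sm hv (hu ⟨hui.1.le, hui.2.le⟩)))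
    refine hH.trans ?_
    rw [mul_assoc]
    refine mul_le_mul_right ?_ _
    rw [← lintegral_const_mul' _ _ (by finiteness)]
    refine setLIntegral_mono' measurableSet_Icc fun u hu => ?_
    have hcoe : ((L : ℝ≥0∞) ^ 2 + 1) = ENNReal.ofReal ((L : ℝ) ^ 2 + 1) := by
      rw [ENNReal.ofReal_add (by positivity) (by norm_num), ENNReal.ofReal_pow (by positivity), ENNReal.ofReal_coe_nnreal,
        ENNReal.ofReal_one]
    rw [hcoe, hW, ← ENNReal.ofReal_mul (by positivity)]
    apply ENNReal.ofReal_le_ofReal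
    have e1 : (u - c) ^ 2 ≤ Srf.rfn z (Φ (y₁, u)) ^ 2 := by
      rw [← sq_abs]
      refine pow_le_pow_left₀ (abs_nonneg _) ?_ 2
      have := rfn_ge (x := Φ (y₁, u)) hz hF.τ1 hτz
      have e2 : ⟪Φ (y₁, u) - z, τ⟫ = u - c := by
        have e4 : ⟪Φ (y₁, u) - p, τ⟫ = u := (h1 (y₁, u) (abs_le.2 hy₁) (abs_le.2 hu)).2.2
        rw [hc, ← sub_sub_sub_cancel_right (Φ (y₁, u)) z p, inner_sub_left, e4]
      rwa [e2] at this
    have e3 : (L * ‖Srf.grad V (Φ (y₁, u))‖) ^ 2 + V (Φ (y₁, u)) ^ 2 ≤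
        ((L : ℝ) ^ 2 + 1) * (‖Srf.grad V (Φ (y₁, u))‖ ^ 2 + V (Φ (y₁, u)) ^ 2) := by
      nlinarith [sq_nonneg (‖Srf.grad V (Φ (y₁, u))‖), mul_nonneg (sq_nonneg (L : ℝ)) (sq_nonneg (V (Φ (y₁, u))))]
    calc _ ≤ Srf.rfn z (Φ (y₁, u)) ^ 2 * (((L : ℝ) ^ 2 + 1) * (‖Srf.grad V (Φ (y₁, u))‖ ^ 2 + V (Φ (y₁, u)) ^ 2)) := by
          exact mul_le_mul e1 e3 (by positivity) (by positivity)
      _ = _ := by ring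
  have step3 : ∫⁻ y in sq s, W (Φ y) ≤ ∫⁻ x, W x ∂Srf.mu := by
    rw [← lintegral_map' (mW.mono_ac hac) hm]
    exact lintegral_mono' hle le_rfl
  calc _ ≤ _ := step1
    _ ≤ (L : ℝ≥0∞) ^ 2 * (ENNReal.ofReal Cs * ((L : ℝ≥0∞) ^ 2 + 1) * ∫⁻ x, W x ∂Srf.mu) := by
        gcongr; exact step2.trans (by gcongr)
    _ = _ := by push_cast; rw [ENNReal.ofReal]; ring

variable (Srf) in
lemma exists_hardy : ∃ C : ℝ, 0 < C ∧ ∀ z ∈ Srf.S, ∀ (γ₀ h K : ℝ), Sm Srf γ₀ h K →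
    ∀ (Tr : Triangulation Srf γ₀ h) (v : E3 → ℝ), Tr.IsVh v →
    ∫ x, (Tr.liftS v x ^ 2) ∂Srf.mu ≤
      C * ∫ x, (Srf.rfn z x ^ 2 * (‖Srf.grad (Tr.liftS v) x‖ ^ 2 + Tr.liftS v x ^ 2)) ∂Srf.mu := by
  have key : ∃ C : ℝ≥0, ∀ z ∈ Srf.S, ∀ (γ₀ h K : ℝ), Sm Srf γ₀ h K →
    ∀ (Tr : Triangulation Srf γ₀ h) (v : E3 → ℝ), Tr.IsVh v →
    ∫⁻ x in Srf.S, ENNReal.ofReal (Tr.liftS v x ^ 2) ∂Srf.mu ≤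
      C * ∫⁻ x, ENNReal.ofReal (Srf.rfn z x ^ 2 * (‖Srf.grad (Tr.liftS v) x‖ ^ 2 + Tr.liftS v x ^ 2)) ∂Srf.mu := by
    refine Srf.compact.induction_on (p := fun A => ∃ C : ℝ≥0, ∀ z ∈ Srf.S, ∀ (γ₀ h K : ℝ), Sm Srf γ₀ h K →
      ∀ (Tr : Triangulation Srf γ₀ h) (v : E3 → ℝ), Tr.IsVh v →
      ∫⁻ x in A, ENNReal.ofReal (Tr.liftS v x ^ 2) ∂Srf.mu ≤
      C * ∫⁻ x, ENNReal.ofReal (Srf.rfn z x ^ 2 * (‖Srf.grad (Tr.liftS v) x‖ ^ 2 + Tr.liftS v x ^ 2)) ∂Srf.mu) ?_ ?_ ?_ ?_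
    · exact ⟨0, by simp⟩
    · rintro A B hAB ⟨C, H⟩
      exact ⟨C, fun z hz γ₀ h K sm Tr v hv => (lintegral_mono_set hAB).trans (H z hz γ₀ h K sm Tr v hv)⟩
    · rintro A B ⟨C, H⟩ ⟨C', H'⟩
      refine ⟨C + C', fun z hz γ₀ h K sm Tr v hv => (lintegral_union_le _ _ _).trans ?_⟩
      push_cast
      rw [add_mul]
      exact add_le_add (H z hz γ₀ h K sm Tr v hv) (H' z hz γ₀ h K sm Tr v hv)
    · intro p hp
      obtain ⟨ε, hε, C, H⟩ := hardy_local hp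
      exact ⟨ball p ε, mem_nhdsWithin_of_mem_nhds (ball_mem_nhds p hε), C, H⟩
  obtain ⟨C, H⟩ := key
  refine ⟨C + 1, by positivity, fun z hz γ₀ h K sm Tr v hv => ?_⟩
  obtain ⟨M, hM0, hM, hM'⟩ := Vh_bdd sm hv
  obtain ⟨mV, mgV⟩ := Vh_aesm sm hv
  have hb := H z hz γ₀ h K sm Tr v hv
  have hres : Srf.mu.restrict Srf.S = Srf.mu := by rw [mu, Measure.restrict_restrict Srf.measS, Set.inter_self]
  rw [hres] at hb
  obtain ⟨Cr, hCr⟩ := Srf.compact.exists_bound_of_continuousOn (rfn_continuous (Srf := Srf) z).continuousOn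
  have I1 : Integrable (fun x => Tr.liftS v x ^ 2) Srf.mu := by
    refine integrable_bdd (M := M ^ 2) (mV.pow 2) ?_
    filter_upwards [Srf.ae_mem] with y hy
    rw [abs_pow]; exact pow_le_pow_left₀ (abs_nonneg _) (hM y hy) 2
  have I2 : Integrable (fun x => Srf.rfn z x ^ 2 * (‖Srf.grad (Tr.liftS v) x‖ ^ 2 + Tr.liftS v x ^ 2)) Srf.mu := by
    refine integrable_bdd (M := Cr ^ 2 * (M ^ 2 + M ^ 2))
      (((rfn_continuous z).aestronglyMeasurable.pow 2).mul ((mgV.norm.pow 2).add (mV.pow 2))) ?_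
    filter_upwards [sm_ae (Tr := Tr) sm] with y hy
    rw [abs_of_nonneg (by positivity)]
    refine mul_le_mul ?_ (add_le_add (pow_le_pow_left₀ (norm_nonneg _) (hM' y hy) 2) ?_) (by positivity) (by positivity)
    · rw [← sq_abs]; exact pow_le_pow_left₀ (abs_nonneg _) (hCr y (Omt_sub hy)) 2
    · rw [← sq_abs]; exact pow_le_pow_left₀ (abs_nonneg _) (hM y (Omt_sub hy)) 2
  rw [← ofReal_integral_eq_lintegral_ofReal I1 (Filter.Eventually.of_forall fun y => by positivity),
    ← ofReal_integral_eq_lintegral_ofReal I2 (Filter.Eventually.of_forall fun y => by positivity),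
    ← ENNReal.ofReal_coe_nnreal, ← ENNReal.ofReal_mul (by positivity)] at hb
  have h0 : 0 ≤ ∫ x, (Srf.rfn z x ^ 2 * (‖Srf.grad (Tr.liftS v) x‖ ^ 2 + Tr.liftS v x ^ 2)) ∂Srf.mu :=
    integral_nonneg fun x => by positivity
  have := (ENNReal.ofReal_le_ofReal_iff (by positivity)).1 hb
  linarith
end SmoothSurface
end

section
lemma log_rem {s : ℝ} (hs : -(8 / 9) ≤ s) : |Real.log (1 + s) - s| ≤ 9 * s ^ 2 := by
  have h1 : 0 < 1 + s := by linarith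
  have h2 : Real.log (1 + s) ≤ s := by have := Real.log_le_sub_one_of_pos h1; linarith
  have h3 := Real.one_sub_inv_le_log_of_pos h1
  rw [abs_of_nonpos (by linarith)]
  have h4 : s - (1 - (1 + s)⁻¹) = s ^ 2 * (1 + s)⁻¹ := by field_simp; ring
  have h5 : (1 + s)⁻¹ ≤ 9 := by
    rw [inv_le_comm₀ h1 (by norm_num)]; linarith
  have := mul_le_mul_of_nonneg_left h5 (sq_nonneg s)
  linarith

lemma log_sq_le {c D Q : ℝ} (hc : 0 < c) (hc1 : c ≤ 1) (hD : 0 < D) (hQ1 : c ^ 2 * D ≤ Q) (hQ2 : Q ≤ D) (hD5 : D ≤ 5) :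
    Real.log Q ^ 2 ≤ 129 / c ^ 2 / D := by
  have hQ : 0 < Q := lt_of_lt_of_le (by positivity) hQ1
  have hinv : 1 / Q ≤ 1 / c ^ 2 / D := by
    rw [div_div]; exact one_div_le_one_div_of_le (by positivity) hQ1
  have h129 : 129 / c ^ 2 / D = 125 / c ^ 2 / D + 4 * (1 / c ^ 2 / D) := by ring
  have h25 : 25 ≤ 125 / c ^ 2 / D := by
    rw [le_div_iff₀ hD, le_div_iff₀ (by positivity)]
    have : c ^ 2 ≤ 1 := pow_le_one₀ hc.le hc1
    nlinarith
  rcases le_total 0 (Real.log Q) with h0 | h0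
  · have h1 : Real.log Q ≤ 5 := by have := Real.log_le_sub_one_of_pos hQ; linarith
    have h2 : Real.log Q ^ 2 ≤ 25 := by nlinarith
    have : 0 ≤ 1 / c ^ 2 / D := by positivity
    linarith
  · have h1 : Real.log (Real.sqrt (1 / Q)) ≤ Real.sqrt (1 / Q) :=
      (Real.log_le_sub_one_of_pos (Real.sqrt_pos.2 (by positivity))).trans (by linarith)
    rw [Real.log_sqrt (by positivity), one_div, Real.log_inv] at h1
    have h2 : (Real.sqrt Q⁻¹) ^ 2 = 1 / Q := by rw [Real.sq_sqrt (by positivity), one_div]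
    have h3 : 0 ≤ Real.sqrt Q⁻¹ := Real.sqrt_nonneg _
    have h4 : Real.log Q ^ 2 ≤ 4 * (1 / Q) := by rw [← h2]; nlinarith
    linarith

lemma log_ratio_sq {c d h q : ℝ} (hc : 0 < c) (hc1 : c ≤ 1) (hd : 0 < d) (hh : 0 < h) (hq : c ^ 2 * d ^ 2 ≤ q) :
    0 ≤ Real.log (1 + h ^ 2 / q) ∧ Real.log (1 + h ^ 2 / q) ≤ h ^ 2 / (c ^ 2 * d ^ 2) ∧
    Real.log (1 + h ^ 2 / q) ^ 2 ≤ 32 / c ^ 4 * ((h ^ 2 / (d ^ 2 + h ^ 2)) ^ 2 + if d < h then h / d else 0) := by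
  have hq0 : 0 < q := lt_of_lt_of_le (by positivity) hq
  have hu : 0 < h ^ 2 / q := by positivity
  have h0 : 0 ≤ Real.log (1 + h ^ 2 / q) := Real.log_nonneg (by linarith)
  have h1 : Real.log (1 + h ^ 2 / q) ≤ h ^ 2 / q := by
    have := Real.log_le_sub_one_of_pos (show 0 < 1 + h ^ 2 / q by linarith); linarith
  have h2 : h ^ 2 / q ≤ h ^ 2 / (c ^ 2 * d ^ 2) := by gcongr
  refine ⟨h0, h1.trans h2, ?_⟩
  have hc4 : c ^ 4 ≤ 1 := pow_le_one₀ hc.le hc1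
  by_cases hdh : d < h
  · rw [if_pos hdh]
    have hX : 0 < 1 + h ^ 2 / q := by linarith
    set b := Real.sqrt (Real.sqrt (1 + h ^ 2 / q)) with hb
    have hb0 : 0 < b := Real.sqrt_pos.2 (Real.sqrt_pos.2 hX)
    have hl : Real.log (1 + h ^ 2 / q) = 4 * Real.log b := by
      rw [hb, Real.log_sqrt (Real.sqrt_nonneg _), Real.log_sqrt hX.le]; ring
    have hlb : Real.log b ≤ b := (Real.log_le_sub_one_of_pos hb0).trans (by linarith)
    have hb2 : b ^ 2 = Real.sqrt (1 + h ^ 2 / q) := Real.sq_sqrt (Real.sqrt_nonneg _)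
    have hb3 : b ^ 2 ≤ 1 + h / (c * d) := by
      rw [hb2]
      apply Real.sqrt_le_iff.2 ⟨by positivity, ?_⟩
      have : h ^ 2 / (c ^ 2 * d ^ 2) = (h / (c * d)) ^ 2 := by rw [div_pow, mul_pow]
      have h3 : 0 ≤ h / (c * d) := by positivity
      nlinarith
    have h4 : Real.log (1 + h ^ 2 / q) ^ 2 ≤ 16 * (1 + h / (c * d)) := by
      have : Real.log (1 + h ^ 2 / q) ≤ 4 * b := by linarith
      nlinarith
    have h5 : 1 + h / (c * d) ≤ 2 / c ^ 4 * (h / d) := by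
      have hhd : 1 ≤ h / d := (one_le_div hd).2 hdh.le
      have e : h / (c * d) = 1 / c * (h / d) := by field_simp
      have h6 : 1 ≤ 1 / c ^ 4 := by rw [le_div_iff₀ (by positivity)]; linarith
      have h7 : 1 / c ≤ 1 / c ^ 4 := by
        apply one_div_le_one_div_of_le (by positivity)
        calc c ^ 4 = c * c ^ 3 := by ring
          _ ≤ c * 1 := by gcongr; exact pow_le_one₀ hc.le hc1
          _ = c := mul_one c
      have e2 : 2 / c ^ 4 = 1 / c ^ 4 + 1 / c ^ 4 := by ring
      rw [e, e2]
      nlinarith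
    have h8 : 0 ≤ 32 / c ^ 4 * (h ^ 2 / (d ^ 2 + h ^ 2)) ^ 2 := by positivity
    have h9 : 16 * (2 / c ^ 4 * (h / d)) = 32 / c ^ 4 * (h / d) := by ring
    rw [mul_add]
    linarith
  · rw [if_neg hdh, add_zero]
    push Not at hdh
    have h3 : h ^ 2 / (c ^ 2 * d ^ 2) ≤ 2 / c ^ 2 * (h ^ 2 / (d ^ 2 + h ^ 2)) := by
      rw [div_mul_div_comm, div_le_div_iff₀ (by positivity) (by positivity)]
      have : h ^ 2 ≤ d ^ 2 := pow_le_pow_left₀ hh.le hdh 2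
      have h5 : h ^ 2 * c ^ 2 * (d ^ 2 + h ^ 2) ≤ h ^ 2 * c ^ 2 * (2 * d ^ 2) := by gcongr; linarith
      nlinarith
    calc Real.log (1 + h ^ 2 / q) ^ 2 ≤ (2 / c ^ 2 * (h ^ 2 / (d ^ 2 + h ^ 2))) ^ 2 :=
          pow_le_pow_left₀ h0 ((h1.trans h2).trans h3) 2
      _ = 4 / c ^ 4 * (h ^ 2 / (d ^ 2 + h ^ 2)) ^ 2 := by rw [mul_pow, div_pow, ← pow_mul]; norm_num
      _ ≤ _ := by gcongr; norm_num

lemma inv_diff {c d h r : ℝ} (hc : 0 < c) (hc1 : c ≤ 1) (hd : 0 < d) (hh : 0 < h) (hr : c * d ≤ r) :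
    r * (1 / r ^ 2 - 1 / (r ^ 2 + h ^ 2)) ≤
      1 / c ^ 3 * (h / (d ^ 2 + h ^ 2) + (if d < h then h / d else 0) / h) := by
  have hr0 : 0 < r := lt_of_lt_of_le (by positivity) hr
  have e : r * (1 / r ^ 2 - 1 / (r ^ 2 + h ^ 2)) = h ^ 2 / (r * (r ^ 2 + h ^ 2)) := by field_simp; ring
  rw [e]
  by_cases hdh : d < h
  · rw [if_pos hdh]
    have h1 : h ^ 2 / (r * (r ^ 2 + h ^ 2)) ≤ 1 / (c * d) := by
      rw [div_le_div_iff₀ (by positivity) (by positivity)]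
      calc h ^ 2 * (c * d) ≤ h ^ 2 * r := by gcongr
        _ ≤ _ := by nlinarith [pow_pos hr0 3]
    have h2 : 1 / (c * d) = 1 / c * (1 / d) := by rw [one_div_mul_one_div]
    have h3 : h / d / h = 1 / d := by field_simp
    have h7 : 1 / c ≤ 1 / c ^ 3 := by
      apply one_div_le_one_div_of_le (by positivity)
      calc c ^ 3 = c * c ^ 2 := by ring
        _ ≤ c * 1 := by gcongr; exact pow_le_one₀ hc.le hc1
        _ = c := mul_one c
    rw [h3, mul_add (1 / c ^ 3)]
    have h8 : 0 ≤ 1 / c ^ 3 * (h / (d ^ 2 + h ^ 2)) := by positivity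
    have h9 : 1 / c * (1 / d) ≤ 1 / c ^ 3 * (1 / d) := by gcongr
    linarith
  · rw [if_neg hdh, zero_div, add_zero, div_mul_div_comm, one_mul]
    push Not at hdh
    rw [div_le_div_iff₀ (by positivity) (by positivity)]
    have h1 : c ^ 2 * (d ^ 2 + h ^ 2) ≤ r ^ 2 + h ^ 2 := by
      have : (c * d) ^ 2 ≤ r ^ 2 := pow_le_pow_left₀ (by positivity) hr 2
      have : c ^ 2 ≤ 1 := pow_le_one₀ hc.le hc1
      nlinarith [sq_nonneg h]
    calc h ^ 2 * (c ^ 3 * (d ^ 2 + h ^ 2)) = h * (h * c) * (c ^ 2 * (d ^ 2 + h ^ 2)) := by ring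
      _ ≤ h * r * (r ^ 2 + h ^ 2) := by
        gcongr
        calc h * c ≤ d * c := by gcongr
          _ ≤ r := by linarith
      _ = _ := by ring

/-- remainder of half log of q plus h squared; ρ = |PT(y-z)|, Δ = 2 b + m -/
lemma k_rem {ρ ρ' b m h : ℝ} (hh : 0 < h) (hρ : 0 ≤ ρ) (hρ' : ρ - 2 * h ≤ ρ') (hρ'0 : 0 ≤ ρ') (hb : |b| ≤ ρ * (2 * h))
    (hm0 : 0 ≤ m) (hm : m ≤ (2 * h) ^ 2) (hexp : ρ' ^ 2 = ρ ^ 2 + (2 * b + m)) :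
    |1 / 2 * Real.log (ρ' ^ 2 + h ^ 2) - (1 / 2 * Real.log (ρ ^ 2 + h ^ 2) + 1 / (ρ ^ 2 + h ^ 2) * b)| ≤
      146 * (h ^ 2 / (ρ ^ 2 + h ^ 2)) := by
  set Q := ρ ^ 2 + h ^ 2 with hQ
  have hQ0 : 0 < Q := by positivity
  set s := (2 * b + m) / Q with hs
  have e1 : ρ' ^ 2 + h ^ 2 = Q * (1 + s) := by rw [hs, hexp]; field_simp; rw [hQ]; ring
  have hQ' : 0 < ρ' ^ 2 + h ^ 2 := by positivity
  have h1s : 0 < 1 + s := by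
    rw [e1] at hQ'; exact (pos_iff_pos_of_mul_pos hQ').1 hQ0
  have hs1 : -(8 / 9) ≤ s := by
    have : Q ≤ 9 * (ρ' ^ 2 + h ^ 2) := by
      have h2 : ρ ^ 2 ≤ (ρ' + 2 * h) ^ 2 := pow_le_pow_left₀ hρ (by linarith) 2
      nlinarith [sq_nonneg (ρ' - 2 * h)]
    rw [e1] at this
    nlinarith
  have hlog : Real.log (ρ' ^ 2 + h ^ 2) = Real.log Q + Real.log (1 + s) := by
    rw [e1, Real.log_mul hQ0.ne' h1s.ne']
  have hr := log_rem hs1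
  have hs2 : s ^ 2 ≤ 32 * (h ^ 2 / Q) := by
    have h3 : |2 * b + m| ≤ 4 * h * (ρ + h) := by
      refine (abs_add_le _ _).trans ?_
      rw [abs_mul, abs_of_nonneg hm0, abs_two]
      nlinarith
    have h4 : (2 * b + m) ^ 2 ≤ 32 * h ^ 2 * Q := by
      rw [← sq_abs]
      refine (pow_le_pow_left₀ (abs_nonneg _) h3 2).trans ?_
      rw [hQ]
      nlinarith [mul_nonneg (sq_nonneg h) (sq_nonneg (ρ - h))]
    rw [hs, div_pow, div_le_iff₀ (by positivity)]
    calc _ ≤ _ := h4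
      _ = _ := by field_simp
  have e2 : 1 / Q * b = 1 / 2 * s - 1 / 2 * (m / Q) := by rw [hs]; ring
  have hmQ0 : 0 ≤ m / Q := by positivity
  have hmQ : m / Q ≤ 4 * (h ^ 2 / Q) := by
    rw [← mul_div_assoc]; gcongr; linarith
  rw [hlog, e2]
  rw [abs_le] at hr ⊢
  constructor <;> nlinarith
end

section
namespace SmoothSurface
variable {Srf : SmoothSurface}

lemma q_expand {z : E3} (hz : z ∈ Srf.S) (y p : E3) :
    Srf.rfn z p ^ 2 = Srf.rfn z y ^ 2 + (2 * ⟪Srf.PT z (y - z), p - y⟫ + ‖Srf.PT z (p - y)‖ ^ 2) := by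
  rw [Srf.rfn_eq hz, Srf.rfn_eq hz]
  have e : Srf.PT z (p - z) = Srf.PT z (y - z) + Srf.PT z (p - y) := by
    rw [← PT_add]; congr 1; abel
  have e2 : ⟪Srf.PT z (y - z), Srf.PT z (p - y)⟫ = ⟪Srf.PT z (y - z), p - y⟫ := by
    rw [real_inner_comm, Srf.inner_PT (Srf.PT_mem hz _), real_inner_comm]
  rw [e, norm_add_sq_real, e2]; ring

lemma rfn_sq {z : E3} (hz : z ∈ Srf.S) (x : E3) : Srf.rfn z x ^ 2 = ‖x - z‖ ^ 2 - ⟪x - z, Srf.n z⟫ ^ 2 := by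
  rw [Srf.rfn_eq hz, norm_PT_sq Srf hz]

lemma rfn_le {z : E3} (hz : z ∈ Srf.S) (x : E3) : Srf.rfn z x ≤ ‖x - z‖ := by
  rw [Srf.rfn_eq hz]; exact Srf.norm_PT_le hz _

lemma rfn_nonneg (z x : E3) : 0 ≤ Srf.rfn z x := norm_nonneg _

lemma rfn_lip {z : E3} (hz : z ∈ Srf.S) (y p : E3) : Srf.rfn z y - ‖p - y‖ ≤ Srf.rfn z p := by
  rw [Srf.rfn_eq hz, Srf.rfn_eq hz]
  have e : Srf.PT z (y - z) = Srf.PT z (p - z) - Srf.PT z (p - y) := by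
    rw [← PT_sub]; congr 1; abel
  have := norm_sub_le (Srf.PT z (p - z)) (Srf.PT z (p - y))
  rw [← e] at this
  linarith [Srf.norm_PT_le hz (p - y)]

lemma q_contDiff {z : E3} (hz : z ∈ Srf.S) : ContDiff ℝ 2 (fun x => Srf.rfn z x ^ 2) := by
  have : (fun x => Srf.rfn z x ^ 2) = fun x => ‖x - z‖ ^ 2 - ⟪x - z, Srf.n z⟫ ^ 2 := funext fun x => rfn_sq hz x
  rw [this]
  refine ContDiff.sub ?_ ?_
  · exact (contDiff_id.sub contDiff_const).norm_sq ℝ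
  · exact ((contDiff_id.sub contDiff_const).inner ℝ contDiff_const).pow 2

lemma q_fderiv {z : E3} (hz : z ∈ Srf.S) (y : E3) :
    HasFDerivAt (fun x => Srf.rfn z x ^ 2) ((2 : ℝ) • innerSL ℝ (Srf.PT z (y - z))) y := by
  rw [hasFDerivAt_iff_isLittleO]
  refine Asymptotics.IsBigO.trans_isLittleO (g := fun x => ‖x - y‖ ^ 2) ?_ (Asymptotics.isLittleO_pow_sub_sub y one_lt_two)
  refine Asymptotics.IsBigO.of_bound 1 (Filter.Eventually.of_forall fun p => ?_)
  rw [q_expand hz y p]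
  have e : Srf.rfn z y ^ 2 + (2 * ⟪Srf.PT z (y - z), p - y⟫ + ‖Srf.PT z (p - y)‖ ^ 2) - Srf.rfn z y ^ 2 -
      ((2 : ℝ) • innerSL ℝ (Srf.PT z (y - z))) (p - y) = ‖Srf.PT z (p - y)‖ ^ 2 := by
    simp
  rw [e, one_mul, Real.norm_eq_abs, Real.norm_eq_abs, abs_of_nonneg (by positivity), abs_of_nonneg (by positivity)]
  exact pow_le_pow_left₀ (norm_nonneg _) (Srf.norm_PT_le hz _) 2

lemma q_SC1 {z y : E3} (hz : z ∈ Srf.S) : Srf.SC1 (fun x => Srf.rfn z x ^ 2) y :=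
  SC1.of_contDiffAt ((q_contDiff hz).of_le (by norm_num)).contDiffAt

lemma gradient_of {f : E3 → ℝ} {y g : E3} (h : HasFDerivAt f (innerSL ℝ g) y) : gradient f y = g := by
  refine ext_inner_right ℝ fun v => ?_
  rw [inner_gradient, h.fderiv]; rfl

lemma q_grad {z y : E3} (hz : z ∈ Srf.S) (hy : y ∈ Srf.S) :
    Srf.grad (fun x => Srf.rfn z x ^ 2) y = Srf.PT y ((2 : ℝ) • Srf.PT z (y - z)) := by
  rw [grad_of_diff hy (q_fderiv hz y).differentiableAt]
  congr 1
  apply gradient_of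
  refine (q_fderiv hz y).congr_fderiv ?_
  rw [map_smul]

lemma q_grad_norm {z y : E3} (hz : z ∈ Srf.S) (hy : y ∈ Srf.S) :
    ‖Srf.grad (fun x => Srf.rfn z x ^ 2) y‖ ≤ 2 * Srf.rfn z y := by
  rw [q_grad hz hy]
  refine (Srf.norm_PT_le hy _).trans ?_
  rw [norm_smul, Srf.rfn_eq hz]; simp

lemma cutLog_eq (z : E3) (ζ : E3 → ℝ) : cutLog Srf z ζ = fun x => ζ x * (1 / 2 * Real.log (Srf.rfn z x ^ 2)) := by
  funext x
  rw [cutLog, Real.log_pow]; push_cast; ring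

lemma cutLog_grad {z y : E3} (hz : z ∈ Srf.S) (hy : y ∈ Srf.S) (hr : Srf.rfn z y ≠ 0) {ζ : E3 → ℝ} (hζ : ContDiff ℝ 2 ζ) :
    Srf.SC1 (cutLog Srf z ζ) y ∧ Srf.grad (cutLog Srf z ζ) y =
      Srf.PT y ((1 / 2 * Real.log (Srf.rfn z y ^ 2)) • gradient ζ y + (ζ y / Srf.rfn z y ^ 2) • Srf.PT z (y - z)) := by
  have hq : Srf.rfn z y ^ 2 ≠ 0 := pow_ne_zero _ hr
  rw [cutLog_eq]
  have hl : HasFDerivAt (fun x => 1 / 2 * Real.log (Srf.rfn z x ^ 2))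
      ((1 / 2 : ℝ) • ((Srf.rfn z y ^ 2)⁻¹ • ((2 : ℝ) • innerSL ℝ (Srf.PT z (y - z))))) y :=
    ((q_fderiv hz y).log hq).const_mul _
  have hd := ((hζ.differentiable (by norm_num)) y).hasFDerivAt.mul hl
  refine ⟨?_, ?_⟩
  · apply SC1.of_contDiffAt
    have h1 : ContDiffAt ℝ 1 (fun x => Srf.rfn z x ^ 2) y := ((q_contDiff hz).of_le (by norm_num)).contDiffAt
    exact (hζ.of_le (by norm_num)).contDiffAt.mul (contDiffAt_const.mul (h1.log hq))
  · have hd' : DifferentiableAt ℝ (fun x => ζ x * (1 / 2 * Real.log (Srf.rfn z x ^ 2))) y := hd.differentiableAt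
    rw [grad_of_diff hy hd']
    congr 1
    refine ext_inner_right ℝ fun v => ?_
    have e := hd.fderiv
    rw [inner_gradient]
    change fderiv ℝ (ζ * fun x => (1 / 2 * Real.log (Srf.rfn z x ^ 2))) y v = _
    rw [e]
    simp only [inner_add_left, real_inner_smul_left, inner_gradient]
    simp
    field_simp
    ring

end SmoothSurface

/-- cutoff facts -/
lemma cut_rem {z : E3} {r₁ Cζ : ℝ} {ζ : E3 → ℝ} (hζ : IsCutoff z r₁ Cζ ζ) (y p : E3) :
    |ζ p - (ζ y + ⟪gradient ζ y, p - y⟫)| ≤ Cζ * ‖p - y‖ ^ 2 := by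
  obtain ⟨hs, -, -, hb⟩ := hζ
  have hC0 : 0 ≤ Cζ := by
    have := hb 0
    have h1 := abs_nonneg (ζ 0); have h2 := norm_nonneg (fderiv ℝ ζ 0); have h3 := norm_nonneg (fderiv ℝ (fderiv ℝ ζ) 0)
    linarith
  have hd : Differentiable ℝ ζ := hs.differentiable (by simp)
  have hd2 : Differentiable ℝ (fderiv ℝ ζ) := (hs.fderiv_right (m := 1) (by
    norm_cast)).differentiable (by simp)
  have h2 : ∀ x, ‖fderiv ℝ ζ x - fderiv ℝ ζ y‖ ≤ Cζ * ‖x - y‖ := fun x =>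
    convex_univ.norm_image_sub_le_of_norm_fderiv_le (fun x _ => hd2 x) (fun x _ => by
      have := hb x
      have h1 := abs_nonneg (ζ x); have h2 := norm_nonneg (fderiv ℝ ζ x)
      linarith) (Set.mem_univ _) (Set.mem_univ _)
  have h3 := (convex_closedBall y ‖p - y‖).norm_image_sub_le_of_norm_fderiv_le' (f := ζ) (φ := fderiv ℝ ζ y)
    (C := Cζ * ‖p - y‖) (x := y) (y := p) (fun x _ => hd x) (fun x hx => (h2 x).trans (by
      rw [mem_closedBall_iff_norm] at hx
      gcongr)) (mem_closedBall_self (norm_nonneg _)) (by rw [mem_closedBall_iff_norm])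
  rw [inner_gradient]
  rw [Real.norm_eq_abs] at h3
  calc _ = |ζ p - ζ y - (fderiv ℝ ζ y) (p - y)| := by congr 1; ring
    _ ≤ _ := h3
    _ = _ := by ring

lemma cut_bd {z : E3} {r₁ Cζ : ℝ} {ζ : E3 → ℝ} (hζ : IsCutoff z r₁ Cζ ζ) (y : E3) :
    |ζ y| ≤ Cζ ∧ ‖gradient ζ y‖ ≤ Cζ := by
  have hb := hζ.2.2.2 y
  have h1 := abs_nonneg (ζ y); have h2 := norm_nonneg (fderiv ℝ ζ y); have h3 := norm_nonneg (fderiv ℝ (fderiv ℝ ζ) y)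
  refine ⟨by linarith, ?_⟩
  rw [gradient, LinearIsometryEquiv.norm_map]; linarith

lemma cut_out {z : E3} {r₁ Cζ : ℝ} {ζ : E3 → ℝ} (hζ : IsCutoff z r₁ Cζ ζ) {y : E3} (hy : 3 / 2 * r₁ < ‖y - z‖) : ζ y = 0 := by
  by_contra h
  have := hζ.2.1 (subset_tsupport ζ h)
  rw [mem_closedBall_iff_norm] at this
  linarith

lemma cut_in {z : E3} {r₁ Cζ : ℝ} {ζ : E3 → ℝ} (hζ : IsCutoff z r₁ Cζ ζ) {y : E3} (hy : ‖y - z‖ ≤ r₁) : ζ y = 1 :=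
  hζ.2.2.1 y (mem_closedBall_iff_norm.2 hy)

lemma cut_grad_in {z : E3} {r₁ Cζ : ℝ} {ζ : E3 → ℝ} (hζ : IsCutoff z r₁ Cζ ζ) {y : E3} (hy : ‖y - z‖ < r₁) :
    gradient ζ y = 0 := by
  have h : ζ =ᶠ[nhds y] fun _ => 1 := by
    filter_upwards [isOpen_ball.mem_nhds (mem_ball_iff_norm.2 hy)] with x hx
    exact cut_in hζ (mem_ball_iff_norm.1 hx).le
  rw [gradient, h.fderiv_eq]; simp
end

section
namespace SmoothSurface
variable {Srf : SmoothSurface}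

/-- regularised logarithm -/
def ghat (Srf : SmoothSurface) (z : E3) (ζ : E3 → ℝ) (h : ℝ) (x : E3) : ℝ :=
  ζ x * (1 / 2 * Real.log (Srf.rfn z x ^ 2 + h ^ 2))

set_option maxHeartbeats 2000000 in
lemma near_taylor {z y p : E3} (hz : z ∈ Srf.S) {r₁ Cζ h c : ℝ} {ζ : E3 → ℝ} (hCζ : 0 < Cζ) (hζ : IsCutoff z r₁ Cζ ζ)
    (hh : 0 < h) (hh2 : h ≤ 1 / 2) (hc : 0 < c) (hc1 : c ≤ 1) (hr : c * ‖y - z‖ ≤ Srf.rfn z y) (hd : ‖y - z‖ ≤ 2)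
    (hp : ‖p - y‖ ≤ 2 * h) :
    |ghat Srf z ζ h p - (ζ y * (1 / 2 * Real.log (Srf.rfn z y ^ 2 + h ^ 2)) +
      ⟪(1 / 2 * Real.log (Srf.rfn z y ^ 2 + h ^ 2)) • gradient ζ y +
        (ζ y / (Srf.rfn z y ^ 2 + h ^ 2)) • Srf.PT z (y - z), p - y⟫)| ≤
      (4 * Cζ * (5 + 129 / c ^ 2) + 454 * Cζ / c ^ 2) / (‖y - z‖ ^ 2 + h ^ 2) * h ^ 2 := by
  set ρ := Srf.rfn z y with hρ
  set Q := ρ ^ 2 + h ^ 2 with hQ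
  set D := ‖y - z‖ ^ 2 + h ^ 2 with hD
  have hρ0 : 0 ≤ ρ := rfn_nonneg _ _
  have hρd : ρ ≤ ‖y - z‖ := rfn_le hz y
  have hQ0 : 0 < Q := by positivity
  have hD0 : 0 < D := by positivity
  have hD5 : D ≤ 5 := by rw [hD]; nlinarith [norm_nonneg (y - z)]
  have hQD : Q ≤ D := by rw [hQ, hD]; gcongr
  have hcQ : c ^ 2 * D ≤ Q := by
    rw [hQ, hD]
    have h1 : (c * ‖y - z‖) ^ 2 ≤ ρ ^ 2 := pow_le_pow_left₀ (by positivity) hr 2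
    have h2 : c ^ 2 ≤ 1 := pow_le_one₀ hc.le hc1
    nlinarith [sq_nonneg h]
  have hQinv : 1 / Q ≤ 1 / c ^ 2 / D := by
    rw [div_div]; exact one_div_le_one_div_of_le (by positivity) hcQ
  set k := 1 / 2 * Real.log Q with hk
  set kp := 1 / 2 * Real.log (Srf.rfn z p ^ 2 + h ^ 2) with hkp
  set b := ⟪Srf.PT z (y - z), p - y⟫ with hb
  set g := ⟪gradient ζ y, p - y⟫ with hg
  have hbb : |b| ≤ ρ * (2 * h) := by
    refine (abs_real_inner_le_norm _ _).trans ?_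
    rw [hρ, Srf.rfn_eq hz]; gcongr
  have hB : |kp - (k + 1 / Q * b)| ≤ 146 * (h ^ 2 / Q) := by
    refine k_rem (m := ‖Srf.PT z (p - y)‖ ^ 2) hh hρ0 ?_ (rfn_nonneg _ _) hbb (by positivity) ?_ (q_expand hz y p)
    · have := rfn_lip hz y p; linarith
    · exact pow_le_pow_left₀ (norm_nonneg _) ((Srf.norm_PT_le hz _).trans hp) 2
  have hA := cut_rem hζ y p
  rw [← hg] at hA
  obtain ⟨hz1, hz2⟩ := cut_bd hζ y
  have hp2 : ‖p - y‖ ^ 2 ≤ 4 * h ^ 2 := by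
    have := pow_le_pow_left₀ (norm_nonneg _) hp 2; linarith
  have hA' : |ζ p - (ζ y + g)| ≤ 4 * Cζ * h ^ 2 := hA.trans (by nlinarith)
  have hgb : |g| ≤ 2 * Cζ * h := by
    refine (abs_real_inner_le_norm _ _).trans ?_
    calc _ ≤ Cζ * (2 * h) := by gcongr
      _ = _ := by ring
  have hdz : |ζ p - ζ y| ≤ 4 * Cζ * h := by
    have e : ζ p - ζ y = (ζ p - (ζ y + g)) + g := by ring
    rw [e]
    refine (abs_add_le _ _).trans ?_
    have : 4 * Cζ * h ^ 2 ≤ 2 * Cζ * h := by nlinarith [mul_pos hCζ hh]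
    linarith
  have hk2 : |k| ≤ (5 + 129 / c ^ 2) / D := by
    have h1 := log_sq_le hc hc1 hD0 hcQ hQD hD5
    have h2 : k ^ 2 ≤ 129 / c ^ 2 / D := by
      have h9 : k ^ 2 = 1 / 4 * Real.log Q ^ 2 := by rw [hk]; ring
      rw [h9]; linarith [sq_nonneg (Real.log Q)]
    have h3 : |k| ≤ 1 + k ^ 2 := by
      have a1 := sq_nonneg (|k| - 1)
      have a2 := sq_abs k
      have a3 : (|k| - 1) ^ 2 = |k| ^ 2 - 2 * |k| + 1 := by ring
      have a4 := abs_nonneg k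
      linarith
    have h4 : 1 ≤ 5 / D := by rw [le_div_iff₀ hD0]; linarith
    rw [add_div]; linarith
  have hQi0 : 0 < 1 / Q := by positivity
  have hdk : |kp - k| ≤ 77 * h * (1 / Q) := by
    have e : kp - k = (kp - (k + 1 / Q * b)) + 1 / Q * b := by ring
    rw [e]
    refine (abs_add_le _ _).trans ?_
    rw [abs_mul, abs_of_pos hQi0]
    have h1 : 1 / Q * |b| ≤ 1 / Q * (4 * h) := by
      gcongr; refine hbb.trans ?_; nlinarith
    have h2 : h ^ 2 / Q ≤ 1 / 2 * h * (1 / Q) := by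
      rw [div_eq_mul_one_div]; gcongr; nlinarith
    nlinarith
  have e : ghat Srf z ζ h p - (ζ y * k + ⟪k • gradient ζ y + (ζ y / Q) • Srf.PT z (y - z), p - y⟫) =
      k * (ζ p - (ζ y + g)) + ζ y * (kp - (k + 1 / Q * b)) + (ζ p - ζ y) * (kp - k) := by
    rw [inner_add_left, real_inner_smul_left, real_inner_smul_left, ← hb, ← hg, ghat, ← hkp]
    ring
  rw [e]
  have t1 : |k * (ζ p - (ζ y + g))| ≤ (5 + 129 / c ^ 2) / D * (4 * Cζ * h ^ 2) := by
    rw [abs_mul]; gcongr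
  have hQh : h ^ 2 / Q ≤ h ^ 2 * (1 / c ^ 2 / D) := by
    rw [div_eq_mul_one_div]; gcongr
  have t2 : |ζ y * (kp - (k + 1 / Q * b))| ≤ Cζ * (146 * (h ^ 2 * (1 / c ^ 2 / D))) := by
    rw [abs_mul]; gcongr; linarith
  have t3 : |(ζ p - ζ y) * (kp - k)| ≤ (4 * Cζ * h) * (77 * h * (1 / c ^ 2 / D)) := by
    rw [abs_mul]; gcongr; exact hdk.trans (by gcongr)
  refine (abs_add_le _ _).trans ((add_le_add ((abs_add_le _ _).trans (add_le_add t1 t2)) t3).trans (le_of_eq ?_))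
  ring

set_option maxHeartbeats 2000000 in
lemma near_bounds {z y : E3} (hz : z ∈ Srf.S) (hy : y ∈ Srf.S) (hyz : y ≠ z) {r₁ Cζ h c : ℝ} {ζ : E3 → ℝ} (hr₁ : 0 < r₁)
    (hCζ : 0 < Cζ) (hζ : IsCutoff z r₁ Cζ ζ)
    (hh : 0 < h) (hh2 : h ≤ 1 / 2) (hc : 0 < c) (hc1 : c ≤ 1) (hr : c * ‖y - z‖ ≤ Srf.rfn z y) (hd : ‖y - z‖ ≤ 2)
    {T0 : ℝ} {w : E3} (hT0 : T0 = ζ y * (1 / 2 * Real.log (Srf.rfn z y ^ 2 + h ^ 2)))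
    (hw : w = (1 / 2 * Real.log (Srf.rfn z y ^ 2 + h ^ 2)) • gradient ζ y +
        (ζ y / (Srf.rfn z y ^ 2 + h ^ 2)) • Srf.PT z (y - z)) :
    Srf.SC1 (cutLog Srf z ζ) y ∧
    ‖w‖ ^ 2 ≤ (260 * Cζ ^ 2 / c ^ 2) / (‖y - z‖ ^ 2 + h ^ 2) ∧
    T0 ^ 2 ≤ (129 * Cζ ^ 2 / c ^ 2) / (‖y - z‖ ^ 2 + h ^ 2) ∧
    ‖Srf.grad (cutLog Srf z ζ) y - Srf.PT y w‖ ≤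
      (2 * Cζ / (c ^ 2 * r₁ ^ 2) + Cζ / c ^ 3) * (h / (‖y - z‖ ^ 2 + h ^ 2) + wgt z h y / h) ∧
    (cutLog Srf z ζ y - T0) ^ 2 ≤ (8 * Cζ ^ 2 / c ^ 4) * (kap z h y ^ 2 + wgt z h y) := by
  set ρ := Srf.rfn z y with hρ
  set Q := ρ ^ 2 + h ^ 2 with hQ
  set D := ‖y - z‖ ^ 2 + h ^ 2 with hD
  have hd0 : 0 < ‖y - z‖ := norm_pos_iff.2 (sub_ne_zero.2 hyz)
  have hρ0 : 0 < ρ := lt_of_lt_of_le (by positivity) hr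
  have hρd : ρ ≤ ‖y - z‖ := rfn_le hz y
  have hQ0 : 0 < Q := by positivity
  have hD0 : 0 < D := by positivity
  have hD5 : D ≤ 5 := by rw [hD]; nlinarith [norm_nonneg (y - z)]
  have hQD : Q ≤ D := by rw [hQ, hD]; gcongr
  have hcQ : c ^ 2 * D ≤ Q := by
    rw [hQ, hD]
    have h1 : (c * ‖y - z‖) ^ 2 ≤ ρ ^ 2 := pow_le_pow_left₀ (by positivity) hr 2
    have h2 : c ^ 2 ≤ 1 := pow_le_one₀ hc.le hc1
    nlinarith [sq_nonneg h]
  have hQinv : 1 / Q ≤ 1 / c ^ 2 / D := by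
    rw [div_div]; exact one_div_le_one_div_of_le (by positivity) hcQ
  set k := 1 / 2 * Real.log Q with hk
  obtain ⟨hz1, hz2⟩ := cut_bd hζ y
  have hk2 : k ^ 2 ≤ 129 / c ^ 2 / D := by
    have h1 := log_sq_le hc hc1 hD0 hcQ hQD hD5
    have h9 : k ^ 2 = 1 / 4 * Real.log Q ^ 2 := by rw [hk]; ring
    rw [h9]; linarith [sq_nonneg (Real.log Q)]
  have hnPT : ‖Srf.PT z (y - z)‖ = ρ := by rw [hρ, Srf.rfn_eq hz]
  obtain ⟨hSC, hgr⟩ := cutLog_grad hz hy hρ0.ne' (hζ.1.of_le (by norm_cast))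
  have hcd : c ^ 2 * ‖y - z‖ ^ 2 ≤ ρ ^ 2 := by
    rw [← mul_pow]; exact pow_le_pow_left₀ (by positivity) hr 2
  obtain ⟨l0, l1, l2⟩ := log_ratio_sq hc hc1 hd0 hh hcd
  set ℓ := Real.log (1 + h ^ 2 / ρ ^ 2) with hℓ
  have hℓe : Real.log (ρ ^ 2) - Real.log Q = -ℓ := by
    have : 1 + h ^ 2 / ρ ^ 2 = Q / ρ ^ 2 := by rw [hQ]; field_simp
    rw [hℓ, this, Real.log_div hQ0.ne' (by positivity)]; ring
  have hwg : wgt z h y = if ‖y - z‖ < h then h / ‖y - z‖ else 0 := by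
    unfold wgt; split_ifs <;> rfl
  refine ⟨hSC, ?_, ?_, ?_, ?_⟩
  · have h1 : ‖w‖ ≤ Cζ * |k| + Cζ * (ρ / Q) := by
      rw [hw]
      refine (norm_add_le _ _).trans ?_
      rw [norm_smul, norm_smul, hnPT, Real.norm_eq_abs, Real.norm_eq_abs, abs_div, abs_of_pos hQ0]
      have a1 : |k| * ‖gradient ζ y‖ ≤ |k| * Cζ := by gcongr
      have a2 : |ζ y| / Q * ρ ≤ Cζ / Q * ρ := by gcongr
      have a3 : Cζ / Q * ρ = Cζ * (ρ / Q) := by ring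
      linarith
    have h2 : (ρ / Q) ^ 2 ≤ 1 / Q := by
      rw [div_pow, div_le_div_iff₀ (by positivity) hQ0, one_mul, pow_two Q]
      gcongr; rw [hQ]; linarith [sq_nonneg h]
    have h3 : ‖w‖ ^ 2 ≤ (Cζ * |k| + Cζ * (ρ / Q)) ^ 2 := pow_le_pow_left₀ (norm_nonneg _) h1 2
    have h4 : (Cζ * |k| + Cζ * (ρ / Q)) ^ 2 ≤ 2 * Cζ ^ 2 * (k ^ 2 + (ρ / Q) ^ 2) := by
      rw [← sq_abs k]; nlinarith [sq_nonneg (Cζ * |k| - Cζ * (ρ / Q))]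
    have h5 : 2 * Cζ ^ 2 * (k ^ 2 + (ρ / Q) ^ 2) ≤ 2 * Cζ ^ 2 * (129 / c ^ 2 / D + 1 / c ^ 2 / D) := by
      gcongr; linarith
    refine h3.trans (h4.trans (h5.trans (le_of_eq ?_)))
    ring
  · rw [hT0, mul_pow]
    have : ζ y ^ 2 ≤ Cζ ^ 2 := by rw [← sq_abs]; exact pow_le_pow_left₀ (abs_nonneg _) hz1 2
    calc ζ y ^ 2 * k ^ 2 ≤ Cζ ^ 2 * (129 / c ^ 2 / D) := by gcongr
      _ = _ := by ring
  · rw [hgr, ← PT_sub]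
    refine (Srf.norm_PT_le hy _).trans ?_
    have e : (1 / 2 * Real.log (ρ ^ 2)) • gradient ζ y + (ζ y / ρ ^ 2) • Srf.PT z (y - z) - w =
        (1 / 2 * (-ℓ)) • gradient ζ y + (ζ y * (1 / ρ ^ 2 - 1 / Q)) • Srf.PT z (y - z) := by
      rw [hw, ← hℓe, hk]; module
    rw [e]
    refine (norm_add_le _ _).trans ?_
    have hwn : 0 ≤ wgt z h y / h := div_nonneg (wgt_nonneg z hh y) hh.le
    have t1 : ‖(1 / 2 * (-ℓ)) • gradient ζ y‖ ≤ (2 * Cζ / (c ^ 2 * r₁ ^ 2)) * (h / D) := by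
      by_cases hin : ‖y - z‖ < r₁
      · rw [cut_grad_in hζ hin, smul_zero, norm_zero]; positivity
      · push Not at hin
        rw [norm_smul, Real.norm_eq_abs, abs_mul, abs_neg, abs_of_nonneg l0]
        have h1 : ℓ ≤ h ^ 2 / (c ^ 2 * r₁ ^ 2) := l1.trans (by gcongr)
        have h2 : |(1 / 2 : ℝ)| = 1 / 2 := abs_of_pos (by norm_num)
        rw [h2]
        calc 1 / 2 * ℓ * ‖gradient ζ y‖ ≤ 1 / 2 * (h ^ 2 / (c ^ 2 * r₁ ^ 2)) * Cζ := by gcongr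
          _ = (Cζ / (c ^ 2 * r₁ ^ 2)) * h * (1 / 2 * h) := by ring
          _ ≤ (Cζ / (c ^ 2 * r₁ ^ 2)) * h * (2 / D) := by
            gcongr
            rw [le_div_iff₀ hD0]; nlinarith
          _ = _ := by ring
    have t2 : ‖(ζ y * (1 / ρ ^ 2 - 1 / Q)) • Srf.PT z (y - z)‖ ≤ Cζ / c ^ 3 * (h / D + wgt z h y / h) := by
      have h1 := inv_diff hc hc1 hd0 hh hr
      rw [← hwg] at h1
      have h2 : 0 ≤ 1 / ρ ^ 2 - 1 / Q := by
        rw [sub_nonneg]; apply one_div_le_one_div_of_le (by positivity); rw [hQ]; linarith [sq_nonneg h]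
      rw [norm_smul, hnPT, Real.norm_eq_abs, abs_mul, abs_of_nonneg h2]
      calc |ζ y| * (1 / ρ ^ 2 - 1 / Q) * ρ ≤ Cζ * (1 / ρ ^ 2 - 1 / Q) * ρ := by gcongr
        _ = Cζ * (ρ * (1 / ρ ^ 2 - 1 / Q)) := by ring
        _ ≤ Cζ * (1 / c ^ 3 * (h / D + wgt z h y / h)) := by gcongr
        _ = _ := by ring
    have t3 : (2 * Cζ / (c ^ 2 * r₁ ^ 2)) * (h / D) ≤ (2 * Cζ / (c ^ 2 * r₁ ^ 2)) * (h / D + wgt z h y / h) := by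
      gcongr; linarith
    rw [add_mul]; linarith
  · have e : cutLog Srf z ζ y - T0 = ζ y * (1 / 2 * (-ℓ)) := by
      rw [cutLog_eq, hT0, ← hℓe, hk]; ring
    have : ζ y ^ 2 ≤ Cζ ^ 2 := by rw [← sq_abs]; exact pow_le_pow_left₀ (abs_nonneg _) hz1 2
    rw [← hwg] at l2
    rw [e, mul_pow]
    have h2 : (1 / 2 * (-ℓ)) ^ 2 = 1 / 4 * ℓ ^ 2 := by ring
    rw [h2, kap]
    calc ζ y ^ 2 * (1 / 4 * ℓ ^ 2) ≤ Cζ ^ 2 * (1 / 4 * (32 / c ^ 4 * ((h ^ 2 / (‖y - z‖ ^ 2 + h ^ 2)) ^ 2 + wgt z h y))) := by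
          gcongr
      _ = _ := by ring

set_option maxHeartbeats 2000000 in
variable (Srf) in
lemma exists_pt {r₁ Cζ : ℝ} (hr₁ : Srf.IsGraphRadius r₁) (hCζ : 0 < Cζ) : ∃ C : ℝ, 0 < C ∧ ∀ z ∈ Srf.S, ∀ ζ,
    IsCutoff z r₁ Cζ ζ → ∀ h : ℝ, 0 < h → h ≤ 1 / 2 → 8 * h ≤ r₁ → ∀ y ∈ Srf.S, y ≠ z → ∃ (T0 : ℝ) (w : E3),
    Srf.SC1 (cutLog Srf z ζ) y ∧
    (∀ p, ‖p - y‖ ≤ 2 * h → |ghat Srf z ζ h p - (T0 + ⟪w, p - y⟫)| ≤ C / (‖y - z‖ ^ 2 + h ^ 2) * h ^ 2) ∧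
    ‖w‖ ^ 2 ≤ C / (‖y - z‖ ^ 2 + h ^ 2) ∧ ‖w‖ ≤ C / (‖y - z‖ ^ 2 + h ^ 2) ∧
    T0 ^ 2 ≤ C / (‖y - z‖ ^ 2 + h ^ 2) ∧
    ‖Srf.grad (cutLog Srf z ζ) y - Srf.PT y w‖ ≤ C * (h / (‖y - z‖ ^ 2 + h ^ 2) + wgt z h y / h) ∧
    (cutLog Srf z ζ y - T0) ^ 2 ≤ C * (kap z h y ^ 2 + wgt z h y) := by
  obtain ⟨c0, hc0, hlow⟩ := Srf.exists_r_lower hr₁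
  obtain ⟨hr0, hr1, -⟩ := hr₁
  set c := min c0 1 with hcdef
  have hc : 0 < c := lt_min hc0 one_pos
  have hc1 : c ≤ 1 := min_le_right _ _
  set C1 := 4 * Cζ * (5 + 129 / c ^ 2) + 454 * Cζ / c ^ 2 with hC1
  set C2 := 260 * Cζ ^ 2 / c ^ 2 with hC2
  set C3 := 2 * Cζ / (c ^ 2 * r₁ ^ 2) + Cζ / c ^ 3 with hC3
  set C4 := 8 * Cζ ^ 2 / c ^ 4 with hC4
  set C5 := 129 * Cζ ^ 2 / c ^ 2 with hC5
  have p1 : 0 < C1 := by positivity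
  have p2 : 0 < C2 := by positivity
  have p3 : 0 < C3 := by positivity
  have p4 : 0 < C4 := by positivity
  have p5 : 0 < C5 := by positivity
  refine ⟨C1 + C2 + C3 + C4 + C5 + 5, by positivity, ?_⟩
  intro z hz ζ hζ h hh hh2 hh8 y hy hyz
  set C := C1 + C2 + C3 + C4 + C5 + 5 with hC
  have hC0 : 0 < C := by positivity
  have hwn : 0 ≤ wgt z h y / h := div_nonneg (wgt_nonneg z hh y) hh.le
  have hD0 : 0 < ‖y - z‖ ^ 2 + h ^ 2 := by positivity
  by_cases hd : ‖y - z‖ ≤ 2 * r₁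
  · have hr : c * ‖y - z‖ ≤ Srf.rfn z y := by
      refine le_trans ?_ (hlow z hz y hy hd)
      gcongr; exact min_le_left _ _
    have hd2 : ‖y - z‖ ≤ 2 := by linarith
    obtain ⟨b1, b2, b3, b4, b5⟩ := near_bounds hz hy hyz hr0 hCζ hζ hh hh2 hc hc1 hr hd2 rfl rfl
    refine ⟨_, _, b1, fun p hp => ?_, b2.trans ?_, ?_, b3.trans ?_, b4.trans ?_, b5.trans ?_⟩
    · refine (near_taylor hz hCζ hζ hh hh2 hc hc1 hr hd2 hp).trans ?_
      gcongr; linarith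
    · gcongr; linarith
    · set w := (1 / 2 * Real.log (Srf.rfn z y ^ 2 + h ^ 2)) • gradient ζ y +
        (ζ y / (Srf.rfn z y ^ 2 + h ^ 2)) • Srf.PT z (y - z)
      have h1 : ‖w‖ ≤ 1 + ‖w‖ ^ 2 := by nlinarith [sq_nonneg (‖w‖ - 1)]
      have h2 : 1 ≤ 5 / (‖y - z‖ ^ 2 + h ^ 2) := by
        rw [le_div_iff₀ hD0]; nlinarith [norm_nonneg (y - z)]
      calc ‖w‖ ≤ 5 / (‖y - z‖ ^ 2 + h ^ 2) + C2 / (‖y - z‖ ^ 2 + h ^ 2) := by linarith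
        _ = (5 + C2) / (‖y - z‖ ^ 2 + h ^ 2) := by ring
        _ ≤ _ := by gcongr; linarith
    · gcongr; linarith
    · gcongr; linarith
    · have := wgt_nonneg z hh y
      gcongr; linarith
  · push Not at hd
    have hout : ∀ x, ‖x - y‖ ≤ 2 * h → ζ x = 0 := fun x hx => by
      apply cut_out hζ
      have : ‖y - z‖ ≤ ‖x - z‖ + ‖x - y‖ := by
        rw [norm_sub_rev x y, add_comm]; exact norm_sub_le_norm_sub_add_norm_sub y x z
      linarith
    have hev : cutLog Srf z ζ =ᶠ[nhds y] fun _ => 0 := by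
      filter_upwards [ball_mem_nhds y (show 0 < 2 * h by positivity)] with x hx
      rw [cutLog, hout x (mem_ball_iff_norm.1 hx).le, zero_mul]
    have hgr : Srf.grad (cutLog Srf z ζ) y = 0 := by
      rw [grad_eq (W := fun _ => 0) hy (differentiableAt_const _) (hev.filter_mono nhdsWithin_le_nhds)]
      simp [gradient, PT]
    refine ⟨0, 0, ⟨fun _ => 0, contDiffAt_const, hev.filter_mono nhdsWithin_le_nhds⟩, fun p hp => ?_, ?_, ?_, ?_, ?_, ?_⟩
    · rw [ghat, hout p hp]; simp; positivity
    · simp; positivity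
    · simp; positivity
    · simp; positivity
    · rw [hgr]; simp [PT]; positivity
    · rw [cutLog, hout y (by simp; positivity)]; simp
      have := wgt_nonneg z hh y
      positivity
end SmoothSurface
end

section
open SmoothSurface Triangulation

lemma sq_add_le2 (a b : ℝ) : (a + b) ^ 2 ≤ 2 * a ^ 2 + 2 * b ^ 2 := by nlinarith [sq_nonneg (a - b)]

set_option maxHeartbeats 1000000 in
lemma exists_eta (Srf : SmoothSurface) {γ₀ K r₁ Cζ : ℝ} (hγ : 0 < γ₀) (hK : Srf.Cst K) (hr₁ : Srf.IsGraphRadius r₁)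
    (hCζ : 0 < Cζ) : ∃ C : ℝ, 0 < C ∧ ∀ z ∈ Srf.S, ∀ ζ, IsCutoff z r₁ Cζ ζ → ∀ h : ℝ, Sm Srf γ₀ h K → 8 * h ≤ r₁ →
    ∀ Tr : Triangulation Srf γ₀ h, ∃ vG, Tr.IsVh vG ∧ ∀ y ∈ Tr.Omt, y ≠ z →
      Srf.SC1 (cutLog Srf z ζ) y ∧
      ‖Srf.grad (cutLog Srf z ζ) y - Srf.grad (Tr.liftS vG) y‖ ≤ C * (h / (‖y - z‖ ^ 2 + h ^ 2) + wgt z h y / h) ∧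
      (cutLog Srf z ζ y - Tr.liftS vG y) ^ 2 ≤ C * (kap z h y ^ 2 + wgt z h y) ∧
      Tr.liftS vG y ^ 2 ≤ C / (‖y - z‖ ^ 2 + h ^ 2) ∧
      ‖Srf.grad (Tr.liftS vG) y‖ ^ 2 ≤ C / (‖y - z‖ ^ 2 + h ^ 2) := by
  obtain ⟨C1, hC1, H⟩ := Srf.exists_pt hr₁ hCζ
  set A := 2 / γ₀ + 16 * C2 K γ₀ with hA
  set B := 1 + 4 * K with hB
  have hA0 : 0 ≤ A := by have := C2_nonneg hγ hK; positivity
  have hB0 : 0 ≤ B := by have := hK.one; positivity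
  refine ⟨2 * C1 + 2 * A * C1 + 8 * A ^ 2 * C1 ^ 2 + 8 * B ^ 2 * C1 ^ 2, by positivity, ?_⟩
  intro z hz ζ hζ h sm h8 Tr
  set C := 2 * C1 + 2 * A * C1 + 8 * A ^ 2 * C1 ^ 2 + 8 * B ^ 2 * C1 ^ 2 with hC
  have i1 : 0 ≤ A * C1 := by positivity
  have i2 : 0 ≤ A ^ 2 * C1 ^ 2 := by positivity
  have i3 : 0 ≤ B ^ 2 * C1 ^ 2 := by positivity
  obtain ⟨vG, hG, hGi⟩ := exists_interp Tr (ghat Srf z ζ h)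
  refine ⟨vG, hG, fun y hy hyz => ?_⟩
  obtain ⟨t, ht, hyt⟩ := mem_Omt.1 hy
  have hh := sm.hh
  obtain ⟨T0, w, b1, b2, b3, b4, b5, b6, b7⟩ := H z hz ζ hζ h hh sm.s3 h8 y (Omt_sub hy) hyz
  obtain ⟨e1, e2⟩ := interp_est sm hG ht hyt (T0 := T0) (w := w) (fun p hp => by
    rw [hGi t ht p hp]; exact b2 p (Om_diam ht hyt hp))
  set G := Tr.liftS vG y
  set gG := Srf.grad (Tr.liftS vG) y
  set D := ‖y - z‖ ^ 2 + h ^ 2 with hD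
  have hD0 : 0 < D := by positivity
  have hkap : kap z h y = h ^ 2 / D := rfl
  have hk0 := kap_nonneg z h y
  have hk1 := kap_le_one z h y
  have hw0 := wgt_nonneg z hh y
  have hwh : 0 ≤ wgt z h y / h := by positivity
  set κ := kap z h y
  rw [← hA] at e1
  rw [← hB] at e2
  have e1' : ‖gG - Srf.PT y w‖ ≤ 2 * A * C1 * (h / D) := by
    refine e1.trans ?_
    calc A * h * (C1 / D + ‖w‖) ≤ A * h * (C1 / D + C1 / D) := by gcongr
      _ = _ := by ring
  have e2' : |G - T0| ≤ 2 * B * C1 * κ := by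
    refine e2.trans ?_
    calc B * h ^ 2 * (C1 / D + ‖w‖) ≤ B * h ^ 2 * (C1 / D + C1 / D) := by gcongr
      _ = 2 * B * C1 * (h ^ 2 / D) := by ring
  have e2s : (G - T0) ^ 2 ≤ 4 * (B ^ 2 * C1 ^ 2) * κ ^ 2 := by
    rw [← sq_abs]
    refine (pow_le_pow_left₀ (abs_nonneg _) e2' 2).trans (le_of_eq (by ring))
  have hκ2 : κ ^ 2 ≤ 1 / D := by
    have : κ ^ 2 ≤ κ := by nlinarith
    refine this.trans ?_
    rw [hkap]; gcongr; have := sm.s3; nlinarith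
  have hhD : (h / D) ^ 2 ≤ 1 / D := by
    have : (h / D) ^ 2 = κ * (1 / D) := by rw [hkap]; ring
    rw [this]
    have : 0 ≤ 1 / D := by positivity
    nlinarith
  refine ⟨b1, ?_, ?_, ?_, ?_⟩
  · have e : Srf.grad (cutLog Srf z ζ) y - gG = (Srf.grad (cutLog Srf z ζ) y - Srf.PT y w) - (gG - Srf.PT y w) := by abel
    rw [e]
    refine (norm_sub_le _ _).trans ((add_le_add b6 e1').trans ?_)
    have h1 : 0 ≤ h / D := by positivity
    have h2 : 2 * A * C1 * (h / D) ≤ 2 * A * C1 * (h / D + wgt z h y / h) := by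
      apply mul_le_mul_of_nonneg_left _ (by positivity); linarith
    have h3 : (C1 + 2 * A * C1) * (h / D + wgt z h y / h) ≤ C * (h / D + wgt z h y / h) := by
      apply mul_le_mul_of_nonneg_right _ (by positivity); rw [hC]; linarith
    linarith
  · have e : cutLog Srf z ζ y - G = (cutLog Srf z ζ y - T0) + (T0 - G) := by ring
    rw [e]
    refine (sq_add_le2 _ _).trans ?_
    have h1 : (T0 - G) ^ 2 = (G - T0) ^ 2 := by ring
    rw [h1]
    have h2 : 8 * (B ^ 2 * C1 ^ 2) * κ ^ 2 ≤ 8 * (B ^ 2 * C1 ^ 2) * (κ ^ 2 + wgt z h y) := by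
      apply mul_le_mul_of_nonneg_left _ (by positivity); linarith
    have h3 : (2 * C1 + 8 * (B ^ 2 * C1 ^ 2)) * (κ ^ 2 + wgt z h y) ≤ C * (κ ^ 2 + wgt z h y) := by
      apply mul_le_mul_of_nonneg_right _ (by positivity); rw [hC]; linarith
    linarith
  · have e : G = T0 + (G - T0) := by ring
    rw [e]
    refine (sq_add_le2 _ _).trans ?_
    have h2 : 8 * (B ^ 2 * C1 ^ 2) * κ ^ 2 ≤ 8 * (B ^ 2 * C1 ^ 2) * (1 / D) := by gcongr
    have h3 : (2 * C1 + 8 * (B ^ 2 * C1 ^ 2)) * (1 / D) ≤ C * (1 / D) := by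
      apply mul_le_mul_of_nonneg_right _ (by positivity); rw [hC]; linarith
    rw [div_eq_mul_one_div] at b5 ⊢
    linarith
  · have h0 : ‖gG‖ ≤ ‖w‖ + 2 * A * C1 * (h / D) := by
      have e : gG = (gG - Srf.PT y w) + Srf.PT y w := by abel
      calc ‖gG‖ = ‖(gG - Srf.PT y w) + Srf.PT y w‖ := by rw [← e]
        _ ≤ _ := by
          refine (norm_add_le _ _).trans ?_
          have := Srf.norm_PT_le (Omt_sub hy) w
          linarith
    refine (pow_le_pow_left₀ (norm_nonneg _) h0 2).trans ((sq_add_le2 _ _).trans ?_)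
    have h1 : (2 * A * C1 * (h / D)) ^ 2 = 4 * (A ^ 2 * C1 ^ 2) * (h / D) ^ 2 := by ring
    have h2 : 8 * (A ^ 2 * C1 ^ 2) * (h / D) ^ 2 ≤ 8 * (A ^ 2 * C1 ^ 2) * (1 / D) := by gcongr
    have h3 : (2 * C1 + 8 * (A ^ 2 * C1 ^ 2)) * (1 / D) ≤ C * (1 / D) := by
      apply mul_le_mul_of_nonneg_right _ (by positivity); rw [hC]; linarith
    rw [h1, div_eq_mul_one_div C D]
    rw [div_eq_mul_one_div C1 D] at b3
    linarith
end

section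
open SmoothSurface Triangulation

lemma R_arith {q r m b s ρ e g h c2 B : ℝ} (hq : q = r ^ 2) (hr : 0 ≤ r) (hrB : r ≤ B) (hh : 0 < h) (hg : 0 ≤ g)
    (hc : 0 ≤ c2) (hm0 : 0 ≤ m) (hm : m ≤ 4 * h ^ 2) (hb : |b| ≤ r * (2 * h)) (hs : |s| ≤ g * (2 * h))
    (hρ : |ρ| ≤ 7 * c2 * h ^ 2 * g) (hc2 : 100 * (c2 * h) ≤ 1) :
    |(q + (2 * b + m)) * (e + s + ρ) - (q * e + (e * (2 * b) + q * s))| ≤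
      (7 * c2 * B + 12) * (|e| + (r + h) * g) * h ^ 2 := by
  have hρ' : |ρ| ≤ h * g := by
    refine hρ.trans ?_
    have : 0 ≤ h * g := by positivity
    nlinarith
  have t1 : |q * ρ| ≤ 7 * c2 * B * (r * g) * h ^ 2 := by
    rw [abs_mul, hq, abs_of_nonneg (by positivity)]
    calc r ^ 2 * |ρ| ≤ r ^ 2 * (7 * c2 * h ^ 2 * g) := by gcongr
      _ = r * (7 * c2 * h ^ 2 * g * r) := by ring
      _ ≤ B * (7 * c2 * h ^ 2 * g * r) := by gcongr
      _ = _ := by ring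
  have t2 : |2 * b * s| ≤ 8 * (r * g) * h ^ 2 := by
    rw [abs_mul, abs_mul, abs_two]
    calc 2 * |b| * |s| ≤ 2 * (r * (2 * h)) * (g * (2 * h)) := by gcongr
      _ = _ := by ring
  have t3 : |2 * b * ρ| ≤ 4 * (r * g) * h ^ 2 := by
    rw [abs_mul, abs_mul, abs_two]
    calc 2 * |b| * |ρ| ≤ 2 * (r * (2 * h)) * (h * g) := by gcongr
      _ = _ := by ring
  have t4 : |m * e| ≤ 4 * |e| * h ^ 2 := by
    rw [abs_mul, abs_of_nonneg hm0]
    calc m * |e| ≤ 4 * h ^ 2 * |e| := by gcongr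
      _ = _ := by ring
  have t5 : |m * s| ≤ 8 * (h * g) * h ^ 2 := by
    rw [abs_mul, abs_of_nonneg hm0]
    calc m * |s| ≤ 4 * h ^ 2 * (g * (2 * h)) := by gcongr
      _ = _ := by ring
  have t6 : |m * ρ| ≤ 4 * (h * g) * h ^ 2 := by
    rw [abs_mul, abs_of_nonneg hm0]
    calc m * |ρ| ≤ 4 * h ^ 2 * (h * g) := by gcongr
      _ = _ := by ring
  have ee : (q + (2 * b + m)) * (e + s + ρ) - (q * e + (e * (2 * b) + q * s)) =
    q * ρ + 2 * b * s + 2 * b * ρ + m * e + m * s + m * ρ := by ring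
  rw [ee]
  have t := (abs_add_le (q * ρ + 2 * b * s + 2 * b * ρ + m * e + m * s) (m * ρ))
  have t' := (abs_add_le (q * ρ + 2 * b * s + 2 * b * ρ + m * e) (m * s))
  have t'' := (abs_add_le (q * ρ + 2 * b * s + 2 * b * ρ) (m * e))
  have t3' := (abs_add_le (q * ρ + 2 * b * s) (2 * b * ρ))
  have t4' := (abs_add_le (q * ρ) (2 * b * s))
  have p0 : 0 ≤ 7 * c2 * B := by have := hr.trans hrB; positivity
  have p1 : 0 ≤ 7 * c2 * B * (|e| + h * g) * h ^ 2 := by positivity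
  have p2 : 0 ≤ 8 * |e| * h ^ 2 := by positivity
  have e2 : (7 * c2 * B + 12) * (|e| + (r + h) * g) * h ^ 2 = 7 * c2 * B * (r * g) * h ^ 2 + 
    7 * c2 * B * (|e| + h * g) * h ^ 2 + 12 * (r * g) * h ^ 2 + 12 * (h * g) * h ^ 2 + 4 * |e| * h ^ 2 + 8 * |e| * h ^ 2 := by ring
  linarith

set_option maxHeartbeats 1000000 in
lemma exists_R (Srf : SmoothSurface) {γ₀ K : ℝ} (hγ : 0 < γ₀) (hK : Srf.Cst K) :
    ∃ C : ℝ, 0 < C ∧ ∀ z ∈ Srf.S, ∀ h : ℝ, Sm Srf γ₀ h K → 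
    ∀ (Tr : Triangulation Srf γ₀ h) (v : E3 → ℝ), Tr.IsVh v → ∃ vV, Tr.IsVh vV ∧ ∀ y ∈ Tr.Omt,
      ‖(Srf.rfn z y ^ 2 • Srf.grad (Tr.liftS v) y + Tr.liftS v y • Srf.grad (fun x => Srf.rfn z x ^ 2) y) -
        Srf.grad (Tr.liftS vV) y‖ ≤ C * h * (|Tr.liftS v y| + (Srf.rfn z y + h) * ‖Srf.grad (Tr.liftS v) y‖) ∧
      |Srf.rfn z y ^ 2 * Tr.liftS v y - Tr.liftS vV y| ≤
        C * h * (|Tr.liftS v y| + (Srf.rfn z y + h) * ‖Srf.grad (Tr.liftS v) y‖) := by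
  obtain ⟨B, hB, hBd⟩ := Srf.exists_bdd
  set A := 2 / γ₀ + 16 * C2 K γ₀ with hA
  set B1 := 1 + 4 * K with hB1
  have hc2 := C2_nonneg hγ hK
  have hA0 : 0 ≤ A := by positivity
  have hB0 : 1 ≤ B1 := by have := hK.one; linarith
  set M0 := (7 * C2 K γ₀ * B + 12) + 2 * B with hM0
  have hM00 : 0 < M0 := by positivity
  refine ⟨(A + B1) * M0, by positivity, fun z hz h sm Tr v hv => ?_⟩
  obtain ⟨vV, hV, hVi⟩ := exists_interp Tr (fun x => Srf.rfn z x ^ 2 * v x)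
  refine ⟨vV, hV, fun y hy => ?_⟩
  obtain ⟨t, ht, hyt⟩ := mem_Omt.1 hy
  have hyS := Omt_sub hy
  have hh := sm.hh
  set e := Tr.liftS v y with he
  set g := Srf.grad (Tr.liftS v) y with hg
  set r := Srf.rfn z y with hr
  have hr0 : 0 ≤ r := rfn_nonneg _ _
  have hrB : r ≤ B := (rfn_le hz y).trans (hBd z hz y hyS)
  set w := (e * 2) • Srf.PT z (y - z) + r ^ 2 • g with hw
  have hnPT : ‖Srf.PT z (y - z)‖ = r := by rw [hr, Srf.rfn_eq hz]
  set X := |e| + (r + h) * ‖g‖ with hX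
  have hX0 : 0 ≤ X := by positivity
  have hwn : ‖w‖ ≤ 2 * B * X := by
    refine (norm_add_le _ _).trans ?_
    rw [norm_smul, norm_smul, hnPT, Real.norm_eq_abs, Real.norm_eq_abs, abs_mul, abs_two, abs_of_nonneg (by positivity : 0 ≤ r ^ 2)]
    have h1 : |e| * 2 * r ≤ |e| * 2 * B := by gcongr
    have h2 : r ^ 2 * ‖g‖ ≤ B * (r * ‖g‖) := by
      rw [pow_two, mul_assoc]; gcongr
    have h3 : 0 ≤ B * (r * ‖g‖) := by positivity
    have h4 : 0 ≤ B * (h * ‖g‖) := by positivity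
    have e1 : 2 * B * X = |e| * 2 * B + 2 * (B * (r * ‖g‖)) + 2 * (B * (h * ‖g‖)) := by rw [hX]; ring
    linarith
  obtain ⟨e1, e2⟩ := interp_est sm hV ht hyt (T0 := r ^ 2 * e) (w := w) (M := (7 * C2 K γ₀ * B + 12) * X) (fun p hp => by
    rw [hVi t ht p hp]
    have hpd := Om_diam ht hyt hp
    have hvt := vert_taylor sm hv ht hyt hp
    rw [← he, ← hg] at hvt
    have := R_arith (q := r ^ 2) (m := ‖Srf.PT z (p - y)‖ ^ 2) (b := ⟪Srf.PT z (y - z), p - y⟫) (s := ⟪g, p - y⟫)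
      (ρ := v p - (e + ⟪g, p - y⟫)) (e := e) (g := ‖g‖) (c2 := C2 K γ₀) rfl hr0 hrB hh (norm_nonneg _) hc2 (by positivity)
      (by 
        have := pow_le_pow_left₀ (norm_nonneg _) ((Srf.norm_PT_le hz _).trans hpd) 2
        linarith) 
      (by
        refine (abs_real_inner_le_norm _ _).trans ?_
        rw [hnPT]; gcongr)
      (by
        refine (abs_real_inner_le_norm _ _).trans ?_
        gcongr) hvt sm.s2
    rw [← hX] at this
    refine le_trans (le_of_eq ?_) this
    rw [q_expand hz y p, ← hr, hw, inner_add_left, real_inner_smul_left, real_inner_smul_left]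
    congr 1; ring)
  have hM : (7 * C2 K γ₀ * B + 12) * X + ‖w‖ ≤ M0 * X := by rw [hM0]; linarith
  have hPT : Srf.PT y w = r ^ 2 • g + e • Srf.grad (fun x => Srf.rfn z x ^ 2) y := by
    rw [q_grad hz hyS, hw, PT_add, PT_smul, PT_smul, PT_smul, Srf.PT_of_mem (y := y) (v := g) grad_mem]
    module
  constructor
  · rw [← hPT, norm_sub_rev]
    refine e1.trans ?_
    rw [← hA]
    calc A * h * ((7 * C2 K γ₀ * B + 12) * X + ‖w‖) ≤ A * h * (M0 * X) := by gcongr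
      _ ≤ (A + B1) * h * (M0 * X) := by gcongr; linarith
      _ = _ := by ring
  · rw [abs_sub_comm]
    refine e2.trans ?_
    rw [← hB1]
    have hs := sm.s3
    calc B1 * h ^ 2 * ((7 * C2 K γ₀ * B + 12) * X + ‖w‖) ≤ B1 * h * (M0 * X) := by gcongr; nlinarith
      _ ≤ (A + B1) * h * (M0 * X) := by gcongr; linarith
      _ = _ := by ring
end

section
lemma yng {ε : ℝ} (hε : 0 < ε) (x y : ℝ) : x * y ≤ ε * x ^ 2 + 1 / (4 * ε) * y ^ 2 := by
  have h : 0 ≤ ε * (x - y / (2 * ε)) ^ 2 := by positivity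
  have e : ε * (x - y / (2 * ε)) ^ 2 = ε * x ^ 2 - x * y + 1 / (4 * ε) * y ^ 2 := by field_simp; ring
  linarith

set_option maxHeartbeats 2000000 in
/-- pointwise estimate of the main terms -/
lemma S1 {C B ε : ℝ} (hC : 0 < C) (hB : 0 ≤ B) (hε : 0 < ε) : ∃ k : ℝ, 0 ≤ k ∧ ∀ r h κ w a b E' e η E : ℝ,
    0 ≤ r → r ≤ B → 0 < h → h ≤ 1 → 0 ≤ κ → κ ≤ 1 → 0 ≤ w → 0 ≤ a → 0 ≤ b → 0 ≤ E' → 0 ≤ e → 0 ≤ η → 0 ≤ E →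
    (r * b) ^ 2 ≤ C * (κ + w) → h * b ≤ C * (κ + w) → w * r ≤ w * h → η ^ 2 ≤ C * (κ + w) →
    r ^ 2 * E' * b + 2 * r * E' * η + (a + b) * (C * h * (e + (r + h) * a)) + r ^ 2 * E * η +
      (η + e) * (C * h * (e + (r + h) * a)) ≤
    3 * ε * (r ^ 2 * E' ^ 2 + r ^ 2 * a ^ 2 + e ^ 2 + w * e ^ 2) + 1 / 4 * (r ^ 2 * E ^ 2) +
      k * ((κ + w) + h ^ 2 * ((1 + w) * (a ^ 2 + e ^ 2))) := by
  set q := 1 / (4 * ε) with hq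
  have hq0 : 0 < q := by positivity
  refine ⟨q * C + 4 * q * C + (2 * q * C ^ 2 + C) + (2 * q * C ^ 4 + 4 * C ^ 2) + B ^ 2 * C +
    (C + (1 + q) * C ^ 2 * (2 + 2 * (B + 1) ^ 2)), by positivity, ?_⟩
  intro r h κ w a b E' e η E hr hrB hh hh1 hκ hκ1 hw ha hb hE' he hη hE h1 h2 h3 h4
  set W := κ + w with hW
  set H := h ^ 2 * ((1 + w) * (a ^ 2 + e ^ 2)) with hH
  have hW0 : 0 ≤ W := by positivity
  have hH0 : 0 ≤ H := by positivity
  have hHa : h ^ 2 * a ^ 2 ≤ H := by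
    rw [hH]; apply mul_le_mul_of_nonneg_left _ (by positivity)
    nlinarith [mul_nonneg hw (sq_nonneg a), mul_nonneg hw (sq_nonneg e), sq_nonneg e]
  have hHe : h ^ 2 * e ^ 2 ≤ H := by
    rw [hH]; apply mul_le_mul_of_nonneg_left _ (by positivity)
    nlinarith [mul_nonneg hw (sq_nonneg a), mul_nonneg hw (sq_nonneg e), sq_nonneg a]
  have hHw : w * (h ^ 2 * a ^ 2) ≤ H := by
    have : w * (h ^ 2 * a ^ 2) = h ^ 2 * (w * a ^ 2) := by ring
    rw [this, hH]; apply mul_le_mul_of_nonneg_left _ (by positivity)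
    nlinarith [mul_nonneg hw (sq_nonneg a), mul_nonneg hw (sq_nonneg e), sq_nonneg a, sq_nonneg e]
  have hκ2 : κ ^ 2 ≤ κ := by nlinarith
  have hκW : κ ≤ W := by linarith
  have hwW : w ≤ W := by linarith
  -- T1
  have T1 : r ^ 2 * E' * b ≤ ε * (r ^ 2 * E' ^ 2) + q * C * W := by
    have := yng hε (r * E') (r * b)
    have h5 : q * (r * b) ^ 2 ≤ q * (C * W) := by gcongr
    have e1 : r * E' * (r * b) = r ^ 2 * E' * b := by ring
    have e2 : ε * (r * E') ^ 2 = ε * (r ^ 2 * E' ^ 2) := by ring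
    linarith
  have T2 : 2 * r * E' * η ≤ ε * (r ^ 2 * E' ^ 2) + 4 * q * C * W := by
    have := yng hε (r * E') (2 * η)
    have h5 : q * η ^ 2 ≤ q * (C * W) := by gcongr
    have e1 : r * E' * (2 * η) = 2 * r * E' * η := by ring
    have e2 : ε * (r * E') ^ 2 = ε * (r ^ 2 * E' ^ 2) := by ring
    have e3 : q * (2 * η) ^ 2 = 4 * (q * η ^ 2) := by ring
    linarith
  have T3 : a * (C * h * (e + (r + h) * a)) ≤ ε * e ^ 2 + ε * (r ^ 2 * a ^ 2) + (2 * q * C ^ 2 + C) * H := by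
    have y1 := yng hε e (C * h * a)
    have y2 := yng hε (r * a) (C * h * a)
    have e1 : a * (C * h * (e + (r + h) * a)) = e * (C * h * a) + r * a * (C * h * a) + C * (h ^ 2 * a ^ 2) := by ring
    have e2 : q * (C * h * a) ^ 2 = q * C ^ 2 * (h ^ 2 * a ^ 2) := by ring
    have e3 : ε * (r * a) ^ 2 = ε * (r ^ 2 * a ^ 2) := by ring
    have g1 : q * C ^ 2 * (h ^ 2 * a ^ 2) ≤ q * C ^ 2 * H := by gcongr
    have g2 : C * (h ^ 2 * a ^ 2) ≤ C * H := by gcongr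
    have e4 : (2 * q * C ^ 2 + C) * H = 2 * (q * C ^ 2 * H) + C * H := by ring
    linarith
  have T4 : b * (C * h * (e + (r + h) * a)) ≤ ε * e ^ 2 + ε * (r ^ 2 * a ^ 2) + ε * (w * e ^ 2) +
      (2 * q * C ^ 4 + 4 * C ^ 2) * (W + H) := by
    have s0 : b * (C * h * (e + (r + h) * a)) = C * (h * b) * (e + (r + h) * a) := by ring
    have s1 : C * (h * b) * (e + (r + h) * a) ≤ C * (C * W) * (e + (r + h) * a) := by gcongr
    have s2 : C * (C * W) * (e + (r + h) * a) = e * (C ^ 2 * κ) + r * a * (C ^ 2 * κ) + C ^ 2 * (h * a * κ) +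
      w * (e * C ^ 2) + C ^ 2 * ((w * r) * a) + C ^ 2 * (w * (h * a)) := by rw [hW]; ring
    have y1 := yng hε e (C ^ 2 * κ)
    have y2 := yng hε (r * a) (C ^ 2 * κ)
    have y3 : h * a * κ ≤ W + H := by
      have n1 := sq_nonneg (h * a - κ)
      have n2 : (h * a - κ) ^ 2 = h ^ 2 * a ^ 2 - 2 * (h * a * κ) + κ ^ 2 := by ring
      have n3 : 0 ≤ h * a * κ := by positivity
      linarith
    have y4 : w * (e * C ^ 2) ≤ w * (ε * e ^ 2 + q * (C ^ 2) ^ 2) := by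
      apply mul_le_mul_of_nonneg_left (yng hε e (C ^ 2)) hw
    have y5 : w * (h * a) ≤ W + H := by
      have : w * (h * a) ≤ w * (1 + h ^ 2 * a ^ 2) := by
        apply mul_le_mul_of_nonneg_left _ hw
        have n1 := sq_nonneg (h * a - 1)
        have n2 : (h * a - 1) ^ 2 = h ^ 2 * a ^ 2 - 2 * (h * a) + 1 := by ring
        have n3 : 0 ≤ h * a := by positivity
        linarith
      linarith
    have y6 : (w * r) * a ≤ W + H := by
      have : (w * r) * a ≤ w * h * a := by gcongr
      linarith
    have e1 : q * (C ^ 2 * κ) ^ 2 = q * C ^ 4 * κ ^ 2 := by ring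
    have e3 : ε * (r * a) ^ 2 = ε * (r ^ 2 * a ^ 2) := by ring
    have g1 : q * C ^ 4 * κ ^ 2 ≤ q * C ^ 4 * κ := by gcongr
    have g3 : C ^ 2 * (h * a * κ) ≤ C ^ 2 * (W + H) := by gcongr
    have g5 : C ^ 2 * (w * (h * a)) ≤ C ^ 2 * (W + H) := by gcongr
    have g6 : C ^ 2 * ((w * r) * a) ≤ C ^ 2 * (W + H) := by gcongr
    have e4 : w * (ε * e ^ 2 + q * (C ^ 2) ^ 2) = ε * (w * e ^ 2) + q * C ^ 4 * w := by ring
    have p1 : q * C ^ 4 * κ + q * C ^ 4 * w = q * C ^ 4 * W := by rw [hW]; ring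
    have p2 : q * C ^ 4 * κ ≤ q * C ^ 4 * W := by gcongr
    have p3 : 0 ≤ q * C ^ 4 * H := by positivity
    have p4 : 0 ≤ C ^ 2 * (W + H) := by positivity
    have e5 : (2 * q * C ^ 4 + 4 * C ^ 2) * (W + H) = 2 * (q * C ^ 4 * W) + 2 * (q * C ^ 4 * H) + 4 * (C ^ 2 * (W + H)) := by
      ring
    linarith
  have T5 : r ^ 2 * E * η ≤ 1 / 4 * (r ^ 2 * E ^ 2) + B ^ 2 * C * W := by
    have y := yng (show (0:ℝ) < 1 / 4 by norm_num) (r * E) (r * η)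
    have g : r ^ 2 * η ^ 2 ≤ B ^ 2 * (C * W) := by gcongr
    have e1 : 1 / (4 * (1 / 4 : ℝ)) = 1 := by norm_num
    rw [e1] at y
    have e2 : r * E * (r * η) = r ^ 2 * E * η := by ring
    have e3 : (r * E) ^ 2 = r ^ 2 * E ^ 2 := by ring
    have e4 : (r * η) ^ 2 = r ^ 2 * η ^ 2 := by ring
    rw [e2, e3, e4] at y
    linarith
  have T6 : (η + e) * (C * h * (e + (r + h) * a)) ≤ ε * e ^ 2 + (C + (1 + q) * C ^ 2 * (2 + 2 * (B + 1) ^ 2)) * (W + H) := by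
    set Z := C * h * (e + (r + h) * a) with hZ
    have hZ2 : Z ^ 2 ≤ C ^ 2 * (2 + 2 * (B + 1) ^ 2) * H := by
      have z1 : e + (r + h) * a ≤ e + (B + 1) * a := by gcongr
      have z2 : (e + (r + h) * a) ^ 2 ≤ 2 * e ^ 2 + 2 * (B + 1) ^ 2 * a ^ 2 := by
        refine (pow_le_pow_left₀ (by positivity) z1 2).trans ?_
        refine (sq_add_le2 _ _).trans (le_of_eq (by ring))
      calc Z ^ 2 = C ^ 2 * h ^ 2 * (e + (r + h) * a) ^ 2 := by rw [hZ]; ring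
        _ ≤ C ^ 2 * h ^ 2 * (2 * e ^ 2 + 2 * (B + 1) ^ 2 * a ^ 2) := by gcongr
        _ = C ^ 2 * (2 * (h ^ 2 * e ^ 2) + 2 * (B + 1) ^ 2 * (h ^ 2 * a ^ 2)) := by ring
        _ ≤ C ^ 2 * (2 * H + 2 * (B + 1) ^ 2 * H) := by gcongr
        _ = _ := by ring
    have y1 := yng hε e Z
    have y2 : η * Z ≤ η ^ 2 + Z ^ 2 := by nlinarith [sq_nonneg (η - Z), sq_nonneg η, sq_nonneg Z]
    have e1 : (1 + q) * Z ^ 2 ≤ (1 + q) * (C ^ 2 * (2 + 2 * (B + 1) ^ 2) * H) := by gcongr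
    have p : 0 ≤ (1 + q) * (C ^ 2 * (2 + 2 * (B + 1) ^ 2) * W) := by positivity
    have p' : 0 ≤ C * H := by positivity
    have e2 : (C + (1 + q) * C ^ 2 * (2 + 2 * (B + 1) ^ 2)) * (W + H) = C * W + C * H +
      (1 + q) * (C ^ 2 * (2 + 2 * (B + 1) ^ 2) * W) + (1 + q) * (C ^ 2 * (2 + 2 * (B + 1) ^ 2) * H) := by ring
    have e3 : (η + e) * Z = η * Z + e * Z := by ring
    linarith
  have p1 : 0 ≤ q * C * H := by positivity
  have p2 : 0 ≤ B ^ 2 * C * H := by positivity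
  have p3 : 0 ≤ (2 * q * C ^ 2 + C) * W := by positivity
  have q1 : 0 ≤ ε * (r ^ 2 * E' ^ 2) := by positivity
  have q2 : 0 ≤ ε * (r ^ 2 * a ^ 2) := by positivity
  have q3 : 0 ≤ ε * (w * e ^ 2) := by positivity
  have fe : (a + b) * (C * h * (e + (r + h) * a)) = a * (C * h * (e + (r + h) * a)) + b * (C * h * (e + (r + h) * a)) := by ring
  have fk : (q * C + 4 * q * C + (2 * q * C ^ 2 + C) + (2 * q * C ^ 4 + 4 * C ^ 2) + B ^ 2 * C +
    (C + (1 + q) * C ^ 2 * (2 + 2 * (B + 1) ^ 2))) * (W + H) = q * C * W + 4 * q * C * W + 5 * (q * C * H) +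
    (2 * q * C ^ 2 + C) * W + (2 * q * C ^ 2 + C) * H + (2 * q * C ^ 4 + 4 * C ^ 2) * (W + H) + B ^ 2 * C * W +
    B ^ 2 * C * H + (C + (1 + q) * C ^ 2 * (2 + 2 * (B + 1) ^ 2)) * (W + H) := by ring
  rw [fk, fe]
  linarith

set_option maxHeartbeats 2000000 in
/-- pointwise estimate of the geometric form error -/
lemma S2 {C c B ε : ℝ} (hC : 0 < C) (hc : 0 < c) (hB : 0 ≤ B) (hε : 0 < ε) : ∃ k : ℝ, 0 ≤ k ∧ ∀ r h a e g G : ℝ,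
    0 ≤ r → r ≤ B → 0 < h → h ≤ 1 → 0 ≤ a → 0 ≤ e → 0 ≤ g → 0 ≤ G → (r + h) * g ≤ c → (r + h) * G ≤ c →
    h * ((g + a) * (r ^ 2 * a + e * (2 * r) + C * h * (e + (r + h) * a)) +
      (G + e) * (r ^ 2 * e + C * h * (e + (r + h) * a))) ≤
    6 * ε * (r ^ 2 * a ^ 2 + e ^ 2) + k * (h ^ 2 * (1 + (a ^ 2 + e ^ 2))) := by
  set q := 1 / (4 * ε) with hq
  have hq0 : 0 < q := by positivity
  refine ⟨q * c ^ 2 + 4 * q * c ^ 2 + 2 * (q * (C * c) ^ 2 + C * c) + q * B ^ 2 + 4 * q * B ^ 2 + C * (B + 2) +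
    q * (c * B) ^ 2 + q * (B ^ 2) ^ 2 + C * (B + 2), by positivity, ?_⟩
  intro r h a e g G hr hrB hh hh1 ha he hg hG hg' hG'
  set Z := h ^ 2 * (1 + (a ^ 2 + e ^ 2)) with hZ
  have z1 : h ^ 2 ≤ Z := by rw [hZ]; nlinarith [sq_nonneg a, sq_nonneg e, sq_nonneg h, mul_nonneg (sq_nonneg h) (sq_nonneg a), mul_nonneg (sq_nonneg h) (sq_nonneg e)]
  have z2 : h ^ 2 * a ^ 2 ≤ Z := by rw [hZ]; nlinarith [sq_nonneg h, mul_nonneg (sq_nonneg h) (sq_nonneg e)]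
  have z3 : h ^ 2 * e ^ 2 ≤ Z := by rw [hZ]; nlinarith [sq_nonneg h, mul_nonneg (sq_nonneg h) (sq_nonneg a)]
  have z4 : h ^ 2 * a ≤ Z := by rw [hZ]; apply mul_le_mul_of_nonneg_left _ (by positivity); nlinarith [sq_nonneg (a - 1), sq_nonneg e]
  have z5 : h ^ 2 * (a * e) ≤ Z := by rw [hZ]; apply mul_le_mul_of_nonneg_left _ (by positivity); nlinarith [sq_nonneg (a - e), sq_nonneg e]
  have hZ0 : 0 ≤ Z := by positivity
  have hrg : r * g ≤ c := by nlinarith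
  have hhg : h * g ≤ c := by nlinarith
  have hrG : r * G ≤ c := by nlinarith
  have hhG : h * G ≤ c := by nlinarith
  -- generic: coefficient times h e
  have gen : ∀ m : ℝ, m * (h * e) ≤ ε * e ^ 2 + q * m ^ 2 * Z := by
    intro m
    have y := yng hε e (m * h)
    have : q * m ^ 2 * h ^ 2 ≤ q * m ^ 2 * Z := by gcongr
    have e1 : q * (m * h) ^ 2 = q * m ^ 2 * h ^ 2 := by ring
    have e2 : e * (m * h) = m * (h * e) := by ring
    linarith
  have U1 : h * (g * (r ^ 2 * a)) ≤ ε * (r ^ 2 * a ^ 2) + q * c ^ 2 * Z := by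
    have y := yng hε (r * a) (c * h)
    have : q * c ^ 2 * h ^ 2 ≤ q * c ^ 2 * Z := by gcongr
    have e1 : h * (g * (r ^ 2 * a)) = (r * g) * (h * (r * a)) := by ring
    have e2 : (r * g) * (h * (r * a)) ≤ c * (h * (r * a)) := by gcongr
    have e3 : c * (h * (r * a)) = r * a * (c * h) := by ring
    have e4 : ε * (r * a) ^ 2 = ε * (r ^ 2 * a ^ 2) := by ring
    have e5 : q * (c * h) ^ 2 = q * c ^ 2 * h ^ 2 := by ring
    linarith
  have U2 : h * (g * (e * (2 * r))) ≤ ε * e ^ 2 + 4 * q * c ^ 2 * Z := by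
    have y := gen (2 * c)
    have e1 : h * (g * (e * (2 * r))) = (r * g) * (2 * (h * e)) := by ring
    have e2 : (r * g) * (2 * (h * e)) ≤ c * (2 * (h * e)) := by gcongr
    have e3 : q * (2 * c) ^ 2 * Z = 4 * q * c ^ 2 * Z := by ring
    linarith
  have U3 : ∀ g : ℝ, 0 ≤ g → (r + h) * g ≤ c → h * g ≤ c →
      h * (g * (C * h * (e + (r + h) * a))) ≤ ε * e ^ 2 + (q * (C * c) ^ 2 + C * c) * Z := by
    intro g hg hg' hhg
    have y := gen (C * c)
    have e1 : h * (g * (C * h * (e + (r + h) * a))) = C * ((h * g) * (h * e)) + C * (((r + h) * g) * (h ^ 2 * a)) := by ring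
    have e2 : C * ((h * g) * (h * e)) ≤ C * (c * (h * e)) := by gcongr
    have e3 : C * (((r + h) * g) * (h ^ 2 * a)) ≤ C * (c * Z) := by gcongr
    linarith
  have U3g := U3 g hg hg' hhg
  have U3G := U3 G hG hG' hhG
  have U4 : h * (a * (r ^ 2 * a)) ≤ ε * (r ^ 2 * a ^ 2) + q * B ^ 2 * Z := by
    have y := yng hε (r * a) (B * (h * a))
    have e1 : h * (a * (r ^ 2 * a)) = r * ((h * a) * (r * a)) := by ring
    have e2 : r * ((h * a) * (r * a)) ≤ B * ((h * a) * (r * a)) := by gcongr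
    have e3 : B * ((h * a) * (r * a)) = r * a * (B * (h * a)) := by ring
    have e4 : ε * (r * a) ^ 2 = ε * (r ^ 2 * a ^ 2) := by ring
    have e5 : q * (B * (h * a)) ^ 2 = q * B ^ 2 * (h ^ 2 * a ^ 2) := by ring
    have e6 : q * B ^ 2 * (h ^ 2 * a ^ 2) ≤ q * B ^ 2 * Z := by gcongr
    linarith
  have U5 : h * (a * (e * (2 * r))) ≤ ε * e ^ 2 + 4 * q * B ^ 2 * Z := by
    have y := yng hε e (2 * B * (h * a))
    have e1 : h * (a * (e * (2 * r))) = r * (2 * (e * (h * a))) := by ring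
    have e2 : r * (2 * (e * (h * a))) ≤ B * (2 * (e * (h * a))) := by gcongr
    have e5 : q * (2 * B * (h * a)) ^ 2 = 4 * (q * B ^ 2 * (h ^ 2 * a ^ 2)) := by ring
    have e6 : q * B ^ 2 * (h ^ 2 * a ^ 2) ≤ q * B ^ 2 * Z := by gcongr
    linarith
  have U6 : h * (a * (C * h * (e + (r + h) * a))) ≤ C * (B + 2) * Z := by
    have e1 : h * (a * (C * h * (e + (r + h) * a))) = C * (h ^ 2 * (a * e) + (r + h) * (h ^ 2 * a ^ 2)) := by ring
    have e2 : C * (h ^ 2 * (a * e) + (r + h) * (h ^ 2 * a ^ 2)) ≤ C * (Z + (B + 1) * Z) := by gcongr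
    linarith
  have U7 : h * (G * (r ^ 2 * e)) ≤ ε * e ^ 2 + q * (c * B) ^ 2 * Z := by
    have y := gen (c * B)
    have e1 : h * (G * (r ^ 2 * e)) = (r * G) * r * (h * e) := by ring
    have e2 : (r * G) * r * (h * e) ≤ c * B * (h * e) := by gcongr
    linarith
  have U9 : h * (e * (r ^ 2 * e)) ≤ ε * e ^ 2 + q * (B ^ 2) ^ 2 * Z := by
    have y := yng hε e (B ^ 2 * (h * e))
    have e1 : h * (e * (r ^ 2 * e)) = r ^ 2 * (e * (h * e)) := by ring
    have e2 : r ^ 2 * (e * (h * e)) ≤ B ^ 2 * (e * (h * e)) := by gcongr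
    have e5 : q * (B ^ 2 * (h * e)) ^ 2 = q * (B ^ 2) ^ 2 * (h ^ 2 * e ^ 2) := by ring
    have e6 : q * (B ^ 2) ^ 2 * (h ^ 2 * e ^ 2) ≤ q * (B ^ 2) ^ 2 * Z := by gcongr
    linarith
  have U10 : h * (e * (C * h * (e + (r + h) * a))) ≤ C * (B + 2) * Z := by
    have e1 : h * (e * (C * h * (e + (r + h) * a))) = C * (h ^ 2 * e ^ 2 + (r + h) * (h ^ 2 * (a * e))) := by ring
    have e2 : C * (h ^ 2 * e ^ 2 + (r + h) * (h ^ 2 * (a * e))) ≤ C * (Z + (B + 1) * Z) := by gcongr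
    linarith
  have fe : h * ((g + a) * (r ^ 2 * a + e * (2 * r) + C * h * (e + (r + h) * a)) +
      (G + e) * (r ^ 2 * e + C * h * (e + (r + h) * a))) = h * (g * (r ^ 2 * a)) + h * (g * (e * (2 * r))) +
      h * (g * (C * h * (e + (r + h) * a))) + h * (a * (r ^ 2 * a)) + h * (a * (e * (2 * r))) +
      h * (a * (C * h * (e + (r + h) * a))) + h * (G * (r ^ 2 * e)) + h * (G * (C * h * (e + (r + h) * a))) +
      h * (e * (r ^ 2 * e)) + h * (e * (C * h * (e + (r + h) * a))) := by ring
  have q1 : 0 ≤ ε * (r ^ 2 * a ^ 2) := by positivity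
  have q2 : 0 ≤ ε * e ^ 2 := by positivity
  rw [fe]
  simp only [add_mul]
  simp only [add_mul] at U3g U3G
  linarith

/-- pointwise estimate for the energy bound -/
lemma S3 {C c0 ε : ℝ} (hC : 0 < C) (hc : 0 ≤ c0) (hε : 0 < ε) : ∃ k : ℝ, 0 ≤ k ∧ ∀ h κ w u a b e η g G : ℝ,
    0 < h → 0 ≤ κ → κ ≤ 1 → 0 ≤ w → 0 ≤ u → 0 ≤ a → 0 ≤ e → 0 ≤ η → 0 ≤ g → 0 ≤ G → b ≤ C * (u + w / h) →
    η ^ 2 ≤ C * (κ + w) → (h * g) ^ 2 ≤ C * κ → (h * G) ^ 2 ≤ C * κ → c0 * h ≤ 1 / 8 → 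
    b * a + η * e + c0 * h * ((g + a) * a + (G + e) * e) ≤
    3 / 8 * (a ^ 2 + e ^ 2) + ε * (w * a ^ 2) + k * (u ^ 2 + w / h ^ 2 + κ + w) := by
  set q := 1 / (4 * ε) with hq
  have hq0 : 0 < q := by positivity
  refine ⟨2 * C ^ 2 + q * C ^ 2 + 2 * C + 4 * c0 ^ 2 * C, by positivity, ?_⟩
  intro h κ w u a b e η g G hh hκ hκ1 hw hu ha he hη hg hG hb hη2 hg2 hG2 hch
  have h8 : (0:ℝ) < 1 / 8 := by norm_num
  have e8 : 1 / (4 * (1 / 8 : ℝ)) = 2 := by norm_num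
  have wh : 0 ≤ w / h ^ 2 := by positivity
  set N := u ^ 2 + w / h ^ 2 + κ + w with hN
  have hN1 : u ^ 2 ≤ N := by linarith
  have hN2 : w / h ^ 2 ≤ N := by nlinarith
  have hN3 : κ + w ≤ N := by nlinarith
  have hN4 : κ ≤ N := by linarith
  have t1 : b * a ≤ 1 / 8 * a ^ 2 + 2 * C ^ 2 * N + (ε * (w * a ^ 2) + q * C ^ 2 * N) := by
    have s1 : b * a ≤ C * (u + w / h) * a := by gcongr
    have y1 := yng h8 a (C * u)
    rw [e8] at y1
    have y2 : w * (a * (C / h)) ≤ w * (ε * a ^ 2 + q * (C / h) ^ 2) := by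
      apply mul_le_mul_of_nonneg_left (yng hε _ _) hw
    have e1 : C * (u + w / h) * a = a * (C * u) + w * (a * (C / h)) := by ring
    have e2 : w * (ε * a ^ 2 + q * (C / h) ^ 2) = ε * (w * a ^ 2) + q * C ^ 2 * (w / h ^ 2) := by ring
    have e3 : q * C ^ 2 * (w / h ^ 2) ≤ q * C ^ 2 * N := by gcongr
    have e4 : 2 * (C * u) ^ 2 = 2 * C ^ 2 * u ^ 2 := by ring
    have e5 : 2 * C ^ 2 * u ^ 2 ≤ 2 * C ^ 2 * N := by gcongr
    linarith
  have t2 : η * e ≤ 1 / 8 * e ^ 2 + 2 * C * N := by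
    have y1 := yng h8 e η
    rw [e8] at y1
    have : C * (κ + w) ≤ C * N := by gcongr
    linarith
  have t3 : ∀ g a : ℝ, (h * g) ^ 2 ≤ C * κ → c0 * (a * (h * g)) ≤ 1 / 8 * a ^ 2 + 2 * c0 ^ 2 * C * N := by
    intro g a hg2
    have y1 := yng h8 a (c0 * (h * g))
    rw [e8] at y1
    have : C * κ ≤ C * N := by gcongr
    have e1 : 2 * (c0 * (h * g)) ^ 2 = 2 * c0 ^ 2 * (h * g) ^ 2 := by ring
    have e2 : 2 * c0 ^ 2 * (h * g) ^ 2 ≤ 2 * c0 ^ 2 * (C * N) := by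
      apply mul_le_mul_of_nonneg_left _ (by positivity); linarith
    linarith
  have t4 := t3 g a hg2
  have t5 := t3 G e hG2
  have t6 : c0 * h * (a ^ 2 + e ^ 2) ≤ 1 / 8 * (a ^ 2 + e ^ 2) := by gcongr
  have fe : c0 * h * ((g + a) * a + (G + e) * e) = c0 * (a * (h * g)) + c0 * (e * (h * G)) + c0 * h * (a ^ 2 + e ^ 2) := by ring
  rw [fe]
  simp only [add_mul]
  have p : 0 ≤ e ^ 2 := by positivity
  have p : 0 ≤ a ^ 2 := by positivity
  linarith
end

section
open SmoothSurface
namespace Triangulation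
variable {Srf : SmoothSurface} {γ₀ h : ℝ} {Tr : Triangulation Srf γ₀ h}

lemma IsVh.add {v w : E3 → ℝ} (hv : Tr.IsVh v) (hw : Tr.IsVh w) : Tr.IsVh (fun x => v x + w x) := by
  refine ⟨hv.1.add hw.1, fun t ht => ?_⟩
  obtain ⟨L, c, h1⟩ := hv.2 t ht
  obtain ⟨L', c', h2⟩ := hw.2 t ht
  refine ⟨L + L', c + c', fun x hx => ?_⟩
  beta_reduce
  rw [h1 x hx, h2 x hx, LinearMap.add_apply]; ring

lemma IsVh.sub {v w : E3 → ℝ} (hv : Tr.IsVh v) (hw : Tr.IsVh w) : Tr.IsVh (fun x => v x - w x) := by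
  refine ⟨hv.1.sub hw.1, fun t ht => ?_⟩
  obtain ⟨L, c, h1⟩ := hv.2 t ht
  obtain ⟨L', c', h2⟩ := hw.2 t ht
  refine ⟨L - L', c - c', fun x hx => ?_⟩
  beta_reduce
  rw [h1 x hx, h2 x hx, LinearMap.sub_apply]; ring

/-- all the data entering the final estimate -/
structure Dat (Tr : Triangulation Srf γ₀ h) (K C B : ℝ) (z : E3) (l vG ve vV : E3 → ℝ) : Prop where
  sm : Sm Srf γ₀ h K
  hz : z ∈ Srf.S
  hC : 0 < C
  hB : 0 ≤ B
  hrB : ∀ y ∈ Srf.S, Srf.rfn z y ≤ B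
  hG : Tr.IsVh vG
  he : Tr.IsVh ve
  hV : Tr.IsVh vV
  eta : ∀ y ∈ Tr.Omt, y ≠ z → Srf.SC1 l y ∧
      ‖Srf.grad l y - Srf.grad (Tr.liftS vG) y‖ ≤ C * (h / (‖y - z‖ ^ 2 + h ^ 2) + wgt z h y / h) ∧
      (l y - Tr.liftS vG y) ^ 2 ≤ C * (kap z h y ^ 2 + wgt z h y) ∧
      Tr.liftS vG y ^ 2 ≤ C / (‖y - z‖ ^ 2 + h ^ 2) ∧
      ‖Srf.grad (Tr.liftS vG) y‖ ^ 2 ≤ C / (‖y - z‖ ^ 2 + h ^ 2)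
  R : ∀ y ∈ Tr.Omt, 
      ‖(Srf.rfn z y ^ 2 • Srf.grad (Tr.liftS ve) y + Tr.liftS ve y • Srf.grad (fun x => Srf.rfn z x ^ 2) y) -
        Srf.grad (Tr.liftS vV) y‖ ≤ C * h * (|Tr.liftS ve y| + (Srf.rfn z y + h) * ‖Srf.grad (Tr.liftS ve) y‖) ∧
      |Srf.rfn z y ^ 2 * Tr.liftS ve y - Tr.liftS vV y| ≤
        C * h * (|Tr.liftS ve y| + (Srf.rfn z y + h) * ‖Srf.grad (Tr.liftS ve) y‖)
  proj : Tr.IsDiscreteProjection l (fun x => vG x + ve x)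

variable {K C B : ℝ} {z : E3} {l vG ve vV : E3 → ℝ}

lemma pt_arith {r h d D κ w b C g : ℝ} (hh : 0 < h) (hd : 0 < d) (hr : 0 ≤ r) (hrd : r ≤ d) (hD : D = d ^ 2 + h ^ 2)
    (hκ : κ = h ^ 2 / D) (hw : w = if d < h then h / d else 0) (hC : 0 < C) (hb0 : 0 ≤ b) (hb : b ≤ C * (h / D + w / h))
    (hg : g ^ 2 ≤ C / D) :
    (r * b) ^ 2 ≤ 2 * C ^ 2 * (κ + w) ∧ h * b ≤ C * (κ + w) ∧ w * r ≤ w * h ∧ (r + h) * g ≤ 1 + 2 * C ∧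
    (h * g) ^ 2 ≤ C * κ := by
  have hD0 : 0 < D := by rw [hD]; positivity
  have hw0 : 0 ≤ w := by rw [hw]; split_ifs <;> positivity
  have hκ0 : 0 ≤ κ := by rw [hκ]; positivity
  have hwr : w * r ≤ h := by
    rw [hw]; split_ifs
    · rw [div_mul_eq_mul_div, div_le_iff₀ hd]; gcongr
    · simpa using hh.le
  have hwh : w * r ≤ w * h := by
    rw [hw]; split_ifs with h1
    · gcongr; linarith
    · simp
  have hrD : r ^ 2 ≤ D := by
    have := pow_le_pow_left₀ hr hrd 2
    rw [hD]; nlinarith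
  have hhD : h ^ 2 ≤ D := by rw [hD]; nlinarith
  have hg' : D * g ^ 2 ≤ C := by rw [le_div_iff₀ hD0] at hg; linarith
  refine ⟨?_, ?_, hwh, ?_, ?_⟩
  · have h1 : r * b ≤ C * (r * h / D + w * r / h) := by
      calc r * b ≤ r * (C * (h / D + w / h)) := by gcongr
        _ = _ := by ring
    have h2 : (r * h / D) ^ 2 ≤ κ := by
      rw [hκ, div_pow, div_le_div_iff₀ (by positivity) hD0]
      calc (r * h) ^ 2 * D = r ^ 2 * (h ^ 2 * D) := by ring
        _ ≤ D * (h ^ 2 * D) := by gcongr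
        _ = _ := by ring
    have h3 : (w * r / h) ^ 2 ≤ w := by
      have i1 : w * r / h ≤ 1 := by rw [div_le_one hh]; exact hwr
      have i2 : w * r / h ≤ w := by rw [div_le_iff₀ hh]; exact hwh
      have i0 : 0 ≤ w * r / h := by positivity
      calc (w * r / h) ^ 2 = (w * r / h) * (w * r / h) := by ring
        _ ≤ 1 * w := by gcongr
        _ = w := one_mul w
    calc (r * b) ^ 2 ≤ (C * (r * h / D + w * r / h)) ^ 2 := by gcongr
      _ = C ^ 2 * (r * h / D + w * r / h) ^ 2 := by ring
      _ ≤ C ^ 2 * (2 * (r * h / D) ^ 2 + 2 * (w * r / h) ^ 2) := by gcongr; exact sq_add_le2 _ _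
      _ ≤ C ^ 2 * (2 * κ + 2 * w) := by gcongr
      _ = _ := by ring
  · calc h * b ≤ h * (C * (h / D + w / h)) := by gcongr
      _ = C * (h ^ 2 / D + w * (h / h)) := by ring
      _ = _ := by rw [div_self hh.ne', hκ, mul_one]
  · have : ((r + h) * g) ^ 2 ≤ 4 * C := by
      calc ((r + h) * g) ^ 2 = (r + h) ^ 2 * g ^ 2 := by ring
        _ ≤ (2 * r ^ 2 + 2 * h ^ 2) * g ^ 2 := by gcongr; exact sq_add_le2 _ _
        _ ≤ (2 * D + 2 * D) * g ^ 2 := by gcongr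
        _ = 4 * (D * g ^ 2) := by ring
        _ ≤ _ := by gcongr
    nlinarith [sq_nonneg ((r + h) * g - 1)]
  · rw [hκ]
    calc (h * g) ^ 2 = h ^ 2 * g ^ 2 := by ring
      _ ≤ h ^ 2 * (C / D) := by gcongr
      _ = _ := by ring

namespace Dat
variable (d : Dat Tr K C B z l vG ve vV)
include d

lemma pt {y : E3} (hy : y ∈ Tr.Omt) (hyz : y ≠ z) :
    (Srf.rfn z y * ‖Srf.grad l y - Srf.grad (Tr.liftS vG) y‖) ^ 2 ≤ 2 * C ^ 2 * (kap z h y + wgt z h y) ∧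
    h * ‖Srf.grad l y - Srf.grad (Tr.liftS vG) y‖ ≤ C * (kap z h y + wgt z h y) ∧
    wgt z h y * Srf.rfn z y ≤ wgt z h y * h ∧
    (l y - Tr.liftS vG y) ^ 2 ≤ C * (kap z h y + wgt z h y) ∧
    (Srf.rfn z y + h) * ‖Srf.grad (Tr.liftS vG) y‖ ≤ 1 + 2 * C ∧
    (Srf.rfn z y + h) * |Tr.liftS vG y| ≤ 1 + 2 * C ∧
    (h * ‖Srf.grad (Tr.liftS vG) y‖) ^ 2 ≤ C * kap z h y ∧ (h * |Tr.liftS vG y|) ^ 2 ≤ C * kap z h y := by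
  obtain ⟨h1, h2, h3, h4, h5⟩ := d.eta y hy hyz
  have hd0 : 0 < ‖y - z‖ := norm_pos_iff.2 (sub_ne_zero.2 hyz)
  have hwg : wgt z h y = if ‖y - z‖ < h then h / ‖y - z‖ else 0 := by
    unfold wgt; split_ifs <;> rfl
  obtain ⟨a1, a2, a3, a4, a5⟩ := pt_arith (κ := kap z h y) d.sm.hh hd0 (rfn_nonneg _ _) (rfn_le d.hz y) rfl rfl hwg d.hC (norm_nonneg _) h2 h5
  obtain ⟨-, -, -, b4, b5⟩ := pt_arith (κ := kap z h y) d.sm.hh hd0 (rfn_nonneg _ _) (rfn_le d.hz y) rfl rfl hwg d.hC (norm_nonneg _) h2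
    (by rw [sq_abs]; exact h4)
  refine ⟨a1, a2, a3, h3.trans ?_, a4, b4, a5, b5⟩
  have := kap_nonneg z h y
  have := kap_le_one z h y
  have := d.hC
  gcongr; nlinarith

lemma ae : ∀ᵐ y ∂Srf.mu, y ∈ Tr.Omt ∧ y ≠ z := by
  have h1 : ∀ᵐ y ∂Srf.mu, y ≠ z := by
    have h0 : Srf.mu {z} = 0 := by
      refine le_antisymm ?_ bot_le
      refine (Measure.restrict_apply_le _ _).trans ?_
      have := Measure.nullSingletonClass_hausdorff E3 (d := 2) (by norm_num)
      exact (measure_singleton z).le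
    rw [ae_iff]; simpa using h0
  filter_upwards [sm_ae (Tr := Tr) d.sm, h1] with y a b using ⟨a, b⟩

lemma l_aesm : AEStronglyMeasurable l Srf.mu :=
  sm_aesm (Tr := Tr) d.sm z fun y hy hyz => (d.eta y hy hyz).1.continuousWithinAt (Omt_sub hy)
lemma gl_aesm : AEStronglyMeasurable (Srf.grad l) Srf.mu :=
  sm_aesm (Tr := Tr) d.sm z fun y hy hyz => (d.eta y hy hyz).1.grad_continuousWithinAt (Omt_sub hy)

end Dat

lemma r_aesm : AEStronglyMeasurable (fun y => Srf.rfn z y) Srf.mu := (rfn_continuous z).aestronglyMeasurable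

end Triangulation

lemma int_of_lint {mu : Measure E3} {f : E3 → ℝ} {c : ℝ} (hf : Measurable f) (h0 : ∀ x, 0 ≤ f x)
    (h : ∫⁻ x, ENNReal.ofReal (f x) ∂mu ≤ ENNReal.ofReal c) (hc : 0 ≤ c) : Integrable f mu ∧ ∫ x, f x ∂mu ≤ c := by
  have hi : Integrable f mu := by
    refine ⟨hf.aestronglyMeasurable, ?_⟩
    rw [hasFiniteIntegral_iff_ofReal (Filter.Eventually.of_forall h0)]
    exact h.trans_lt ENNReal.ofReal_lt_top
  refine ⟨hi, ?_⟩
  rw [← ofReal_integral_eq_lintegral_ofReal hi (Filter.Eventually.of_forall h0)] at h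
  exact (ENNReal.ofReal_le_ofReal_iff hc).1 h

/-- integral bounds of the weights -/
lemma exists_weights (Srf : SmoothSurface) : ∃ C : ℝ, 0 < C ∧ ∀ z ∈ Srf.S, ∀ h : ℝ, 0 < h → h ≤ 1 / 2 →
    (Integrable (fun y => kap z h y + wgt z h y) Srf.mu ∧ ∫ y, (kap z h y + wgt z h y) ∂Srf.mu ≤ C * (h ^ 2 * |Real.log h|)) ∧
    (Integrable (fun y => (h / (‖y - z‖ ^ 2 + h ^ 2)) ^ 2 + wgt z h y / h ^ 2 + kap z h y + wgt z h y) Srf.mu ∧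
      ∫ y, ((h / (‖y - z‖ ^ 2 + h ^ 2)) ^ 2 + wgt z h y / h ^ 2 + kap z h y + wgt z h y) ∂Srf.mu ≤ C) ∧
    h ^ 2 ≤ 2 * (h ^ 2 * |Real.log h|) := by
  obtain ⟨C1, hC1, J1⟩ := Srf.exists_J1
  obtain ⟨C2, hC2, J2⟩ := Srf.exists_J2
  obtain ⟨C3, hC3, J3⟩ := Srf.exists_J3
  refine ⟨2 * C1 + C2 + 3 * C3, by positivity, fun z hz h hh hh2 => ?_⟩
  have hlog : 1 / 2 ≤ |Real.log h| := by
    have h1 : Real.log h ≤ Real.log (1 / 2) := Real.log_le_log hh hh2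
    have h2 : Real.log (1 / 2) = - Real.log 2 := by rw [one_div, Real.log_inv]
    have h3 := Real.log_two_gt_d9
    rw [abs_of_nonpos (by linarith)]; linarith
  have hlog2 : h ^ 2 * |Real.log h| ≤ 1 := by
    have h1 : |Real.log h| ≤ 1 / h := by
      have := Real.abs_log_mul_self_lt h hh (by linarith)
      rw [abs_mul, abs_of_pos hh] at this
      rw [le_div_iff₀ hh]; exact this.le
    calc h ^ 2 * |Real.log h| ≤ h ^ 2 * (1 / h) := by gcongr
      _ = h := by field_simp
      _ ≤ 1 := by linarith
  have hsq : h ^ 2 ≤ 2 * (h ^ 2 * |Real.log h|) := by nlinarith [sq_nonneg h]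
  obtain ⟨i1, b1⟩ := int_of_lint (measurable_kap z h) (kap_nonneg z h) (J1 z hz h hh hh2) (by positivity)
  obtain ⟨i3, b3⟩ := int_of_lint (measurable_wgt z h) (wgt_nonneg z hh) (J3 z h hh) (by positivity)
  obtain ⟨i2, b2⟩ := int_of_lint (by fun_prop) (fun x => by positivity) (J2 z h hh) (by positivity)
  refine ⟨⟨i1.add i3, ?_⟩, ⟨((i2.add (i3.div_const _)).add i1).add i3, ?_⟩, hsq⟩
  · rw [integral_add i1 i3]
    have : 0 ≤ C2 * (h ^ 2 * |Real.log h|) := by positivity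
    nlinarith
  · have i12 : Integrable (fun y => (h / (‖y - z‖ ^ 2 + h ^ 2)) ^ 2 + wgt z h y / h ^ 2) Srf.mu := i2.add (i3.div_const _)
    have i123 : Integrable (fun y => (h / (‖y - z‖ ^ 2 + h ^ 2)) ^ 2 + wgt z h y / h ^ 2 + kap z h y) Srf.mu := i12.add i1
    rw [integral_add i123 i3, integral_add i12 i1, integral_add i2 (i3.div_const _), integral_div]
    have : (∫ y, wgt z h y ∂Srf.mu) / h ^ 2 ≤ C3 := by rw [div_le_iff₀ (by positivity)]; exact b3
    have e1 : C1 * h ^ 2 * |Real.log h| ≤ C1 * 1 := by rw [mul_assoc]; gcongr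
    have e2 : C3 * h ^ 2 ≤ C3 * 1 := by gcongr; nlinarith
    linarith
end

section
open SmoothSurface
namespace Triangulation
variable {Srf : SmoothSurface} {γ₀ h : ℝ} {Tr : Triangulation Srf γ₀ h}
variable {K C B : ℝ} {z : E3} {l vG ve vV : E3 → ℝ}

lemma Vh_pair (sm : Sm Srf γ₀ h K) {v w : E3 → ℝ} (hv : Tr.IsVh v) (hw : Tr.IsVh w) :
    Integrable (fun y => ⟪Srf.grad (Tr.liftS v) y, Srf.grad (Tr.liftS w) y⟫ + Tr.liftS v y * Tr.liftS w y) Srf.mu ∧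
    Integrable (fun y => ‖Srf.grad (Tr.liftS v) y‖ * ‖Srf.grad (Tr.liftS w) y‖) Srf.mu ∧
    Integrable (fun y => |Tr.liftS v y| * |Tr.liftS w y|) Srf.mu := by
  obtain ⟨Ml, hMl0, hMl, hMl'⟩ := Vh_bdd sm hv
  obtain ⟨Mv, hMv0, hMv, hMv'⟩ := Vh_bdd sm hw
  obtain ⟨ml, ml'⟩ := Vh_aesm sm hv
  obtain ⟨mv, mv'⟩ := Vh_aesm sm hw
  have I1 : Integrable (fun y => ⟪Srf.grad (Tr.liftS v) y, Srf.grad (Tr.liftS w) y⟫) Srf.mu := by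
    refine integrable_bdd (M := Ml * Mv) (ml'.inner mv') ?_
    filter_upwards [sm_ae (Tr := Tr) sm] with y hy
    exact (abs_real_inner_le_norm _ _).trans (mul_le_mul (hMl' y hy) (hMv' y hy) (norm_nonneg _) hMl0)
  have I2 : Integrable (fun y => Tr.liftS v y * Tr.liftS w y) Srf.mu := by
    refine integrable_bdd (M := Ml * Mv) (ml.mul mv) ?_
    filter_upwards [sm_ae (Tr := Tr) sm] with y hy
    rw [abs_mul]
    exact mul_le_mul (hMl y (Omt_sub hy)) (hMv y (Omt_sub hy)) (abs_nonneg _) hMl0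
  refine ⟨I1.add I2, ?_, ?_⟩
  · refine integrable_bdd (M := Ml * Mv) (ml'.norm.mul mv'.norm) ?_
    filter_upwards [sm_ae (Tr := Tr) sm] with y hy
    rw [abs_mul, abs_norm, abs_norm]
    exact mul_le_mul (hMl' y hy) (hMv' y hy) (norm_nonneg _) hMl0
  · have := I2.abs
    simpa only [abs_mul] using this

lemma Vh_sq (sm : Sm Srf γ₀ h K) {v : E3 → ℝ} (hv : Tr.IsVh v) :
    Integrable (fun y => ‖Srf.grad (Tr.liftS v) y‖ ^ 2) Srf.mu ∧
    Integrable (fun y => Tr.liftS v y ^ 2) Srf.mu := by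
  obtain ⟨-, h1, h2⟩ := Vh_pair sm hv hv
  refine ⟨by simpa only [← _root_.sq] using h1, by simpa only [← _root_.sq, sq_abs] using h2⟩

namespace Dat
variable (d : Dat Tr K C B z l vG ve vV)
include d

lemma eta_int (hW : Integrable (fun y => kap z h y + wgt z h y) Srf.mu) {v : E3 → ℝ} (hv : Tr.IsVh v) :
    Integrable (fun y => ⟪Srf.grad l y - Srf.grad (Tr.liftS vG) y, Srf.grad (Tr.liftS v) y⟫ +
      (l y - Tr.liftS vG y) * Tr.liftS v y) Srf.mu := by
  obtain ⟨M, hM0, hM, hM'⟩ := Vh_bdd d.sm hv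
  obtain ⟨mv, mv'⟩ := Vh_aesm d.sm hv
  obtain ⟨mG, mG'⟩ := Vh_aesm d.sm d.hG
  have hh := d.sm.hh
  refine Integrable.mono' (((hW.const_mul (C / h)).mul_const M).add (((integrable_const (1:ℝ)).add (hW.const_mul C)).mul_const M))
    (((d.gl_aesm.sub mG').inner mv').add ((d.l_aesm.sub mG).mul mv)) ?_
  filter_upwards [d.ae] with y ⟨hy, hyz⟩
  obtain ⟨-, h2, -, h4, -⟩ := d.pt hy hyz
  refine (norm_add_le _ _).trans (add_le_add ?_ ?_)
  · refine (norm_inner_le_norm _ _).trans (mul_le_mul ?_ (hM' y hy) (norm_nonneg _) ?_)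
    · rw [div_mul_eq_mul_div, le_div_iff₀ hh, mul_comm]; exact h2
    · have := kap_nonneg z h y
      have := wgt_nonneg z hh y
      have := d.hC
      positivity
  · rw [norm_mul]
    refine mul_le_mul ?_ (hM y (Omt_sub hy)) (norm_nonneg _) ?_
    · rw [Real.norm_eq_abs]
      rw [← sq_abs] at h4
      show _ ≤ 1 + C * _
      nlinarith [sq_nonneg (|l y - Tr.liftS vG y| - 1)]
    · have := kap_nonneg z h y
      have := wgt_nonneg z hh y
      have := d.hC
      show 0 ≤ 1 + C * _
      positivity

lemma form_diff (hW : Integrable (fun y => kap z h y + wgt z h y) Srf.mu) {v : E3 → ℝ} (hv : Tr.IsVh v) :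
    Integrable (fun y => ⟪(Srf.grad l y - Srf.grad (Tr.liftS vG) y) - Srf.grad (Tr.liftS ve) y, Srf.grad (Tr.liftS v) y⟫ +
      ((l y - Tr.liftS vG y) - Tr.liftS ve y) * Tr.liftS v y) Srf.mu ∧
    |∫ y, (⟪(Srf.grad l y - Srf.grad (Tr.liftS vG) y) - Srf.grad (Tr.liftS ve) y, Srf.grad (Tr.liftS v) y⟫ +
      ((l y - Tr.liftS vG y) - Tr.liftS ve y) * Tr.liftS v y) ∂Srf.mu| ≤
    ∫ y, 100 * C2 K γ₀ * h * ((‖Srf.grad (Tr.liftS vG) y‖ + ‖Srf.grad (Tr.liftS ve) y‖) * ‖Srf.grad (Tr.liftS v) y‖ +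
      (|Tr.liftS vG y| + |Tr.liftS ve y|) * |Tr.liftS v y|) ∂Srf.mu ∧
    Integrable (fun y => 100 * C2 K γ₀ * h * ((‖Srf.grad (Tr.liftS vG) y‖ + ‖Srf.grad (Tr.liftS ve) y‖) * ‖Srf.grad (Tr.liftS v) y‖ +
      (|Tr.liftS vG y| + |Tr.liftS ve y|) * |Tr.liftS v y|)) Srf.mu := by
  have i1 := d.eta_int hW hv
  obtain ⟨i2, i2', i2''⟩ := Vh_pair d.sm d.hG hv
  obtain ⟨i3, i3', i3''⟩ := Vh_pair d.sm d.he hv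
  have hL : Tr.IsVh (fun x => vG x + ve x) := d.hG.add d.he
  obtain ⟨i4, i4', i4''⟩ := Vh_pair d.sm hL hv
  have hgL : ∀ y ∈ Tr.Omt, Srf.grad (Tr.liftS (fun x => vG x + ve x)) y = Srf.grad (Tr.liftS vG) y + Srf.grad (Tr.liftS ve) y :=
    fun y hy => grad_add (Omt_sub hy) (Vh_SC1 d.sm d.hG hy) (Vh_SC1 d.sm d.he hy)
  have j : Integrable (fun y => (‖Srf.grad (Tr.liftS vG) y‖ + ‖Srf.grad (Tr.liftS ve) y‖) * ‖Srf.grad (Tr.liftS v) y‖ +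
      (|Tr.liftS vG y| + |Tr.liftS ve y|) * |Tr.liftS v y|) Srf.mu := by
    refine ((i2'.add i3').add (i2''.add i3'')).congr (Filter.Eventually.of_forall fun y => ?_)
    simp only [Pi.add_apply]; ring
  have a1 : Srf.aForm l (Tr.liftS v) = ∫ y, (⟪Srf.grad l y - Srf.grad (Tr.liftS vG) y, Srf.grad (Tr.liftS v) y⟫ +
      (l y - Tr.liftS vG y) * Tr.liftS v y) ∂Srf.mu +
      ∫ y, (⟪Srf.grad (Tr.liftS vG) y, Srf.grad (Tr.liftS v) y⟫ + Tr.liftS vG y * Tr.liftS v y) ∂Srf.mu := by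
    rw [← integral_add i1 i2]
    refine integral_congr_ae (Filter.Eventually.of_forall fun y => ?_)
    simp only [inner_sub_left]; ring
  have a2 : Srf.aForm (Tr.liftS (fun x => vG x + ve x)) (Tr.liftS v) =
      ∫ y, (⟪Srf.grad (Tr.liftS vG) y, Srf.grad (Tr.liftS v) y⟫ + Tr.liftS vG y * Tr.liftS v y) ∂Srf.mu +
      ∫ y, (⟪Srf.grad (Tr.liftS ve) y, Srf.grad (Tr.liftS v) y⟫ + Tr.liftS ve y * Tr.liftS v y) ∂Srf.mu := by
    rw [← integral_add i2 i3]
    refine integral_congr_ae ?_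
    filter_upwards [d.ae] with y ⟨hy, _⟩
    rw [hgL y hy, inner_add_left]
    show _ + (Tr.liftS vG y + Tr.liftS ve y) * _ = _
    ring
  refine ⟨(i1.sub i3).congr (Filter.Eventually.of_forall fun y => ?_), ?_, j.const_mul _⟩
  · simp only [Pi.sub_apply, inner_sub_left]; ring
  · have e1 : ∫ y, (⟪(Srf.grad l y - Srf.grad (Tr.liftS vG) y) - Srf.grad (Tr.liftS ve) y, Srf.grad (Tr.liftS v) y⟫ +
      ((l y - Tr.liftS vG y) - Tr.liftS ve y) * Tr.liftS v y) ∂Srf.mu =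
        -(Srf.aForm (Tr.liftS (fun x => vG x + ve x)) (Tr.liftS v) - Tr.ahForm (fun x => vG x + ve x) v) := by
      rw [d.proj.2 v hv, a1, a2]
      have : ∫ y, (⟪(Srf.grad l y - Srf.grad (Tr.liftS vG) y) - Srf.grad (Tr.liftS ve) y, Srf.grad (Tr.liftS v) y⟫ +
        ((l y - Tr.liftS vG y) - Tr.liftS ve y) * Tr.liftS v y) ∂Srf.mu =
        ∫ y, (⟪Srf.grad l y - Srf.grad (Tr.liftS vG) y, Srf.grad (Tr.liftS v) y⟫ +
        (l y - Tr.liftS vG y) * Tr.liftS v y) ∂Srf.mu - 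
        ∫ y, (⟪Srf.grad (Tr.liftS ve) y, Srf.grad (Tr.liftS v) y⟫ + Tr.liftS ve y * Tr.liftS v y) ∂Srf.mu := by
        rw [← integral_sub i1 i3]
        refine integral_congr_ae (Filter.Eventually.of_forall fun y => ?_)
        simp only [inner_sub_left]; ring
      rw [this]; ring
    rw [e1, abs_neg, integral_const_mul]
    refine (form_error d.sm hL hv).trans ?_
    have hc : 0 ≤ 100 * C2 K γ₀ * h := by
      have := C2_nonneg d.sm.hγ d.sm.hK
      have := d.sm.hh
      positivity
    refine mul_le_mul_of_nonneg_left (integral_mono_ae (i4'.add i4'') j ?_) hc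
    filter_upwards [d.ae] with y ⟨hy, _⟩
    show ‖_‖ * _ + |Tr.liftS vG y + Tr.liftS ve y| * _ ≤ _
    rw [hgL y hy]
    gcongr
    · exact norm_add_le _ _
    · exact abs_add_le _ _

end Dat

lemma near_e {Cn : ℝ} (sm : Sm Srf γ₀ h K) {ve : E3 → ℝ} (he : Tr.IsVh ve) 
    (hn : ∀ (f F : E3 → ℝ), AEStronglyMeasurable f Srf.mu → (∀ y, 0 ≤ f y) → (∀ y, 0 ≤ F y) → Integrable F Srf.mu →
      (∀ t ∈ Tr.T, ∀ y ∈ Tr.Om t, ∀ y' ∈ Tr.Om t, f y ≤ F y') → Integrable (fun y => wgt z h y * f y) Srf.mu ∧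
      ∫ y, wgt z h y * f y ∂Srf.mu ≤ Cn * ∫ y, F y ∂Srf.mu) :
    (Integrable (fun y => wgt z h y * ‖Srf.grad (Tr.liftS ve) y‖ ^ 2) Srf.mu ∧
      ∫ y, wgt z h y * ‖Srf.grad (Tr.liftS ve) y‖ ^ 2 ∂Srf.mu ≤ Cn * (16 * ∫ y, ‖Srf.grad (Tr.liftS ve) y‖ ^ 2 ∂Srf.mu)) ∧
    (Integrable (fun y => wgt z h y * Tr.liftS ve y ^ 2) Srf.mu ∧
      ∫ y, wgt z h y * Tr.liftS ve y ^ 2 ∂Srf.mu ≤ Cn * (2 * ∫ y, Tr.liftS ve y ^ 2 ∂Srf.mu +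
        8 * h ^ 2 * ∫ y, ‖Srf.grad (Tr.liftS ve) y‖ ^ 2 ∂Srf.mu)) := by
  obtain ⟨q1, q2⟩ := Vh_sq sm he
  obtain ⟨m1, m2⟩ := Vh_aesm sm he
  constructor
  · have := hn (fun y => ‖Srf.grad (Tr.liftS ve) y‖ ^ 2) (fun y => 16 * ‖Srf.grad (Tr.liftS ve) y‖ ^ 2) (m2.norm.pow 2)
      (fun y => by positivity) (fun y => by positivity) (q1.const_mul _) (fun t ht y hy y' hy' => by
        have h1 := (Vh_same sm he ht hy hy').1
        calc _ ≤ (4 * ‖Srf.grad (Tr.liftS ve) y'‖) ^ 2 := by gcongr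
          _ = _ := by ring)
    rwa [integral_const_mul] at this
  · have := hn (fun y => Tr.liftS ve y ^ 2) (fun y => 2 * Tr.liftS ve y ^ 2 + 8 * h ^ 2 * ‖Srf.grad (Tr.liftS ve) y‖ ^ 2) (m1.pow 2)
      (fun y => by positivity) (fun y => by positivity) ((q2.const_mul _).add (q1.const_mul _)) (fun t ht y hy y' hy' => by
        have h1 := (Vh_same sm he ht hy hy').2
        have h2 := pow_le_pow_left₀ (abs_nonneg _) h1 2
        rw [sq_abs] at h2
        have h3 := sq_add_le2 (Tr.liftS ve y') (Tr.liftS ve y - Tr.liftS ve y')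
        rw [add_sub_cancel] at h3
        calc _ ≤ _ := h3
          _ ≤ 2 * Tr.liftS ve y' ^ 2 + 2 * (2 * h * ‖Srf.grad (Tr.liftS ve) y'‖) ^ 2 := by gcongr
          _ = _ := by ring)
    rwa [integral_add (q2.const_mul _) (q1.const_mul _), integral_const_mul, integral_const_mul] at this

end Triangulation

open Triangulation in
/-- the (non-weighted) energy of the discrete error is bounded -/
lemma exists_energy (Srf : SmoothSurface) {γ₀ K C : ℝ} (hγ : 0 < γ₀) (hK : Srf.Cst K) (hC : 0 < C) :
    ∃ A : ℝ, 0 ≤ A ∧ ∀ (h : ℝ) (Tr : Triangulation Srf γ₀ h) (B : ℝ) (z : E3) (l vG ve vV : E3 → ℝ),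
      Dat Tr K C B z l vG ve vV → 800 * (C2 K γ₀ * h) ≤ 1 →
      ∫ y, (‖Srf.grad (Tr.liftS ve) y‖ ^ 2 + Tr.liftS ve y ^ 2) ∂Srf.mu ≤ A := by
  obtain ⟨Cn, hCn, near⟩ := exists_near Srf γ₀ hγ
  obtain ⟨Cw, hCw, wts⟩ := exists_weights Srf
  have hC2 : 0 ≤ C2 K γ₀ := C2_nonneg hγ hK
  obtain ⟨k, hk, S⟩ := S3 hC (c0 := 100 * C2 K γ₀) (by positivity) (ε := 1 / (128 * Cn)) (by positivity)
  refine ⟨2 * k * Cw, by positivity, fun h Tr B z l vG ve vV d hh8 => ?_⟩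
  have hh := d.sm.hh
  obtain ⟨⟨hW, -⟩, ⟨hN, hN'⟩, -⟩ := wts z d.hz h hh d.sm.s3
  obtain ⟨⟨n1, n2⟩, -⟩ := near_e d.sm d.he (near h K d.sm Tr z)
  obtain ⟨q1, q2⟩ := Vh_sq d.sm d.he
  obtain ⟨f1, f2, f3⟩ := d.form_diff hW d.he
  have e1 := d.eta_int hW d.he
  have hA : ∫ y, (‖Srf.grad (Tr.liftS ve) y‖ ^ 2 + Tr.liftS ve y ^ 2) ∂Srf.mu =
      ∫ y, (⟪Srf.grad l y - Srf.grad (Tr.liftS vG) y, Srf.grad (Tr.liftS ve) y⟫ +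
      (l y - Tr.liftS vG y) * Tr.liftS ve y) ∂Srf.mu - 
      ∫ y, (⟪(Srf.grad l y - Srf.grad (Tr.liftS vG) y) - Srf.grad (Tr.liftS ve) y, Srf.grad (Tr.liftS ve) y⟫ +
      ((l y - Tr.liftS vG y) - Tr.liftS ve y) * Tr.liftS ve y) ∂Srf.mu := by
    rw [← integral_sub e1 f1]
    refine integral_congr_ae (Filter.Eventually.of_forall fun y => ?_)
    simp only [inner_sub_left, real_inner_self_eq_norm_sq]; ring
  have hq : Integrable (fun y => 3 / 8 * (‖Srf.grad (Tr.liftS ve) y‖ ^ 2 + Tr.liftS ve y ^ 2)) Srf.mu := (q1.add q2).const_mul _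
  have hn1 : Integrable (fun y => 1 / (128 * Cn) * (wgt z h y * ‖Srf.grad (Tr.liftS ve) y‖ ^ 2)) Srf.mu := n1.const_mul _
  have hqn : Integrable (fun y => 3 / 8 * (‖Srf.grad (Tr.liftS ve) y‖ ^ 2 + Tr.liftS ve y ^ 2) +
    1 / (128 * Cn) * (wgt z h y * ‖Srf.grad (Tr.liftS ve) y‖ ^ 2)) Srf.mu := hq.add hn1
  have key := integral_mono_ae (e1.add f3) (hqn.add (hN.const_mul k)) (by
    filter_upwards [d.ae] with y hy
    obtain ⟨hy, hyz⟩ := hy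
    obtain ⟨-, -, -, p4, -, -, p7, p8⟩ := d.pt hy hyz
    have p1 := (d.eta y hy hyz).2.1
    have := S h (kap z h y) (wgt z h y) (h / (‖y - z‖ ^ 2 + h ^ 2)) ‖Srf.grad (Tr.liftS ve) y‖ _ |Tr.liftS ve y|
      |l y - Tr.liftS vG y| ‖Srf.grad (Tr.liftS vG) y‖ |Tr.liftS vG y| hh (kap_nonneg _ _ _) (kap_le_one _ _ _)
      (wgt_nonneg z hh y) (by positivity) (norm_nonneg _) (abs_nonneg _) (abs_nonneg _) (norm_nonneg _) (abs_nonneg _)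
      p1 (by rw [sq_abs]; exact p4) p7 p8 (by linarith)
    rw [sq_abs] at this
    have j1 := (le_abs_self _).trans (abs_real_inner_le_norm (Srf.grad l y - Srf.grad (Tr.liftS vG) y) (Srf.grad (Tr.liftS ve) y))
    have j2 := le_abs_self ((l y - Tr.liftS vG y) * Tr.liftS ve y)
    rw [abs_mul] at j2
    simp only [Pi.add_apply]
    linarith)
  simp only [Pi.add_apply] at key
  rw [integral_add e1 f3, integral_add hqn (hN.const_mul k), integral_add hq hn1, integral_const_mul, integral_const_mul, integral_const_mul, integral_const_mul] at key
  rw [integral_const_mul] at f2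
  have hA2 : ∫ y, ‖Srf.grad (Tr.liftS ve) y‖ ^ 2 ∂Srf.mu ≤ ∫ y, (‖Srf.grad (Tr.liftS ve) y‖ ^ 2 + Tr.liftS ve y ^ 2) ∂Srf.mu :=
    integral_mono q1 (q1.add q2) fun y => by simp only [Pi.add_apply]; nlinarith [sq_nonneg (Tr.liftS ve y)]
  have hA3 : 1 / (128 * Cn) * ∫ y, wgt z h y * ‖Srf.grad (Tr.liftS ve) y‖ ^ 2 ∂Srf.mu ≤ 
      1 / 8 * ∫ y, (‖Srf.grad (Tr.liftS ve) y‖ ^ 2 + Tr.liftS ve y ^ 2) ∂Srf.mu := by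
    calc _ ≤ 1 / (128 * Cn) * (Cn * (16 * ∫ y, (‖Srf.grad (Tr.liftS ve) y‖ ^ 2 + Tr.liftS ve y ^ 2) ∂Srf.mu)) := by
          refine mul_le_mul_of_nonneg_left (n2.trans ?_) (by positivity)
          gcongr
      _ = (Cn / Cn) * (1 / 8 * ∫ y, (‖Srf.grad (Tr.liftS ve) y‖ ^ 2 + Tr.liftS ve y ^ 2) ∂Srf.mu) := by
          rw [one_div, mul_inv]; ring
      _ = _ := by rw [div_self hCn.ne', one_mul]
  have hA4 := mul_le_mul_of_nonneg_left hN' hk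
  have f2' := neg_abs_le (∫ y, (⟪(Srf.grad l y - Srf.grad (Tr.liftS vG) y) - Srf.grad (Tr.liftS ve) y, Srf.grad (Tr.liftS ve) y⟫ +
      ((l y - Tr.liftS vG y) - Tr.liftS ve y) * Tr.liftS ve y) ∂Srf.mu)
  clear hN near wts S
  linarith
end

section
open SmoothSurface

/-- the final absorption argument, real numbers only -/
lemma fin_arith {q X Y Xa Ye a2 e2 wa we W FB m ε k k2 h Λ Cn CH Cw A C B : ℝ}
    (hX : 0 ≤ X) (hY : 0 ≤ Y) (he2 : 0 ≤ e2) (ha2 : 0 ≤ a2) (hε : 0 < ε) (hk : 0 ≤ k) (hk2 : 0 ≤ k2)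
    (hCn : 0 < Cn) (hCH : 0 < CH) (hC : 0 < C) (hh1 : h ^ 2 ≤ 1) (hm : 0 ≤ m)
    (hεq : ε * (21 + (9 + 6 * Cn) * (2 * CH)) = 1 / 4)
    (hq : q ≤ 3 * ε * (X + Xa + e2 + we) + k * (W + h ^ 2 * (a2 + e2 + wa + we)) - 3 / 4 * Y + FB)
    (hFB : FB ≤ 6 * ε * (Xa + e2) + k2 * (h ^ 2 * (m + (a2 + e2))))
    (hXa : Xa ≤ 2 * X + 4 * C ^ 2 * W) (hYe : Ye ≤ 2 * Y + 2 * B ^ 2 * C * W)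
    (hH : e2 ≤ CH * (Xa + Ye)) (hwa : wa ≤ Cn * (16 * a2)) (hwe : we ≤ Cn * (2 * e2 + 8 * h ^ 2 * a2))
    (hW : W ≤ Cw * Λ) (hA : a2 + e2 ≤ A) (hΛ : h ^ 2 ≤ 2 * Λ) :
    q ≤ 1 / 4 * X + (k * Cw + 2 * k * (A + 26 * Cn * A) + 2 * k2 * (m + A) + 3 * ε * Cn * 16 * A + 9 * ε * 4 * C ^ 2 * Cw +
      (9 + 6 * Cn) * ε * CH * (4 * C ^ 2 + 2 * B ^ 2 * C) * Cw) * Λ := by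
  have hh0 : 0 ≤ h ^ 2 := sq_nonneg h
  have hA0 : 0 ≤ A := by linarith
  have hCnA : 0 ≤ Cn * A := by positivity
  have u1 : a2 + e2 + wa + we ≤ A + 26 * Cn * A := by
    have : Cn * (8 * h ^ 2 * a2) ≤ Cn * (8 * 1 * a2) := by gcongr
    have : Cn * a2 ≤ Cn * A := by gcongr; linarith
    have : Cn * e2 ≤ Cn * A := by gcongr; linarith
    linarith
  have v1 : h ^ 2 * (a2 + e2 + wa + we) ≤ 2 * Λ * (A + 26 * Cn * A) := by
    calc _ ≤ h ^ 2 * (A + 26 * Cn * A) := by gcongr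
      _ ≤ _ := by gcongr
  have v2 : k * (W + h ^ 2 * (a2 + e2 + wa + we)) ≤ k * (Cw * Λ + 2 * Λ * (A + 26 * Cn * A)) := by gcongr
  have v3 : h ^ 2 * (m + (a2 + e2)) ≤ 2 * Λ * (m + A) := by
    calc _ ≤ h ^ 2 * (m + A) := by gcongr
      _ ≤ _ := by gcongr
  have v4 : k2 * (h ^ 2 * (m + (a2 + e2))) ≤ k2 * (2 * Λ * (m + A)) := by gcongr
  have v5 : we ≤ 2 * Cn * e2 + 16 * Cn * A * Λ := by
    have : Cn * (8 * h ^ 2 * a2) ≤ Cn * (8 * (2 * Λ) * A) := by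
      have : a2 ≤ A := by linarith
      gcongr; linarith
    linarith
  have v6 : e2 ≤ CH * (2 * X + 2 * Y + (4 * C ^ 2 + 2 * B ^ 2 * C) * (Cw * Λ)) := by
    refine hH.trans ?_
    have : (4 * C ^ 2 + 2 * B ^ 2 * C) * W ≤ (4 * C ^ 2 + 2 * B ^ 2 * C) * (Cw * Λ) := by gcongr
    exact mul_le_mul_of_nonneg_left (by linarith) hCH.le
  have v7 : Xa ≤ 2 * X + 4 * C ^ 2 * (Cw * Λ) := hXa.trans (by gcongr)
  have w1 : 3 * ε * we ≤ 3 * ε * (2 * Cn * e2 + 16 * Cn * A * Λ) := by gcongr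
  have w2 : (9 + 6 * Cn) * ε * e2 ≤ (9 + 6 * Cn) * ε * (CH * (2 * X + 2 * Y + (4 * C ^ 2 + 2 * B ^ 2 * C) * (Cw * Λ))) := by gcongr
  have w3 : 9 * ε * Xa ≤ 9 * ε * (2 * X + 4 * C ^ 2 * (Cw * Λ)) := by gcongr
  have w4 : ε * (21 + (9 + 6 * Cn) * (2 * CH)) * X = 1 / 4 * X := by rw [hεq]
  have w5 : ε * ((9 + 6 * Cn) * (2 * CH)) * Y ≤ 1 / 4 * Y := by
    rw [← hεq]; gcongr; linarith
  linarith

lemma fin_int {mu : Measure E3} [IsFiniteMeasure mu] {Q FV X Y Xa Ye a2 e2 wa we W FB : E3 → ℝ} 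
    {ε k k2 h Λ Cn CH Cw A C B : ℝ}
    (iFV : Integrable FV mu) (iX : Integrable X mu) (iY : Integrable Y mu) (iXa : Integrable Xa mu)
    (iYe : Integrable Ye mu) (ia2 : Integrable a2 mu) (ie2 : Integrable e2 mu) (iwa : Integrable wa mu)
    (iwe : Integrable we mu) (iW : Integrable W mu) (iFB : Integrable FB mu)
    (hX : ∀ y, 0 ≤ X y) (hY : ∀ y, 0 ≤ Y y) (he2 : ∀ y, 0 ≤ e2 y) (ha2 : ∀ y, 0 ≤ a2 y) (hε : 0 < ε) (hk : 0 ≤ k) (hk2 : 0 ≤ k2)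
    (hCn : 0 < Cn) (hCH : 0 < CH) (hC : 0 < C) (hCw : 0 < Cw) (hh1 : h ^ 2 ≤ 1)
    (hεq : ε * (21 + (9 + 6 * Cn) * (2 * CH)) = 1 / 4)
    (hq : ∀ᵐ y ∂mu, Q y ≤ 3 * ε * (X y + Xa y + e2 y + we y) + k * (W y + h ^ 2 * (a2 y + e2 y + wa y + we y)) - 3 / 4 * Y y - FV y)
    (hFV : |∫ y, FV y ∂mu| ≤ ∫ y, FB y ∂mu)
    (hFB : ∀ᵐ y ∂mu, FB y ≤ 6 * ε * (Xa y + e2 y) + k2 * (h ^ 2 * (1 + (a2 y + e2 y))))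
    (hXa : ∀ᵐ y ∂mu, Xa y ≤ 2 * X y + 4 * C ^ 2 * W y) (hYe : ∀ᵐ y ∂mu, Ye y ≤ 2 * Y y + 2 * B ^ 2 * C * W y)
    (hH : ∫ y, e2 y ∂mu ≤ CH * ∫ y, (Xa y + Ye y) ∂mu) (hwa : ∫ y, wa y ∂mu ≤ Cn * (16 * ∫ y, a2 y ∂mu))
    (hwe : ∫ y, we y ∂mu ≤ Cn * (2 * ∫ y, e2 y ∂mu + 8 * h ^ 2 * ∫ y, a2 y ∂mu))
    (hW : ∫ y, W y ∂mu ≤ Cw * Λ) (hA : ∫ y, (a2 y + e2 y) ∂mu ≤ A) (hΛ : h ^ 2 ≤ 2 * Λ) :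
    ∫ y, Q y ∂mu ≤ 1 / 4 * ∫ y, X y ∂mu + (k * Cw + 2 * k * (A + 26 * Cn * A) + 2 * k2 * (mu.real Set.univ + A) + 3 * ε * Cn * 16 * A + 9 * ε * 4 * C ^ 2 * Cw +
      (9 + 6 * Cn) * ε * CH * (4 * C ^ 2 + 2 * B ^ 2 * C) * Cw) * Λ := by
  have hA0 : 0 ≤ A := (integral_nonneg fun y => add_nonneg (ha2 y) (he2 y)).trans hA
  have hΛ0 : 0 ≤ Λ := by nlinarith [sq_nonneg h]
  by_cases iQ : Integrable Q mu
  swap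
  · rw [integral_undef iQ]
    have := integral_nonneg (μ := mu) (f := X) fun y => hX y
    have : 0 ≤ mu.real Set.univ := measureReal_nonneg
    positivity
  have i1 : Integrable (fun y => 3 * ε * (X y + Xa y + e2 y + we y)) mu := (((iX.add iXa).add ie2).add iwe).const_mul _
  have i2' : Integrable (fun y => h ^ 2 * (a2 y + e2 y + wa y + we y)) mu := ((((ia2.add ie2).add iwa).add iwe).const_mul _)
  have i2 : Integrable (fun y => k * (W y + h ^ 2 * (a2 y + e2 y + wa y + we y))) mu := (iW.add i2').const_mul _
  have i12 : Integrable (fun y => 3 * ε * (X y + Xa y + e2 y + we y) + k * (W y + h ^ 2 * (a2 y + e2 y + wa y + we y))) mu := i1.add i2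
  have i3 : Integrable (fun y => 3 / 4 * Y y) mu := iY.const_mul _
  have i123 : Integrable (fun y => 3 * ε * (X y + Xa y + e2 y + we y) + k * (W y + h ^ 2 * (a2 y + e2 y + wa y + we y)) - 3 / 4 * Y y) mu := i12.sub i3
  have g1 : Integrable (fun y => X y + Xa y) mu := iX.add iXa
  have g2 : Integrable (fun y => X y + Xa y + e2 y) mu := g1.add ie2
  have g3 : Integrable (fun y => a2 y + e2 y) mu := ia2.add ie2
  have g4 : Integrable (fun y => a2 y + e2 y + wa y) mu := g3.add iwa
  have r1 := integral_mono_ae iQ (i123.sub iFV) hq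
  simp only [Pi.sub_apply] at r1
  rw [integral_sub i123 iFV, integral_sub i12 i3, integral_add i1 i2, integral_const_mul, integral_const_mul, integral_const_mul,
    integral_add g2 iwe, integral_add g1 ie2, integral_add iX iXa, integral_add iW i2', integral_const_mul, integral_add g4 iwe,
    integral_add g3 iwa, integral_add ia2 ie2] at r1
  have j1 : Integrable (fun y => 6 * ε * (Xa y + e2 y)) mu := (iXa.add ie2).const_mul _
  have j2' : Integrable (fun y => 1 + (a2 y + e2 y)) mu := (integrable_const _).add g3
  have j2 : Integrable (fun y => k2 * (h ^ 2 * (1 + (a2 y + e2 y)))) mu := (j2'.const_mul _).const_mul _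
  have r2 := integral_mono_ae iFB (j1.add j2) hFB
  simp only [Pi.add_apply] at r2
  rw [integral_add j1 j2, integral_const_mul, integral_const_mul, integral_const_mul, integral_add iXa ie2,
    integral_add (integrable_const _) g3, integral_add ia2 ie2, integral_const, smul_eq_mul, mul_one] at r2
  have r3 := integral_mono_ae iXa ((iX.const_mul _).add (iW.const_mul _)) hXa
  simp only [Pi.add_apply] at r3
  rw [integral_add (iX.const_mul _) (iW.const_mul _), integral_const_mul, integral_const_mul] at r3
  have r4 := integral_mono_ae iYe ((iY.const_mul _).add (iW.const_mul _)) hYe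
  simp only [Pi.add_apply] at r4
  rw [integral_add (iY.const_mul _) (iW.const_mul _), integral_const_mul, integral_const_mul] at r4
  rw [integral_add iXa iYe] at hH
  rw [integral_add ia2 ie2] at hA
  have hFV' := (neg_le_abs _).trans hFV
  exact fin_arith (integral_nonneg fun y => hX y) (integral_nonneg fun y => hY y) (integral_nonneg fun y => he2 y) (integral_nonneg fun y => ha2 y) hε hk hk2 hCn hCH hC hh1
    measureReal_nonneg hεq (by linarith) r2 r3 r4 hH hwa hwe hW hA hΛ

/-- the pointwise algebra behind the weighted estimate -/
lemma fin_pt {gη ge gq gV : E3} {η e V r Rb : ℝ} (hq : ‖gq‖ ≤ 2 * r)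
    (h1 : ‖(r ^ 2 • ge + e • gq) - gV‖ ≤ Rb) (h2 : |r ^ 2 * e - V| ≤ Rb) :
    ⟪gη - ge, r ^ 2 • (gη - ge) + (η - e) • gq⟫ ≤
      (r ^ 2 * ‖gη - ge‖ * ‖gη‖ + 2 * r * ‖gη - ge‖ * |η| + (‖ge‖ + ‖gη‖) * Rb + r ^ 2 * |η - e| * |η| + (|η| + |e|) * Rb)
      - r ^ 2 * |η - e| ^ 2 - (⟪gη - ge, gV⟫ + (η - e) * V) ∧
    ‖gV‖ ≤ r ^ 2 * ‖ge‖ + |e| * (2 * r) + Rb ∧ |V| ≤ r ^ 2 * |e| + Rb := by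
  have hR0 : 0 ≤ Rb := (abs_nonneg _).trans h2
  refine ⟨?_, ?_, ?_⟩
  · have e1 : r ^ 2 • (gη - ge) + (η - e) • gq = r ^ 2 • gη + η • gq - ((r ^ 2 • ge + e • gq) - gV) - gV := by
      module
    have e2 : ⟪gη - ge, r ^ 2 • (gη - ge) + (η - e) • gq⟫ = r ^ 2 * ⟪gη - ge, gη⟫ + η * ⟪gη - ge, gq⟫ -
        ⟪gη - ge, (r ^ 2 • ge + e • gq) - gV⟫ - ⟪gη - ge, gV⟫ := by
      rw [e1, inner_sub_right, inner_sub_right, inner_add_right, inner_smul_right, inner_smul_right]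
    rw [e2]
    have b1 : r ^ 2 * ⟪gη - ge, gη⟫ ≤ r ^ 2 * (‖gη - ge‖ * ‖gη‖) := by gcongr; exact real_inner_le_norm _ _
    have b2 : η * ⟪gη - ge, gq⟫ ≤ |η| * (‖gη - ge‖ * (2 * r)) := by
      refine (le_abs_self _).trans ?_
      rw [abs_mul]; gcongr
      exact (abs_real_inner_le_norm _ _).trans (by gcongr)
    have b3 : -⟪gη - ge, (r ^ 2 • ge + e • gq) - gV⟫ ≤ (‖ge‖ + ‖gη‖) * Rb := by
      refine (neg_le_abs _).trans ((abs_real_inner_le_norm _ _).trans ?_)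
      gcongr
      rw [add_comm]; exact norm_sub_le _ _
    have b4 : r ^ 2 * ((η - e) * η) ≤ r ^ 2 * (|η - e| * |η|) := by
      refine mul_le_mul_of_nonneg_left ?_ (sq_nonneg r)
      rw [← abs_mul]; exact le_abs_self _
    have b5 : -((η - e) * (r ^ 2 * e - V)) ≤ (|η| + |e|) * Rb := by
      refine (neg_le_abs _).trans ?_
      rw [abs_mul]; gcongr
      exact abs_sub _ _
    rw [sq_abs]
    linarith
  · have : gV = (r ^ 2 • ge + e • gq) - ((r ^ 2 • ge + e • gq) - gV) := by abel
    rw [this]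
    refine (norm_sub_le _ _).trans (add_le_add ((norm_add_le _ _).trans (add_le_add ?_ ?_)) h1)
    · rw [norm_smul, Real.norm_eq_abs, abs_of_nonneg (sq_nonneg r)]
    · rw [norm_smul, Real.norm_eq_abs]; gcongr
  · have : V = r ^ 2 * e - (r ^ 2 * e - V) := by ring
    rw [this]
    refine (abs_sub _ _).trans (add_le_add ?_ h2)
    rw [abs_mul, abs_of_nonneg (sq_nonneg r)]
end

section
open SmoothSurface

set_option maxHeartbeats 2000000 in
open Triangulation in
lemma exists_final (Srf : SmoothSurface) {γ₀ K C B : ℝ} (hγ : 0 < γ₀) (hK : Srf.Cst K) (hC : 0 < C) (hB : 0 ≤ B) :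
    ∃ c : ℝ, 0 < c ∧ ∀ (h : ℝ) (Tr : Triangulation Srf γ₀ h) (z : E3) (l vG ve vV : E3 → ℝ),
      Dat Tr K C B z l vG ve vV → 800 * (C2 K γ₀ * h) ≤ 1 →
      ∫ y, ⟪(Srf.grad l y - Srf.grad (Tr.liftS vG) y) - Srf.grad (Tr.liftS ve) y,
        Srf.rfn z y ^ 2 • ((Srf.grad l y - Srf.grad (Tr.liftS vG) y) - Srf.grad (Tr.liftS ve) y) +
        ((l y - Tr.liftS vG y) - Tr.liftS ve y) • Srf.grad (fun x => Srf.rfn z x ^ 2) y⟫ ∂Srf.mu ≤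
      1 / 4 * ∫ y, Srf.rfn z y ^ 2 * ‖(Srf.grad l y - Srf.grad (Tr.liftS vG) y) - Srf.grad (Tr.liftS ve) y‖ ^ 2 ∂Srf.mu +
        c * (h ^ 2 * |Real.log h|) := by
  obtain ⟨Cn, hCn, near⟩ := exists_near Srf γ₀ hγ
  obtain ⟨Cw, hCw, wts⟩ := exists_weights Srf
  obtain ⟨CH, hCH, hardy⟩ := Srf.exists_hardy
  obtain ⟨A, hA, energy⟩ := exists_energy Srf hγ hK hC
  have hC2 : 0 ≤ C2 K γ₀ := C2_nonneg hγ hK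
  set ε := 1 / (4 * (21 + (9 + 6 * Cn) * (2 * CH))) with hεd
  have hε : 0 < ε := by positivity
  have hεq : ε * (21 + (9 + 6 * Cn) * (2 * CH)) = 1 / 4 := by
    rw [hεd, one_div, mul_inv, mul_assoc, inv_mul_cancel₀ (by positivity)]; norm_num
  set c2 := 100 * C2 K γ₀ with hc2
  have hc20 : 0 ≤ c2 := by positivity
  obtain ⟨k, hk, hS1⟩ := S1 (C := C + 2 * C ^ 2) (B := B) (ε := ε) (by positivity) hB hε
  obtain ⟨k2, hk2, hS2⟩ := S2 (C := C) (c := 1 + 2 * C) (B := B) (ε := ε / (c2 + 1)) hC (by positivity) hB (by positivity)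
  refine ⟨(k * Cw + 2 * k * (A + 26 * Cn * A) + 2 * (c2 * k2) * (Srf.mu.real Set.univ + A) + 3 * ε * Cn * 16 * A + 9 * ε * 4 * C ^ 2 * Cw +
      (9 + 6 * Cn) * ε * CH * (4 * C ^ 2 + 2 * B ^ 2 * C) * Cw), ?_, ?_⟩
  · have : 0 ≤ Srf.mu.real Set.univ := measureReal_nonneg
    positivity
  intro h Tr z l vG ve vV d hh8
  have hh := d.sm.hh
  have hh2 := d.sm.s3
  obtain ⟨⟨hW, hW'⟩, -, hΛ⟩ := wts z d.hz h hh hh2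
  obtain ⟨⟨n1, n2⟩, ⟨n3, n4⟩⟩ := near_e d.sm d.he (near h K d.sm Tr z)
  obtain ⟨q1, q2⟩ := Vh_sq d.sm d.he
  obtain ⟨f1, f2, f3⟩ := d.form_diff hW d.hV
  have hy := hardy z d.hz γ₀ h K d.sm Tr ve d.he
  obtain ⟨mG, mG'⟩ := Vh_aesm d.sm d.hG
  obtain ⟨me, me'⟩ := Vh_aesm d.sm d.he
  have mr : AEStronglyMeasurable (fun y => Srf.rfn z y ^ 2) Srf.mu := (r_aesm (Srf := Srf) (z := z)).pow 2
  have hrB : ∀ y ∈ Srf.S, Srf.rfn z y ^ 2 ≤ B ^ 2 := fun y hy => pow_le_pow_left₀ (rfn_nonneg _ _) (d.hrB y hy) 2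
  have iXa : Integrable (fun y => Srf.rfn z y ^ 2 * ‖Srf.grad (Tr.liftS ve) y‖ ^ 2) Srf.mu := by
    refine Integrable.mono' (q1.const_mul (B ^ 2)) (mr.mul (me'.norm.pow 2)) ?_
    filter_upwards [d.ae] with y hy
    rw [Real.norm_of_nonneg (by positivity)]
    have := hrB y (Omt_sub hy.1)
    gcongr
  have iYe : Integrable (fun y => Srf.rfn z y ^ 2 * Tr.liftS ve y ^ 2) Srf.mu := by
    refine Integrable.mono' (q2.const_mul (B ^ 2)) (mr.mul (me.pow 2)) ?_
    filter_upwards [d.ae] with y hy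
    rw [Real.norm_of_nonneg (by positivity)]
    have := hrB y (Omt_sub hy.1)
    gcongr
  have nsq : ∀ a b : E3, ‖a - b‖ ^ 2 ≤ 2 * ‖a‖ ^ 2 + 2 * ‖b‖ ^ 2 := fun a b =>
    (pow_le_pow_left₀ (norm_nonneg _) (norm_sub_le a b) 2).trans (sq_add_le2 _ _)
  have iX : Integrable (fun y => Srf.rfn z y ^ 2 * ‖(Srf.grad l y - Srf.grad (Tr.liftS vG) y) - Srf.grad (Tr.liftS ve) y‖ ^ 2) Srf.mu := by
    refine Integrable.mono' ((hW.const_mul (4 * C ^ 2)).add (iXa.const_mul 2)) (mr.mul (((d.gl_aesm.sub mG').sub me').norm.pow 2)) ?_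
    filter_upwards [d.ae] with y hy
    rw [Real.norm_of_nonneg (by positivity)]
    obtain ⟨p1, -⟩ := d.pt hy.1 hy.2
    have := mul_le_mul_of_nonneg_left (nsq (Srf.grad l y - Srf.grad (Tr.liftS vG) y) (Srf.grad (Tr.liftS ve) y)) (sq_nonneg (Srf.rfn z y))
    rw [mul_pow] at p1
    simp only [Pi.add_apply]
    linarith
  have iY : Integrable (fun y => Srf.rfn z y ^ 2 * |(l y - Tr.liftS vG y) - Tr.liftS ve y| ^ 2) Srf.mu := by
    refine Integrable.mono' ((hW.const_mul (2 * B ^ 2 * C)).add (iYe.const_mul 2)) (mr.mul (((d.l_aesm.sub mG).sub me).norm.pow 2)) ?_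
    filter_upwards [d.ae] with y hy
    rw [Real.norm_of_nonneg (by positivity), sq_abs]
    obtain ⟨-, -, -, p4, -⟩ := d.pt hy.1 hy.2
    have := sq_add_le2 (l y - Tr.liftS vG y) (- Tr.liftS ve y)
    rw [← sub_eq_add_neg, neg_sq] at this
    have := mul_le_mul_of_nonneg_left this (sq_nonneg (Srf.rfn z y))
    have : Srf.rfn z y ^ 2 * (l y - Tr.liftS vG y) ^ 2 ≤ B ^ 2 * (C * (kap z h y + wgt z h y)) :=
      mul_le_mul (hrB y (Omt_sub hy.1)) p4 (sq_nonneg _) (sq_nonneg _)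
    simp only [Pi.add_apply]
    linarith
  refine fin_int f1 iX iY iXa iYe q1 q2 n1 n3 hW f3 (fun y => by positivity) (fun y => by positivity) (fun y => by positivity)
    (fun y => by positivity) hε hk (by positivity) hCn hCH hC hCw (by nlinarith) hεq ?_ f2 ?_ ?_ ?_ ?_ n2 n4 hW' 
    (energy h Tr B z l vG ve vV d hh8) hΛ
  · filter_upwards [d.ae] with y hy
    obtain ⟨hy, hyz⟩ := hy
    obtain ⟨p1, p2, p3, p4, p5, p6, p7, p8⟩ := d.pt hy hyz
    obtain ⟨R1, R2⟩ := d.R y hy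
    have hκ := kap_nonneg z h y
    have hw := wgt_nonneg z hh y
    have hr0 := rfn_nonneg (Srf := Srf) z y
    have hRb : C * h * (|Tr.liftS ve y| + (Srf.rfn z y + h) * ‖Srf.grad (Tr.liftS ve) y‖) ≤
        (C + 2 * C ^ 2) * h * (|Tr.liftS ve y| + (Srf.rfn z y + h) * ‖Srf.grad (Tr.liftS ve) y‖) := by
      gcongr; linarith [sq_nonneg C]
    obtain ⟨F, -, -⟩ := fin_pt (gη := Srf.grad l y - Srf.grad (Tr.liftS vG) y) (η := l y - Tr.liftS vG y)
      (q_grad_norm d.hz (Omt_sub hy)) (R1.trans hRb) (R2.trans hRb)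
    have hCW : C * (kap z h y + wgt z h y) ≤ (C + 2 * C ^ 2) * (kap z h y + wgt z h y) := by gcongr; linarith [sq_nonneg C]
    have hCW2 : 2 * C ^ 2 * (kap z h y + wgt z h y) ≤ (C + 2 * C ^ 2) * (kap z h y + wgt z h y) := by gcongr; linarith [sq_nonneg C]
    have G := hS1 (Srf.rfn z y) h (kap z h y) (wgt z h y) ‖Srf.grad (Tr.liftS ve) y‖ ‖Srf.grad l y - Srf.grad (Tr.liftS vG) y‖
      ‖(Srf.grad l y - Srf.grad (Tr.liftS vG) y) - Srf.grad (Tr.liftS ve) y‖ |Tr.liftS ve y| |l y - Tr.liftS vG y|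
      |(l y - Tr.liftS vG y) - Tr.liftS ve y| hr0 (d.hrB y (Omt_sub hy)) hh (by linarith) hκ (kap_le_one _ _ _) hw
      (norm_nonneg _) (norm_nonneg _) (norm_nonneg _) (abs_nonneg _) (abs_nonneg _) (abs_nonneg _)
      (p1.trans hCW2) (p2.trans hCW) p3 (by rw [sq_abs]; exact p4.trans hCW)
    refine F.trans ?_
    rw [sq_abs (Tr.liftS ve y)] at G
    have e1 : (1 + wgt z h y) * (‖Srf.grad (Tr.liftS ve) y‖ ^ 2 + Tr.liftS ve y ^ 2) =
      ‖Srf.grad (Tr.liftS ve) y‖ ^ 2 + Tr.liftS ve y ^ 2 + wgt z h y * ‖Srf.grad (Tr.liftS ve) y‖ ^ 2 + wgt z h y * Tr.liftS ve y ^ 2 := by ring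
    rw [e1] at G
    linarith
  · filter_upwards [d.ae] with y hy
    obtain ⟨hy, hyz⟩ := hy
    obtain ⟨p1, p2, p3, p4, p5, p6, p7, p8⟩ := d.pt hy hyz
    obtain ⟨R1, R2⟩ := d.R y hy
    have hr0 := rfn_nonneg (Srf := Srf) z y
    obtain ⟨-, F1, F2⟩ := fin_pt (gη := Srf.grad l y - Srf.grad (Tr.liftS vG) y) (η := l y - Tr.liftS vG y)
      (q_grad_norm d.hz (Omt_sub hy)) R1 R2
    have G := hS2 (Srf.rfn z y) h ‖Srf.grad (Tr.liftS ve) y‖ |Tr.liftS ve y| ‖Srf.grad (Tr.liftS vG) y‖ |Tr.liftS vG y|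
      hr0 (d.hrB y (Omt_sub hy)) hh (by linarith) (norm_nonneg _) (abs_nonneg _) (norm_nonneg _) (abs_nonneg _) p5 p6
    rw [sq_abs (Tr.liftS ve y)] at G
    calc _ = c2 * (h * ((‖Srf.grad (Tr.liftS vG) y‖ + ‖Srf.grad (Tr.liftS ve) y‖) * ‖Srf.grad (Tr.liftS vV) y‖ +
          (|Tr.liftS vG y| + |Tr.liftS ve y|) * |Tr.liftS vV y|)) := by ring
      _ ≤ c2 * (h * ((‖Srf.grad (Tr.liftS vG) y‖ + ‖Srf.grad (Tr.liftS ve) y‖) * _ +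
          (|Tr.liftS vG y| + |Tr.liftS ve y|) * _)) := by gcongr
      _ ≤ c2 * _ := mul_le_mul_of_nonneg_left G hc20
      _ = c2 * (ε / (c2 + 1)) * (6 * (Srf.rfn z y ^ 2 * ‖Srf.grad (Tr.liftS ve) y‖ ^ 2 + Tr.liftS ve y ^ 2)) +
        c2 * k2 * (h ^ 2 * (1 + (‖Srf.grad (Tr.liftS ve) y‖ ^ 2 + Tr.liftS ve y ^ 2))) := by ring
      _ ≤ ε * (6 * (Srf.rfn z y ^ 2 * ‖Srf.grad (Tr.liftS ve) y‖ ^ 2 + Tr.liftS ve y ^ 2)) +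
        c2 * k2 * (h ^ 2 * (1 + (‖Srf.grad (Tr.liftS ve) y‖ ^ 2 + Tr.liftS ve y ^ 2))) := by
          gcongr
          rw [mul_div_assoc', div_le_iff₀ (by positivity)]
          nlinarith
      _ = _ := by ring
  · filter_upwards [d.ae] with y hy
    obtain ⟨p1, -⟩ := d.pt hy.1 hy.2
    have := nsq (Srf.grad l y - Srf.grad (Tr.liftS vG) y) ((Srf.grad l y - Srf.grad (Tr.liftS vG) y) - (Srf.grad (Tr.liftS ve) y))
    rw [sub_sub_cancel] at this
    have := mul_le_mul_of_nonneg_left this (sq_nonneg (Srf.rfn z y))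
    rw [mul_pow] at p1
    linarith
  · filter_upwards [d.ae] with y hy
    rw [sq_abs]
    obtain ⟨-, -, -, p4, -⟩ := d.pt hy.1 hy.2
    have := sq_add_le2 (l y - Tr.liftS vG y) (- (l y - Tr.liftS vG y - Tr.liftS ve y))
    rw [← sub_eq_add_neg, neg_sq, sub_sub_cancel] at this
    have := mul_le_mul_of_nonneg_left this (sq_nonneg (Srf.rfn z y))
    have : Srf.rfn z y ^ 2 * (l y - Tr.liftS vG y) ^ 2 ≤ B ^ 2 * (C * (kap z h y + wgt z h y)) :=
      mul_le_mul (hrB y (Omt_sub hy.1)) p4 (sq_nonneg _) (sq_nonneg _)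
    linarith
  · simpa only [mul_add] using hy
end

section
open SmoothSurface Triangulation

lemma key_weighted_aux (Srf : SmoothSurface) (γ₀ : ℝ) (hγ₀ : 0 < γ₀)
    (r₁ : ℝ) (hr₁ : Srf.IsGraphRadius r₁) (Cζ : ℝ) (hCζ : 0 < Cζ) :
    ∃ c > 0, ∃ h₀ > 0, h₀ < 1 ∧
      ∀ z₀ ∈ Srf.S, ∀ ζ : E3 → ℝ, IsCutoff z₀ r₁ Cζ ζ →
        ∀ h : ℝ, 0 < h → h ≤ h₀ →
          ∀ Tr : Triangulation Srf γ₀ h, ∀ lh : E3 → ℝ,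
            Tr.IsDiscreteProjection (cutLog Srf z₀ ζ) lh →
            (∫ x in Srf.S,
                ⟪Srf.grad (fun y => cutLog Srf z₀ ζ y - Tr.liftS lh y) x,
                  Srf.grad (fun y =>
                    Srf.rfn z₀ y ^ 2 * (cutLog Srf z₀ ζ y - Tr.liftS lh y)) x⟫ ∂μH[2]) ≤
              (1 / 4) * (∫ x in Srf.S,
                  Srf.rfn z₀ x ^ 2 *
                    ‖Srf.grad (fun y => cutLog Srf z₀ ζ y - Tr.liftS lh y) x‖ ^ 2 ∂μH[2]) +
                c * h ^ 2 * |Real.log h| := by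
  obtain ⟨K, hK⟩ := SmoothSurface.exists_Cst Srf
  obtain ⟨C1, hC1, hE⟩ := exists_eta Srf hγ₀ hK hr₁ hCζ
  obtain ⟨CR, hCR, hR⟩ := exists_R Srf hγ₀ hK
  obtain ⟨B, hB, hBd⟩ := Srf.exists_bdd
  obtain ⟨c, hc, H⟩ := exists_final Srf (C := C1 + CR) hγ₀ hK (by positivity) hB
  have hK1 : 1 ≤ K := hK.one
  have hC2 : 0 ≤ C2 K γ₀ := C2_nonneg hγ₀ hK
  have hr0 := hr₁.1
  have hr1 := hr₁.2.1
  refine ⟨c, hc, r₁ / (16 * K + 800 * C2 K γ₀), by positivity, ?_, ?_⟩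
  · rw [div_lt_one (by positivity)]; linarith
  intro z hz ζ hζ h hh hh0 Tr lh hlh
  rw [le_div_iff₀ (by positivity)] at hh0
  have g1 : h * 1 ≤ h * K := by gcongr
  have g2 : 0 ≤ h * C2 K γ₀ := by positivity
  have sm : Triangulation.Sm Srf γ₀ h K := ⟨hγ₀, hh, hK, by linarith, by linarith, by linarith⟩
  obtain ⟨vG, hG, eta⟩ := hE z hz ζ hζ h sm (by linarith) Tr
  have hlG : (fun x => vG x + (fun x => lh x - vG x) x) = lh := by funext x; simp
  have he : Tr.IsVh (fun x => lh x - vG x) := hlh.1.sub hG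
  set ve : E3 → ℝ := fun x => lh x - vG x with hve
  obtain ⟨vV, hV, R⟩ := hR z hz h sm Tr ve he
  have d : Triangulation.Dat Tr K (C1 + CR) B z (cutLog Srf z ζ) vG ve vV := by
    refine ⟨sm, hz, by positivity, hB, fun y hy => (rfn_le hz y).trans (hBd z hz y hy), hG, he, hV, ?_, ?_, ?_⟩
    · intro y hy hyz
      obtain ⟨e1, e2, e3, e4, e5⟩ := eta y hy hyz
      have hC : C1 ≤ C1 + CR := by linarith
      have := wgt_nonneg z hh y
      exact ⟨e1, e2.trans (by gcongr), e3.trans (by gcongr), e4.trans (by gcongr), e5.trans (by gcongr)⟩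
    · intro y hy
      obtain ⟨e1, e2⟩ := R y hy
      have hC : CR ≤ C1 + CR := by linarith
      have := rfn_nonneg (Srf := Srf) z y
      exact ⟨e1.trans (by gcongr), e2.trans (by gcongr)⟩
    · rw [hlG]; exact hlh
  have F := H h Tr z _ vG ve vV d (by linarith)
  have hg : ∀ᵐ y ∂Srf.mu,
      Srf.grad (fun y => cutLog Srf z ζ y - Tr.liftS lh y) y =
        (Srf.grad (cutLog Srf z ζ) y - Srf.grad (Tr.liftS vG) y) - Srf.grad (Tr.liftS ve) y ∧
      Srf.grad (fun y => Srf.rfn z y ^ 2 * (cutLog Srf z ζ y - Tr.liftS lh y)) y =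
        Srf.rfn z y ^ 2 • ((Srf.grad (cutLog Srf z ζ) y - Srf.grad (Tr.liftS vG) y) - Srf.grad (Tr.liftS ve) y) +
        ((cutLog Srf z ζ y - Tr.liftS vG y) - Tr.liftS ve y) • Srf.grad (fun x => Srf.rfn z x ^ 2) y := by
    filter_upwards [d.ae] with y hy
    have hyS := Triangulation.Omt_sub hy.1
    have s1 := (d.eta y hy.1 hy.2).1
    have s2 := Triangulation.Vh_SC1 sm hlh.1 hy.1
    have sG := Triangulation.Vh_SC1 sm hG hy.1
    have se := Triangulation.Vh_SC1 sm he hy.1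
    have e1 : Srf.grad (Tr.liftS lh) y = Srf.grad (Tr.liftS vG) y + Srf.grad (Tr.liftS ve) y := by
      rw [← grad_add hyS sG se]
      congr 1
      funext x
      show lh _ = vG _ + (lh _ - vG _)
      ring
    have e2 : Srf.grad (fun y => cutLog Srf z ζ y - Tr.liftS lh y) y =
        (Srf.grad (cutLog Srf z ζ) y - Srf.grad (Tr.liftS vG) y) - Srf.grad (Tr.liftS ve) y := by
      rw [grad_sub hyS s1 s2, e1]; abel
    refine ⟨e2, ?_⟩
    rw [grad_mul hyS (q_SC1 hz) (s1.sub s2), e2]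
    have e3 : cutLog Srf z ζ y - Tr.liftS lh y = (cutLog Srf z ζ y - Tr.liftS vG y) - Tr.liftS ve y := by
      show cutLog Srf z ζ y - lh _ = (cutLog Srf z ζ y - vG _) - (lh _ - vG _)
      ring
    rw [e3]
  rw [mul_assoc c]
  refine le_of_eq_of_le ?_ (F.trans (le_of_eq ?_))
  · refine integral_congr_ae ?_
    filter_upwards [hg] with y hy
    rw [hy.1, hy.2]
  · congr 2
    refine integral_congr_ae ?_
    filter_upwards [hg] with y hy
    rw [hy.1]
end

/-- **The key weighted estimate.** The error `E = l̃ − L̃_h` satisfies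
`∫_S ⟨∇_S E, ∇_S(r² E)⟩ ≤ (1/4) ∫_S r² |∇_S E|² + c h² |log h|`. -/
theorem key_weighted_estimate (Srf : SmoothSurface) (γ₀ : ℝ) (hγ₀ : 0 < γ₀)
    (r₁ : ℝ) (hr₁ : Srf.IsGraphRadius r₁) (Cζ : ℝ) (hCζ : 0 < Cζ) :
    ∃ c > 0, ∃ h₀ > 0, h₀ < 1 ∧
      ∀ z₀ ∈ Srf.S, ∀ ζ : E3 → ℝ, IsCutoff z₀ r₁ Cζ ζ →
        ∀ h : ℝ, 0 < h → h ≤ h₀ →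
          ∀ Tr : Triangulation Srf γ₀ h, ∀ lh : E3 → ℝ,
            Tr.IsDiscreteProjection (cutLog Srf z₀ ζ) lh →
            (∫ x in Srf.S,
                ⟪Srf.grad (fun y => cutLog Srf z₀ ζ y - Tr.liftS lh y) x,
                  Srf.grad (fun y =>
                    Srf.rfn z₀ y ^ 2 * (cutLog Srf z₀ ζ y - Tr.liftS lh y)) x⟫ ∂μH[2]) ≤
              (1 / 4) * (∫ x in Srf.S,
                  Srf.rfn z₀ x ^ 2 *
                    ‖Srf.grad (fun y => cutLog Srf z₀ ζ y - Tr.liftS lh y) x‖ ^ 2 ∂μH[2]) +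
                c * h ^ 2 * |Real.log h| := by
  exact key_weighted_aux Srf γ₀ hγ₀ r₁ hr₁ Cζ hCζ

end
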